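/- Let Ω₁, Ω₂ ⊂ ℂⁿ be bounded strictly pseudoconvex domains with C^∞ boundary and let φ : Ω₁ → Ω₂ be a proper holomorphic mapping. Then det φ′ belongs to Lip_{1/2}(Ω̄₁): there is a constant C such that |det φ′(z) − det φ′(w)| ≤ C‖z − w‖^{1/2} for all z, w ∈ Ω₁; in particular det φ′ extends continuously to Ω̄₁. -/

import Mathlib

open Complex Metric

noncomputable section

/-- The Wirtinger derivative `∂f/∂z_j` of `f : ℂⁿ → ℂ` at `z`. -/
def wDz (n : ℕ) (j : Fin n) (f : EuclideanSpace ℂ (Fin n) → ℂ)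
    (z : EuclideanSpace ℂ (Fin n)) : ℂ :=
  (fderiv ℝ f z (EuclideanSpace.single j 1)
    - Complex.I * fderiv ℝ f z (EuclideanSpace.single j Complex.I)) / 2

/-- The Wirtinger derivative `∂f/∂z̄_j` of `f : ℂⁿ → ℂ` at `z`. -/
def wDzBar (n : ℕ) (j : Fin n) (f : EuclideanSpace ℂ (Fin n) → ℂ)
    (z : EuclideanSpace ℂ (Fin n)) : ℂ :=
  (fderiv ℝ f z (EuclideanSpace.single j 1)
    + Complex.I * fderiv ℝ f z (EuclideanSpace.single j Complex.I)) / 2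

/-- The complex Hessian matrix `H(u)(z) = [∂²u/∂z_i∂z̄_j(z)]` of a real-valued `u`. -/
def cHess (n : ℕ) (u : EuclideanSpace ℂ (Fin n) → ℝ)
    (z : EuclideanSpace ℂ (Fin n)) : Matrix (Fin n) (Fin n) ℂ :=
  Matrix.of fun i j => wDz n i (fun w => wDzBar n j (fun v => ((u v : ℝ) : ℂ)) w) z

/-- The Hermitian form `Σ_{i,j} H(u)(z)_{ij} w_i w̄_j`. -/
def cHessForm (n : ℕ) (u : EuclideanSpace ℂ (Fin n) → ℝ)
    (z : EuclideanSpace ℂ (Fin n)) (w : Fin n → ℂ) : ℂ :=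
  ∑ i, ∑ j, cHess n u z i j * w i * (starRingEnd ℂ) (w j)

/-- The pairing `Σ_j (∂u/∂z_j)(z) w_j` of the complex gradient with a vector. -/
def cGradPair (n : ℕ) (u : EuclideanSpace ℂ (Fin n) → ℝ)
    (z : EuclideanSpace ℂ (Fin n)) (w : Fin n → ℂ) : ℂ :=
  ∑ j, wDz n j (fun v => ((u v : ℝ) : ℂ)) z * w j

/-- `ρ` is a `C^k` defining function for `Ω`, defined on the open neighborhood `U` of `Ω̄`. -/
def IsDefiningFn (n : ℕ) (k : ℕ∞) (Ω U : Set (EuclideanSpace ℂ (Fin n)))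
    (ρ : EuclideanSpace ℂ (Fin n) → ℝ) : Prop :=
  IsOpen U ∧ closure Ω ⊆ U ∧ ContDiffOn ℝ k ρ U ∧
    Ω = {z ∈ U | ρ z < 0} ∧ ∀ z ∈ frontier Ω, fderiv ℝ ρ z ≠ 0

/-- `Ω` is a bounded strictly pseudoconvex domain with `C^k` boundary. -/
def IsStrictlyPseudoconvexDomain (n : ℕ) (k : ℕ∞)
    (Ω : Set (EuclideanSpace ℂ (Fin n))) : Prop :=
  IsOpen Ω ∧ Bornology.IsBounded Ω ∧
    ∃ U ρ, IsDefiningFn n k Ω U ρ ∧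
      ∀ z ∈ frontier Ω, ∀ w : Fin n → ℂ, w ≠ 0 →
        cGradPair n ρ z w = 0 → 0 < (cHessForm n ρ z w).re

/-- The complex Jacobian matrix `φ'(z) = [∂φ_i/∂z_j(z)]` of `φ : ℂⁿ → ℂⁿ`. -/
def jacobian (n : ℕ) (φ : EuclideanSpace ℂ (Fin n) → EuclideanSpace ℂ (Fin n))
    (z : EuclideanSpace ℂ (Fin n)) : Matrix (Fin n) (Fin n) ℂ :=
  Matrix.of fun i j => wDz n j (fun w => φ w i) z

/-- `φ` is a proper map from `Ω₁` to `Ω₂`. -/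
def IsProperMapOn (n : ℕ) (φ : EuclideanSpace ℂ (Fin n) → EuclideanSpace ℂ (Fin n))
    (Ω₁ Ω₂ : Set (EuclideanSpace ℂ (Fin n))) : Prop :=
  Set.MapsTo φ Ω₁ Ω₂ ∧ ∀ K ⊆ Ω₂, IsCompact K → IsCompact {z ∈ Ω₁ | φ z ∈ K}


section
open MeasureTheory in
lemma integrableOn_aesm_bdd {α : Type*} [MeasurableSpace α] {μ : Measure α} {s : Set α}
    {E : Type*} [NormedAddCommGroup E] {f : α → E} {M : ℝ}
    (hs : MeasurableSet s) (hfin : μ s ≠ ⊤) (hm : AEStronglyMeasurable f (μ.restrict s))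
    (hb : ∀ x ∈ s, ‖f x‖ ≤ M) : IntegrableOn f s μ := by
  have : IsFiniteMeasure (μ.restrict s) := ⟨by
    rw [Measure.restrict_apply_univ]; exact hfin.lt_top⟩
  exact Integrable.of_bound hm M ((ae_restrict_mem hs).mono hb)

lemma radial_beta (k m : ℕ) :
    ∫ x in (0:ℝ)..1, x * x ^ (2 * k) * (1 - x ^ 2) ^ m
      = (k.factorial * m.factorial : ℝ) / (2 * (k + m + 1).factorial) := by
  induction m generalizing k with
  | zero =>
    have : ∀ x : ℝ, x * x ^ (2 * k) * (1 - x ^ 2) ^ 0 = x ^ (2 * k + 1) := fun x => by ring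
    simp_rw [this]
    rw [integral_pow]
    rw [add_zero, Nat.factorial_succ]
    have := Nat.factorial_pos k
    push_cast
    simp only [Nat.factorial_zero, Nat.cast_one]
    field_simp
    ring
  | succ m ih =>
    have : ∀ x : ℝ, x * x ^ (2 * k) * (1 - x ^ 2) ^ (m + 1)
        = x * x ^ (2 * k) * (1 - x ^ 2) ^ m - x * x ^ (2 * (k + 1)) * (1 - x ^ 2) ^ m :=
      fun x => by ring
    simp_rw [this]
    rw [intervalIntegral.integral_sub, ih, ih]
    · have h1 : k + 1 + m + 1 = (k + m + 1) + 1 := by ring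
      have h2 : k + (m + 1) + 1 = (k + m + 1) + 1 := by ring
      rw [h1, h2, Nat.factorial_succ (k + m + 1), Nat.factorial_succ k, Nat.factorial_succ m]
      have := Nat.factorial_pos (k + m + 1)
      push_cast
      field_simp
      ring
    · exact (by fun_prop : Continuous fun x : ℝ => x * x ^ (2 * k) * (1 - x ^ 2) ^ m).intervalIntegrable _ _
    · exact (by fun_prop : Continuous fun x : ℝ => x * x ^ (2 * (k+1)) * (1 - x ^ 2) ^ m).intervalIntegrable _ _

lemma circ_coeff {g : ℂ → ℂ} (hg : DifferentiableOn ℂ g (ball 0 1)) {ρ : ℝ} (h0 : 0 < ρ)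
    (h1 : ρ < 1) (k : ℕ) :
    ∫ θ in (-Real.pi)..Real.pi, g (circleMap 0 ρ θ) * (starRingEnd ℂ (circleMap 0 ρ θ)) ^ k
      = 2 * Real.pi * ρ ^ (2 * k) * (iteratedDeriv k g 0 / k.factorial) := by
  have hper : ∫ θ in (-Real.pi)..Real.pi,
      g (circleMap 0 ρ θ) * (starRingEnd ℂ (circleMap 0 ρ θ)) ^ k
      = ∫ θ in (0:ℝ)..2 * Real.pi,
      g (circleMap 0 ρ θ) * (starRingEnd ℂ (circleMap 0 ρ θ)) ^ k := by
    have hp : Function.Periodic (fun θ => g (circleMap 0 ρ θ) * (starRingEnd ℂ (circleMap 0 ρ θ)) ^ k)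
        (2 * Real.pi) := fun θ => by
      simp only [periodic_circleMap 0 ρ θ]
    have := hp.intervalIntegral_add_eq (-Real.pi) 0
    rw [show -Real.pi + 2 * Real.pi = Real.pi by ring, zero_add] at this
    exact this
  rw [hper]
  lift ρ to NNReal using h0.le
  have hsub : closedBall (0:ℂ) ρ ⊆ ball 0 1 := closedBall_subset_ball h1
  have hF := (hg.mono hsub).hasFPowerSeriesOnBall (c := 0) (R := ρ) (by exact_mod_cast h0)
  have hA : AnalyticAt ℂ g 0 := hF.analyticAt
  have heq := hF.hasFPowerSeriesAt.eq_formalMultilinearSeries hA.hasFPowerSeriesAt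
  have hk := congrArg (fun p : FormalMultilinearSeries ℂ ℂ ℂ => p k (fun _ => (1:ℂ))) heq
  simp only [cauchyPowerSeries_apply, FormalMultilinearSeries.ofScalars_apply_eq] at hk
  simp only [circleIntegral, smul_eq_mul, one_pow, mul_one, deriv_circleMap, sub_zero] at hk
  have e1 : ∀ θ : ℝ, g (circleMap 0 ρ θ) * (starRingEnd ℂ (circleMap 0 ρ θ)) ^ k
      = (ρ:ℂ)^(2*k) * ((-I) * (circleMap 0 ρ θ * I * ((1 / circleMap 0 ρ θ) ^ k *
        ((circleMap 0 ρ θ)⁻¹ * g (circleMap 0 ρ θ))))) := fun θ => by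
    have hne : circleMap 0 (ρ:ℝ) θ ≠ 0 := circleMap_ne_center (by exact_mod_cast h0.ne')
    have hc : starRingEnd ℂ (circleMap 0 ρ θ) = (ρ:ℂ)^2 / circleMap 0 ρ θ := by
      rw [eq_div_iff hne, mul_comm, Complex.mul_conj, Complex.normSq_eq_norm_sq]
      simp
    have hnk : circleMap 0 (ρ:ℝ) θ ^ k ≠ 0 := pow_ne_zero k hne
    have hI : (-I) * I = 1 := by simp
    rw [hc, div_pow, ← pow_mul, div_pow, one_pow]
    field_simp
    linear_combination (- g (circleMap 0 (ρ:ℝ) θ) * (ρ:ℂ) ^ (2*k)) * hI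
  simp_rw [e1]
  rw [intervalIntegral.integral_const_mul, intervalIntegral.integral_const_mul]
  have hpi : (2 * Real.pi * I : ℂ) ≠ 0 := Complex.two_pi_I_ne_zero
  rw [inv_mul_eq_iff_eq_mul₀ hpi] at hk
  rw [hk]
  linear_combination (-2 * Real.pi * (ρ:ℂ) ^ (2*k) * (iteratedDeriv k g 0 / k.factorial)) * I_sq

open MeasureTheory in
lemma disc_moment {g : ℂ → ℂ} (hg : DifferentiableOn ℂ g (ball 0 1)) {M : ℝ}
    (hM : ∀ z ∈ ball (0:ℂ) 1, ‖g z‖ ≤ M) (m k : ℕ) :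
    ∫ z in ball (0:ℂ) 1, g z * (1 - ‖z‖ ^ 2 : ℝ) ^ m * (starRingEnd ℂ z) ^ k
      = Real.pi * ((k.factorial * m.factorial : ℝ) / ((k + m + 1).factorial) : ℝ)
        * (iteratedDeriv k g 0 / k.factorial) := by
  set F : ℂ → ℂ := fun z => g z * (1 - ‖z‖ ^ 2 : ℝ) ^ m * (starRingEnd ℂ z) ^ k with hF
  have hFc : ContinuousOn F (ball 0 1) := by
    refine (hg.continuousOn.mul ?_).mul ?_
    · exact (by fun_prop : Continuous fun z : ℂ => (((1 - ‖z‖ ^ 2 : ℝ) : ℂ)) ^ m).continuousOn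
    · exact ((Complex.continuous_conj).pow k).continuousOn
  have hFM : ∀ z ∈ ball (0:ℂ) 1, ‖F z‖ ≤ M := fun z hz => by
    have hz1 : ‖z‖ < 1 := by simpa using hz
    have h1 : ‖(((1 - ‖z‖ ^ 2 : ℝ) : ℂ)) ^ m‖ ≤ 1 := by
      rw [norm_pow]
      apply pow_le_one₀ (norm_nonneg _)
      rw [Complex.norm_real, Real.norm_eq_abs, abs_le]
      constructor <;> nlinarith [norm_nonneg z]
    have h2 : ‖(starRingEnd ℂ z) ^ k‖ ≤ 1 := by
      rw [norm_pow]
      apply pow_le_one₀ (norm_nonneg _)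
      simpa using hz1.le
    have hM0 : 0 ≤ M := (norm_nonneg _).trans (hM z hz)
    calc ‖F z‖ = ‖g z‖ * ‖(((1 - ‖z‖ ^ 2 : ℝ) : ℂ)) ^ m‖ * ‖(starRingEnd ℂ z) ^ k‖ := by
          simp only [hF, norm_mul]
      _ ≤ M * 1 * 1 := by gcongr; exact hM z hz
      _ = M := by ring
  rw [← integral_indicator measurableSet_ball, ← Complex.integral_comp_polarCoord_symm]
  have hps : ∀ p : ℝ × ℝ, Complex.polarCoord.symm p = circleMap 0 p.1 p.2 := fun p => by
    simp [circleMap, Complex.exp_mul_I]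
  have hsub : Set.Ioo (0:ℝ) 1 ×ˢ Set.Ioo (-Real.pi) Real.pi ⊆ polarCoord.target := by
    rintro ⟨a, b⟩ ⟨h1, h2⟩
    exact ⟨h1.1, h2⟩
  have hmeas : MeasurableSet (Set.Ioo (0:ℝ) 1 ×ˢ Set.Ioo (-Real.pi) Real.pi) :=
    measurableSet_Ioo.prod measurableSet_Ioo
  rw [setIntegral_eq_of_subset_of_forall_sdiff_eq_zero (polarCoord.open_target.measurableSet) hsub]
  swap
  · rintro ⟨a, b⟩ ⟨⟨h1, h2⟩, h3⟩
    have : ¬ a < 1 := fun h => h3 ⟨⟨h1, h⟩, h2⟩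
    have hn : circleMap 0 a b ∉ ball (0:ℂ) 1 := by
      simp only [mem_ball_zero_iff, norm_circleMap_zero]
      rw [abs_of_pos h1]; exact this
    simp only [hps]
    rw [Set.indicator_of_notMem hn, smul_zero]
  have hmem : ∀ p ∈ Set.Ioo (0:ℝ) 1 ×ˢ Set.Ioo (-Real.pi) Real.pi, circleMap 0 p.1 p.2 ∈ ball (0:ℂ) 1 := by
    rintro ⟨a, b⟩ ⟨h1, h2⟩
    simp only [mem_ball_zero_iff, norm_circleMap_zero]
    rw [abs_of_pos h1.1]; exact h1.2
  have hcong : ∫ p in Set.Ioo (0:ℝ) 1 ×ˢ Set.Ioo (-Real.pi) Real.pi,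
      p.1 • (ball (0:ℂ) 1).indicator F (Complex.polarCoord.symm p)
      = ∫ p in Set.Ioo (0:ℝ) 1 ×ˢ Set.Ioo (-Real.pi) Real.pi, p.1 • F (circleMap 0 p.1 p.2) := by
    apply setIntegral_congr_fun hmeas
    intro p hp
    simp only [hps]
    rw [Set.indicator_of_mem (hmem p hp)]
  rw [hcong]
  have hcm : Continuous fun p : ℝ × ℝ => circleMap 0 p.1 p.2 := by
    unfold circleMap; fun_prop
  have hintble : IntegrableOn (fun p : ℝ × ℝ => p.1 • F (circleMap 0 p.1 p.2))
      (Set.Ioo (0:ℝ) 1 ×ˢ Set.Ioo (-Real.pi) Real.pi) (volume.prod volume) := by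
    refine integrableOn_aesm_bdd (M := M) hmeas ?_ ?_ ?_
    · rw [Measure.prod_prod]; simp
    · apply ContinuousOn.aestronglyMeasurable _ hmeas
      exact continuousOn_fst.smul (hFc.comp hcm.continuousOn hmem)
    · intro p hp
      have hb := hFM _ (hmem p hp)
      rw [norm_smul, Real.norm_eq_abs, abs_of_pos hp.1.1]
      calc p.1 * ‖F (circleMap 0 p.1 p.2)‖ ≤ 1 * M := by
            apply mul_le_mul hp.1.2.le hb (norm_nonneg _) zero_le_one
        _ = M := one_mul _
  rw [Measure.volume_eq_prod, setIntegral_prod _ hintble]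
  have hinner : ∀ x ∈ Set.Ioo (0:ℝ) 1, ∫ y in Set.Ioo (-Real.pi) Real.pi, x • F (circleMap 0 x y)
      = ((x * x ^ (2 * k) * (1 - x ^ 2) ^ m : ℝ) : ℂ)
        * (2 * Real.pi * (iteratedDeriv k g 0 / k.factorial)) := by
    intro x hx
    rw [← integral_Ioc_eq_integral_Ioo, ← intervalIntegral.integral_of_le (by linarith [Real.pi_pos])]
    have e : ∀ y : ℝ, x • F (circleMap 0 x y) = ((x * (1 - x ^ 2) ^ m : ℝ) : ℂ) *
        (g (circleMap 0 x y) * (starRingEnd ℂ (circleMap 0 x y)) ^ k) := fun y => by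
      simp only [hF, norm_circleMap_zero, sq_abs, Complex.real_smul]
      push_cast; ring
    simp_rw [e]
    rw [intervalIntegral.integral_const_mul, circ_coeff hg hx.1 hx.2]
    push_cast; ring
  rw [setIntegral_congr_fun measurableSet_Ioo hinner, integral_mul_const, integral_complex_ofReal,
    ← integral_Ioc_eq_integral_Ioo, ← intervalIntegral.integral_of_le zero_le_one, radial_beta]
  push_cast
  have := Nat.factorial_pos (k + m + 1)
  field_simp

open MeasureTheory in
lemma disc_formula {g : ℂ → ℂ} (hg : DifferentiableOn ℂ g (ball 0 1)) {M : ℝ}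
    (hM : ∀ z ∈ ball (0:ℂ) 1, ‖g z‖ ≤ M) (m : ℕ) {α : ℝ} (h0 : 0 ≤ α) (h1 : α < 1) :
    ∫ z in ball (0:ℂ) 1, g z * (1 - ‖z‖ ^ 2 : ℝ) ^ m *
        (starRingEnd ℂ z * (1 - α * starRingEnd ℂ z)⁻¹ ^ (m + 3))
      = (Real.pi * (m.factorial / (m + 2).factorial : ℝ) : ℝ) * deriv g α := by
  set μ := volume.restrict (ball (0:ℂ) 1) with hμ
  set c : ℕ → ℂ := fun j => (((j + (m + 2)).choose (m + 2) : ℕ) : ℂ) * (α : ℂ) ^ j with hc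
  set G : ℕ → ℂ → ℂ := fun j z => c j *
    (g z * (1 - ‖z‖ ^ 2 : ℝ) ^ m * (starRingEnd ℂ z) ^ (j + 1)) with hG
  have hM0 : 0 ≤ M := (norm_nonneg _).trans (hM 0 (by simp))
  have hFc : ∀ k : ℕ, ContinuousOn
      (fun z : ℂ => g z * (1 - ‖z‖ ^ 2 : ℝ) ^ m * (starRingEnd ℂ z) ^ k) (ball 0 1) := fun k => by
    refine (hg.continuousOn.mul ?_).mul ?_
    · exact (by fun_prop : Continuous fun z : ℂ => (((1 - ‖z‖ ^ 2 : ℝ) : ℂ)) ^ m).continuousOn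
    · exact ((Complex.continuous_conj).pow k).continuousOn
  have hFM : ∀ k : ℕ, ∀ z ∈ ball (0:ℂ) 1,
      ‖g z * (1 - ‖z‖ ^ 2 : ℝ) ^ m * (starRingEnd ℂ z) ^ k‖ ≤ M := fun k z hz => by
    have hz1 : ‖z‖ < 1 := by simpa using hz
    have h1 : ‖(((1 - ‖z‖ ^ 2 : ℝ) : ℂ)) ^ m‖ ≤ 1 := by
      rw [norm_pow]
      apply pow_le_one₀ (norm_nonneg _)
      rw [Complex.norm_real, Real.norm_eq_abs, abs_le]
      constructor <;> nlinarith [norm_nonneg z]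
    have h2 : ‖(starRingEnd ℂ z) ^ k‖ ≤ 1 := by
      rw [norm_pow]
      apply pow_le_one₀ (norm_nonneg _)
      simpa using hz1.le
    rw [norm_mul, norm_mul]
    calc _ ≤ M * 1 * 1 := by gcongr; exact hM z hz
      _ = M := by ring
  have hfin : μ Set.univ ≠ ⊤ := by
    rw [hμ, Measure.restrict_apply_univ]; exact measure_ball_lt_top.ne
  have : IsFiniteMeasure μ := ⟨hfin.lt_top⟩
  have hGint : ∀ j, Integrable (G j) μ := fun j => by
    refine Integrable.const_mul ?_ _
    refine integrableOn_aesm_bdd (M := M) measurableSet_ball measure_ball_lt_top.ne ?_ ?_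
    · exact (hFc _).aestronglyMeasurable measurableSet_ball
    · exact fun z hz => hFM _ z hz
  have hα : ‖(α:ℂ)‖ < 1 := by simpa [abs_of_nonneg h0] using h1
  have hsc : Summable fun j => ‖c j‖ := by
    have := (summable_choose_mul_geometric_of_norm_lt_one (R := ℝ) (m + 2)
      (r := α) (by simpa [abs_of_nonneg h0] using h1))
    refine this.congr fun j => ?_
    simp [hc, abs_of_nonneg h0]
  have hsum : Summable fun j => ∫ z, ‖G j z‖ ∂μ := by
    refine Summable.of_nonneg_of_le (fun j => integral_nonneg fun z => norm_nonneg _) (fun j => ?_)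
      (hsc.mul_right (M * μ.real Set.univ))
    calc ∫ z, ‖G j z‖ ∂μ ≤ ∫ z, ‖c j‖ * M ∂μ := by
          apply integral_mono_ae (hGint j).norm (integrable_const _)
          filter_upwards [ae_restrict_mem measurableSet_ball] with z hz
          simp only [hG]
          rw [norm_mul]
          gcongr
          exact hFM _ z hz
      _ = ‖c j‖ * (M * μ.real Set.univ) := by
          rw [integral_const]; simp; ring
  have hS := hasSum_integral_of_summable_integral_norm hGint hsum
  have hL : ∫ z, ∑' j, G j z ∂μ = ∫ z in ball (0:ℂ) 1, g z * (1 - ‖z‖ ^ 2 : ℝ) ^ m *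
        (starRingEnd ℂ z * (1 - α * starRingEnd ℂ z)⁻¹ ^ (m + 3)) := by
    apply setIntegral_congr_fun measurableSet_ball
    intro z hz
    have hz1 : ‖z‖ < 1 := by simpa using hz
    have hr : ‖(α:ℂ) * starRingEnd ℂ z‖ < 1 := by
      rw [norm_mul, Complex.norm_conj]
      calc _ ≤ ‖(α:ℂ)‖ * 1 := by gcongr
        _ < 1 := by simpa using hα
    have h := (hasSum_choose_mul_geometric_of_norm_lt_one (m + 2) hr).mul_left
      (g z * (1 - ‖z‖ ^ 2 : ℝ) ^ m * starRingEnd ℂ z)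
    rw [show m + 2 + 1 = m + 3 by ring] at h
    have h2 : HasSum (fun j => G j z) (g z * (1 - ‖z‖ ^ 2 : ℝ) ^ m * starRingEnd ℂ z *
      (1 / (1 - (α:ℂ) * starRingEnd ℂ z) ^ (m + 3))) := by
      convert! h using 1
      funext j
      simp only [hG, hc, mul_pow, pow_succ]
      ring
    simp only
    rw [h2.tsum_eq, one_div, inv_pow, mul_assoc _ (starRingEnd ℂ z)]
  rw [hL] at hS
  have hterm : ∀ j, ∫ z, G j z ∂μ = (Real.pi * (m.factorial / (m + 2).factorial : ℝ) : ℝ) *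
      ((j.factorial : ℂ)⁻¹ * (α:ℂ) ^ j * iteratedDeriv j (deriv g) 0) := fun j => by
    simp only [hG, hμ]
    rw [integral_const_mul, disc_moment hg hM, ← iteratedDeriv_succ']
    simp only [hc]
    rw [Nat.add_choose, show j + 1 + m + 1 = j + (m + 2) by ring]
    have e1 := Nat.factorial_ne_zero (j + (m + 2))
    have e2 := Nat.factorial_ne_zero j
    have e3 := Nat.factorial_ne_zero (m + 2)
    have e4 := Nat.factorial_ne_zero (j + 1)
    rw [Nat.cast_div (Nat.factorial_mul_factorial_dvd_factorial_add _ _) (by positivity)]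
    push_cast
    have e1' : ((j + (m + 2)).factorial : ℂ) ≠ 0 := by exact_mod_cast e1
    have e2' : ((j).factorial : ℂ) ≠ 0 := by exact_mod_cast e2
    have e3' : ((m + 2).factorial : ℂ) ≠ 0 := by exact_mod_cast e3
    have e4' : ((j + 1).factorial : ℂ) ≠ 0 := by exact_mod_cast e4
    field_simp
  have hT : HasSum (fun j : ℕ => (j.factorial : ℂ)⁻¹ * (α:ℂ) ^ j * iteratedDeriv j (deriv g) 0)
      (deriv g α) := by
    have hd : DifferentiableOn ℂ (deriv g) (ball 0 1) := hg.deriv isOpen_ball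
    have := Complex.hasSum_taylorSeries_on_ball hd (z := α) (by simpa [abs_of_nonneg h0] using h1)
    refine this.congr_fun ?_ |> fun h => h
    intro j
    simp [smul_eq_mul, mul_assoc]
  simp_rw [hterm] at hS
  exact hS.unique (hT.mul_left _)
end

section
open MeasureTheory in
lemma lint_scale (E : Type*) [NormedAddCommGroup E] [NormedSpace ℝ E] [FiniteDimensional ℝ E]
    [MeasureSpace E] [BorelSpace E] [(volume : Measure E).IsAddHaarMeasure] {a : ℝ}
    (ha : (Module.finrank ℝ E : ℝ) < a) :
    ∃ C : ℝ, 0 ≤ C ∧ ∀ δ : ℝ, 0 < δ →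
      ∫⁻ x : E, ENNReal.ofReal ((δ + ‖x‖) ^ (-a))
        ≤ ENNReal.ofReal (C * δ ^ ((Module.finrank ℝ E : ℝ) - a)) := by
  have hi : Integrable (fun x : E => (1 + ‖x‖) ^ (-a)) := integrable_one_add_norm ha
  refine ⟨∫ x : E, (1 + ‖x‖) ^ (-a), integral_nonneg fun x => by positivity, fun δ hδ => ?_⟩
  have e : ∀ x : E, (δ + ‖x‖) ^ (-a) = δ ^ (-a) * (1 + ‖δ⁻¹ • x‖) ^ (-a) := fun x => by
    rw [norm_smul, Real.norm_eq_abs, abs_of_pos (by positivity), ← Real.mul_rpow hδ.le (by positivity)]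
    congr 1
    field_simp
  have hi2 : Integrable (fun x : E => (1 + ‖δ⁻¹ • x‖) ^ (-a)) :=
    hi.comp_smul (inv_ne_zero hδ.ne')
  simp_rw [e]
  rw [← ofReal_integral_eq_lintegral_ofReal (hi2.const_mul _)
    (Filter.Eventually.of_forall fun x => by positivity)]
  apply ENNReal.ofReal_le_ofReal
  rw [integral_const_mul, Measure.integral_comp_inv_smul_of_nonneg volume
    (fun x : E => (1 + ‖x‖) ^ (-a)) hδ.le, smul_eq_mul]
  apply le_of_eq
  rw [sub_eq_add_neg, Real.rpow_add hδ, Real.rpow_natCast]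
  ring

open MeasureTheory in
lemma lint_X (m : ℕ) : ∃ C : ℝ, 0 ≤ C ∧ ∀ δ : ℝ, 0 < δ →
      ∫⁻ x : Fin m → ℂ, ENNReal.ofReal ((δ + ‖x‖ ^ 2) ^ (-((m:ℝ) + 1/4)))
        ≤ ENNReal.ofReal (C * δ ^ (-(1/4 : ℝ))) := by
  have hd : Module.finrank ℝ (Fin m → ℂ) = m * 2 := by
    rw [Module.finrank_pi_fintype]; simp [Complex.finrank_real_complex]
  obtain ⟨C, hC, h⟩ := lint_scale (Fin m → ℂ) (a := 2 * m + 1/2) (by rw [hd]; push_cast; linarith)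
  refine ⟨2 ^ ((m:ℝ) + 1/4) * C, by positivity, fun δ hδ => ?_⟩
  have h2 := h (√δ) (by positivity)
  have e : ∀ x : Fin m → ℂ, ENNReal.ofReal ((δ + ‖x‖ ^ 2) ^ (-((m:ℝ) + 1/4)))
      ≤ ENNReal.ofReal (2 ^ ((m:ℝ) + 1/4)) * ENNReal.ofReal ((√δ + ‖x‖) ^ (-(2 * (m:ℝ) + 1/2))) := by
    intro x
    rw [← ENNReal.ofReal_mul (by positivity)]
    apply ENNReal.ofReal_le_ofReal
    have hp : 0 < √δ + ‖x‖ := by positivity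
    have e1 : (√δ + ‖x‖) ^ (-(2 * (m:ℝ) + 1/2)) = ((√δ + ‖x‖) ^ 2) ^ (-((m:ℝ) + 1/4)) := by
      rw [← Real.rpow_natCast, ← Real.rpow_mul hp.le]; congr 1; push_cast; ring
    have e2 : (2:ℝ) ^ ((m:ℝ) + 1/4) = (1/2) ^ (-((m:ℝ) + 1/4)) := by
      rw [Real.rpow_neg (by norm_num), ← Real.inv_rpow (by norm_num)]; norm_num
    rw [e1, e2, ← Real.mul_rpow (by norm_num) (by positivity)]
    apply Real.rpow_le_rpow_of_nonpos (by positivity)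
    · have : √δ ^ 2 = δ := Real.sq_sqrt hδ.le
      nlinarith [sq_nonneg (√δ - ‖x‖)]
    · have : (0:ℝ) ≤ m := by positivity
      linarith
  calc _ ≤ ∫⁻ x : Fin m → ℂ, ENNReal.ofReal (2 ^ ((m:ℝ) + 1/4)) *
        ENNReal.ofReal ((√δ + ‖x‖) ^ (-(2 * (m:ℝ) + 1/2))) := lintegral_mono e
    _ ≤ ENNReal.ofReal (2 ^ ((m:ℝ) + 1/4)) * ENNReal.ofReal (C * √δ ^ (((m * 2 : ℕ):ℝ) - (2 * m + 1/2))) := by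
        rw [lintegral_const_mul' _ _ ENNReal.ofReal_ne_top]
        gcongr
        rw [hd] at h2
        exact h2
    _ = _ := by
        rw [← ENNReal.ofReal_mul (by positivity)]
        congr 1
        rw [mul_assoc]
        congr 2
        rw [Real.sqrt_eq_rpow, ← Real.rpow_mul hδ.le]
        congr 1; push_cast; ring

/-- the size function -/
def tt {m : ℕ} (δ : ℝ) (p : (Fin m → ℂ) × ℂ) : ℝ := δ + ‖p.2‖ + ‖p.1‖ ^ 2

lemma tt_pos {m : ℕ} {δ : ℝ} (hδ : 0 < δ) (p : (Fin m → ℂ) × ℂ) : 0 < tt δ p := by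
  unfold tt; positivity

lemma continuous_tt {m : ℕ} (δ : ℝ) : Continuous (tt (m := m) δ) := by
  unfold tt; fun_prop

open MeasureTheory in
/-- integral of `t^{-(m+5/2)}` -/
lemma lint_t (m : ℕ) : ∃ C : ℝ, 0 ≤ C ∧ ∀ δ : ℝ, 0 < δ →
      ∫⁻ p : (Fin m → ℂ) × ℂ, ENNReal.ofReal (tt δ p ^ (-((m:ℝ) + 5/2)))
        ≤ ENNReal.ofReal (C * δ ^ (-(1/2 : ℝ))) := by
  obtain ⟨C1, hC1, h1⟩ := lint_X m
  obtain ⟨C2, hC2, h2⟩ := lint_scale ℂ (a := 9/4) (by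
    rw [Complex.finrank_real_complex]; norm_num)
  refine ⟨C1 * C2, by positivity, fun δ hδ => ?_⟩
  have h1 := h1 δ hδ
  have h2 := h2 δ hδ
  rw [Complex.finrank_real_complex] at h2
  have e : ∀ p : (Fin m → ℂ) × ℂ, ENNReal.ofReal (tt δ p ^ (-((m:ℝ) + 5/2))) ≤
      ENNReal.ofReal ((δ + ‖p.1‖ ^ 2) ^ (-((m:ℝ) + 1/4))) * ENNReal.ofReal ((δ + ‖p.2‖) ^ (-(9/4:ℝ))) := by
    intro p
    rw [← ENNReal.ofReal_mul (by positivity)]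
    apply ENNReal.ofReal_le_ofReal
    have ht := tt_pos hδ p
    have hm : (0:ℝ) ≤ m := by positivity
    calc tt δ p ^ (-((m:ℝ) + 5/2)) = tt δ p ^ (-((m:ℝ) + 1/4)) * tt δ p ^ (-(9/4:ℝ)) := by
          rw [← Real.rpow_add ht]; congr 1; ring
      _ ≤ _ := by
        gcongr ?_ * ?_
        · apply Real.rpow_le_rpow_of_nonpos (by positivity) _ (by linarith)
          unfold tt; linarith [norm_nonneg p.2]
        · apply Real.rpow_le_rpow_of_nonpos (by positivity) _ (by linarith)
          unfold tt; linarith [sq_nonneg ‖p.1‖]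
  refine (lintegral_mono e).trans ?_
  rw [Measure.volume_eq_prod, lintegral_prod_mul
    (f := fun x : Fin m → ℂ => ENNReal.ofReal ((δ + ‖x‖ ^ 2) ^ (-((m:ℝ) + 1/4))))
    (g := fun w : ℂ => ENNReal.ofReal ((δ + ‖w‖) ^ (-(9/4:ℝ))))]
  · refine (mul_le_mul' h1 h2).trans ?_
    rw [← ENNReal.ofReal_mul (by positivity)]
    apply le_of_eq
    congr 1
    have : δ ^ (-(1/2:ℝ)) = δ ^ (-(1/4 : ℝ)) * δ ^ (((2:ℕ):ℝ) - 9/4) := by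
      rw [← Real.rpow_add hδ]; norm_num
    rw [this]; ring
  · exact (by fun_prop : Measurable _).aemeasurable
  · exact (by fun_prop : Measurable _).aemeasurable
end

section
open MeasureTheory in
lemma lint_C_le (F : ℂ → ENNReal) (hF : Measurable F) :
    ∫⁻ w, F w = ∫⁻ y : ℝ, ∫⁻ u : ℝ, F (u + y * I) := by
  rw [← (Complex.volume_preserving_equiv_real_prod.symm).lintegral_comp_emb
    measurableEquivRealProd.symm.measurableEmbedding]
  rw [Measure.volume_eq_prod, lintegral_prod_symm]
  · apply lintegral_congr; intro y; apply lintegral_congr; intro u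
    congr 1
    apply Complex.ext <;> simp [measurableEquivRealProd]
  · exact (hF.comp measurableEquivRealProd.symm.measurable).aemeasurable

open MeasureTheory in
lemma lint_Zslice (m : ℕ) (B : ℝ) (hB : 0 ≤ B) : ∃ C' : ℝ, 0 ≤ C' ∧
    ∀ δ : ℝ, 0 < δ → ∀ H : (Fin m → ℂ) → ℝ, Continuous H →
      ∫⁻ p : (Fin m → ℂ) × ℂ,
        Set.indicator {p : (Fin m → ℂ) × ℂ | |H p.1 + 2 * p.2.re - δ| ≤
          B * ((δ + |p.2.im| + ‖p.1‖^2) * √(δ + |p.2.im| + ‖p.1‖^2))}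
        (fun p => ENNReal.ofReal ((δ + |p.2.im| + ‖p.1‖^2) ^ (-((m:ℝ) + 3)))) p
        ≤ ENNReal.ofReal (C' * δ ^ (-(1/2 : ℝ))) := by
  obtain ⟨C1, hC1, h1⟩ := lint_X m
  obtain ⟨C2, hC2, h2⟩ := lint_scale ℝ (a := 5/4) (by
    rw [Module.finrank_self]; norm_num)
  refine ⟨B * (C1 * C2), by positivity, fun δ hδ H hH => ?_⟩
  have h1 := h1 δ hδ
  have h2 := h2 δ hδ
  rw [Module.finrank_self] at h2
  set Z := {p : (Fin m → ℂ) × ℂ | |H p.1 + 2 * p.2.re - δ| ≤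
          B * ((δ + |p.2.im| + ‖p.1‖^2) * √(δ + |p.2.im| + ‖p.1‖^2))} with hZ
  have hZm : MeasurableSet Z := by
    apply IsClosed.measurableSet
    apply isClosed_le
    · have := hH.comp (continuous_fst (X := Fin m → ℂ) (Y := ℂ))
      have h3 : Continuous fun p : (Fin m → ℂ) × ℂ => p.2.re := Complex.continuous_re.comp continuous_snd
      exact ((this.add (h3.const_mul 2)).sub continuous_const).abs
    · have h3 : Continuous fun p : (Fin m → ℂ) × ℂ => p.2.im := Complex.continuous_im.comp continuous_snd
      fun_prop
  have hFm : Measurable (Z.indicator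
        (fun p : (Fin m → ℂ) × ℂ => ENNReal.ofReal ((δ + |p.2.im| + ‖p.1‖^2) ^ (-((m:ℝ) + 3))))) := by
    refine Measurable.indicator ?_ hZm
    have h3 : Measurable fun p : (Fin m → ℂ) × ℂ => p.2.im := Complex.measurable_im.comp measurable_snd
    have h4 : Measurable fun p : (Fin m → ℂ) × ℂ => δ + |p.2.im| + ‖p.1‖^2 :=
      ((h3.abs).const_add δ).add (measurable_fst.norm.pow_const 2)
    exact (h4.pow_const _).ennreal_ofReal
  rw [Measure.volume_eq_prod, lintegral_prod _ hFm.aemeasurable]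
  have hin : ∀ x : Fin m → ℂ, ∫⁻ w : ℂ, Z.indicator
      (fun p : (Fin m → ℂ) × ℂ => ENNReal.ofReal ((δ + |p.2.im| + ‖p.1‖^2) ^ (-((m:ℝ) + 3)))) (x, w)
      ≤ ENNReal.ofReal ((δ + ‖x‖ ^ 2) ^ (-((m:ℝ) + 1/4))) *
        (ENNReal.ofReal B * ENNReal.ofReal (C2 * δ ^ (((1:ℕ):ℝ) - 5/4))) := by
    intro x
    rw [lint_C_le (fun w : ℂ => Z.indicator (fun p : (Fin m → ℂ) × ℂ =>
      ENNReal.ofReal ((δ + |p.2.im| + ‖p.1‖^2) ^ (-((m:ℝ) + 3)))) (x, w))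
      (hFm.comp measurable_prodMk_left)]
    have hy : ∀ y : ℝ, ∫⁻ u : ℝ, Z.indicator
      (fun p : (Fin m → ℂ) × ℂ => ENNReal.ofReal ((δ + |p.2.im| + ‖p.1‖^2) ^ (-((m:ℝ) + 3))))
        (x, (u:ℂ) + y * I)
        ≤ (ENNReal.ofReal ((δ + ‖x‖ ^ 2) ^ (-((m:ℝ) + 1/4))) * ENNReal.ofReal B) *
          ENNReal.ofReal ((δ + ‖y‖) ^ (-(5/4:ℝ))) := by
      intro y
      set τ := δ + |y| + ‖x‖ ^ 2 with hτ
      have hτ0 : 0 < τ := by positivity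
      have hsub : ∀ u : ℝ, Z.indicator
        (fun p : (Fin m → ℂ) × ℂ => ENNReal.ofReal ((δ + |p.2.im| + ‖p.1‖^2) ^ (-((m:ℝ) + 3))))
        (x, (u:ℂ) + y * I) ≤ (Set.Icc ((δ - H x - B * (τ * √τ)) / 2) ((δ - H x + B * (τ * √τ)) / 2)).indicator
          (fun _ => ENNReal.ofReal (τ ^ (-((m:ℝ) + 3)))) u := by
        intro u
        by_cases hu : (x, (u:ℂ) + y * I) ∈ Z
        · have hu' : u ∈ Set.Icc ((δ - H x - B * (τ * √τ)) / 2) ((δ - H x + B * (τ * √τ)) / 2) := by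
            simp only [hZ, Set.mem_setOf_eq] at hu
            simp at hu
            rw [abs_le] at hu
            constructor <;> linarith [hu.1, hu.2]
          rw [Set.indicator_of_mem hu, Set.indicator_of_mem hu']
          simp [hτ]
        · rw [Set.indicator_of_notMem hu]; exact zero_le
      refine (lintegral_mono hsub).trans ?_
      rw [lintegral_indicator_const measurableSet_Icc, Real.volume_Icc, ← ENNReal.ofReal_mul (by positivity),
        ← ENNReal.ofReal_mul (by positivity), ← ENNReal.ofReal_mul (by positivity)]
      apply ENNReal.ofReal_le_ofReal
      have hm : (0:ℝ) ≤ m := by positivity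
      calc τ ^ (-((m:ℝ) + 3)) * ((δ - H x + B * (τ * √τ)) / 2 - (δ - H x - B * (τ * √τ)) / 2)
          = B * (τ ^ (-((m:ℝ) + 3)) * τ ^ (1:ℝ) * τ ^ (1/2:ℝ)) := by
            rw [← Real.sqrt_eq_rpow, Real.rpow_one]; ring
        _ = B * (τ ^ (-((m:ℝ) + 1/4)) * τ ^ (-(5/4:ℝ))) := by
            rw [← Real.rpow_add hτ0, ← Real.rpow_add hτ0, ← Real.rpow_add hτ0]
            congr 2; ring
        _ ≤ B * ((δ + ‖x‖ ^ 2) ^ (-((m:ℝ) + 1/4)) * (δ + ‖y‖) ^ (-(5/4:ℝ))) := by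
            gcongr B * (?_ * ?_)
            · apply Real.rpow_le_rpow_of_nonpos (by positivity) _ (by linarith)
              rw [hτ]; linarith [abs_nonneg y]
            · apply Real.rpow_le_rpow_of_nonpos (by positivity) _ (by linarith)
              rw [hτ, Real.norm_eq_abs]; linarith [sq_nonneg ‖x‖]
        _ = _ := by ring
    refine (lintegral_mono hy).trans ?_
    rw [lintegral_const_mul' _ _ (ENNReal.mul_ne_top ENNReal.ofReal_ne_top ENNReal.ofReal_ne_top), mul_assoc]
    gcongr
  refine (lintegral_mono hin).trans ?_
  rw [lintegral_mul_const' _ _ (ENNReal.mul_ne_top ENNReal.ofReal_ne_top ENNReal.ofReal_ne_top)]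
  refine (mul_le_mul_left h1 _).trans ?_
  rw [← ENNReal.ofReal_mul (by positivity), ← ENNReal.ofReal_mul (by positivity)]
  apply le_of_eq
  congr 1
  have : δ ^ (-(1/2:ℝ)) = δ ^ (-(1/4 : ℝ)) * δ ^ (((1:ℕ):ℝ) - 5/4) := by
    rw [← Real.rpow_add hδ]; norm_num
  rw [this]; ring

open MeasureTheory in
lemma lint_Z (m : ℕ) (C₁ C : ℝ) (hC₁ : 0 ≤ C₁) (hC : 1 ≤ C) : ∃ C' : ℝ, 0 ≤ C' ∧
    ∀ δ : ℝ, 0 < δ → δ ≤ 1 → ∀ H : (Fin m → ℂ) → ℝ, Continuous H → (∀ x, 0 ≤ H x) →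
      (∀ x, H x ≤ C₁ * ‖x‖ ^ 2) →
      ∫⁻ p in {p : (Fin m → ℂ) × ℂ | p ∈ ball (0 : (Fin m → ℂ) × ℂ) 1 ∧
          |H p.1 + 2 * p.2.re - δ| ≤ C * (tt δ p * √(tt δ p))},
        ENNReal.ofReal (tt δ p ^ (-((m:ℝ) + 3)))
        ≤ ENNReal.ofReal (C' * δ ^ (-(1/2 : ℝ))) := by
  obtain ⟨C3, hC3, h3⟩ := lint_Zslice m (C * (2 + C₁) ^ 2) (by positivity)
  have hm : (0:ℝ) ≤ m := by positivity
  set A : ℝ := (1 / (4 * C ^ 2)) ^ (-((m:ℝ) + 3)) with hA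
  have hA0 : 0 ≤ A := by positivity
  set V : ℝ := (volume (ball (0 : (Fin m → ℂ) × ℂ) 1)).toReal with hV
  refine ⟨A * V + C3, by positivity, fun δ hδ hδ1 H hH hH0 hHle => ?_⟩
  have h3 := h3 δ hδ H hH
  set Z := {p : (Fin m → ℂ) × ℂ | |H p.1 + 2 * p.2.re - δ| ≤
          C * (2 + C₁) ^ 2 * ((δ + |p.2.im| + ‖p.1‖^2) * √(δ + |p.2.im| + ‖p.1‖^2))} with hZ
  have hWm : MeasurableSet {p : (Fin m → ℂ) × ℂ | p ∈ ball (0 : (Fin m → ℂ) × ℂ) 1 ∧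
          |H p.1 + 2 * p.2.re - δ| ≤ C * (tt δ p * √(tt δ p))} := by
    apply measurableSet_ball.inter
    apply IsClosed.measurableSet
    refine isClosed_le (f := fun p : (Fin m → ℂ) × ℂ => |H p.1 + 2 * p.2.re - δ|)
      (g := fun p => C * (tt δ p * √(tt δ p))) ?_ ?_
    · have := hH.comp (continuous_fst (X := Fin m → ℂ) (Y := ℂ))
      have h3 : Continuous fun p : (Fin m → ℂ) × ℂ => p.2.re := Complex.continuous_re.comp continuous_snd
      exact ((this.add (h3.const_mul 2)).sub continuous_const).abs
    · have := continuous_tt (m := m) δ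
      fun_prop
  rw [← lintegral_indicator hWm]
  have hpt : ∀ p : (Fin m → ℂ) × ℂ, Set.indicator {p : (Fin m → ℂ) × ℂ | p ∈ ball (0 : (Fin m → ℂ) × ℂ) 1 ∧
          |H p.1 + 2 * p.2.re - δ| ≤ C * (tt δ p * √(tt δ p))}
          (fun p => ENNReal.ofReal (tt δ p ^ (-((m:ℝ) + 3)))) p
      ≤ (ball (0 : (Fin m → ℂ) × ℂ) 1).indicator (fun _ => ENNReal.ofReal A) p + Z.indicator
        (fun p => ENNReal.ofReal ((δ + |p.2.im| + ‖p.1‖^2) ^ (-((m:ℝ) + 3)))) p := by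
    intro p
    by_cases hp : p ∈ {p : (Fin m → ℂ) × ℂ | p ∈ ball (0 : (Fin m → ℂ) × ℂ) 1 ∧
          |H p.1 + 2 * p.2.re - δ| ≤ C * (tt δ p * √(tt δ p))}
    swap
    · rw [Set.indicator_of_notMem hp]; exact zero_le
    rw [Set.indicator_of_mem hp]
    obtain ⟨hp1, hp2⟩ := hp
    have ht := tt_pos hδ p
    set t := tt δ p with htdef
    by_cases hbig : 1/2 ≤ C * √t
    · refine le_trans ?_ (le_add_of_nonneg_right zero_le)
      rw [Set.indicator_of_mem hp1]
      apply ENNReal.ofReal_le_ofReal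
      apply Real.rpow_le_rpow_of_nonpos (by positivity) _ (by linarith)
      rw [div_le_iff₀ (by positivity)]
      have : (1/2:ℝ)^2 ≤ (C * √t)^2 := by gcongr
      rw [mul_pow, Real.sq_sqrt ht.le] at this
      linarith
    · push Not at hbig
      refine le_trans ?_ (le_add_of_nonneg_left zero_le)
      set τ := δ + |p.2.im| + ‖p.1‖^2 with hτ
      have hτ0 : 0 < τ := by positivity
      have hw : ‖p.2‖ ≤ |p.2.re| + |p.2.im| := Complex.norm_le_abs_re_add_abs_im _
      have him : |p.2.im| ≤ ‖p.2‖ := Complex.abs_im_le_norm _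
      have htτ : τ ≤ t := by rw [hτ, htdef]; unfold tt; linarith
      have h5 : C * (t * √t) ≤ t / 2 := by nlinarith
      have h6 : 2 * |p.2.re| ≤ H p.1 + δ + t / 2 := by
        have := hp2.trans h5
        rw [abs_le] at this
        rw [← abs_two, ← abs_mul, abs_le]
        constructor <;> linarith [hH0 p.1]
      have h7 : t ≤ τ + |p.2.re| := by rw [htdef, hτ]; unfold tt; linarith
      have h8 : H p.1 ≤ C₁ * τ := (hHle p.1).trans (by
        apply mul_le_mul_of_nonneg_left _ hC₁
        rw [hτ]; linarith [abs_nonneg p.2.im])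
      have h9 : δ ≤ τ := by rw [hτ]; linarith [abs_nonneg p.2.im, sq_nonneg ‖p.1‖]
      have h10 : t ≤ (2 + C₁) * τ := by nlinarith
      have hmem : p ∈ Z := by
        show |H p.1 + 2 * p.2.re - δ| ≤ _
        refine hp2.trans ?_
        have hs : √t ≤ (2 + C₁) * √τ := by
          calc √t ≤ √((2 + C₁) ^ 2 * τ) := by
                apply Real.sqrt_le_sqrt
                nlinarith
            _ = (2 + C₁) * √τ := by
                rw [Real.sqrt_mul (by positivity), Real.sqrt_sq (by positivity)]
        calc C * (t * √t) ≤ C * ((2 + C₁) * τ * ((2 + C₁) * √τ)) := by gcongr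
          _ = _ := by ring
      rw [Set.indicator_of_mem hmem]
      apply ENNReal.ofReal_le_ofReal
      apply Real.rpow_le_rpow_of_nonpos (by positivity) htτ (by linarith)
  refine (lintegral_mono hpt).trans ?_
  rw [lintegral_add_left (measurable_const.indicator measurableSet_ball),
    lintegral_indicator_const measurableSet_ball]
  have hVe : volume (ball (0 : (Fin m → ℂ) × ℂ) 1) = ENNReal.ofReal V := by
    rw [hV, ENNReal.ofReal_toReal measure_ball_lt_top.ne]
  rw [hVe, ← ENNReal.ofReal_mul hA0]
  refine (add_le_add_right h3 _).trans ?_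
  rw [← ENNReal.ofReal_add (by positivity) (by positivity)]
  apply ENNReal.ofReal_le_ofReal
  have : 1 ≤ δ ^ (-(1/2:ℝ)) := by
    apply Real.one_le_rpow_of_pos_of_le_one_of_nonpos hδ hδ1 (by norm_num)
  nlinarith [mul_nonneg hA0 (show 0 ≤ V by positivity)]
end

section
/-- the antiholomorphic kernel -/
def kap (m : ℕ) (K δ : ℝ) (w : ℂ) : ℂ :=
  starRingEnd ℂ ((w + (1 / K : ℝ)) * ((δ - w)⁻¹) ^ (m + 3))

/-- the model height -/
def sfun (K δ : ℝ) (w : ℂ) : ℝ := δ - 2 * w.re - K * ‖w‖ ^ 2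

def RD (K δ : ℝ) : ℝ := √((δ + 1 / K) / K)

lemma RD_pos {K δ : ℝ} (hK : 0 < K) (hδ : 0 < δ) : 0 < RD K δ := by
  unfold RD; positivity

lemma RD_sq {K δ : ℝ} (hK : 0 < K) (hδ : 0 < δ) : RD K δ ^ 2 = (δ + 1 / K) / K := by
  unfold RD; rw [Real.sq_sqrt (by positivity)]

lemma sfun_eq {K δ : ℝ} (hK : 0 < K) (w : ℂ) :
    sfun K δ w = δ + 1 / K - K * ‖w - (-(1 / K : ℝ) : ℂ)‖ ^ 2 := by
  unfold sfun
  rw [← Complex.normSq_eq_norm_sq, ← Complex.normSq_eq_norm_sq, Complex.normSq_apply, Complex.normSq_apply]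
  simp
  field_simp
  ring

lemma mem_disc_iff {K δ : ℝ} (hK : 0 < K) (hδ : 0 < δ) (w : ℂ) :
    w ∈ ball (-(1 / K : ℝ) : ℂ) (RD K δ) ↔ 0 < sfun K δ w := by
  rw [mem_ball, dist_eq_norm, sfun_eq hK, ← abs_of_nonneg (norm_nonneg (w - (-(1 / K : ℝ) : ℂ))),
    ← abs_of_pos (RD_pos hK hδ), ← sq_lt_sq, RD_sq hK hδ, lt_div_iff₀ hK, abs_norm]
  constructor <;> intro h <;> linarith

open MeasureTheory in
lemma integral_ball_scale (F : ℂ → ℂ) (c : ℂ) {R : ℝ} (hR : 0 < R) :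
    ∫ w in ball c R, F w = (R ^ 2 : ℝ) * ∫ ξ in ball (0:ℂ) 1, F (c + R * ξ) := by
  rw [← integral_indicator measurableSet_ball, ← integral_indicator measurableSet_ball]
  set F' := (ball c R).indicator F with hF'
  have h1 : ∫ w, F' w = ∫ w, F' (c + w) := (integral_add_left_eq_self F' c).symm
  have h2 := Measure.integral_comp_smul volume (fun w => F' (c + w)) R
  rw [Complex.finrank_real_complex, abs_of_pos (by positivity)] at h2
  have h3 : ∀ ξ : ℂ, (ball (0:ℂ) 1).indicator (fun ξ => F (c + R * ξ)) ξ = F' (c + R • ξ) := by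
    intro ξ
    by_cases h : ξ ∈ ball (0:ℂ) 1
    · have h' : c + R • ξ ∈ ball c R := by
        rw [mem_ball, dist_eq_norm]
        simp only [add_sub_cancel_left, norm_smul, Real.norm_eq_abs, abs_of_pos hR]
        have : ‖ξ‖ < 1 := by simpa using h
        nlinarith
      rw [Set.indicator_of_mem h, hF', Set.indicator_of_mem h', Complex.real_smul]
    · have h' : c + R • ξ ∉ ball c R := by
        rw [mem_ball, dist_eq_norm]
        simp only [add_sub_cancel_left, norm_smul, Real.norm_eq_abs, abs_of_pos hR]
        have : ¬ ‖ξ‖ < 1 := by simpa using h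
        nlinarith
      rw [Set.indicator_of_notMem h, hF', Set.indicator_of_notMem h']
  simp_rw [h3]
  rw [h2, h1, Complex.real_smul, ← mul_assoc, ← Complex.ofReal_mul, mul_inv_cancel₀ (by positivity)]
  simp

open MeasureTheory in
lemma model_disc {g : ℂ → ℂ} {K δ M : ℝ} (hK : 0 < K) (hδ : 0 < δ)
    (hg : DifferentiableOn ℂ g (ball (-(1 / K : ℝ) : ℂ) (RD K δ)))
    (hM : ∀ z ∈ ball (-(1 / K : ℝ) : ℂ) (RD K δ), ‖g z‖ ≤ M) (m : ℕ) :
    ∫ w in ball (-(1 / K : ℝ) : ℂ) (RD K δ), g w * kap m K δ w * ((sfun K δ w : ℝ) : ℂ) ^ m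
      = ((Real.pi * (m.factorial / (m + 2).factorial) * (K ^ 2 * (δ + 1 / K))⁻¹ : ℝ) : ℂ) * deriv g 0 := by
  set R := RD K δ with hR
  have hR0 : 0 < R := RD_pos hK hδ
  have hR2 : R ^ 2 = (δ + 1 / K) / K := RD_sq hK hδ
  set d := δ + 1 / K with hd
  have hd0 : 0 < d := by positivity
  set α := R / d with hα
  have hα1 : α < 1 := by
    rw [hα, div_lt_one hd0]
    apply lt_of_pow_lt_pow_left₀ 2 hd0.le
    rw [hR2, div_lt_iff₀ hK, sq, mul_assoc]
    have : d * K = δ * K + 1 := by rw [hd]; field_simp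
    rw [this]
    nlinarith [mul_pos hδ hK]
  set c : ℂ := (-(1 / K : ℝ) : ℂ) with hc
  rw [integral_ball_scale _ _ hR0]
  set g' : ℂ → ℂ := fun ξ => g (c + R * ξ) with hg'
  have hmaps : Set.MapsTo (fun ξ : ℂ => c + R * ξ) (ball 0 1) (ball c R) := by
    intro ξ hξ
    have : ‖ξ‖ < 1 := by simpa using hξ
    rw [mem_ball, dist_eq_norm]
    simp only [add_sub_cancel_left, norm_mul, Complex.norm_real, Real.norm_eq_abs, abs_of_pos hR0]
    nlinarith
  have hgd : DifferentiableOn ℂ g' (ball 0 1) :=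
    hg.comp (by fun_prop) hmaps
  have hgM : ∀ z ∈ ball (0:ℂ) 1, ‖g' z‖ ≤ M := fun z hz => hM _ (hmaps hz)
  have hform := disc_formula hgd hgM m (α := α) (by positivity) hα1
  have hcα : c + R * α = 0 := by
    rw [hc, hα]
    have : R * (R / d) = 1 / K := by
      rw [← mul_div_assoc, ← sq, hR2]; field_simp
    rw [← Complex.ofReal_mul, this]; simp
  have hder : deriv g' α = R * deriv g 0 := by
    have hga : DifferentiableAt ℂ g (c + R * α) := by
      apply hg.differentiableAt (isOpen_ball.mem_nhds (hmaps _))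
      simpa [abs_of_nonneg (show 0 ≤ α by positivity)] using hα1
    have h1 : HasDerivAt (fun ξ : ℂ => c + R * ξ) (R:ℂ) (α:ℂ) := by
      simpa using ((hasDerivAt_id (α:ℂ)).const_mul (R:ℂ)).const_add c
    have := hga.hasDerivAt.comp (α:ℂ) h1
    rw [hcα] at this
    rw [mul_comm]; exact this.deriv
  rw [hder] at hform
  have hpt : ∀ ξ ∈ ball (0:ℂ) 1, g (c + R * ξ) * kap m K δ (c + R * ξ) *
      ((sfun K δ (c + R * ξ) : ℝ) : ℂ) ^ m = ((R / d ^ 3 : ℝ) : ℂ) * (g' ξ * (1 - ‖ξ‖ ^ 2 : ℝ) ^ m *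
        (starRingEnd ℂ ξ * (1 - α * starRingEnd ℂ ξ)⁻¹ ^ (m + 3))) := by
    intro ξ hξ
    have e1 : sfun K δ (c + R * ξ) = d * (1 - ‖ξ‖ ^ 2) := by
      rw [sfun_eq hK, ← hc, add_sub_cancel_left, norm_mul, Complex.norm_real, Real.norm_eq_abs,
        abs_of_pos hR0, mul_pow, hR2, ← hd]
      field_simp
    have e2 : (δ : ℂ) - (c + R * ξ) = d * (1 - α * ξ) := by
      have : (d:ℂ) * α = R := by
        rw [← Complex.ofReal_mul, hα, mul_div_cancel₀ _ hd0.ne']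
      rw [mul_sub, ← mul_assoc, this, hc, hd]
      push_cast; ring
    have e3 : c + R * ξ + ((1 / K : ℝ) : ℂ) = R * ξ := by rw [hc]; ring
    unfold kap
    rw [e1, e2, e3]
    have hd' : (d:ℂ) ≠ 0 := by exact_mod_cast hd0.ne'
    simp only [map_mul, map_pow, map_inv₀, map_sub, map_one, Complex.conj_ofReal, mul_inv, mul_pow, hg']
    push_cast
    have : (d:ℂ)⁻¹ ^ (m + 3) * (d:ℂ) ^ m = (d ^ 3 : ℂ)⁻¹ := by
      rw [inv_pow, pow_add]; field_simp
    rw [div_eq_mul_inv, ← this, mul_pow]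
    ring
  rw [setIntegral_congr_fun measurableSet_ball hpt, integral_const_mul, hform]
  rw [← mul_assoc, ← mul_assoc, ← mul_assoc]
  congr 1
  norm_cast
  have hR4 : R * R * R ^ 2 = (d / K) ^ 2 := by rw [← hR2]; ring
  have : R ^ 2 * (R / d ^ 3) * (Real.pi * (m.factorial / (m + 2).factorial)) * R
    = (R * R * R ^ 2) / d ^ 3 * (Real.pi * (m.factorial / (m + 2).factorial)) := by ring
  rw [this, hR4]
  field_simp

open MeasureTheory Pointwise in
lemma vol_H_scale {m : ℕ} {H : (Fin m → ℂ) → ℝ} (hhom : ∀ (c : ℂ) x, H (c • x) = ‖c‖ ^ 2 * H x)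
    {s : ℝ} (hs : 0 < s) :
    volume {x | H x < s} = ENNReal.ofReal (s ^ m) * volume {x | H x < 1} := by
  have : {x | H x < s} = (√s) • {x | H x < 1} := by
    ext x
    have hs' : √s ≠ 0 := (Real.sqrt_pos.mpr hs).ne'
    rw [Set.mem_smul_set_iff_inv_smul_mem₀ hs']
    have : (√s)⁻¹ • x = (((√s)⁻¹ : ℝ) : ℂ) • x := by
      ext i; simp
    show H x < s ↔ H ((√s)⁻¹ • x) < 1
    rw [this, hhom, Complex.norm_real, Real.norm_eq_abs, sq_abs, inv_pow, Real.sq_sqrt hs.le,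
      inv_mul_lt_iff₀ hs, mul_one]
  rw [this, Measure.addHaar_smul]
  congr 2
  have hd : Module.finrank ℝ (Fin m → ℂ) = 2 * m := by
    rw [Module.finrank_pi_fintype]; simp [Complex.finrank_real_complex, mul_comm]
  rw [hd, pow_mul, Real.sq_sqrt hs.le, abs_of_pos (by positivity)]
end

section
open MeasureTheory in
lemma rot_preserving (m : ℕ) (θ : ℝ) : MeasurePreserving
    (fun p : (Fin m → ℂ) × ℂ => ((circleMap 0 1 θ) • p.1, p.2)) volume volume := by
  have h1 : MeasurePreserving (fun z : ℂ => circleMap 0 1 θ * z) volume volume := by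
    have := (rotation (Circle.exp θ)).measurePreserving
    convert! this using 1
    funext z
    simp [rotation_apply, circleMap, Circle.coe_exp]
  have h2 : MeasurePreserving (fun x : Fin m → ℂ => (circleMap 0 1 θ) • x) volume volume :=
    volume_preserving_pi (fun _ : Fin m => h1)
  exact h2.prod (MeasurePreserving.id volume)

open MeasureTheory in
lemma rot_avg {m : ℕ} {S O : Set ((Fin m → ℂ) × ℂ)} {f : (Fin m → ℂ) × ℂ → ℂ} {κ : ℂ → ℂ} {M A : ℝ}
    (hS : MeasurableSet S) (hfin : volume S ≠ ⊤)
    (hcirc : ∀ x w, (x, w) ∈ S → ∀ c : ℂ, ‖c‖ ≤ 1 → (c • x, w) ∈ S)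
    (hO : IsOpen O) (hSO : S ⊆ O) (hf : DifferentiableOn ℂ f O) (hM : ∀ p ∈ S, ‖f p‖ ≤ M)
    (hκ : ContinuousOn (fun p : (Fin m → ℂ) × ℂ => κ p.2) S) (hA : ∀ p ∈ S, ‖κ p.2‖ ≤ A) :
    ∫ p in S, f p * κ p.2 = ∫ p in S, f (0, p.2) * κ p.2 := by
  have hrot : ∀ θ : ℝ, ∫ p in S, f p * κ p.2
      = ∫ p in S, f (circleMap 0 1 θ • p.1, p.2) * κ p.2 := by
    intro θ
    have hn : ‖circleMap 0 1 θ‖ = 1 := by simp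
    have hne : circleMap 0 1 θ ≠ 0 := by rw [← norm_pos_iff, hn]; norm_num
    rw [← integral_indicator hS, ← integral_indicator hS]
    have hpre := rot_preserving m θ
    have hemb : MeasurableEmbedding (fun p : (Fin m → ℂ) × ℂ => ((circleMap 0 1 θ) • p.1, p.2)) := by
      have hc : Continuous (fun p : (Fin m → ℂ) × ℂ => ((circleMap 0 1 θ) • p.1, p.2)) := by fun_prop
      apply hc.measurableEmbedding
      rintro ⟨a, b⟩ ⟨c, d⟩ h
      simp only [Prod.mk.injEq] at h
      rw [smul_right_injective _ hne h.1, h.2]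
    rw [← hpre.integral_comp hemb]
    congr 1
    funext p
    have hiff : (circleMap 0 1 θ • p.1, p.2) ∈ S ↔ p ∈ S := by
      constructor
      · intro h
        have := hcirc _ _ h (circleMap 0 1 θ)⁻¹ (by rw [norm_inv, hn]; norm_num)
        rwa [inv_smul_smul₀ hne] at this
      · intro h
        exact hcirc _ _ h _ hn.le
    by_cases hp : p ∈ S
    · rw [Set.indicator_of_mem hp, Set.indicator_of_mem (hiff.mpr hp)]
    · rw [Set.indicator_of_notMem hp, Set.indicator_of_notMem (fun h => hp (hiff.mp h))]
  have hmean : ∀ p ∈ S, ∫ θ in (0:ℝ)..2 * Real.pi, f (circleMap 0 1 θ • p.1, p.2)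
      = 2 * Real.pi * f (0, p.2) := by
    intro p hp
    have hd : DifferentiableOn ℂ (fun c : ℂ => f (c • p.1, p.2)) (closedBall 0 1) := by
      refine hf.comp (t := O) (by fun_prop) ?_
      intro c hc
      exact hSO (hcirc _ _ hp c (by simpa using hc))
    have h1 : DiffContOnCl ℂ (fun c : ℂ => f (c • p.1, p.2)) (ball 0 |1|) := by
      rw [abs_one]
      apply DifferentiableOn.diffContOnCl
      rwa [closure_ball _ one_ne_zero]
    have := h1.circleAverage
    rw [Real.circleAverage_def, zero_smul, inv_smul_eq_iff₀ (by positivity)] at this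
    rw [this, Complex.real_smul]; push_cast; ring
  set μ := (volume : Measure ((Fin m → ℂ) × ℂ)).restrict S with hμ
  set ν := (volume : Measure ℝ).restrict (Set.Ioc 0 (2 * Real.pi)) with hν
  have hintble : Integrable (Function.uncurry fun (θ : ℝ) (p : (Fin m → ℂ) × ℂ) =>
      f (circleMap 0 1 θ • p.1, p.2) * κ p.2) (ν.prod μ) := by
    rw [hμ, hν, Measure.prod_restrict]
    refine integrableOn_aesm_bdd (M := M * A) (measurableSet_Ioc.prod hS) ?_ ?_ ?_
    · rw [Measure.prod_prod]
      exact ENNReal.mul_ne_top measure_Ioc_lt_top.ne hfin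
    · apply ContinuousOn.aestronglyMeasurable _ (measurableSet_Ioc.prod hS)
      have hcm : Continuous fun p : ℝ × ((Fin m → ℂ) × ℂ) => ((circleMap 0 1 p.1) • p.2.1, p.2.2) := by
        fun_prop
      refine ContinuousOn.mul ?_ ?_
      · refine hf.continuousOn.comp hcm.continuousOn ?_
        rintro ⟨θ, p⟩ ⟨_, hp⟩
        exact hSO (hcirc _ _ hp _ (by simp))
      · exact hκ.comp continuousOn_snd (fun q hq => hq.2)
    · rintro ⟨θ, p⟩ ⟨_, hp⟩
      simp only [Function.uncurry]
      rw [norm_mul]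
      exact mul_le_mul (hM _ (hcirc _ _ hp _ (by simp))) (hA p hp) (norm_nonneg _)
        ((norm_nonneg _).trans (hM p hp))
  have hsw := integral_integral_swap hintble
  have hl : ∫ θ, ∫ p, f (circleMap 0 1 θ • p.1, p.2) * κ p.2 ∂μ ∂ν = 2 * Real.pi * ∫ p in S, f p * κ p.2 := by
    simp_rw [← hrot]
    rw [integral_const]
    simp [hν, Real.pi_pos.le]
    rfl
  have hr : ∫ p, ∫ θ, f (circleMap 0 1 θ • p.1, p.2) * κ p.2 ∂ν ∂μ
      = 2 * Real.pi * ∫ p in S, f (0, p.2) * κ p.2 := by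
    rw [← integral_const_mul]
    apply setIntegral_congr_fun hS
    intro p hp
    simp only
    rw [integral_mul_const, hν, ← intervalIntegral.integral_of_le (by positivity), hmean p hp]
    ring
  rw [hl, hr] at hsw
  have : (2 * Real.pi : ℂ) ≠ 0 := by exact_mod_cast (by positivity : (2 * Real.pi) ≠ 0)
  exact mul_left_cancel₀ this hsw

/-- the error term of the normal form -/
def EE {m : ℕ} (C₁ : ℝ) (p : (Fin m → ℂ) × ℂ) : ℝ :=
  C₁ * (‖p.2‖ ^ 2 + ‖p.2‖ * ‖p.1‖ + ‖p.1‖ ^ 3)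

lemma EE_nonneg {m : ℕ} {C₁ : ℝ} (h : 0 ≤ C₁) (p : (Fin m → ℂ) × ℂ) : 0 ≤ EE C₁ p := by
  unfold EE; positivity

lemma EE_le {m : ℕ} {C₁ δ : ℝ} (h : 0 ≤ C₁) (hδ : 0 < δ) (p : (Fin m → ℂ) × ℂ) (ht : tt δ p ≤ 1) :
    EE C₁ p ≤ 3 * C₁ * (tt δ p * √(tt δ p)) := by
  have htp := tt_pos hδ p
  set t := tt δ p with htd
  have hw : ‖p.2‖ ≤ t := by rw [htd]; unfold tt; nlinarith [norm_nonneg p.2, sq_nonneg ‖p.1‖]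
  have hx2 : ‖p.1‖ ^ 2 ≤ t := by rw [htd]; unfold tt; nlinarith [norm_nonneg p.2, sq_nonneg ‖p.1‖]
  have hx : ‖p.1‖ ≤ √t := Real.le_sqrt_of_sq_le hx2
  have hs1 : √t ≤ 1 := Real.sqrt_le_one.mpr ht
  have hs0 := Real.sqrt_nonneg t
  have hts : t ≤ √t := by nlinarith [Real.mul_self_sqrt htp.le]
  have e1 : ‖p.2‖ ^ 2 ≤ t * √t := by
    rw [sq]; exact mul_le_mul hw (hw.trans hts) (norm_nonneg _) htp.le
  have e2 : ‖p.2‖ * ‖p.1‖ ≤ t * √t := mul_le_mul hw hx (norm_nonneg _) htp.le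
  have e3 : ‖p.1‖ ^ 3 ≤ t * √t := by
    rw [pow_succ]; exact mul_le_mul hx2 hx (norm_nonneg _) htp.le
  unfold EE
  nlinarith

lemma ball_fst_snd {m : ℕ} {p : (Fin m → ℂ) × ℂ} {r : ℝ} (hp : p ∈ ball (0 : (Fin m → ℂ) × ℂ) r) :
    ‖p.1‖ < r ∧ ‖p.2‖ < r := by
  rw [mem_ball_zero_iff, Prod.norm_def] at hp
  exact max_lt_iff.mp hp

lemma EE_le_lin {m : ℕ} {C₁ δ r : ℝ} (h : 0 ≤ C₁) (hδ : 0 < δ) (p : (Fin m → ℂ) × ℂ)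
    (hp : p ∈ ball (0 : (Fin m → ℂ) × ℂ) r) :
    EE C₁ p ≤ 2 * C₁ * r * tt δ p := by
  obtain ⟨h1, h2⟩ := ball_fst_snd hp
  unfold EE tt
  have e1 : ‖p.2‖ ^ 2 ≤ r * ‖p.2‖ := by nlinarith [norm_nonneg p.2]
  have e2 : ‖p.2‖ * ‖p.1‖ ≤ r * ‖p.2‖ := by nlinarith [norm_nonneg p.2]
  have e3 : ‖p.1‖ ^ 3 ≤ r * ‖p.1‖ ^ 2 := by
    rw [pow_succ]; nlinarith [sq_nonneg ‖p.1‖]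
  have hr : 0 < r := (norm_nonneg _).trans_lt h1
  have e4 : 0 ≤ r * ‖p.1‖^2 := by positivity
  have : ‖p.2‖ ^ 2 + ‖p.2‖ * ‖p.1‖ + ‖p.1‖ ^ 3 ≤ 2 * r * (δ + ‖p.2‖ + ‖p.1‖ ^ 2) := by nlinarith
  nlinarith

lemma kernel_lower {m : ℕ} {c₁ C₁ δ : ℝ} (hc0 : 0 < c₁) (hc1 : c₁ ≤ 1) (hC : 1 ≤ C₁) (hδ : 0 < δ)
    {p : (Fin m → ℂ) × ℂ} (hp : p ∈ ball (0 : (Fin m → ℂ) × ℂ) (c₁ / (8 * C₁)))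
    (h : c₁ * ‖p.1‖ ^ 2 + 2 * p.2.re - δ ≤ EE C₁ p) :
    tt δ p ≤ (2 + 8 / c₁) * ‖(δ:ℂ) - p.2‖ := by
  have hE := EE_le_lin (C₁ := C₁) (by linarith) hδ p hp
  have e : 2 * C₁ * (c₁ / (8 * C₁)) = c₁ / 4 := by field_simp; norm_num
  rw [e] at hE
  have hre : δ - p.2.re ≤ ‖(δ:ℂ) - p.2‖ := by
    have := Complex.re_le_norm ((δ:ℂ) - p.2)
    simpa using this
  have hw : ‖p.2‖ ≤ ‖(δ:ℂ) - p.2‖ + δ := by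
    have h1 := norm_sub_norm_le p.2 (δ:ℂ)
    rw [norm_sub_rev, Complex.norm_real, Real.norm_eq_abs, abs_of_pos hδ] at h1
    linarith
  set N := ‖(δ:ℂ) - p.2‖ with hN
  have ht : tt δ p = δ + ‖p.2‖ + ‖p.1‖ ^ 2 := rfl
  set t := tt δ p with htd
  have h1 : c₁ * (δ + ‖p.1‖ ^ 2) ≤ 2 * N + c₁ / 4 * t := by nlinarith
  have h2 : t ≤ N + 2 * (δ + ‖p.1‖ ^ 2) := by rw [ht]; nlinarith [sq_nonneg ‖p.1‖]
  have h3 : c₁ * t ≤ c₁ * N + 4 * N + c₁ / 2 * t := by nlinarith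
  have h4 : c₁ * t ≤ c₁ * ((2 + 8 / c₁) * N) := by
    have : c₁ * ((2 + 8 / c₁) * N) = 2 * c₁ * N + 8 * N := by field_simp
    rw [this]; linarith
  exact le_of_mul_le_mul_left h4 hc0
end

section
lemma disc_small {c₁ K r₁ δ : ℝ} (hc0 : 0 < c₁) (hc1 : c₁ ≤ 1) (hr0 : 0 < r₁) (hr1 : r₁ ≤ 1)
    (hK : 8 ≤ K * (c₁ * r₁ ^ 2)) (hδ : 0 < δ) (hδK : δ * K ≤ 1) {w : ℂ} (hw : 0 < sfun K δ w) :
    ‖w‖ < r₁ ∧ sfun K δ w ≤ δ + 2 * ‖w‖ ∧ δ + 2 * ‖w‖ < c₁ * r₁ ^ 2 := by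
  have hcr : 0 < c₁ * r₁ ^ 2 := by positivity
  have hK0 : 0 < K := by
    by_contra h
    push Not at h
    nlinarith
  have hre : -‖w‖ ≤ w.re := by
    have := Complex.abs_re_le_norm w
    linarith [neg_abs_le w.re]
  have hs : sfun K δ w ≤ δ + 2 * ‖w‖ := by
    unfold sfun
    nlinarith [sq_nonneg ‖w‖]
  -- K |w|^2 < δ + 2|w| so (K|w|)^2 < 1 + 2 K|w| , K|w| < 3
  have h1 : K * ‖w‖ ^ 2 < δ + 2 * ‖w‖ := by
    unfold sfun at hw; linarith
  have h2 : K * ‖w‖ < 5 / 2 := by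
    by_contra h
    push Not at h
    have : K * (K * ‖w‖ ^ 2) < K * (δ + 2 * ‖w‖) := mul_lt_mul_of_pos_left h1 hK0
    nlinarith
  have h3 : K * (δ + 2 * ‖w‖) ≤ 6 := by nlinarith
  have h4 : δ + 2 * ‖w‖ < c₁ * r₁ ^ 2 := by
    by_contra h
    push Not at h
    nlinarith
  refine ⟨?_, hs, h4⟩
  have : c₁ * r₁ ^ 2 ≤ r₁ := by nlinarith
  linarith [norm_nonneg w]

def Om2 {m : ℕ} (H : (Fin m → ℂ) → ℝ) (K δ : ℝ) : Set ((Fin m → ℂ) × ℂ) :=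
  {p | 0 < sfun K δ p.2 ∧ H p.1 < sfun K δ p.2}

def Om1 {m : ℕ} (H : (Fin m → ℂ) → ℝ) (K δ C₃ : ℝ) : Set ((Fin m → ℂ) × ℂ) :=
  {p | 0 < sfun K δ p.2 ∧ H p.1 < sfun K δ p.2 - C₃ * ((δ + ‖p.2‖) * √(δ + ‖p.2‖))}

lemma Om1_sub {m : ℕ} {H : (Fin m → ℂ) → ℝ} {K δ C₃ : ℝ} (hδ : 0 < δ) (hC₃ : 0 ≤ C₃) :
    Om1 H K δ C₃ ⊆ Om2 H K δ := by
  rintro p ⟨h1, h2⟩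
  refine ⟨h1, h2.trans_le ?_⟩
  have : 0 ≤ C₃ * ((δ + ‖p.2‖) * √(δ + ‖p.2‖)) := by positivity
  linarith

lemma continuous_sfun (K δ : ℝ) : Continuous (sfun K δ) := by
  unfold sfun; fun_prop

lemma isOpen_Om2 {m : ℕ} {H : (Fin m → ℂ) → ℝ} {K δ : ℝ} (hH : Continuous H) : IsOpen (Om2 H K δ) := by
  have := continuous_sfun K δ
  have h1 : IsOpen {p : (Fin m → ℂ) × ℂ | 0 < sfun K δ p.2} := isOpen_lt (by fun_prop) (by fun_prop)
  have h2 : IsOpen {p : (Fin m → ℂ) × ℂ | H p.1 < sfun K δ p.2} := isOpen_lt (by fun_prop) (by fun_prop)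
  exact h1.inter h2

lemma isOpen_Om1 {m : ℕ} {H : (Fin m → ℂ) → ℝ} {K δ C₃ : ℝ} (hH : Continuous H) : IsOpen (Om1 H K δ C₃) := by
  have := continuous_sfun K δ
  have h1 : IsOpen {p : (Fin m → ℂ) × ℂ | 0 < sfun K δ p.2} := isOpen_lt (by fun_prop) (by fun_prop)
  have h2 : IsOpen {p : (Fin m → ℂ) × ℂ | H p.1 < sfun K δ p.2 - C₃ * ((δ + ‖p.2‖) * √(δ + ‖p.2‖))} :=
    isOpen_lt (by fun_prop) (by fun_prop)
  exact h1.inter h2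

lemma Om2_ball {m : ℕ} {H : (Fin m → ℂ) → ℝ} {c₁ K r₁ δ : ℝ} (hc0 : 0 < c₁) (hc1 : c₁ ≤ 1) (hr0 : 0 < r₁) (hr1 : r₁ ≤ 1)
    (hK : 8 ≤ K * (c₁ * r₁ ^ 2)) (hδ : 0 < δ) (hδK : δ * K ≤ 1) (hH : ∀ x, c₁ * ‖x‖ ^ 2 ≤ H x) :
    Om2 H K δ ⊆ ball 0 r₁ := by
  rintro p ⟨h1, h2⟩
  obtain ⟨a, b, c⟩ := disc_small hc0 hc1 hr0 hr1 hK hδ hδK h1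
  rw [mem_ball_zero_iff, Prod.norm_def]
  refine max_lt ?_ a
  have : c₁ * ‖p.1‖ ^ 2 < c₁ * r₁ ^ 2 := by linarith [hH p.1]
  exact lt_of_pow_lt_pow_left₀ 2 hr0.le (lt_of_mul_lt_mul_left this hc0.le)

/-- the estimate giving Om1 ⊂ O -/
lemma Om1_EE {m : ℕ} {H : (Fin m → ℂ) → ℝ} {c₁ C₁ K δ : ℝ} (hc0 : 0 < c₁) (hc1 : c₁ ≤ 1) (hC : 1 ≤ C₁)
    (hKC : C₁ ≤ K) (hδ : 0 < δ) (hH : ∀ x, c₁ * ‖x‖ ^ 2 ≤ H x) {p : (Fin m → ℂ) × ℂ}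
    (hp : p ∈ Om1 H K δ (C₁ * (2 / c₁ + (2 / c₁) ^ 2))) :
    H p.1 + 2 * p.2.re - δ + EE C₁ p < 0 := by
  obtain ⟨h1, h2⟩ := hp
  set b := 2 / c₁ with hb
  have hb1 : 1 ≤ b := by rw [hb, le_div_iff₀ hc0]; linarith
  set q := δ + ‖p.2‖ with hq
  have hq0 : 0 < q := by positivity
  have hqs := Real.mul_self_sqrt hq0.le
  have hsq0 : 0 < √q := Real.sqrt_pos.mpr hq0
  set C3 := C₁ * (b + b ^ 2) with hC3
  have hC30 : 0 ≤ C3 * (q * √q) := by positivity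
  have hre : -‖p.2‖ ≤ p.2.re := by
    have := Complex.abs_re_le_norm p.2
    linarith [neg_abs_le p.2.re]
  have hx2 : ‖p.1‖ ^ 2 ≤ b * q := by
    rw [hb, div_mul_eq_mul_div, le_div_iff₀ hc0]
    have := hH p.1
    unfold sfun at h2
    have : 0 ≤ K * ‖p.2‖ ^ 2 := by have : 0 < K := by linarith
                                   positivity
    nlinarith
  have hx : ‖p.1‖ ≤ b * √q := by
    apply le_of_sq_le_sq _ (by positivity)
    calc ‖p.1‖ ^ 2 ≤ b * q := hx2
      _ ≤ b ^ 2 * q := by nlinarith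
      _ = (b * √q) ^ 2 := by rw [mul_pow, Real.sq_sqrt hq0.le]
  have hwq : ‖p.2‖ ≤ q := by rw [hq]; linarith
  have e2 : ‖p.2‖ * ‖p.1‖ ≤ q * (b * √q) := mul_le_mul hwq hx (norm_nonneg _) hq0.le
  have e3 : ‖p.1‖ ^ 3 ≤ (b * q) * (b * √q) := by
    rw [pow_succ]; exact mul_le_mul hx2 hx (norm_nonneg _) (by positivity)
  have e1 : C₁ * ‖p.2‖ ^ 2 ≤ K * ‖p.2‖ ^ 2 := by nlinarith [sq_nonneg ‖p.2‖]
  have e4 : EE C₁ p ≤ K * ‖p.2‖ ^ 2 + C3 * (q * √q) := by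
    unfold EE
    rw [hC3]
    have := mul_le_mul_of_nonneg_left (add_le_add e2 e3) (by linarith : (0:ℝ) ≤ C₁)
    nlinarith
  unfold sfun at h2
  linarith

/-- excluded set is in the zone -/
lemma zone_of {m : ℕ} {H : (Fin m → ℂ) → ℝ} {C₁ C₃ K δ : ℝ} (hC : 1 ≤ C₁) (hC₃ : 0 ≤ C₃) (hK : 0 < K)
    (hδ : 0 < δ) (hH : ∀ x, 0 ≤ H x) {p : (Fin m → ℂ) × ℂ} (ht : tt δ p ≤ 1)
    (h1 : H p.1 + 2 * p.2.re - δ ≤ EE C₁ p) (h2 : p ∉ Om1 H K δ C₃) :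
    |H p.1 + 2 * p.2.re - δ| ≤ (3 * C₁ + K + C₃) * (tt δ p * √(tt δ p)) := by
  have hE := EE_le (C₁ := C₁) (by linarith) hδ p ht
  have htp := tt_pos hδ p
  have hqt : δ + ‖p.2‖ ≤ tt δ p := by unfold tt; nlinarith [sq_nonneg ‖p.1‖]
  have hqq : (δ + ‖p.2‖) * √(δ + ‖p.2‖) ≤ tt δ p * √(tt δ p) :=
    mul_le_mul hqt (Real.sqrt_le_sqrt hqt) (Real.sqrt_nonneg _) htp.le
  set t := tt δ p
  have hts : t ≤ √t := by
    have h1 := Real.mul_self_sqrt htp.le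
    have h2 : √t ≤ 1 := Real.sqrt_le_one.mpr ht
    nlinarith [Real.sqrt_nonneg t]
  have e1 : ‖p.2‖ ^ 2 ≤ t * √t := by
    rw [sq]; exact mul_le_mul (by linarith) (by linarith) (norm_nonneg _) htp.le
  have hs0 : 0 ≤ t * √t := by positivity
  have hq0 : 0 ≤ (δ + ‖p.2‖) * √(δ + ‖p.2‖) := by positivity
  have f1 := mul_le_mul_of_nonneg_left e1 hK.le
  have f2 := mul_le_mul_of_nonneg_left hqq hC₃
  rw [abs_le]
  constructor
  · unfold Om1 at h2
    simp only [Set.mem_ofPred_eq, not_and_or, not_lt] at h2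
    unfold sfun at h2
    have g1 : 0 ≤ C₃ * (t * √t) := by positivity
    have g2 : 0 ≤ C₁ * (t * √t) := by positivity
    have g3 : 0 ≤ K * (t * √t) := by positivity
    rcases h2 with h2 | h2
    · have := hH p.1
      nlinarith
    · nlinarith
  · have g1 : 0 ≤ C₃ * (t * √t) := by positivity
    have g3 : 0 ≤ K * (t * √t) := by positivity
    nlinarith

lemma kap_bound {m : ℕ} {c₁ C₁ K δ : ℝ} (hc0 : 0 < c₁) (hc1 : c₁ ≤ 1) (hC : 1 ≤ C₁) (hK : 1 ≤ K) (hδ : 0 < δ)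
    {p : (Fin m → ℂ) × ℂ} (hp : p ∈ ball (0 : (Fin m → ℂ) × ℂ) (c₁ / (8 * C₁)))
    (h : c₁ * ‖p.1‖ ^ 2 + 2 * p.2.re - δ ≤ EE C₁ p) :
    ‖kap m K δ p.2‖ ≤ 2 * (2 + 8 / c₁) ^ (m + 3) * tt δ p ^ (-((m:ℝ) + 3)) ∧ (δ:ℂ) - p.2 ≠ 0 := by
  have hk := kernel_lower hc0 hc1 hC hδ hp h
  have htp := tt_pos hδ p
  have hb : 0 < 2 + 8 / c₁ := by positivity
  have hN : 0 < ‖(δ:ℂ) - p.2‖ := by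
    by_contra h0
    push Not at h0
    nlinarith
  refine ⟨?_, norm_pos_iff.mp hN⟩
  have hpw : ‖p.2‖ < 1 := by
    refine (ball_fst_snd hp).2.trans_le ?_
    rw [div_le_one (by positivity)]; linarith
  unfold kap
  rw [Complex.norm_conj, norm_mul, norm_pow, norm_inv]
  have e1 : ‖p.2 + ((1 / K : ℝ) : ℂ)‖ ≤ 2 := by
    refine (norm_add_le _ _).trans ?_
    rw [Complex.norm_real, Real.norm_eq_abs, abs_of_pos (by positivity)]
    have : 1 / K ≤ 1 := by rw [div_le_one (by positivity)]; exact hK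
    linarith
  have e2 : (‖(δ:ℂ) - p.2‖⁻¹) ≤ (2 + 8 / c₁) * (tt δ p)⁻¹ := by
    rw [inv_le_comm₀ hN (by positivity), mul_inv, inv_inv, inv_mul_le_iff₀ hb]
    exact hk
  have e3 : tt δ p ^ (-((m:ℝ) + 3)) = ((tt δ p)⁻¹) ^ (m + 3) := by
    rw [Real.rpow_neg htp.le, inv_pow]
    congr 1
    rw [← Real.rpow_natCast]; push_cast; rfl
  rw [e3, mul_assoc, ← mul_pow]
  exact mul_le_mul e1 (pow_le_pow_left₀ (by positivity) e2 _) (by positivity) (by norm_num)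

open MeasureTheory in
lemma Om2_integral {m : ℕ} {H : (Fin m → ℂ) → ℝ} {K δ : ℝ} (hH : Continuous H)
    (hhom : ∀ (c : ℂ) x, H (c • x) = ‖c‖ ^ 2 * H x) (hK : 0 < K) (hδ : 0 < δ)
    (u : ℂ → ℂ) (hintble : IntegrableOn (fun p : (Fin m → ℂ) × ℂ => u p.2) (Om2 H K δ)) :
    ∫ p in Om2 H K δ, u p.2 = ((volume {x | H x < 1}).toReal : ℂ) *
      ∫ w in ball (-(1 / K : ℝ) : ℂ) (RD K δ), u w * ((sfun K δ w : ℝ) : ℂ) ^ m := by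
  have hO := (isOpen_Om2 (K := K) (δ := δ) hH).measurableSet
  rw [← integral_indicator hO, Measure.volume_eq_prod, integral_prod_symm]
  swap
  · rw [← Measure.volume_eq_prod]
    exact hintble.integrable_indicator hO
  rw [← integral_const_mul, ← integral_indicator measurableSet_ball]
  congr 1
  funext w
  by_cases hw : w ∈ ball (-(1 / K : ℝ) : ℂ) (RD K δ)
  · rw [Set.indicator_of_mem hw]
    have hs := (mem_disc_iff hK hδ w).mp hw
    have : ∀ x, (Om2 H K δ).indicator (fun p : (Fin m → ℂ) × ℂ => u p.2) (x, w)
        = {x | H x < sfun K δ w}.indicator (fun _ => u w) x := by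
      intro x
      simp only [Set.indicator_apply, Om2, Set.mem_ofPred_eq, hs, true_and]
    simp only [this]
    rw [integral_indicator (isOpen_lt hH continuous_const).measurableSet, setIntegral_const,
      Measure.real, vol_H_scale hhom hs, ENNReal.toReal_mul, ENNReal.toReal_ofReal (by positivity)]
    rw [Complex.real_smul]
    push_cast
    ring
  · rw [Set.indicator_of_notMem hw]
    have hs := fun h => hw ((mem_disc_iff hK hδ w).mpr h)
    have : ∀ x, (Om2 H K δ).indicator (fun p : (Fin m → ℂ) × ℂ => u p.2) (x, w) = 0 := by
      intro x
      simp only [Set.indicator_apply, Om2, Set.mem_ofPred_eq]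
      rw [if_neg (fun h => hs h.1)]
    simp [this]
end

section
set_option maxHeartbeats 4000000 in
open MeasureTheory in
theorem core (m : ℕ) {c₁ C₁ r₀ r₁ : ℝ} (hc0 : 0 < c₁) (hc1 : c₁ ≤ 1) (hC : 1 ≤ C₁)
    (hr : r₀ ≤ c₁ / (8 * C₁)) (hr1 : 0 < r₁) (hr10 : r₁ < r₀) :
    ∃ K : ℝ, 1 ≤ K ∧ ∃ δ₀ : ℝ, 0 < δ₀ ∧ ∃ C : ℝ, 0 ≤ C ∧ ∀ δ : ℝ, 0 < δ → δ < δ₀ →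
    ∀ (H : (Fin m → ℂ) → ℝ) (O : Set ((Fin m → ℂ) × ℂ)) (f : (Fin m → ℂ) × ℂ → ℂ)
      (χ : (Fin m → ℂ) × ℂ → ℝ) (M A : ℝ), Continuous H →
      (∀ (c : ℂ) x, H (c • x) = ‖c‖ ^ 2 * H x) → (∀ x, c₁ * ‖x‖ ^ 2 ≤ H x) → (∀ x, H x ≤ C₁ * ‖x‖ ^ 2) →
      IsOpen O →
      (∀ p ∈ ball (0 : (Fin m → ℂ) × ℂ) r₀, H p.1 + 2 * p.2.re - δ + EE C₁ p < 0 → p ∈ O) →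
      (∀ p ∈ ball (0 : (Fin m → ℂ) × ℂ) r₀, p ∈ O → H p.1 + 2 * p.2.re - δ - EE C₁ p < 0) →
      DifferentiableOn ℂ f O → 0 ≤ M → 0 ≤ A → (∀ p ∈ O ∩ ball 0 r₀, ‖f p‖ ≤ M) →
      Continuous χ → (∀ p, 0 ≤ χ p) → (∀ p, χ p ≤ 1) → (∀ p ∈ ball 0 r₁, χ p = 1) →
      (‖∫ p in O ∩ ball 0 r₀, f p * χ p * kap m K δ p.2‖ₑ ≤
        ENNReal.ofReal A * ∫⁻ p in O ∩ ball 0 r₀, ENNReal.ofReal (tt δ p * ‖kap m K δ p.2‖)) →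
      ‖deriv (fun w => f (0, w)) 0‖ ≤ C * (M + A) * δ ^ (-(1/2 : ℝ)) := by
  have hr0p : 0 < r₀ := hr1.trans hr10
  have hr08 : r₀ ≤ 1 / 8 := by
    refine hr.trans ?_
    rw [div_le_div_iff₀ (by positivity) (by norm_num)]; linarith
  set K : ℝ := C₁ + 8 / (c₁ * r₁ ^ 2) with hKd
  have hKC : C₁ ≤ K := by
    have : 0 < 8 / (c₁ * r₁ ^ 2) := by positivity
    linarith
  have hK1 : 1 ≤ K := hC.trans hKC
  have hK0 : 0 < K := by linarith
  have hK8 : 8 ≤ K * (c₁ * r₁ ^ 2) := by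
    have : 8 / (c₁ * r₁ ^ 2) * (c₁ * r₁ ^ 2) = 8 := by field_simp
    have h2 : 0 < C₁ * (c₁ * r₁ ^ 2) := by positivity
    rw [hKd, add_mul]; linarith
  set C₃ : ℝ := C₁ * (2 / c₁ + (2 / c₁) ^ 2) with hC₃d
  have hC₃ : 0 ≤ C₃ := by positivity
  set CZ : ℝ := 3 * C₁ + K + C₃ with hCZd
  obtain ⟨Z, hZ0, hZ⟩ := lint_Z m C₁ CZ (by linarith) (by linarith)
  obtain ⟨T, hT0, hT⟩ := lint_t m
  set B : ℝ := 2 * (2 + 8 / c₁) ^ (m + 3) with hBd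
  have hB : 0 ≤ B := by positivity
  set v₀ : ℝ := (volume (ball (0 : Fin m → ℂ) (1 / C₁))).toReal with hv₀
  have hv₀pos : 0 < v₀ := by
    rw [hv₀]
    exact ENNReal.toReal_pos (measure_ball_pos _ _ (by positivity)).ne' measure_ball_lt_top.ne
  set cm : ℝ := Real.pi * (m.factorial / (m + 2).factorial) * (2 * K)⁻¹ with hcm
  have hcmpos : 0 < cm := by positivity
  refine ⟨K, hK1, min (1 / K) (1 / 4), by positivity, (v₀ * cm)⁻¹ * (B * T + 2 * B * Z), by positivity, ?_⟩
  intro δ hδ hδ0 H O f χ M A hH hhom hHl hHu hO h1 h2 hf hM0 hA0 hM hχ hχ0 hχ1 hχr hA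
  have hδK : δ * K ≤ 1 := by
    have := hδ0.trans_le (min_le_left _ _)
    rw [lt_div_iff₀ hK0] at this
    exact this.le
  have hδ4 : δ ≤ 1 / 4 := (hδ0.trans_le (min_le_right _ _)).le
  have hHnn : ∀ x, 0 ≤ H x := fun x => (by positivity : 0 ≤ c₁ * ‖x‖ ^ 2).trans (hHl x)
  have ht1 : ∀ p ∈ ball (0 : (Fin m → ℂ) × ℂ) r₀, tt δ p ≤ 1 := by
    intro p hp
    obtain ⟨a, b⟩ := ball_fst_snd hp
    unfold tt
    nlinarith [norm_nonneg p.1]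
  set S0 : Set ((Fin m → ℂ) × ℂ) := O ∩ ball 0 r₀ with hS0
  set S1 := Om1 H K δ C₃ with hS1
  set S2 := Om2 H K δ with hS2
  have hS12 : S1 ⊆ S2 := Om1_sub hδ hC₃
  have hS2b : S2 ⊆ ball 0 r₁ := Om2_ball hc0 hc1 hr1 (by linarith) hK8 hδ hδK hHl
  have hbb : ball (0 : (Fin m → ℂ) × ℂ) r₁ ⊆ ball 0 r₀ := ball_subset_ball hr10.le
  have hS10 : S1 ⊆ S0 := by
    intro p hp
    have hb := hbb (hS2b (hS12 hp))
    exact ⟨h1 p hb (Om1_EE hc0 hc1 hC hKC hδ hHl hp), hb⟩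
  have hS0E : ∀ p ∈ S0, H p.1 + 2 * p.2.re - δ ≤ EE C₁ p := by
    intro p hp
    have := h2 p hp.2 hp.1
    linarith
  have hS2E : ∀ p ∈ S2, H p.1 + 2 * p.2.re - δ ≤ EE C₁ p := by
    intro p hp
    have h := hp.2
    have := EE_nonneg (C₁ := C₁) (by linarith) p
    unfold sfun at h
    have : 0 ≤ K * ‖p.2‖ ^ 2 := by positivity
    linarith
  have hkap : ∀ p ∈ S0 ∪ S2, ‖kap m K δ p.2‖ ≤ B * tt δ p ^ (-((m:ℝ) + 3)) ∧ (δ:ℂ) - p.2 ≠ 0 := by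
    intro p hp
    have hb : p ∈ ball (0 : (Fin m → ℂ) × ℂ) r₀ := by
      rcases hp with hp | hp
      · exact hp.2
      · exact hbb (hS2b hp)
    have hE : H p.1 + 2 * p.2.re - δ ≤ EE C₁ p := by
      rcases hp with hp | hp
      · exact hS0E p hp
      · exact hS2E p hp
    refine kap_bound hc0 hc1 hC hK1 hδ (ball_subset_ball hr hb) ?_
    have := hHl p.1
    linarith
  have hkapδ : ∀ p ∈ S0 ∪ S2, ‖kap m K δ p.2‖ ≤ B * δ ^ (-((m:ℝ) + 3)) := by
    intro p hp
    refine (hkap p hp).1.trans ?_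
    refine mul_le_mul_of_nonneg_left ?_ hB
    apply Real.rpow_le_rpow_of_nonpos hδ
    · unfold tt; nlinarith [norm_nonneg p.2, sq_nonneg ‖p.1‖]
    · have : (0:ℝ) ≤ m := by positivity
      linarith
  have hkc : ContinuousOn (fun p : (Fin m → ℂ) × ℂ => kap m K δ p.2) (S0 ∪ S2) := by
    unfold kap
    refine Complex.continuous_conj.comp_continuousOn ?_
    refine ContinuousOn.mul (by fun_prop) (ContinuousOn.pow (ContinuousOn.inv₀ (by fun_prop) ?_) _)
    intro p hp
    exact (hkap p hp).2
  have hS0o : IsOpen S0 := hO.inter isOpen_ball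
  have hS1o : IsOpen S1 := isOpen_Om1 hH
  have hS2o : IsOpen S2 := isOpen_Om2 hH
  have hfinb : volume (ball (0 : (Fin m → ℂ) × ℂ) r₀) ≠ ⊤ := measure_ball_lt_top.ne
  have hS0fin : volume S0 ≠ ⊤ := measure_ne_top_of_subset Set.inter_subset_right hfinb
  have hS2fin : volume S2 ≠ ⊤ := measure_ne_top_of_subset (hS2b.trans hbb) hfinb
  have hS1fin : volume S1 ≠ ⊤ := measure_ne_top_of_subset hS12 hS2fin
  have hdisc : ∀ w : ℂ, 0 < sfun K δ w → ((0 : Fin m → ℂ), w) ∈ S0 := by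
    intro w hw
    obtain ⟨a, -, -⟩ := disc_small hc0 hc1 hr1 (by linarith) hK8 hδ hδK hw
    have hb : ((0 : Fin m → ℂ), w) ∈ ball (0 : (Fin m → ℂ) × ℂ) r₀ := by
      rw [mem_ball_zero_iff, Prod.norm_def]
      simp only [norm_zero]
      exact max_lt hr0p (a.trans hr10)
    refine ⟨h1 _ hb ?_, hb⟩
    have hH0 : H 0 ≤ 0 := by simpa using hHu 0
    unfold EE
    unfold sfun at hw
    simp only [norm_zero]
    nlinarith [sq_nonneg ‖w‖]
  set g : ℂ → ℂ := fun w => f (0, w) with hg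
  have hgd : DifferentiableOn ℂ g {w | 0 < sfun K δ w} := by
    refine hf.comp (t := O) (by fun_prop) ?_
    intro w hw
    exact (hdisc w hw).1
  have hgM : ∀ w, 0 < sfun K δ w → ‖g w‖ ≤ M := fun w hw => hM _ (hdisc w hw)
  set κ : (Fin m → ℂ) × ℂ → ℂ := fun p => kap m K δ p.2 with hκ
  set Bδ := B * δ ^ (-((m:ℝ) + 3)) with hBδ
  have hBδ0 : 0 ≤ Bδ := by positivity
  -- integrability
  have hi0 : IntegrableOn (fun p => f p * χ p * κ p) S0 := by
    refine integrableOn_aesm_bdd (M := M * Bδ) hS0o.measurableSet hS0fin ?_ ?_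
    · refine ContinuousOn.aestronglyMeasurable ?_ hS0o.measurableSet
      refine ((hf.continuousOn.mono Set.inter_subset_left).mul (by fun_prop)).mul (hkc.mono Set.subset_union_left)
    · intro p hp
      rw [norm_mul, norm_mul, Complex.norm_real, Real.norm_eq_abs, abs_of_nonneg (hχ0 p)]
      have e1 : ‖f p‖ * χ p ≤ M * 1 := mul_le_mul (hM p hp) (hχ1 p) (hχ0 p) hM0
      rw [mul_one] at e1
      exact mul_le_mul e1 (hkapδ p (Or.inl hp)) (norm_nonneg _) hM0
  have hi2 : IntegrableOn (fun p : (Fin m → ℂ) × ℂ => g p.2 * kap m K δ p.2) S2 := by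
    refine integrableOn_aesm_bdd (M := M * Bδ) hS2o.measurableSet hS2fin ?_ ?_
    · refine ContinuousOn.aestronglyMeasurable ?_ hS2o.measurableSet
      refine ContinuousOn.mul ?_ (hkc.mono Set.subset_union_right)
      refine hgd.continuousOn.comp (by fun_prop) ?_
      intro p hp
      exact hp.1
    · intro p hp
      rw [norm_mul]
      exact mul_le_mul (hgM _ hp.1) (hkapδ p (Or.inr hp)) (norm_nonneg _) hM0
  -- decomposition
  have d0 : ∫ p in S0, f p * χ p * κ p = (∫ p in S1, f p * χ p * κ p) + ∫ p in S0 \ S1, f p * χ p * κ p := by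
    rw [← setIntegral_union Set.disjoint_sdiff_right (hS0o.measurableSet.diff hS1o.measurableSet)
      (hi0.mono_set hS10) (hi0.mono_set Set.sdiff_subset), Set.union_sdiff_cancel hS10]
  have d2 : ∫ p in S2, g p.2 * κ p = (∫ p in S1, g p.2 * κ p) + ∫ p in S2 \ S1, g p.2 * κ p := by
    rw [← setIntegral_union Set.disjoint_sdiff_right (hS2o.measurableSet.diff hS1o.measurableSet)
      (hi2.mono_set hS12) (hi2.mono_set Set.sdiff_subset), Set.union_sdiff_cancel hS12]
  have d1 : ∫ p in S1, f p * χ p * κ p = ∫ p in S1, g p.2 * κ p := by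
    have e1 : ∫ p in S1, f p * χ p * κ p = ∫ p in S1, f p * kap m K δ p.2 := by
      refine setIntegral_congr_fun hS1o.measurableSet ?_
      intro p hp
      simp only [hκ]
      rw [hχr p (hS2b (hS12 hp))]
      simp
    rw [e1]
    refine rot_avg (O := O) (M := M) (A := Bδ) hS1o.measurableSet hS1fin ?_ hO (hS10.trans Set.inter_subset_left) hf
      (fun p hp => hM p (hS10 hp)) (hkc.mono (hS12.trans Set.subset_union_right))
      (fun p hp => hkapδ p (Or.inr (hS12 hp)))
    rintro x w ⟨ha, hb⟩ c hc
    refine ⟨ha, lt_of_le_of_lt ?_ hb⟩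
    rw [hhom]
    have : ‖c‖ ^ 2 ≤ 1 := pow_le_one₀ (norm_nonneg _) hc
    nlinarith [hHnn x]
  -- the zone bound
  set Zset : Set ((Fin m → ℂ) × ℂ) := {p | p ∈ ball (0 : (Fin m → ℂ) × ℂ) 1 ∧
          |H p.1 + 2 * p.2.re - δ| ≤ CZ * (tt δ p * √(tt δ p))} with hZset
  have hZ' := hZ δ hδ (by linarith) H hH hHnn hHu
  have hzone : ∀ (S : Set ((Fin m → ℂ) × ℂ)) (u : (Fin m → ℂ) × ℂ → ℂ), S ⊆ S0 ∪ S2 → MeasurableSet S →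
      (∀ p ∈ S, p ∉ S1) → (∀ p ∈ S, ‖u p‖ ≤ M * ‖κ p‖) →
      ‖∫ p in S, u p‖ₑ ≤ ENNReal.ofReal (M * B * (Z * δ ^ (-(1/2:ℝ)))) := by
    intro S u hS hSm hS1' hu
    refine (enorm_integral_le_lintegral_enorm _).trans ?_
    have hSZ : S ⊆ Zset := by
      intro p hp
      have hb : p ∈ ball (0 : (Fin m → ℂ) × ℂ) r₀ := by
        rcases hS hp with hp | hp
        · exact hp.2
        · exact hbb (hS2b hp)
      have hE : H p.1 + 2 * p.2.re - δ ≤ EE C₁ p := by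
        rcases hS hp with hp | hp
        · exact hS0E p hp
        · exact hS2E p hp
      exact ⟨ball_subset_ball (by linarith) hb, zone_of hC hC₃ hK0 hδ hHnn (ht1 p hb) hE (hS1' p hp)⟩
    calc ∫⁻ p in S, ‖u p‖ₑ ≤ ∫⁻ p in S, ENNReal.ofReal (M * B) * ENNReal.ofReal (tt δ p ^ (-((m:ℝ) + 3))) := by
          refine setLIntegral_mono' hSm ?_
          intro p hp
          rw [← ofReal_norm, ← ENNReal.ofReal_mul (by positivity)]
          refine ENNReal.ofReal_le_ofReal ((hu p hp).trans ?_)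
          rw [mul_assoc]
          exact mul_le_mul_of_nonneg_left (hkap p (hS hp)).1 hM0
      _ = ENNReal.ofReal (M * B) * ∫⁻ p in S, ENNReal.ofReal (tt δ p ^ (-((m:ℝ) + 3))) := by
          rw [lintegral_const_mul' _ _ ENNReal.ofReal_ne_top]
      _ ≤ ENNReal.ofReal (M * B) * ENNReal.ofReal (Z * δ ^ (-(1/2 : ℝ))) := by
          gcongr
          exact (lintegral_mono_set hSZ).trans hZ'
      _ = _ := by rw [← ENNReal.ofReal_mul (by positivity)]
  have z0 := hzone (S0 \ S1) (fun p => f p * χ p * κ p) (Set.sdiff_subset.trans Set.subset_union_left)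
    (hS0o.measurableSet.diff hS1o.measurableSet) (fun p hp => hp.2) (by
      intro p hp

      rw [norm_mul, norm_mul, Complex.norm_real, Real.norm_eq_abs, abs_of_nonneg (hχ0 p)]
      have e1 : ‖f p‖ * χ p ≤ M * 1 := mul_le_mul (hM p hp.1) (hχ1 p) (hχ0 p) hM0
      rw [mul_one] at e1
      exact mul_le_mul_of_nonneg_right e1 (norm_nonneg _))
  have z2 := hzone (S2 \ S1) (fun p => g p.2 * κ p) (Set.sdiff_subset.trans Set.subset_union_right)
    (hS2o.measurableSet.diff hS1o.measurableSet) (fun p hp => hp.2) (by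
      intro p hp

      rw [norm_mul]
      exact mul_le_mul_of_nonneg_right (hgM _ hp.1.1) (norm_nonneg _))
  -- the A term
  have hAint : ∫⁻ p in S0, ENNReal.ofReal (tt δ p * ‖kap m K δ p.2‖) ≤ ENNReal.ofReal (B * (T * δ ^ (-(1/2:ℝ)))) := by
    calc ∫⁻ p in S0, ENNReal.ofReal (tt δ p * ‖kap m K δ p.2‖)
        ≤ ∫⁻ p in S0, ENNReal.ofReal B * ENNReal.ofReal (tt δ p ^ (-((m:ℝ) + 5/2))) := by
          refine setLIntegral_mono' hS0o.measurableSet ?_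
          intro p hp
          rw [← ENNReal.ofReal_mul hB]
          refine ENNReal.ofReal_le_ofReal ?_
          have htp := tt_pos hδ p
          calc tt δ p * ‖kap m K δ p.2‖ ≤ tt δ p * (B * tt δ p ^ (-((m:ℝ) + 3))) :=
                mul_le_mul_of_nonneg_left (hkap p (Or.inl hp)).1 htp.le
            _ = B * tt δ p ^ (-((m:ℝ) + 2)) := by
                have : tt δ p ^ (-((m:ℝ) + 2)) = tt δ p ^ ((1:ℝ) + -((m:ℝ) + 3)) := by congr 1; ring
                rw [this, Real.rpow_add htp, Real.rpow_one]; ring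
            _ ≤ B * tt δ p ^ (-((m:ℝ) + 5/2)) := by
                refine mul_le_mul_of_nonneg_left ?_ hB
                exact Real.rpow_le_rpow_of_exponent_ge htp (ht1 p hp.2) (by linarith)
      _ = ENNReal.ofReal B * ∫⁻ p in S0, ENNReal.ofReal (tt δ p ^ (-((m:ℝ) + 5/2))) := by
          rw [lintegral_const_mul' _ _ ENNReal.ofReal_ne_top]
      _ ≤ ENNReal.ofReal B * ENNReal.ofReal (T * δ ^ (-(1/2 : ℝ))) := by
          gcongr
          exact (setLIntegral_le_lintegral _ _).trans (hT δ hδ)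
      _ = _ := by rw [← ENNReal.ofReal_mul hB]
  have hA' : ‖∫ p in S0, f p * χ p * κ p‖ₑ ≤ ENNReal.ofReal (A * (B * (T * δ ^ (-(1/2:ℝ))))) := by
    refine hA.trans ?_
    rw [ENNReal.ofReal_mul hA0]
    gcongr
  have toR : ∀ (z : ℂ) (a : ℝ), 0 ≤ a → ‖z‖ₑ ≤ ENNReal.ofReal a → ‖z‖ ≤ a := by
    intro z a ha h
    rw [← ofReal_norm] at h
    exact (ENNReal.ofReal_le_ofReal_iff ha).mp h
  have y0 := toR _ _ (by positivity) z0
  have y2 := toR _ _ (by positivity) z2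
  have yA := toR _ _ (by positivity) hA'
  have tot : ‖∫ p in S2, g p.2 * κ p‖ ≤ A * (B * (T * δ ^ (-(1/2:ℝ)))) + 2 * (M * B * (Z * δ ^ (-(1/2:ℝ)))) := by
    have : ∫ p in S2, g p.2 * κ p = (∫ p in S0, f p * χ p * κ p) - (∫ p in S0 \ S1, f p * χ p * κ p)
        + ∫ p in S2 \ S1, g p.2 * κ p := by rw [d0, d2, d1]; ring
    rw [this]
    refine (norm_add_le _ _).trans ?_
    have := norm_sub_le (∫ p in S0, f p * χ p * κ p) (∫ p in S0 \ S1, f p * χ p * κ p)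
    linarith
  have hmod : ∫ p in S2, g p.2 * κ p = ((volume {x | H x < 1}).toReal : ℂ) *
      (((Real.pi * (m.factorial / (m + 2).factorial) * (K ^ 2 * (δ + 1 / K))⁻¹ : ℝ) : ℂ) * deriv g 0) := by
    rw [← model_disc (M := M) hK0 hδ (hgd.mono fun w hw => (mem_disc_iff hK0 hδ w).mp hw)
      (fun w hw => hgM w ((mem_disc_iff hK0 hδ w).mp hw)) m]
    exact Om2_integral hH hhom hK0 hδ (fun w => g w * kap m K δ w) hi2
  rw [hmod, norm_mul, norm_mul, Complex.norm_real, Complex.norm_real, Real.norm_eq_abs, Real.norm_eq_abs,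
    abs_of_nonneg ENNReal.toReal_nonneg, abs_of_pos (by positivity)] at tot
  have hvl : v₀ ≤ (volume {x | H x < 1}).toReal := by
    refine ENNReal.toReal_mono ?_ (measure_mono ?_)
    · refine ne_of_lt ((measure_mono (t := ball (0 : Fin m → ℂ) (1 / c₁)) ?_).trans_lt measure_ball_lt_top)
      intro x hx
      rw [mem_ball_zero_iff, lt_div_iff₀ hc0]
      have h3 : c₁ * ‖x‖ ^ 2 < 1 := (hHl x).trans_lt hx
      by_contra h4
      push Not at h4
      have : 1 ≤ ‖x‖ := by nlinarith [norm_nonneg x]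
      nlinarith
    · intro x hx
      rw [mem_ball_zero_iff, lt_div_iff₀ (by linarith)] at hx
      have := hHu x
      have h3 : ‖x‖ < 1 := by nlinarith [norm_nonneg x]
      show H x < 1
      nlinarith [norm_nonneg x]
  have hcl : cm ≤ Real.pi * (m.factorial / (m + 2).factorial) * (K ^ 2 * (δ + 1 / K))⁻¹ := by
    rw [hcm]
    refine mul_le_mul_of_nonneg_left ?_ (by positivity)
    refine inv_anti₀ (by positivity) ?_
    have : K ^ 2 * (δ + 1 / K) = K * (δ * K) + K := by field_simp
    rw [this]; nlinarith
  have hlow : (v₀ * cm) * ‖deriv g 0‖ ≤ A * (B * (T * δ ^ (-(1/2:ℝ)))) + 2 * (M * B * (Z * δ ^ (-(1/2:ℝ)))) := by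
    refine le_trans ?_ tot
    rw [mul_assoc]
    exact mul_le_mul hvl (mul_le_mul_of_nonneg_right hcl (norm_nonneg _)) (by positivity) ENNReal.toReal_nonneg
  have hδp : 0 ≤ δ ^ (-(1/2:ℝ)) := by positivity
  have hfin : A * (B * (T * δ ^ (-(1/2:ℝ)))) + 2 * (M * B * (Z * δ ^ (-(1/2:ℝ))))
      ≤ (B * T + 2 * B * Z) * (M + A) * δ ^ (-(1/2:ℝ)) := by
    have q1 : 0 ≤ B * T * M := by positivity
    have q2 : 0 ≤ B * Z * A := by positivity
    have : A * (B * (T * δ ^ (-(1/2:ℝ)))) + 2 * (M * B * (Z * δ ^ (-(1/2:ℝ))))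
      = (A * B * T + 2 * M * B * Z) * δ ^ (-(1/2:ℝ)) := by ring
    rw [this]
    refine mul_le_mul_of_nonneg_right ?_ hδp
    nlinarith
  rw [mul_assoc, mul_assoc, inv_mul_eq_div, le_div_iff₀ (by positivity)]
  calc ‖deriv g 0‖ * (v₀ * cm) = (v₀ * cm) * ‖deriv g 0‖ := by ring
    _ ≤ _ := hlow.trans hfin
    _ = _ := by ring
end

section
set_option maxSynthPendingDepth 3

/-- compactness lemma -/
lemma cpt_two {X : Type*} [TopologicalSpace X] {S : Set X} (hS : IsCompact S) {F G : X → ℝ}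
    (hF : ContinuousOn F S) (hG : ContinuousOn G S) (hG0 : ∀ x ∈ S, 0 ≤ G x)
    (h : ∀ x ∈ S, G x = 0 → 0 < F x) :
    ∃ N : ℝ, 0 ≤ N ∧ ∃ c : ℝ, 0 < c ∧ ∀ x ∈ S, c ≤ F x + N * G x := by
  have : CompactSpace S := isCompact_iff_compactSpace.mp hS
  have hF' := hF.domRestrict
  have hG' := hG.domRestrict
  let W : ℕ → Set S := fun N => {x | 1 / ((N:ℝ) + 1) < S.domRestrict F x + N * S.domRestrict G x}
  have hWo : ∀ N, IsOpen (W N) := fun N => isOpen_lt (by fun_prop) (by fun_prop)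
  have hcov : (Set.univ : Set S) ⊆ ⋃ N, W N := by
    rintro ⟨x, hx⟩ -
    rw [Set.mem_iUnion]
    rcases (hG0 x hx).lt_or_eq with hp | hp
    · obtain ⟨N, hN⟩ := exists_nat_gt ((1 - F x) / G x)
      refine ⟨N, ?_⟩
      rw [div_lt_iff₀ hp] at hN
      show 1 / ((N:ℝ) + 1) < F x + N * G x
      have : 1 / ((N:ℝ) + 1) ≤ 1 := by
        rw [div_le_one (by positivity)]
        have : (0:ℝ) ≤ N := by positivity
        linarith
      linarith
    · obtain ⟨N, hN⟩ := exists_nat_one_div_lt (h x hx hp.symm)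
      refine ⟨N, ?_⟩
      show 1 / ((N:ℝ) + 1) < F x + N * G x
      rw [← hp]; linarith
  have hdir : Directed (· ⊆ ·) W := by
    apply Monotone.directed_le (f := W)
    intro a b hab x hx
    have hx' : 1 / ((a:ℝ) + 1) < F x + a * G x := hx
    show 1 / ((b:ℝ) + 1) < F x + b * G x
    have hab' : (a:ℝ) ≤ b := by exact_mod_cast hab
    have h1 : 1 / ((b:ℝ) + 1) ≤ 1 / ((a:ℝ) + 1) := by
      apply one_div_le_one_div_of_le (by positivity); linarith
    have := hG0 x x.2
    nlinarith
  obtain ⟨N, hN⟩ := isCompact_univ.elim_directed_cover W hWo hcov hdir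
  refine ⟨N, by positivity, 1 / ((N:ℝ) + 1), by positivity, ?_⟩
  intro x hx
  have : 1 / ((N:ℝ) + 1) < F x + N * G x := hN (Set.mem_univ (⟨x, hx⟩ : S))
  exact this.le

section generic
variable {E : Type*} [NormedAddCommGroup E] [NormedSpace ℝ E] [NormedSpace ℂ E]

/-- four times the Levi form -/
def Lam (r : E → ℝ) (z v : E) : ℝ :=
  fderiv ℝ (fderiv ℝ r) z v v + fderiv ℝ (fderiv ℝ r) z (I • v) (I • v)

/-- complex linear part of a real-linear form -/
def ell (r : E → ℝ) (z v : E) : ℂ :=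
  ((fderiv ℝ r z v : ℝ) - I * (fderiv ℝ r z (I • v) : ℝ)) / 2

lemma norm_ell_sq (r : E → ℝ) (z v : E) :
    ‖ell r z v‖ ^ 2 = ((fderiv ℝ r z v) ^ 2 + (fderiv ℝ r z (I • v)) ^ 2) / 4 := by
  rw [← Complex.normSq_eq_norm_sq, ell, Complex.normSq_apply]
  simp
  ring

lemma ell_re (r : E → ℝ) (z v : E) : 2 * (ell r z v).re = fderiv ℝ r z v := by
  simp [ell]
  ring

end generic
section generic2
variable {E : Type*} [NormedAddCommGroup E] [NormedSpace ℝ E]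

/-- uniform Taylor to second order -/
lemma taylor3 {r : E → ℝ} {z : E} {d L : ℝ} (hd : 0 < d)
    (hr : ∀ w ∈ ball z d, ContDiffAt ℝ 3 r w)
    (hL : ∀ w ∈ ball z d, ‖fderiv ℝ (fderiv ℝ (fderiv ℝ r)) w‖ ≤ L) {v : E} (hv : ‖v‖ < d) :
    |r (z + v) - r z - fderiv ℝ r z v - fderiv ℝ (fderiv ℝ r) z v v / 2| ≤ L * ‖v‖ ^ 3 := by
  have hz : z ∈ ball z d := mem_ball_self hd
  have hL0 : 0 ≤ L := (norm_nonneg _).trans (hL z hz)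
  have hd1 : ∀ w ∈ ball z d, ContDiffAt ℝ 2 (fderiv ℝ r) w := fun w hw =>
    (hr w hw).fderiv_right (m := 2) (by norm_num)
  have hd2 : ∀ w ∈ ball z d, ContDiffAt ℝ 1 (fderiv ℝ (fderiv ℝ r)) w := fun w hw =>
    (hd1 w hw).fderiv_right (m := 1) (by norm_num)
  have hball : ∀ u : E, ‖u‖ < d → z + u ∈ ball z d := by
    intro u hu; rw [mem_ball, dist_eq_norm]; simpa using hu
  -- second derivative Lipschitz
  have s2 : ∀ u : E, ‖u‖ < d → ‖fderiv ℝ (fderiv ℝ r) (z + u) - fderiv ℝ (fderiv ℝ r) z‖ ≤ L * ‖u‖ := by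
    intro u hu
    have := (convex_ball z d).norm_image_sub_le_of_norm_fderiv_le (𝕜 := ℝ)
      (fun w hw => (hd2 w hw).differentiableAt (by norm_num)) hL hz (hball u hu)
    simpa using this
  have hsymm : ∀ a b, fderiv ℝ (fderiv ℝ r) z a b = fderiv ℝ (fderiv ℝ r) z b a := by
    intro a b
    exact ((hr z hz).isSymmSndFDerivAt (by simp; norm_num)) a b
  have s1 : ∀ u : E, ‖u‖ < d →
      ‖fderiv ℝ r (z + u) - fderiv ℝ r z - fderiv ℝ (fderiv ℝ r) z u‖ ≤ L * ‖u‖ * ‖u‖ := by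
    intro u hu
    have hD : ∀ y ∈ closedBall (0:E) ‖u‖, HasFDerivWithinAt
        (fun y => fderiv ℝ r (z + y) - fderiv ℝ (fderiv ℝ r) z y)
        (fderiv ℝ (fderiv ℝ r) (z + y) - fderiv ℝ (fderiv ℝ r) z) (closedBall (0:E) ‖u‖) y := by
      intro y hy
      have hy' : ‖y‖ < d := (by simpa using hy : ‖y‖ ≤ ‖u‖).trans_lt hu
      apply HasFDerivAt.hasFDerivWithinAt
      refine HasFDerivAt.sub ?_ (fderiv ℝ (fderiv ℝ r) z).hasFDerivAt
      have h1 := ((hd1 _ (hball y hy')).differentiableAt (by norm_num)).hasFDerivAt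
      exact (hasFDerivAt_comp_add_left z).mpr h1
    have := (convex_closedBall (0:E) ‖u‖).norm_image_sub_le_of_norm_hasFDerivWithin_le
      (C := L * ‖u‖) hD (fun y hy => by
        have hy' : ‖y‖ ≤ ‖u‖ := (by simpa using hy)
        exact (s2 y (hy'.trans_lt hu)).trans (by gcongr)) (x := 0) (y := u) (by simp) (by simp)
    simpa [sub_right_comm] using this
  have hD : ∀ y ∈ closedBall (0:E) ‖v‖, HasFDerivWithinAt
      (fun y => r (z + y) - fderiv ℝ r z y - fderiv ℝ (fderiv ℝ r) z y y / 2)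
      (fderiv ℝ r (z + y) - fderiv ℝ r z - fderiv ℝ (fderiv ℝ r) z y) (closedBall (0:E) ‖v‖) y := by
    intro y hy
    have hy' : ‖y‖ < d := (by simpa using hy : ‖y‖ ≤ ‖v‖).trans_lt hv
    apply HasFDerivAt.hasFDerivWithinAt
    refine HasFDerivAt.sub (HasFDerivAt.sub ?_ (fderiv ℝ r z).hasFDerivAt) ?_
    · have h1 := ((hr _ (hball y hy')).differentiableAt (by norm_num)).hasFDerivAt
      exact (hasFDerivAt_comp_add_left z).mpr h1
    · have h1 := ((fderiv ℝ (fderiv ℝ r) z).hasFDerivAt (x := y)).clm_apply (hasFDerivAt_id y)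
      have h2 := h1.mul_const (2⁻¹ : ℝ)
      convert! h2 using 1
      ext u
      simp
      rw [hsymm u y]; ring
  have := (convex_closedBall (0:E) ‖v‖).norm_image_sub_le_of_norm_hasFDerivWithin_le
    (C := L * ‖v‖ * ‖v‖) hD (fun y hy => by
      have hy' : ‖y‖ ≤ ‖v‖ := (by simpa using hy)
      exact (s1 y (hy'.trans_lt hv)).trans (by gcongr)) (x := 0) (y := v) (by simp) (by simp)
  simp only [add_zero, map_zero, sub_zero, zero_div] at this
  rw [Real.norm_eq_abs] at this
  refine (le_of_eq ?_).trans (this.trans (le_of_eq (by ring)))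
  congr 1; ring

end generic2
end

section
set_option maxSynthPendingDepth 3

structure Dom (n : ℕ) (Ω U : Set (Fin n → ℂ)) (r : (Fin n → ℂ) → ℝ) (ε c C d : ℝ) : Prop where
  isOpen : IsOpen Ω
  bdd : Bornology.IsBounded Ω
  openU : IsOpen U
  sub : closure Ω ⊆ U
  smooth : ∀ z ∈ U, ContDiffAt ℝ 3 r z
  eq : Ω = {z | z ∈ U ∧ r z < 0}
  hε : 0 < ε
  hc : 0 < c
  hc1 : c ≤ 1
  hC : 1 ≤ C
  hd : 0 < d
  lam : ∀ z ∈ Ω, -ε ≤ r z → ∀ v, c * ‖v‖ ^ 2 ≤ Lam r z v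
  grad : ∀ z ∈ Ω, -ε ≤ r z → c ≤ ‖fderiv ℝ r z‖
  b1 : ∀ z ∈ Ω, ‖fderiv ℝ r z‖ ≤ C
  b2 : ∀ z ∈ Ω, ‖fderiv ℝ (fderiv ℝ r) z‖ ≤ C
  lip1 : ∀ z ∈ Ω, ∀ v, ‖v‖ < d → ‖fderiv ℝ r (z + v) - fderiv ℝ r z‖ ≤ C * ‖v‖
  tayU : ∀ z ∈ Ω, ∀ v, ‖v‖ < d → z + v ∈ U
  tay : ∀ z ∈ Ω, ∀ v, ‖v‖ < d →
    |r (z + v) - r z - fderiv ℝ r z v - fderiv ℝ (fderiv ℝ r) z v v / 2| ≤ C * ‖v‖ ^ 3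

section
variable {n : ℕ}

lemma le_inf1 : (1 : WithTop ℕ∞) + 1 ≤ ((⊤ : ℕ∞) : WithTop ℕ∞) :=
  WithTop.coe_le_coe.mpr (le_top : (1:ℕ∞) + 1 ≤ ⊤)
lemma le_inf2 : (2 : WithTop ℕ∞) + 1 ≤ ((⊤ : ℕ∞) : WithTop ℕ∞) :=
  WithTop.coe_le_coe.mpr (le_top : (2:ℕ∞) + 1 ≤ ⊤)
lemma le_inf3 : (3 : WithTop ℕ∞) ≤ ((⊤ : ℕ∞) : WithTop ℕ∞) :=
  WithTop.coe_le_coe.mpr (le_top : (3:ℕ∞) ≤ ⊤)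
lemma le_inf0 : (2 : WithTop ℕ∞) ≤ ((⊤ : ℕ∞) : WithTop ℕ∞) :=
  WithTop.coe_le_coe.mpr (le_top : (2:ℕ∞) ≤ ⊤)

lemma exp_deriv {U : Set (Fin n → ℂ)} (hU : IsOpen U) {ρ : (Fin n → ℂ) → ℝ}
    (hρ : ContDiffOn ℝ (⊤ : ℕ∞) ρ U) (K : ℝ) {z : Fin n → ℂ} (hz : z ∈ U) :
    fderiv ℝ (fun w => Real.exp (K * ρ w) - 1) z = (K * Real.exp (K * ρ z)) • fderiv ℝ ρ z ∧
    ∀ v, Lam (fun w => Real.exp (K * ρ w) - 1) z v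
      = K * Real.exp (K * ρ z) * (Lam ρ z v + K * (4 * ‖ell ρ z v‖ ^ 2)) := by
  have hat : ∀ w ∈ U, ContDiffAt ℝ 2 ρ w := fun w hw =>
    (hρ.contDiffAt (hU.mem_nhds hw)).of_le le_inf0
  have h1 : ∀ w ∈ U, HasFDerivAt (fun w => Real.exp (K * ρ w) - 1) ((K * Real.exp (K * ρ w)) • fderiv ℝ ρ w) w := by
    intro w hw
    have hd := ((hat w hw).differentiableAt (by norm_num)).hasFDerivAt
    have := ((hd.const_mul K).exp).sub_const 1
    convert! this using 1
    rw [smul_smul, mul_comm]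
  refine ⟨(h1 z hz).fderiv, ?_⟩
  intro v
  have hev : fderiv ℝ (fun w => Real.exp (K * ρ w) - 1) =ᶠ[nhds z]
      fun w => (K * Real.exp (K * ρ w)) • fderiv ℝ ρ w := by
    filter_upwards [hU.mem_nhds hz] with w hw using (h1 w hw).fderiv
  have hd := ((hat z hz).differentiableAt (by norm_num)).hasFDerivAt
  have hd2 := (((hat z hz).fderiv_right (m := 1) (by norm_num)).differentiableAt (by norm_num)).hasFDerivAt
  have h3 := (((hd.const_mul K).exp).const_mul K).smul hd2
  have h4 : fderiv ℝ (fderiv ℝ (fun w => Real.exp (K * ρ w) - 1)) z = _ := hev.fderiv_eq.trans h3.fderiv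
  rw [norm_ell_sq, Lam, h4, Lam]
  simp
  ring

theorem exists_dom {Ω U : Set (Fin n → ℂ)} {ρ : (Fin n → ℂ) → ℝ} (hΩ : IsOpen Ω) (hb : Bornology.IsBounded Ω)
    (hU : IsOpen U) (hsub : closure Ω ⊆ U) (hρ : ContDiffOn ℝ (⊤ : ℕ∞) ρ U) (heq : Ω = {z | z ∈ U ∧ ρ z < 0})
    (hgrad : ∀ z ∈ frontier Ω, fderiv ℝ ρ z ≠ 0)
    (hlev : ∀ z ∈ frontier Ω, ∀ v, v ≠ 0 → ell ρ z v = 0 → 0 < Lam ρ z v) :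
    ∃ r ε c C d, Dom n Ω U r ε c C d := by
  have hcpt : IsCompact (closure Ω) := hb.isCompact_closure
  have hfr : IsCompact (frontier Ω) := hcpt.of_isClosed_subset isClosed_frontier frontier_subset_closure
  have hS : IsCompact (sphere (0 : Fin n → ℂ) 1) := isCompact_sphere _ _
  have hd0 : ContDiffOn ℝ 1 (fderiv ℝ ρ) U := hρ.fderiv_of_isOpen hU le_inf1
  have hd1 : ContinuousOn (fderiv ℝ ρ) U := hd0.continuousOn
  have hd2 : ContinuousOn (fderiv ℝ (fderiv ℝ ρ)) U :=
    hd0.continuousOn_fderiv_of_isOpen hU (by norm_num)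
  -- continuity of Lam and ell
  have hLamC : ∀ (r : (Fin n → ℂ) → ℝ) (S : Set (Fin n → ℂ)), ContinuousOn (fderiv ℝ (fderiv ℝ r)) S →
      ContinuousOn (fun p : (Fin n → ℂ) × (Fin n → ℂ) => Lam r p.1 p.2) (S ×ˢ sphere 0 1) := by
    intro r S h
    unfold Lam
    have h' : ContinuousOn (fun p : (Fin n → ℂ) × (Fin n → ℂ) => fderiv ℝ (fderiv ℝ r) p.1) (S ×ˢ sphere 0 1) :=
      h.comp continuousOn_fst (fun p hp => hp.1)
    have hI : ContinuousOn (fun p : (Fin n → ℂ) × (Fin n → ℂ) => I • p.2) (S ×ˢ sphere 0 1) := by fun_prop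
    exact ((h'.clm_apply continuousOn_snd).clm_apply continuousOn_snd).add ((h'.clm_apply hI).clm_apply hI)
  have hellC : ContinuousOn (fun p : (Fin n → ℂ) × (Fin n → ℂ) => 4 * ‖ell ρ p.1 p.2‖ ^ 2) (frontier Ω ×ˢ sphere 0 1) := by
    have h' : ContinuousOn (fun p : (Fin n → ℂ) × (Fin n → ℂ) => fderiv ℝ ρ p.1) (frontier Ω ×ˢ sphere 0 1) :=
      hd1.comp continuousOn_fst (fun p hp => hsub (frontier_subset_closure hp.1))
    have hI : ContinuousOn (fun p : (Fin n → ℂ) × (Fin n → ℂ) => I • p.2) (frontier Ω ×ˢ sphere 0 1) := by fun_prop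
    have a1 := h'.clm_apply continuousOn_snd
    have a2 := h'.clm_apply hI
    simp only [norm_ell_sq]
    fun_prop
  obtain ⟨N, hN0, c0, hc0, hNc⟩ := cpt_two (hfr.prod hS)
    (hLamC ρ _ (hd2.mono (frontier_subset_closure.trans hsub))) hellC
    (fun p _ => by positivity) (by
      rintro ⟨z, v⟩ ⟨hz, hv⟩ h0
      have hv0 : v ≠ 0 := by
        rintro rfl; simp at hv
      refine hlev z hz v hv0 ?_
      simp only [mul_eq_zero, OfNat.ofNat_ne_zero, false_or, pow_eq_zero_iff, ne_eq, not_false_eq_true, norm_eq_zero] at h0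
      exact h0)
  set K : ℝ := N + 1 with hK
  have hK0 : 0 < K := by linarith
  set r : (Fin n → ℂ) → ℝ := fun w => Real.exp (K * ρ w) - 1 with hr
  have hrneg : ∀ z, r z < 0 ↔ ρ z < 0 := by
    intro z
    simp only [hr, sub_neg, Real.exp_lt_one_iff]
    constructor
    · intro h; by_contra h'; push Not at h'; nlinarith
    · intro h; nlinarith
  have heq' : Ω = {z | z ∈ U ∧ r z < 0} := by
    rw [heq]; ext z; simp [hrneg]
  have hrs : ContDiffOn ℝ (⊤ : ℕ∞) r U := by
    have := (contDiffOn_const (c := K)).mul hρ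
    exact (Real.contDiff_exp.comp_contDiffOn this).sub contDiffOn_const
  have hrc : ContinuousOn r U := hrs.continuousOn
  have hrcl : ∀ z ∈ closure Ω, 0 ≤ - r z := by
    intro z hz
    have := closure_minimal (s := Ω) (t := {w | w ∈ closure Ω ∧ r w ∈ Set.Iic 0}) ?_ ?_ hz
    · simpa using this.2
    · intro w hw
      refine ⟨subset_closure hw, ?_⟩
      rw [heq'] at hw
      exact hw.2.le
    · exact (hrc.mono hsub).preimage_isClosed_of_isClosed isClosed_closure isClosed_Iic
  have hr0fr : ∀ z ∈ closure Ω, - r z = 0 → z ∈ frontier Ω := by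
    intro z hz h0
    rw [hΩ.frontier_eq]
    refine ⟨hz, fun h => ?_⟩
    rw [heq'] at h
    have := h.2
    linarith
  have hrf1 : ContDiffOn ℝ 2 (fderiv ℝ r) U := hrs.fderiv_of_isOpen hU le_inf2
  have hrf2 : ContDiffOn ℝ 1 (fderiv ℝ (fderiv ℝ r)) U := hrf1.fderiv_of_isOpen hU (by norm_num)
  have hrf3 : ContinuousOn (fderiv ℝ (fderiv ℝ (fderiv ℝ r))) U := hrf2.continuousOn_fderiv_of_isOpen hU (by norm_num)
  obtain ⟨N1, hN10, c1, hc1, h1⟩ := cpt_two (hcpt.prod hS)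
    (hLamC r _ (hrf2.continuousOn.mono hsub)) (G := fun p => - r p.1)
    ((hrc.comp continuousOn_fst (fun p hp => hsub hp.1)).neg)
    (fun p hp => hrcl p.1 hp.1) (by
      rintro ⟨z, v⟩ ⟨hz, hv⟩ h0
      have hzf := hr0fr z hz h0
      rw [(exp_deriv hU hρ K (hsub hz)).2 v]
      have := hNc (z, v) ⟨hzf, hv⟩
      simp only at this
      have h4 : 0 ≤ 4 * ‖ell ρ z v‖ ^ 2 := by positivity
      have : 0 < Lam ρ z v + K * (4 * ‖ell ρ z v‖ ^ 2) := by rw [hK]; nlinarith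
      positivity)
  obtain ⟨N2, hN20, c2, hc2, h2⟩ := cpt_two hcpt (F := fun z => ‖fderiv ℝ r z‖) (G := fun p => - r p)
    (hrf1.continuousOn.mono hsub).norm (hrc.mono hsub).neg hrcl (by
      intro z hz h0
      have hzf := hr0fr z hz h0
      rw [(exp_deriv hU hρ K (hsub hz)).1, norm_smul]
      have := norm_pos_iff.mpr (hgrad z hzf)
      have : 0 < ‖K * Real.exp (K * ρ z)‖ := norm_pos_iff.mpr (by positivity)
      positivity)
  -- thickening
  obtain ⟨d, hd, hdU⟩ := hcpt.exists_cthickening_subset_open hU hsub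
  have hTc : IsCompact (cthickening d (closure Ω)) := hcpt.cthickening
  obtain ⟨B1, hB1⟩ := hTc.exists_bound_of_continuousOn (hrf1.continuousOn.mono hdU)
  obtain ⟨B2, hB2⟩ := hTc.exists_bound_of_continuousOn (hrf2.continuousOn.mono hdU)
  obtain ⟨B3, hB3⟩ := hTc.exists_bound_of_continuousOn (hrf3.mono hdU)
  have hballT : ∀ z ∈ Ω, ball z d ⊆ cthickening d (closure Ω) := fun z hz =>
    (ball_subset_closedBall).trans (closedBall_subset_cthickening (subset_closure hz) d)
  have hΩT : Ω ⊆ cthickening d (closure Ω) := fun z hz => hballT z hz (mem_ball_self hd)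
  have hsm : ∀ z ∈ U, ContDiffAt ℝ 3 r z := fun z hz =>
    (hrs.contDiffAt (hU.mem_nhds hz)).of_le le_inf3
  have hzv : ∀ z v : Fin n → ℂ, ‖v‖ < d → z + v ∈ ball z d := by
    intro z v hv; rw [mem_ball, dist_eq_norm]; simpa using hv
  set C := max 1 (max B1 (max B2 B3)) with hC
  have hCB1 : B1 ≤ C := by simp [hC]
  have hCB2 : B2 ≤ C := by simp [hC]
  have hCB3 : B3 ≤ C := by simp [hC]
  set ε := min (c1 / (2 * (N1 + 1))) (c2 / (2 * (N2 + 1))) with hε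
  have hε1 : N1 * ε ≤ c1 / 2 := by
    have h : ε ≤ c1 / (2 * (N1 + 1)) := min_le_left _ _
    rw [le_div_iff₀ (by positivity)] at h
    have : 0 < ε := by positivity
    nlinarith
  have hε2 : N2 * ε ≤ c2 / 2 := by
    have h : ε ≤ c2 / (2 * (N2 + 1)) := min_le_right _ _
    rw [le_div_iff₀ (by positivity)] at h
    have : 0 < ε := by positivity
    nlinarith
  set c := min 1 (min (c1 / 2) (c2 / 2)) with hc
  have hcc1 : c ≤ c1 / 2 := (min_le_right _ _).trans (min_le_left _ _)
  have hcc2 : c ≤ c2 / 2 := (min_le_right _ _).trans (min_le_right _ _)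
  refine ⟨r, ε, c, C, d, ⟨hΩ, hb, hU, hsub, hsm, heq', by positivity, by positivity, min_le_left _ _, le_max_left _ _, hd,
    ?_, ?_, ?_, ?_, ?_, ?_, ?_⟩⟩
  · intro z hz hrz v
    rcases eq_or_ne v 0 with rfl | hv
    · simp [Lam]
    have hvn : 0 < ‖v‖ := norm_pos_iff.mpr hv
    set u := (‖v‖⁻¹ : ℝ) • v with hu
    have hun : ‖u‖ = 1 := by rw [hu, norm_smul]; simp [hvn.ne']
    have hvu : v = ‖v‖ • u := by rw [hu, smul_smul, mul_inv_cancel₀ hvn.ne', one_smul]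
    have h3 := h1 (z, u) ⟨subset_closure hz, by simp [hun]⟩
    simp only at h3
    have h4 : c ≤ Lam r z u := by nlinarith
    have h5 : Lam r z v = ‖v‖ ^ 2 * Lam r z u := by
      conv_lhs => rw [hvu]
      unfold Lam
      rw [smul_comm I ‖v‖ u]
      simp
      ring
    rw [h5]
    nlinarith [sq_nonneg ‖v‖]
  · intro z hz hrz
    have h3 := h2 z (subset_closure hz)
    nlinarith
  · intro z hz
    exact (hB1 z (hΩT hz)).trans hCB1
  · intro z hz
    exact (hB2 z (hΩT hz)).trans hCB2
  · intro z hz v hv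
    have := (convex_ball z d).norm_image_sub_le_of_norm_fderiv_le (𝕜 := ℝ) (f := fderiv ℝ r) (C := C)
      (fun w hw => ((hrf1.contDiffAt (hU.mem_nhds (hdU (hballT z hz hw)))).differentiableAt (by norm_num)))
      (fun w hw => (hB2 w (hballT z hz hw)).trans hCB2) (mem_ball_self hd) (hzv z v hv)
    simpa using this
  · intro z hz v hv
    exact hdU (hballT z hz (hzv z v hv))
  · intro z hz v hv
    exact taylor3 hd (fun w hw => hsm w (hdU (hballT z hz hw)))
      (fun w hw => (hB3 w (hballT z hz hw)).trans hCB3) hv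

end
end

section
set_option maxSynthPendingDepth 3

section generic
variable {E : Type*} [NormedAddCommGroup E] [NormedSpace ℝ E]

lemma snd_apply {F : E → ℝ} {z : E} (hF : ContDiffAt ℝ 2 F z) (a b : E) :
    fderiv ℝ (fderiv ℝ F) z a b = fderiv ℝ (fun y => fderiv ℝ F y b) z a := by
  have h := ((hF.fderiv_right (m := 1) (by norm_num)).differentiableAt (by norm_num)).hasFDerivAt
  have h2 := h.clm_apply (hasFDerivAt_const b z)
  rw [h2.fderiv]
  simp

lemma snd_nonpos_1d {g : ℝ → ℝ} (hg : ContDiffAt ℝ 2 g 0) (h : IsLocalMax g 0) : deriv (deriv g) 0 ≤ 0 := by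
  by_contra hc
  push Not at hc
  have h0 : deriv g 0 = 0 := h.deriv_eq_zero
  have hmin : IsLocalMin g 0 := isLocalMin_of_deriv_deriv_pos hc h0 hg.continuousAt
  have hcst : g =ᶠ[nhds 0] fun _ => g 0 := by
    filter_upwards [h, hmin] with x h1 h2
    exact le_antisymm h1 h2
  have h1 : deriv g =ᶠ[nhds 0] fun _ => 0 := by
    have := hcst.deriv
    refine this.trans ?_
    filter_upwards with x
    simp
  rw [h1.deriv_eq] at hc
  simp at hc

lemma snd_nonpos {F : E → ℝ} {z : E} (hF : ContDiffAt ℝ 2 F z) (h : IsLocalMax F z) (w : E) :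
    fderiv ℝ (fderiv ℝ F) z w w ≤ 0 := by
  set g : ℝ → ℝ := fun t => F (z + t • w) with hg
  have hlin : ContDiff ℝ 2 (fun t : ℝ => z + t • w) := by fun_prop
  have hg2 : ContDiffAt ℝ 2 g 0 := by
    refine ContDiffAt.comp (g := F) (0:ℝ) ?_ hlin.contDiffAt
    simpa using hF
  have hcont : Filter.Tendsto (fun t : ℝ => z + t • w) (nhds 0) (nhds z) := by
    have : Continuous (fun t : ℝ => z + t • w) := by fun_prop
    have := this.tendsto 0
    simpa using this
  have hmax : IsLocalMax g 0 := by
    have := hcont.eventually h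
    simpa [IsLocalMax, IsMaxFilter, hg] using this
  have h1 := snd_nonpos_1d hg2 hmax
  have hev : ∀ᶠ y in nhds z, ContDiffAt ℝ 2 F y := hF.eventually (by norm_num)
  have hd : deriv g =ᶠ[nhds 0] fun t => fderiv ℝ F (z + t • w) w := by
    filter_upwards [hcont.eventually hev] with t ht
    have hl : HasDerivAt (fun t : ℝ => z + t • w) w t := by
      simpa using ((hasDerivAt_id t).smul_const w).const_add z
    exact ((ht.differentiableAt (by norm_num)).hasFDerivAt.comp_hasDerivAt t hl).deriv
  rw [hd.deriv_eq] at h1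
  have hl : HasDerivAt (fun t : ℝ => z + t • w) w 0 := by
    simpa using ((hasDerivAt_id (0:ℝ)).smul_const w).const_add z
  have h2 := ((hF.fderiv_right (m := 1) (by norm_num)).differentiableAt (by norm_num)).hasFDerivAt
  have h3 := h2.clm_apply (hasFDerivAt_const w z)
  have hz : z = z + (0:ℝ) • w := by simp
  have h5 := (HasFDerivAt.comp_hasDerivAt_of_eq (0:ℝ) h3 hl hz).deriv
  have h6 : deriv (fun t : ℝ => fderiv ℝ F (z + t • w) w) 0 = fderiv ℝ (fderiv ℝ F) z w w := by
    rw [← Function.comp_def (fun y => fderiv ℝ F y w)]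
    rw [h5]; simp
  rwa [h6] at h1

end generic

section lam
variable {E : Type*} [NormedAddCommGroup E] [NormedSpace ℝ E] [NormedSpace ℂ E]

lemma Lam_nonpos {F : E → ℝ} {z : E} (hF : ContDiffAt ℝ 2 F z) (h : IsLocalMax F z) (w : E) : Lam F z w ≤ 0 :=
  add_nonpos (snd_nonpos hF h w) (snd_nonpos hF h (I • w))

lemma Lam_add {F G : E → ℝ} {z : E} (hF : ContDiffAt ℝ 2 F z) (hG : ContDiffAt ℝ 2 G z) (a b : ℝ) (w : E) :
    Lam (fun y => a * F y + b * G y) z w = a * Lam F z w + b * Lam G z w := by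
  have hev : fderiv ℝ (fun y => a * F y + b * G y) =ᶠ[nhds z] fun y => a • fderiv ℝ F y + b • fderiv ℝ G y := by
    filter_upwards [hF.eventually (by norm_num), hG.eventually (by norm_num)] with y h1 h2
    exact (((h1.differentiableAt (by norm_num)).hasFDerivAt.const_mul a).add
      ((h2.differentiableAt (by norm_num)).hasFDerivAt.const_mul b)).fderiv
  have hF2 := ((hF.fderiv_right (m := 1) (by norm_num)).differentiableAt (by norm_num)).hasFDerivAt
  have hG2 := ((hG.fderiv_right (m := 1) (by norm_num)).differentiableAt (by norm_num)).hasFDerivAt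
  have h := ((hF2.const_smul a).add (hG2.const_smul b)).fderiv
  unfold Lam
  have h4 : fderiv ℝ (fderiv ℝ (fun y => a * F y + b * G y)) z = _ := hev.fderiv_eq.trans h
  rw [h4]
  simp
  ring

lemma Lam_quad {u : E → ℝ} {z : E} (hF : ContDiffAt ℝ 2 u z) (K : ℝ) (w : E) :
    Lam (fun y => - u y + K * u y ^ 2) z w = (-1 + 2 * K * u z) * Lam u z w + 2 * K * (4 * ‖ell u z w‖ ^ 2) := by
  have hev : fderiv ℝ (fun y => - u y + K * u y ^ 2) =ᶠ[nhds z] fun y => (-1 + 2 * K * u y) • fderiv ℝ u y := by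
    filter_upwards [hF.eventually (by norm_num)] with y h1
    have hd := (h1.differentiableAt (by norm_num)).hasFDerivAt
    have := (hd.neg.add ((hd.pow 2).const_mul K)).fderiv
    have h2 : fderiv ℝ (fun y => - u y + K * u y ^ 2) y = _ := this
    rw [h2]
    ext v
    simp
    ring
  have hd := (hF.differentiableAt (by norm_num)).hasFDerivAt
  have hF2 := ((hF.fderiv_right (m := 1) (by norm_num)).differentiableAt (by norm_num)).hasFDerivAt
  have h := (((hd.const_mul (2 * K)).const_add (-1)).smul hF2).fderiv
  rw [norm_ell_sq]
  unfold Lam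
  have h4 : fderiv ℝ (fderiv ℝ (fun y => - u y + K * u y ^ 2)) z = _ := hev.fderiv_eq.trans h
  rw [h4]
  simp
  ring

variable [IsScalarTower ℝ ℂ E]

lemma hasFDerivAt_real_of_complex {f : ℂ → E} {ζ : ℂ} (hf : DifferentiableAt ℂ f ζ) :
    HasFDerivAt f ((ContinuousLinearMap.toSpanSingleton ℂ (deriv f ζ)).restrictScalars ℝ) ζ :=
  hf.hasDerivAt.hasFDerivAt.restrictScalars ℝ

lemma fderiv_real_of_complex {f : ℂ → E} {ζ : ℂ} (hf : DifferentiableAt ℂ f ζ) (w : ℂ) :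
    fderiv ℝ f ζ w = w • deriv f ζ := by
  rw [(hasFDerivAt_real_of_complex hf).fderiv]
  simp

lemma fderiv_comp_hol {r : E → ℝ} {f : ℂ → E} {ζ : ℂ} (hf : DifferentiableAt ℂ f ζ) (hr : DifferentiableAt ℝ r (f ζ))
    (w : ℂ) : fderiv ℝ (fun ζ => r (f ζ)) ζ w = fderiv ℝ r (f ζ) (w • deriv f ζ) := by
  have h := hasFDerivAt_real_of_complex hf
  have := (hr.hasFDerivAt.comp ζ h).fderiv
  rw [Function.comp_def] at this
  rw [this]
  simp

lemma Lam_comp [CompleteSpace E] {r : E → ℝ} {f : ℂ → E} {ζ : ℂ} (hf : AnalyticAt ℂ f ζ) (hr : ContDiffAt ℝ 2 r (f ζ)) :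
    ContDiffAt ℝ 2 (fun ζ => r (f ζ)) ζ ∧ Lam (fun ζ => r (f ζ)) ζ 1 = Lam r (f ζ) (deriv f ζ) ∧
    ell (fun ζ => r (f ζ)) ζ 1 = ell r (f ζ) (deriv f ζ) := by
  have hfR : ContDiffAt ℝ 2 f ζ := (hf.contDiffAt (n := 2)).restrict_scalars ℝ
  have hcd : ContDiffAt ℝ 2 (fun ζ => r (f ζ)) ζ := hr.comp ζ hfR
  refine ⟨hcd, ?_, ?_⟩
  · have hev : ∀ w : ℂ, (fun y => fderiv ℝ (fun ζ => r (f ζ)) y w) =ᶠ[nhds ζ]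
        fun y => fderiv ℝ r (f y) (w • deriv f y) := by
      intro w
      filter_upwards [hf.eventually_analyticAt, hf.continuousAt.eventually (hr.eventually (by norm_num))] with y h1 h2
      exact fderiv_comp_hol h1.differentiableAt (h2.differentiableAt (by norm_num)) w
    have hdf := hasFDerivAt_real_of_complex hf.differentiableAt
    have hdf2 := hasFDerivAt_real_of_complex hf.deriv.differentiableAt
    have h2 := ((hr.fderiv_right (m := 1) (by norm_num)).differentiableAt (by norm_num)).hasFDerivAt
    have key : ∀ w : ℂ, fderiv ℝ (fderiv ℝ (fun ζ => r (f ζ))) ζ w w =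
        fderiv ℝ (fderiv ℝ r) (f ζ) (w • deriv f ζ) (w • deriv f ζ)
          + fderiv ℝ r (f ζ) ((w * w) • deriv (deriv f) ζ) := by
      intro w
      rw [snd_apply hcd, (hev w).fderiv_eq]
      have h3 := ((h2.comp ζ hdf).clm_apply (hdf2.const_smul w)).fderiv
      simp only [Function.comp_def] at h3
      have h4 : fderiv ℝ (fun y => fderiv ℝ r (f y) (w • deriv f y)) ζ = _ := h3
      rw [h4]
      simp [smul_smul]
      ring
    unfold Lam
    rw [key, key]
    simp
    ring
  · unfold ell
    rw [fderiv_comp_hol hf.differentiableAt (hr.differentiableAt (by norm_num)),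
      fderiv_comp_hol hf.differentiableAt (hr.differentiableAt (by norm_num))]
    simp

end lam
end

section
set_option maxSynthPendingDepth 3

section hol
variable {E : Type*} [NormedAddCommGroup E] [NormedSpace ℂ E]
variable {F : Type*} [NormedAddCommGroup F] [NormedSpace ℂ F]

/-- slice of a holomorphic map -/
lemma slice_hasDerivAt {f : E → F} {z v : E} {ζ : ℂ} (hf : DifferentiableAt ℂ f (z + ζ • v)) :
    HasDerivAt (fun ζ : ℂ => f (z + ζ • v)) (fderiv ℂ f (z + ζ • v) v) ζ := by
  have hl : HasDerivAt (fun t : ℂ => z + t • v) v ζ := by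
    simpa using ((hasDerivAt_id ζ).smul_const v).const_add z
  exact hf.hasFDerivAt.comp_hasDerivAt ζ hl

lemma slice_deriv0 {f : E → F} {z v : E} (hf : DifferentiableAt ℂ f z) :
    deriv (fun ζ : ℂ => f (z + ζ • v)) 0 = fderiv ℂ f z v := by
  have h : HasDerivAt (fun ζ : ℂ => f (z + ζ • v)) _ 0 := slice_hasDerivAt (by simpa using hf)
  simpa using h.deriv

lemma slice_mapsTo {z v : E} {R ρ : ℝ} (hRv : ρ * ‖v‖ ≤ R) {ζ : ℂ} (hζ : ζ ∈ closedBall (0:ℂ) ρ) :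
    z + ζ • v ∈ closedBall z R := by
  rw [mem_closedBall_iff_norm]
  simp only [add_sub_cancel_left, norm_smul]
  refine le_trans ?_ hRv
  have : ‖ζ‖ ≤ ρ := by simpa using hζ
  gcongr

lemma slice_diffOn {f : E → F} {W : Set E} (hW : IsOpen W) (hf : DifferentiableOn ℂ f W) (z v : E) :
    IsOpen {ζ : ℂ | z + ζ • v ∈ W} ∧ DifferentiableOn ℂ (fun ζ : ℂ => f (z + ζ • v)) {ζ : ℂ | z + ζ • v ∈ W} := by
  constructor
  · exact hW.preimage (by fun_prop)
  · intro ζ hζ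
    exact (slice_hasDerivAt (hf.differentiableAt (hW.mem_nhds hζ))).differentiableAt.differentiableWithinAt

/-- Cauchy estimate for a disc of radius ρ -/
lemma cauchy_disc {f : E → F} {W : Set E} (hW : IsOpen W) (hf : DifferentiableOn ℂ f W) {z v : E} {ρ M : ℝ}
    (hρ : 0 < ρ) (hs : ∀ ζ : ℂ, ‖ζ‖ ≤ ρ → z + ζ • v ∈ W) (hM : ∀ ζ : ℂ, ‖ζ‖ ≤ ρ → ‖f (z + ζ • v)‖ ≤ M) :
    ‖fderiv ℂ f z v‖ ≤ M / ρ := by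
  have hz : z ∈ W := by simpa using hs 0 (by simpa using hρ.le)
  rw [← slice_deriv0 (hf.differentiableAt (hW.mem_nhds hz))]
  obtain ⟨h1, h2⟩ := slice_diffOn hW hf z v
  have hsub : closedBall (0:ℂ) ρ ⊆ {ζ : ℂ | z + ζ • v ∈ W} := fun ζ hζ => hs ζ (by simpa using hζ)
  have hd : DiffContOnCl ℂ (fun ζ : ℂ => f (z + ζ • v)) (ball 0 ρ) := by
    apply DifferentiableOn.diffContOnCl
    rw [closure_ball _ hρ.ne']
    exact h2.mono hsub
  exact norm_deriv_le_of_forall_mem_sphere_norm_le hρ hd (fun ζ hζ => hM ζ (by simpa using (mem_sphere_zero_iff_norm.mp hζ).le))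

lemma cauchy_ball {f : E → F} {W : Set E} (hW : IsOpen W) (hf : DifferentiableOn ℂ f W) {z : E} {R M : ℝ}
    (hR : 0 < R) (hs : closedBall z R ⊆ W) (hM : ∀ w ∈ closedBall z R, ‖f w‖ ≤ M) :
    ‖fderiv ℂ f z‖ ≤ M / R := by
  have hM0 : 0 ≤ M := (norm_nonneg _).trans (hM z (mem_closedBall_self hR.le))
  refine ContinuousLinearMap.opNorm_le_bound _ (by positivity) fun v => ?_
  by_cases hv : v = 0
  · simp [hv]
  have hv' : 0 < ‖v‖ := norm_pos_iff.mpr hv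
  have hm : ∀ ζ : ℂ, ‖ζ‖ ≤ R / ‖v‖ → z + ζ • v ∈ closedBall z R := by
    intro ζ hζ
    exact slice_mapsTo (ρ := R / ‖v‖) (by field_simp; exact le_rfl) (by simpa using hζ)
  have := cauchy_disc hW hf (z := z) (v := v) (ρ := R / ‖v‖) (M := M) (by positivity) (fun ζ hζ => hs (hm ζ hζ))
    (fun ζ hζ => hM _ (hm ζ hζ))
  refine this.trans (le_of_eq ?_)
  field_simp

end hol

section hol2
variable {n : ℕ}

lemma hol_partial {f : (Fin n → ℂ) → ℂ} {W : Set (Fin n → ℂ)} (hW : IsOpen W) (hf : DifferentiableOn ℂ f W)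
    (v : Fin n → ℂ) : DifferentiableOn ℂ (fun z => fderiv ℂ f z v) W := by
  intro z₀ hz₀
  apply DifferentiableAt.differentiableWithinAt
  obtain ⟨R, hR, hRW⟩ : ∃ R > 0, closedBall z₀ (3 * R) ⊆ W := by
    obtain ⟨R, hR, h⟩ := Metric.nhds_basis_closedBall.mem_iff.mp (hW.mem_nhds hz₀)
    exact ⟨R / 3, by positivity, by rwa [mul_div_cancel₀ _ (by norm_num)]⟩
  obtain ⟨M, hM⟩ := (isCompact_closedBall z₀ (3 * R)).exists_bound_of_continuousOn (hf.continuousOn.mono hRW)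
  have hM0 : 0 ≤ M := (norm_nonneg _).trans (hM z₀ (mem_closedBall_self (by positivity)))
  set ρ := R / (‖v‖ + 1) with hρ
  have hρ0 : 0 < ρ := by positivity
  have hρv : ρ * ‖v‖ ≤ R := by
    rw [hρ, div_mul_eq_mul_div, div_le_iff₀ (by positivity)]
    nlinarith [norm_nonneg v]
  have hsub : ∀ z ∈ ball z₀ R, ∀ ζ ∈ closedBall (0:ℂ) ρ, z + ζ • v ∈ closedBall z₀ (2 * R) := by
    intro z hz ζ hζ
    have h1 := slice_mapsTo (z := z) hρv hζ
    rw [mem_closedBall] at *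
    rw [mem_ball] at hz
    linarith [dist_triangle (z + ζ • v) z z₀]
  have hsub2 : closedBall z₀ (2 * R) ⊆ W := (closedBall_subset_closedBall (by linarith)).trans hRW
  have hfd : ∀ w ∈ closedBall z₀ (2 * R), ‖fderiv ℂ f w‖ ≤ M / R := by
    intro w hw
    have hs : closedBall w R ⊆ closedBall z₀ (3 * R) := by
      apply closedBall_subset_closedBall'
      rw [mem_closedBall] at hw; linarith
    exact cauchy_ball hW hf hR (hs.trans hRW) (fun y hy => hM y (hs hy))
  have hev : (fun z => fderiv ℂ f z v) =ᶠ[nhds z₀]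
      fun z => (2 * Real.pi * I : ℂ)⁻¹ * ∫ θ in (0:ℝ)..2 * Real.pi,
        (deriv (circleMap 0 ρ) θ * ((circleMap 0 ρ θ - 0) ^ 2)⁻¹) * f (z + circleMap 0 ρ θ • v) := by
    filter_upwards [ball_mem_nhds z₀ hR] with z hz
    have hzW : z ∈ W := by
      have := hsub z hz 0 (by simpa using hρ0.le)
      exact hsub2 (by simpa using this)
    rw [← slice_deriv0 (hf.differentiableAt (hW.mem_nhds hzW))]
    obtain ⟨h1, h2⟩ := slice_diffOn hW hf z v
    rw [← cderiv_eq_deriv h1 h2 hρ0 (fun ζ hζ => hsub2 (hsub z hz ζ hζ)), cderiv, circleIntegral]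
    simp only [smul_eq_mul, mul_assoc]
  refine DifferentiableAt.congr_of_eventuallyEq ?_ hev
  apply DifferentiableAt.const_mul
  simp only [intervalIntegral.integral_of_le Real.two_pi_pos.le]
  set k : ℝ → ℂ := fun θ => deriv (circleMap 0 ρ) θ * ((circleMap 0 ρ θ - 0) ^ 2)⁻¹ with hk
  have hkn : ∀ θ, ‖k θ‖ ≤ 1 / ρ := by
    intro θ
    simp only [hk, deriv_circleMap, sub_zero, norm_mul, norm_inv, norm_pow, norm_circleMap_zero, norm_I, mul_one]
    rw [abs_of_pos hρ0]
    apply le_of_eq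
    field_simp
  have hkc : Continuous k := by
    simp only [hk, deriv_circleMap, sub_zero]
    refine Continuous.mul (by fun_prop) (Continuous.inv₀ (by fun_prop) ?_)
    intro θ
    exact pow_ne_zero _ (circleMap_ne_center hρ0.ne')
  have hcirc : ∀ θ, circleMap 0 ρ θ ∈ closedBall (0:ℂ) ρ := fun θ => circleMap_mem_closedBall _ hρ0.le θ
  have hcont : ∀ z ∈ ball z₀ R, Continuous (fun θ => k θ * f (z + circleMap 0 ρ θ • v)) := by
    intro z hz
    refine hkc.mul ?_
    have hc : Continuous fun θ => z + circleMap 0 ρ θ • v := by fun_prop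
    exact (hf.continuousOn.mono hsub2).comp_continuous hc (fun θ => hsub z hz _ (hcirc θ))
  have := hasFDerivAt_integral_of_dominated_of_fderiv_le (𝕜 := ℂ) (μ := MeasureTheory.volume.restrict (Set.Ioc 0 (2 * Real.pi)))
    (F := fun z θ => k θ * f (z + circleMap 0 ρ θ • v))
    (F' := fun z θ => k θ • fderiv ℂ f (z + circleMap 0 ρ θ • v)) (x₀ := z₀) (bound := fun _ => 1 / ρ * (M / R)) (s := ball z₀ R)
    (ball_mem_nhds z₀ hR) ?_ ?_ ?_ ?_ ?_ ?_
  · exact this.differentiableAt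
  · filter_upwards [ball_mem_nhds z₀ hR] with z hz
    exact (hcont z hz).aestronglyMeasurable
  · exact (hcont z₀ (mem_ball_self hR)).continuousOn.integrableOn_Icc.mono_set Set.Ioc_subset_Icc_self
  · apply Measurable.aestronglyMeasurable
    refine Measurable.smul hkc.measurable ?_
    exact (measurable_fderiv ℂ f).comp (by fun_prop)
  · filter_upwards with θ z hz
    rw [norm_smul]
    have := hfd _ (hsub z hz _ (hcirc θ))
    have := hkn θ
    gcongr
  · exact MeasureTheory.integrable_const _
  · filter_upwards with θ z hz
    have hw := hsub2 (hsub z hz _ (hcirc θ))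
    have h1 := (hf.differentiableAt (hW.mem_nhds hw)).hasFDerivAt
    have h2 := ((hasFDerivAt_comp_add_right (circleMap 0 ρ θ • v)).mpr h1).const_mul (k θ)
    exact h2

lemma clm_sum {F : Type*} [NormedAddCommGroup F] [NormedSpace ℂ F] (L : (Fin n → ℂ) →L[ℂ] F) :
    L = ∑ j, (ContinuousLinearMap.proj (R := ℂ) (φ := fun _ : Fin n => ℂ) j).smulRight (L (Pi.single j 1)) := by
  ext1 v
  conv_lhs => rw [pi_eq_sum_univ' v]
  simp [map_sum]

lemma hol_contDiffOn (k : ℕ) : ∀ {f : (Fin n → ℂ) → ℂ} {W : Set (Fin n → ℂ)}, IsOpen W → DifferentiableOn ℂ f W →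
    ContDiffOn ℂ k f W := by
  induction k with
  | zero => intro f W hW hf; simpa [contDiffOn_zero] using hf.continuousOn
  | succ k ih =>
    intro f W hW hf
    have := contDiffOn_succ_iff_fderiv_of_isOpen (𝕜 := ℂ) (f := f) (n := (k:WithTop ℕ∞)) hW
    push_cast
    rw [this]
    refine ⟨hf, by simp, ?_⟩
    have h2 : fderiv ℂ f = fun z => ∑ j, (ContinuousLinearMap.proj (R := ℂ) (φ := fun _ : Fin n => ℂ) j).smulRight
        (fderiv ℂ f z (Pi.single j 1)) := by
      funext z; exact clm_sum _
    rw [h2]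
    apply ContDiffOn.sum
    intro j _
    have h3 := ih hW (hol_partial hW hf (Pi.single j 1))
    exact (ContDiffOn.smulRight contDiffOn_const h3)

lemma hol_contDiffOn' (k : ℕ) {m : ℕ} {f : (Fin n → ℂ) → (Fin m → ℂ)} {W : Set (Fin n → ℂ)} (hW : IsOpen W)
    (hf : DifferentiableOn ℂ f W) : ContDiffOn ℂ k f W := by
  rw [contDiffOn_pi]
  intro i
  exact hol_contDiffOn k hW (differentiableOn_pi.mp hf i)

end hol2
end

section
set_option maxSynthPendingDepth 3

section
variable {n : ℕ}

lemma smul_re_im (a : ℂ) (v : Fin n → ℂ) : a • v = a.re • v + a.im • (I • v) := by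
  ext j
  simp only [Pi.smul_apply, Pi.add_apply, smul_eq_mul, real_smul]
  conv_lhs => rw [← re_add_im a]
  ring

def ellL (r : (Fin n → ℂ) → ℝ) (z : Fin n → ℂ) : (Fin n → ℂ) →ₗ[ℂ] ℂ where
  toFun := ell r z
  map_add' x y := by
    unfold ell
    simp only [smul_add, map_add]
    push_cast; ring
  map_smul' a v := by
    unfold ell
    have h1 : fderiv ℝ r z (a • v) = a.re * fderiv ℝ r z v + a.im * fderiv ℝ r z (I • v) := by
      rw [smul_re_im a v]; simp
    have h2 : fderiv ℝ r z (I • a • v) = a.re * fderiv ℝ r z (I • v) - a.im * fderiv ℝ r z v := by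
      have : I • a • v = a.re • (I • v) + (-a.im) • v := by
        rw [smul_smul, smul_re_im]
        simp
        abel
      rw [this]; simp; ring
    rw [h1, h2]
    simp only [RingHom.id_apply, smul_eq_mul]
    push_cast
    conv_rhs => rw [← re_add_im a]
    linear_combination (a.im * ((fderiv ℝ r z (I • v) : ℝ):ℂ) / 2) * I_sq

lemma ellL_apply (r : (Fin n → ℂ) → ℝ) (z v) : ellL r z v = ell r z v := rfl

lemma ell_sum (r : (Fin n → ℂ) → ℝ) (z v) : ell r z v = ∑ j, v j * ell r z (Pi.single j 1) := by
  rw [← ellL_apply]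
  conv_lhs => rw [pi_eq_sum_univ' v]
  simp [map_sum, ellL_apply]

lemma ell_add (r : (Fin n → ℂ) → ℝ) (z v w) : ell r z (v + w) = ell r z v + ell r z w := (ellL r z).map_add v w
lemma ell_smul (r : (Fin n → ℂ) → ℝ) (z) (a : ℂ) (v) : ell r z (a • v) = a * ell r z v := (ellL r z).map_smul a v

lemma norm_ell_le (r : (Fin n → ℂ) → ℝ) (z v) : ‖ell r z v‖ ≤ ‖fderiv ℝ r z‖ * ‖v‖ := by
  unfold ell
  rw [norm_div]
  have h1 := (fderiv ℝ r z).le_opNorm v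
  have h2 := (fderiv ℝ r z).le_opNorm (I • v)
  rw [norm_smul, norm_I, one_mul] at h2
  have : ‖((fderiv ℝ r z v : ℝ) : ℂ) - I * (fderiv ℝ r z (I • v) : ℝ)‖ ≤ 2 * (‖fderiv ℝ r z‖ * ‖v‖) := by
    refine (norm_sub_le _ _).trans ?_
    rw [norm_mul, norm_I, one_mul, Complex.norm_real, Complex.norm_real]
    linarith
  rw [div_le_iff₀ (by simp)]
  simpa [mul_comm] using this

lemma Lam_le (r : (Fin n → ℂ) → ℝ) (z v) : |Lam r z v| ≤ 2 * ‖fderiv ℝ (fderiv ℝ r) z‖ * ‖v‖ ^ 2 := by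
  unfold Lam
  have h1 := (fderiv ℝ (fderiv ℝ r) z).le_opNorm₂ v v
  have h2 := (fderiv ℝ (fderiv ℝ r) z).le_opNorm₂ (I • v) (I • v)
  rw [norm_smul, norm_I, one_mul] at h2
  rw [Real.norm_eq_abs] at h1 h2
  refine (abs_add_le _ _).trans ?_
  nlinarith

lemma Lam_comp_map {m : ℕ} {W : Set (Fin n → ℂ)} (hW : IsOpen W) {φ : (Fin n → ℂ) → (Fin m → ℂ)}
    (hφ : DifferentiableOn ℂ φ W) {z : Fin n → ℂ} (hz : z ∈ W) {r : (Fin m → ℂ) → ℝ} (hr : ContDiffAt ℝ 2 r (φ z)) :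
    ContDiffAt ℝ 2 (fun y => r (φ y)) z ∧ ∀ v, Lam (fun y => r (φ y)) z v = Lam r (φ z) (fderiv ℂ φ z v) ∧
      ell (fun y => r (φ y)) z v = ell r (φ z) (fderiv ℂ φ z v) := by
  have h1 : ContDiffAt ℝ 2 (fun y => r (φ y)) z := by
    have : ContDiffAt ℂ 2 φ z := (hol_contDiffOn' 2 hW hφ).contDiffAt (hW.mem_nhds hz)
    exact hr.comp z (this.restrict_scalars ℝ)
  refine ⟨h1, fun v => ?_⟩
  obtain ⟨o1, d1⟩ := slice_diffOn hW hφ z v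
  have a1 : AnalyticAt ℂ (fun ζ : ℂ => φ (z + ζ • v)) 0 := d1.analyticAt (o1.mem_nhds (by simpa using hz))
  obtain ⟨o2, d2⟩ := slice_diffOn hW (differentiable_id.differentiableOn (𝕜 := ℂ)) z v
  have a2 : AnalyticAt ℂ (fun ζ : ℂ => id (z + ζ • v)) 0 := d2.analyticAt (o2.mem_nhds (by simpa using hz))
  obtain ⟨-, p1, p2⟩ := Lam_comp (r := r) a1 (by simpa using hr)
  obtain ⟨-, q1, q2⟩ := Lam_comp (r := fun y => r (φ y)) a2 (by simpa using h1)
  rw [slice_deriv0 (hφ.differentiableAt (hW.mem_nhds hz))] at p1 p2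
  rw [slice_deriv0 differentiableAt_id] at q1 q2
  simp only [zero_smul, add_zero, id, fderiv_id, ContinuousLinearMap.coe_id', fderiv_id'] at p1 p2 q1 q2
  exact ⟨q1.symm.trans p1, q2.symm.trans p2⟩

/-- abstract maximum principle -/
lemma max_princ {Ω : Set (Fin n → ℂ)} (hΩ : IsOpen Ω) {u s : (Fin n → ℂ) → ℝ}
    (hu : ∀ z ∈ Ω, ContDiffAt ℝ 2 u z) (hs : ∀ z ∈ Ω, ContDiffAt ℝ 2 s z)
    (hu0 : ∀ z ∈ Ω, u z < 0) (hs0 : ∀ z ∈ Ω, s z < 0)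
    (hcpt : ∀ η > 0, IsCompact {z | z ∈ Ω ∧ s z ≤ -η}) {ε K : ℝ} (hε : 0 < ε) (hK : 0 < K)
    (hv : ∀ z ∈ Ω, -ε ≤ s z → ∃ v, ∀ c > 0, 0 < Lam u z v +
      c * ((-1 + 2 * K * s z) * Lam s z v + 2 * K * (4 * ‖ell s z v‖ ^ 2))) :
    ∃ c > 0, ∀ z ∈ Ω, c * (-s z) ≤ -u z := by
  have hsc : ContinuousOn s Ω := fun z hz => (hs z hz).continuousAt.continuousWithinAt
  have huc : ContinuousOn u Ω := fun z hz => (hu z hz).continuousAt.continuousWithinAt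
  -- deep interior
  obtain ⟨m, hm, hmu⟩ : ∃ m > 0, ∀ z ∈ Ω, s z ≤ -ε → u z ≤ -m := by
    by_cases hne : {z | z ∈ Ω ∧ s z ≤ -ε}.Nonempty
    · obtain ⟨x, hx, hmax⟩ := (hcpt ε hε).exists_isMaxOn hne (huc.mono fun z hz => hz.1)
      refine ⟨-u x, by linarith [hu0 x hx.1], fun z hz h => ?_⟩
      have := hmax (show z ∈ {z | z ∈ Ω ∧ s z ≤ -ε} from ⟨hz, h⟩)
      simpa using this
    · refine ⟨1, one_pos, fun z hz h => (hne ⟨z, hz, h⟩).elim⟩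
  obtain ⟨B, hB, hBs⟩ : ∃ B > 0, ∀ z ∈ Ω, s z ≤ -ε → -s z ≤ B := by
    obtain ⟨B, hB⟩ := (hcpt ε hε).exists_bound_of_continuousOn (hsc.mono fun z hz => hz.1)
    refine ⟨max B 1, by positivity, fun z hz h => ?_⟩
    have := hB z ⟨hz, h⟩
    rw [Real.norm_eq_abs] at this
    exact (neg_le_abs _).trans (this.trans (le_max_left _ _))
  set c := min (m / B) (m / (2 * (ε + K * ε ^ 2))) with hc
  have hc0 : 0 < c := by positivity
  have hc1 : c * B ≤ m := by
    have := min_le_left (m / B) (m / (2 * (ε + K * ε ^ 2)))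
    rw [← hc, le_div_iff₀ hB] at this; exact this
  have hc2 : c * (ε + K * ε ^ 2) < m := by
    have := min_le_right (m / B) (m / (2 * (ε + K * ε ^ 2)))
    rw [← hc, le_div_iff₀ (by positivity)] at this; linarith
  refine ⟨c, hc0, fun z hz => ?_⟩
  rcases le_or_gt (s z) (-ε) with h | h
  · have := hBs z hz h
    have := hmu z hz h
    nlinarith
  by_contra hcon
  push Not at hcon
  set F : (Fin n → ℂ) → ℝ := fun y => 1 * u y + c * (- s y + K * s y ^ 2) with hF
  have hF0 : 0 < F z := by
    simp only [hF]
    have : 0 ≤ c * (K * s z ^ 2) := by positivity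
    linarith
  have hFc : ContinuousOn F Ω := by
    apply ContinuousOn.add (huc.const_smul (1:ℝ))
    exact ContinuousOn.mul continuousOn_const (hsc.neg.add (continuousOn_const.mul (hsc.pow 2)))
  set η := F z / (2 * (c * (1 + K * ε))) with hη
  have hη0 : 0 < η := by positivity
  have hηs : ∀ y ∈ Ω, -ε ≤ s y → F z ≤ F y → s y < -η := by
    intro y hy h1 h2
    have h3 : F y ≤ c * (1 + K * ε) * (- s y) := by
      simp only [hF]
      have a1 := hu0 y hy
      have a2 := hs0 y hy
      have : K * s y ^ 2 ≤ K * ε * (- s y) := by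
        rw [mul_assoc]
        apply mul_le_mul_of_nonneg_left _ hK.le
        nlinarith
      nlinarith
    have h4 : F z / (c * (1 + K * ε)) ≤ - s y := by
      rw [div_le_iff₀ (by positivity)]; linarith
    have h5 : η = F z / (c * (1 + K * ε)) / 2 := by rw [hη]; field_simp
    have h6 : 0 < F z / (c * (1 + K * ε)) := by positivity
    linarith
  set S := {y | y ∈ Ω ∧ s y ≤ -η} ∩ {y | y ∈ Ω ∧ s y ≤ -η ∧ -ε ≤ s y} with hS
  have hScpt : IsCompact {y | (y ∈ Ω ∧ s y ≤ -η) ∧ -ε ≤ s y} := by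
    have h1 : IsClosed ({y | y ∈ Ω ∧ s y ≤ -η} ∩ s ⁻¹' (Set.Ici (-ε))) :=
      (hsc.mono fun y (hy : y ∈ Ω ∧ s y ≤ -η) => hy.1).preimage_isClosed_of_isClosed (hcpt η hη0).isClosed isClosed_Ici
    exact (hcpt η hη0).of_isClosed_subset h1 (fun y hy => hy.1)
  have hzS : z ∈ {y | (y ∈ Ω ∧ s y ≤ -η) ∧ -ε ≤ s y} := ⟨⟨hz, (hηs z hz h.le le_rfl).le⟩, h.le⟩
  obtain ⟨x, ⟨⟨hxΩ, hxη⟩, hxε⟩, hmax⟩ := hScpt.exists_isMaxOn ⟨z, hzS⟩ (hFc.mono fun y hy => hy.1.1)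
  have hFx : F z ≤ F x := hmax hzS
  have hxη' := hηs x hxΩ hxε hFx
  have hxε' : -ε < s x := by
    rcases hxε.lt_or_eq with h1 | h1
    · exact h1
    · exfalso
      have h2 := hmu x hxΩ h1.symm.le
      have h3 : F x = u x + c * (ε + K * ε ^ 2) := by simp only [hF, ← h1]; ring
      linarith
  have hloc : IsLocalMax F x := by
    have hca : ContinuousAt s x := (hs x hxΩ).continuousAt
    filter_upwards [hΩ.mem_nhds hxΩ, hca.eventually (isOpen_Ioo.mem_nhds (⟨hxε', hxη'⟩ : s x ∈ Set.Ioo (-ε) (-η)))] with y h1 h2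
    exact hmax ⟨⟨h1, h2.2.le⟩, h2.1.le⟩
  obtain ⟨v, hv⟩ := hv x hxΩ hxε
  have hvc := hv c hc0
  have hq : ContDiffAt ℝ 2 (fun y => - s y + K * s y ^ 2) x :=
    (hs x hxΩ).neg.add (contDiffAt_const.mul ((hs x hxΩ).pow 2))
  have hFd : ContDiffAt ℝ 2 F x := (contDiffAt_const.mul (hu x hxΩ)).add (contDiffAt_const.mul hq)
  have := Lam_nonpos hFd hloc v
  rw [hF, Lam_add (hu x hxΩ) hq, Lam_quad (hs x hxΩ)] at this
  linarith

end
end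

section
set_option maxSynthPendingDepth 3

namespace Dom
variable {n : ℕ} {Ω U : Set (Fin n → ℂ)} {r : (Fin n → ℂ) → ℝ} {ε c C d : ℝ}

lemma neg (D : Dom n Ω U r ε c C d) {z} (hz : z ∈ Ω) : r z < 0 := by
  have := D.eq ▸ hz; exact this.2

lemma memU (D : Dom n Ω U r ε c C d) {z} (hz : z ∈ Ω) : z ∈ U := by
  have := D.eq ▸ hz; exact this.1

lemma mem (D : Dom n Ω U r ε c C d) {z v} (hz : z ∈ Ω) (hv : ‖v‖ < d) (hr : r (z + v) < 0) : z + v ∈ Ω := by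
  rw [D.eq]; exact ⟨D.tayU z hz v hv, hr⟩

lemma smooth2 (D : Dom n Ω U r ε c C d) {z} (hz : z ∈ Ω) : ContDiffAt ℝ 2 r z :=
  (D.smooth z (D.memU hz)).of_le (by norm_num)

lemma cont (D : Dom n Ω U r ε c C d) : ContinuousOn r U :=
  fun z hz => (D.smooth z hz).continuousAt.continuousWithinAt

lemma cpt (D : Dom n Ω U r ε c C d) {η : ℝ} (hη : 0 < η) : IsCompact {z | z ∈ Ω ∧ r z ≤ -η} := by
  have h1 : {z | z ∈ Ω ∧ r z ≤ -η} = closure Ω ∩ r ⁻¹' (Set.Iic (-η)) := by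
    ext z
    constructor
    · rintro ⟨h1, h2⟩; exact ⟨subset_closure h1, h2⟩
    · rintro ⟨h1, h2⟩
      have h2' : r z ≤ -η := h2
      refine ⟨?_, h2⟩
      rw [D.eq]
      exact ⟨D.sub h1, by linarith⟩
  rw [h1]
  have hc : IsCompact (closure Ω) := D.bdd.isCompact_closure
  refine hc.of_isClosed_subset ?_ Set.inter_subset_left
  exact (D.cont.mono D.sub).preimage_isClosed_of_isClosed isClosed_closure isClosed_Iic

lemma exists_k (D : Dom n Ω U r ε c C d) {z} (hz : z ∈ Ω) (hs : -ε ≤ r z) :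
    ∃ k : Fin n, c / (4 * (n + 1)) ≤ ‖ell r z (Pi.single k 1)‖ := by
  by_contra hcon
  push Not at hcon
  have h1 : ‖fderiv ℝ r z‖ ≤ c / 2 := by
    refine ContinuousLinearMap.opNorm_le_bound _ (by linarith [D.hc]) fun v => ?_
    rw [← ell_re, Real.norm_eq_abs, abs_mul, abs_two]
    have h2 : |(ell r z v).re| ≤ ‖ell r z v‖ := Complex.abs_re_le_norm _
    have h3 : ‖ell r z v‖ ≤ ∑ j : Fin n, ‖v‖ * (c / (4 * (n + 1))) := by
      rw [ell_sum]
      refine norm_sum_le_of_le _ fun j _ => ?_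
      rw [norm_mul]
      have := (hcon j).le
      have := norm_le_pi_norm v j
      gcongr
    rw [Finset.sum_const, Finset.card_univ, Fintype.card_fin, nsmul_eq_mul] at h3
    have h4 : (n:ℝ) * (‖v‖ * (c / (4 * (n + 1)))) ≤ c / 4 * ‖v‖ := by
      have : (n:ℝ) * (‖v‖ * (c / (4 * (n + 1)))) = c / 4 * ‖v‖ * (n / (n + 1)) := by field_simp
      rw [this]
      have h5 : (n:ℝ) / (n + 1) ≤ 1 := by
        rw [div_le_one (by positivity)]; linarith
      have : 0 ≤ c / 4 * ‖v‖ := by have := D.hc; positivity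
      nlinarith
    linarith
  linarith [D.grad z hz hs, D.hc]

lemma mono (D : Dom n Ω U r ε c C d) {ε' c' C' d' : ℝ} (h1 : 0 < ε') (h1' : ε' ≤ ε) (h2 : 0 < c') (h2' : c' ≤ c)
    (h3 : C ≤ C') (h4 : 0 < d') (h4' : d' ≤ d) : Dom n Ω U r ε' c' C' d' where
  isOpen := D.isOpen
  bdd := D.bdd
  openU := D.openU
  sub := D.sub
  smooth := D.smooth
  eq := D.eq
  hε := h1
  hc := h2
  hc1 := h2'.trans D.hc1
  hC := D.hC.trans h3
  hd := h4
  lam z hz hs v := le_trans (by gcongr) (D.lam z hz (by linarith) v)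
  grad z hz hs := h2'.trans (D.grad z hz (by linarith))
  b1 z hz := (D.b1 z hz).trans h3
  b2 z hz := (D.b2 z hz).trans h3
  lip1 z hz v hv := (D.lip1 z hz v (by linarith)).trans (by gcongr)
  tayU z hz v hv := D.tayU z hz v (by linarith)
  tay z hz v hv := (D.tay z hz v (by linarith)).trans (by gcongr)

end Dom

structure HM (n : ℕ) (Ω₁ U₁ Ω₂ U₂ : Set (Fin n → ℂ)) (r₁ r₂ : (Fin n → ℂ) → ℝ) (φ : (Fin n → ℂ) → (Fin n → ℂ))
    (ε₁ ε₂ c C d : ℝ) : Prop where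
  D₁ : Dom n Ω₁ U₁ r₁ ε₁ c C d
  D₂ : Dom n Ω₂ U₂ r₂ ε₂ c C d
  hol : DifferentiableOn ℂ φ Ω₁
  maps : ∀ z ∈ Ω₁, φ z ∈ Ω₂
  proper : ∀ K ⊆ Ω₂, IsCompact K → IsCompact {z | z ∈ Ω₁ ∧ φ z ∈ K}
  strip : ∀ z ∈ Ω₁, -ε₁ ≤ r₁ z → -ε₂ ≤ r₂ (φ z)
  hopf1 : ∀ z ∈ Ω₁, c * (-r₁ z) ≤ - r₂ (φ z)
  hopf2 : ∀ z ∈ Ω₁, - r₂ (φ z) ≤ C * (-r₁ z)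

lemma cpt_neg {n : ℕ} {S : Set (Fin n → ℂ)} (hS : IsCompact S) {u : (Fin n → ℂ) → ℝ} (hu : ContinuousOn u S) (h : ∀ z ∈ S, u z < 0) :
    ∃ m > 0, ∀ z ∈ S, u z < -m := by
  by_cases hne : S.Nonempty
  · obtain ⟨x, hx, hmax⟩ := hS.exists_isMaxOn hne hu
    refine ⟨-u x / 2, by linarith [h x hx], fun z hz => ?_⟩
    have : u z ≤ u x := hmax hz
    linarith [h x hx]
  · exact ⟨1, one_pos, fun z hz => (hne ⟨z, hz⟩).elim⟩

lemma quad_pos {K L c0 C s e : ℝ} (hc0 : 0 < c0) (hC : 0 < C) (hK : K = C / c0 ^ 2) (hL0 : |L| ≤ 2 * C) (he : c0 ≤ e)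
    (hs : s < 0) (hs2 : -(1 / (2 * K)) ≤ s) : 0 < (-1 + 2 * K * s) * L + 2 * K * (4 * e ^ 2) := by
  have hK0 : 0 < K := by rw [hK]; positivity
  have h1 : K * c0 ^ 2 = C := by rw [hK]; field_simp
  have h2 : c0 ^ 2 ≤ e ^ 2 := by gcongr
  have h3 : C ≤ K * e ^ 2 := by rw [← h1]; gcongr
  have h4 : -1 ≤ 2 * K * s := by
    have : 2 * K * (-(1 / (2 * K))) = -1 := by field_simp
    nlinarith
  have h5 : 2 * K * s < 0 := by nlinarith
  have h6 := abs_le.mp hL0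
  nlinarith

lemma exists_HM {n : ℕ} {Ω₁ U₁ Ω₂ U₂ : Set (Fin n → ℂ)} {r₁ r₂ : (Fin n → ℂ) → ℝ} {φ : (Fin n → ℂ) → (Fin n → ℂ)}
    {ε₁ ε₂ c₁ c₂ C₁ C₂ d₁ d₂ : ℝ} (D₁ : Dom n Ω₁ U₁ r₁ ε₁ c₁ C₁ d₁) (D₂ : Dom n Ω₂ U₂ r₂ ε₂ c₂ C₂ d₂)
    (hol : DifferentiableOn ℂ φ Ω₁) (maps : ∀ z ∈ Ω₁, φ z ∈ Ω₂)
    (proper : ∀ K ⊆ Ω₂, IsCompact K → IsCompact {z | z ∈ Ω₁ ∧ φ z ∈ K}) :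
    ∃ ε₁ ε₂ c C d, HM n Ω₁ U₁ Ω₂ U₂ r₁ r₂ φ ε₁ ε₂ c C d := by
  have hφc : ∀ z ∈ Ω₁, ContDiffAt ℝ 2 (fun y => r₂ (φ y)) z ∧ _ := fun z hz =>
    Lam_comp_map D₁.isOpen hol hz (D₂.smooth2 (maps z hz))
  have hcont2 : ContinuousOn (fun y => r₂ (φ y)) Ω₁ := fun z hz => (hφc z hz).1.continuousAt.continuousWithinAt
  have hcpt2 : ∀ η > 0, IsCompact {z | z ∈ Ω₁ ∧ r₂ (φ z) ≤ -η} := by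
    intro η hη
    have := proper {q | q ∈ Ω₂ ∧ r₂ q ≤ -η} (fun q hq => hq.1) (D₂.cpt hη)
    convert this using 1
    ext z
    constructor
    · rintro ⟨h1, h2⟩; exact ⟨h1, maps z h1, h2⟩
    · rintro ⟨h1, h2⟩; exact ⟨h1, h2.2⟩
  obtain ⟨e1, he1, hs1⟩ := cpt_neg (hcpt2 ε₂ D₂.hε) (u := r₁) (D₁.cont.mono fun z hz => D₁.memU hz.1) (fun z hz => D₁.neg hz.1)
  obtain ⟨e2, he2, hs2⟩ := cpt_neg (D₁.cpt D₁.hε) (u := fun y => r₂ (φ y)) (hcont2.mono fun z hz => hz.1) (fun z hz => D₂.neg (maps z hz.1))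
  have hstrip : ∀ z ∈ Ω₁, -e1 ≤ r₁ z → -ε₂ ≤ r₂ (φ z) := by
    intro z hz h
    by_contra hc
    push Not at hc
    linarith [hs1 z ⟨hz, hc.le⟩]
  have hstrip2 : ∀ z ∈ Ω₁, -e2 ≤ r₂ (φ z) → -ε₁ ≤ r₁ z := by
    intro z hz h
    by_contra hc
    push Not at hc
    linarith [hs2 z ⟨hz, hc.le⟩]
  have hc1 := D₁.hc
  have hc2 := D₂.hc
  have hC1 := D₁.hC
  have hC2 := D₂.hC
  obtain ⟨a, ha, hopf1⟩ : ∃ a > 0, ∀ z ∈ Ω₁, a * (-r₁ z) ≤ - r₂ (φ z) := by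
    set c0 := c₁ / (4 * (n + 1)) with hc0
    have hc0' : 0 < c0 := by positivity
    set K := C₁ / c0 ^ 2 with hK
    have hK0 : 0 < K := by positivity
    refine max_princ D₁.isOpen (u := fun y => r₂ (φ y)) (s := r₁) (fun z hz => (hφc z hz).1) (fun z hz => D₁.smooth2 hz)
      (fun z hz => D₂.neg (maps z hz)) (fun z hz => D₁.neg hz) (fun η hη => D₁.cpt hη) (ε := min (min e1 ε₁) (1 / (2 * K)))
      (by have := D₁.hε; positivity) hK0 ?_
    intro z hz hs
    have m1 := min_le_left (min e1 ε₁) (1 / (2 * K))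
    have m2 := min_le_right (min e1 ε₁) (1 / (2 * K))
    have m3 := min_le_left e1 ε₁
    have m4 := min_le_right e1 ε₁
    obtain ⟨k, hk⟩ := D₁.exists_k hz (by linarith)
    refine ⟨Pi.single k 1, fun c hc => ?_⟩
    have hn : ‖(Pi.single k 1 : Fin n → ℂ)‖ = 1 := by simp [Pi.norm_single]
    have hl := Lam_le r₁ z (Pi.single k 1)
    rw [hn] at hl
    have hl2 := D₁.b2 z hz
    have hp := quad_pos (s := r₁ z) hc0' (by linarith) hK (hl.trans (by linarith)) hk (D₁.neg hz) (by linarith)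
    have h0 : 0 ≤ Lam (fun y => r₂ (φ y)) z (Pi.single k 1) := by
      rw [((Lam_comp_map D₁.isOpen hol hz (D₂.smooth2 (maps z hz))).2 _).1]
      refine le_trans ?_ (D₂.lam _ (maps z hz) (hstrip z hz (by linarith)) _)
      positivity
    nlinarith
  obtain ⟨b, hb, hopf2⟩ : ∃ a > 0, ∀ z ∈ Ω₁, a * (- r₂ (φ z)) ≤ - r₁ z := by
    set c0 := c₂ / (4 * (n + 1)) with hc0
    have hc0' : 0 < c0 := by positivity
    set K := C₂ / c0 ^ 2 with hK
    have hK0 : 0 < K := by positivity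
    refine max_princ D₁.isOpen (u := r₁) (s := fun y => r₂ (φ y)) (fun z hz => D₁.smooth2 hz) (fun z hz => (hφc z hz).1)
      (fun z hz => D₁.neg hz) (fun z hz => D₂.neg (maps z hz)) hcpt2 (ε := min (min e2 ε₂) (1 / (2 * K)))
      (by have := D₂.hε; positivity) hK0 ?_
    intro z hz hs
    have m1 := min_le_left (min e2 ε₂) (1 / (2 * K))
    have m2 := min_le_right (min e2 ε₂) (1 / (2 * K))
    have m3 := min_le_left e2 ε₂
    have m4 := min_le_right e2 ε₂
    have hL := fun v => (Lam_comp_map D₁.isOpen hol hz (D₂.smooth2 (maps z hz))).2 v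
    have hlam1 := D₁.lam z hz (hstrip2 z hz (by linarith))
    by_cases hinj : Function.Injective (fderiv ℂ φ z)
    · have hsurj : Function.Surjective (fderiv ℂ φ z) :=
        (LinearMap.injective_iff_surjective (f := (fderiv ℂ φ z).toLinearMap)).mp hinj
      obtain ⟨k, hk⟩ := D₂.exists_k (maps z hz) (by linarith)
      obtain ⟨v, hv⟩ := hsurj (Pi.single k 1)
      refine ⟨v, fun c hc => ?_⟩
      rw [(hL v).1, (hL v).2, hv]
      have hn : ‖(Pi.single k 1 : Fin n → ℂ)‖ = 1 := by simp [Pi.norm_single]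
      have hl := Lam_le r₂ (φ z) (Pi.single k 1)
      rw [hn] at hl
      have hl2 := D₂.b2 _ (maps z hz)
      have hp := quad_pos (s := r₂ (φ z)) hc0' (by linarith) hK (hl.trans (by linarith)) hk (D₂.neg (maps z hz)) (by linarith)
      have h0 : 0 ≤ Lam r₁ z v := le_trans (by positivity) (hlam1 v)
      nlinarith
    · rw [injective_iff_map_eq_zero] at hinj
      push Not at hinj
      obtain ⟨v, hv0, hv⟩ := hinj
      refine ⟨v, fun c hc => ?_⟩
      rw [(hL v).1, (hL v).2, hv0]
      have h1 : Lam r₂ (φ z) 0 = 0 := by simp [Lam]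
      have h2 : ell r₂ (φ z) 0 = 0 := by simp [ell]
      rw [h1, h2]
      simp only [norm_zero]
      have : 0 < ‖v‖ := norm_pos_iff.mpr hv
      have h3 : 0 < c₁ * ‖v‖ ^ 2 := by positivity
      linarith [hlam1 v]
  have hd1 := D₁.hd
  have hd2 := D₂.hd
  have hε1 := D₁.hε
  have hε2 := D₂.hε
  refine ⟨min ε₁ e1, ε₂, min (min c₁ c₂) a, max (max C₁ C₂) (1 / b), min d₁ d₂, ?_, ?_, hol, maps, proper, ?_, ?_, ?_⟩
  · exact D₁.mono (by positivity) (min_le_left _ _) (by positivity) ((min_le_left _ _).trans (min_le_left _ _))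
      ((le_max_left _ _).trans (le_max_left _ _)) (by positivity) (min_le_left _ _)
  · exact D₂.mono hε2 le_rfl (by positivity) ((min_le_left _ _).trans (min_le_right _ _))
      ((le_max_right _ _).trans (le_max_left _ _)) (by positivity) (min_le_right _ _)
  · intro z hz h
    exact hstrip z hz (by linarith [min_le_right ε₁ e1])
  · intro z hz
    refine le_trans ?_ (hopf1 z hz)
    have := D₁.neg hz
    apply mul_le_mul_of_nonneg_right (min_le_right _ _) (by linarith)
  · intro z hz
    have h1 := hopf2 z hz
    have h2 : - r₂ (φ z) ≤ 1 / b * (- r₁ z) := by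
      rw [one_div, ← div_eq_inv_mul, le_div_iff₀ hb]; linarith
    refine h2.trans ?_
    have := D₁.neg hz
    apply mul_le_mul_of_nonneg_right (le_max_right _ _) (by linarith)
end

section
set_option maxSynthPendingDepth 3

lemma Lam_norm_sq (w v : ℂ) : Lam (fun x : ℂ => ‖x‖ ^ 2) w v = 4 * ‖v‖ ^ 2 := by
  unfold Lam
  rw [fderiv_norm_sq]
  have : fderiv ℝ (2 • ⇑(innerSL ℝ (E := ℂ))) w = 2 • innerSL ℝ (E := ℂ) :=
    ContinuousLinearMap.fderiv (2 • innerSL ℝ (E := ℂ))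
  rw [this]
  have h : ∀ x : ℂ, (2 • innerSL ℝ (E := ℂ)) x x = 2 * ‖x‖ ^ 2 := by
    intro x
    rw [ContinuousLinearMap.smul_apply, ContinuousLinearMap.smul_apply, innerSL_apply_apply, real_inner_self_eq_norm_sq]
    simp
  rw [h, h, smul_eq_mul, norm_mul, norm_I]
  ring

lemma Lam_norm_sq_comp {h : ℂ → ℂ} {ζ : ℂ} (hh : AnalyticAt ℂ h ζ) :
    ContDiffAt ℝ 2 (fun ζ => ‖h ζ‖ ^ 2) ζ ∧ Lam (fun ζ => ‖h ζ‖ ^ 2) ζ 1 = 4 * ‖deriv h ζ‖ ^ 2 := by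
  obtain ⟨h1, h2, -⟩ := Lam_comp (r := fun x : ℂ => ‖x‖ ^ 2) hh (contDiff_norm_sq ℝ).contDiffAt
  exact ⟨h1, by rw [h2, Lam_norm_sq]⟩

lemma bern_alg (p p' ζ : ℂ) : -2 * ‖p‖ ^ 2 ≤ ‖p'‖ ^ 2 - 2 * ‖p + ζ * p'‖ ^ 2 + ‖2 * ζ * p + ζ ^ 2 * p'‖ ^ 2 := by
  have h : ‖p'‖ ^ 2 - 2 * ‖p + ζ * p'‖ ^ 2 + ‖2 * ζ * p + ζ ^ 2 * p'‖ ^ 2 + 2 * ‖p‖ ^ 2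
      = ‖(1 - ζ * (starRingEnd ℂ) ζ) * p' - 2 * (starRingEnd ℂ) ζ * p‖ ^ 2 := by
    simp only [Complex.sq_norm, normSq_apply]
    simp only [pow_two, add_re, add_im, mul_re, mul_im, sub_re, sub_im, conj_re, conj_im, one_re, one_im, re_ofNat, im_ofNat]
    ring
  have : 0 ≤ ‖(1 - ζ * (starRingEnd ℂ) ζ) * p' - 2 * (starRingEnd ℂ) ζ * p‖ ^ 2 := by positivity
  linarith

/-- Bernstein-type estimate on the unit disc -/
lemma bern {p : ℂ → ℂ} {u : ℂ → ℝ} {W : Set ℂ} (hW : IsOpen W) (hsub : closedBall 0 1 ⊆ W) (hp : DifferentiableOn ℂ p W)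
    (hu : ∀ ζ ∈ closedBall (0:ℂ) 1, ContDiffAt ℝ 2 u ζ) (hu0 : ∀ ζ ∈ closedBall (0:ℂ) 1, u ζ ≤ 0) {c : ℝ} (hc : 0 < c)
    (hlam : ∀ ζ ∈ closedBall (0:ℂ) 1, c * ‖p ζ‖ ^ 2 ≤ Lam u ζ 1) : ‖p 0‖ ^ 2 ≤ 9 / c * (- u 0) := by
  set N : ℂ → ℝ := fun ζ => 1 * (1 * ‖p ζ‖ ^ 2 + (-2) * ‖ζ * p ζ‖ ^ 2) + 1 * ‖ζ ^ 2 * p ζ‖ ^ 2 with hN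
  set F : ℂ → ℝ := fun ζ => 1 * N ζ + 9 / c * u ζ with hF
  have hNe : ∀ ζ, N ζ = (1 - ‖ζ‖ ^ 2) ^ 2 * ‖p ζ‖ ^ 2 := by
    intro ζ; simp only [hN, norm_mul, norm_pow]; ring
  have hpc := hp.continuousOn.mono hsub
  have hFc : ContinuousOn F (closedBall 0 1) := by
    have hN' : ContinuousOn N (closedBall 0 1) := by
      have : N = fun ζ => (1 - ‖ζ‖ ^ 2) ^ 2 * ‖p ζ‖ ^ 2 := funext hNe
      rw [this]
      exact ContinuousOn.mul (by fun_prop) (hpc.norm.pow 2)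
    exact (continuousOn_const.mul hN').add (continuousOn_const.mul (fun ζ hζ => (hu ζ hζ).continuousAt.continuousWithinAt))
  obtain ⟨x, hx, hmax⟩ := (isCompact_closedBall (0:ℂ) 1).exists_isMaxOn ⟨0, by simp⟩ hFc
  have hF0 : F 0 ≤ F x := hmax (by simp)
  suffices hFx : F x ≤ 0 by
    have : F 0 = ‖p 0‖ ^ 2 + 9 / c * u 0 := by simp [hF, hN]
    linarith
  by_contra hcon
  push Not at hcon
  have hcu : 9 / c * u x ≤ 0 := mul_nonpos_of_nonneg_of_nonpos (by positivity) (hu0 x hx)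
  have hNx : 0 < N x := by simp only [hF] at hcon; linarith
  have hpx : 0 < ‖p x‖ := by
    rw [norm_pos_iff]; intro h
    rw [hNe, h] at hNx; simp at hNx
  have hx1 : ‖x‖ < 1 := by
    rcases (show ‖x‖ ≤ 1 by simpa using hx).lt_or_eq with h | h
    · exact h
    · rw [hNe, h] at hNx; simp at hNx
  have hloc : IsLocalMax F x := by
    filter_upwards [isOpen_ball.mem_nhds (show x ∈ ball (0:ℂ) 1 by simpa using hx1)] with y hy
    exact hmax (ball_subset_closedBall hy)
  have ap : AnalyticAt ℂ p x := hp.analyticAt (hW.mem_nhds (hsub hx))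
  have ap1 : AnalyticAt ℂ (fun ζ => ζ * p ζ) x := analyticAt_id.mul ap
  have ap2 : AnalyticAt ℂ (fun ζ => ζ ^ 2 * p ζ) x := (analyticAt_id.pow 2).mul ap
  obtain ⟨s0, l0⟩ := Lam_norm_sq_comp ap
  obtain ⟨s1, l1⟩ := Lam_norm_sq_comp ap1
  obtain ⟨s2, l2⟩ := Lam_norm_sq_comp ap2
  have hdp := ap.differentiableAt.hasDerivAt
  have d1 : deriv (fun ζ => ζ * p ζ) x = p x + x * deriv p x := by
    have : HasDerivAt (fun ζ => ζ * p ζ) _ x := (hasDerivAt_id x).mul hdp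
    rw [this.deriv]; simp
  have d2 : deriv (fun ζ => ζ ^ 2 * p ζ) x = 2 * x * p x + x ^ 2 * deriv p x := by
    have : HasDerivAt (fun ζ => ζ ^ 2 * p ζ) _ x := (hasDerivAt_pow 2 x).mul hdp
    rw [this.deriv]; simp
  rw [d1] at l1
  rw [d2] at l2
  have s3 : ContDiffAt ℝ 2 (fun ζ => 1 * ‖p ζ‖ ^ 2 + (-2) * ‖ζ * p ζ‖ ^ 2) x :=
    (contDiffAt_const.mul s0).add (contDiffAt_const.mul s1)
  have s4 : ContDiffAt ℝ 2 N x := (contDiffAt_const.mul s3).add (contDiffAt_const.mul s2)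
  have s5 : ContDiffAt ℝ 2 F x := (contDiffAt_const.mul s4).add (contDiffAt_const.mul (hu x hx))
  have hL := Lam_nonpos s5 hloc 1
  rw [hF, Lam_add s4 (hu x hx), hN, Lam_add s3 s2, Lam_add s0 s1, l0, l1, l2] at hL
  have hb := bern_alg (p x) (deriv p x) x
  have hl := hlam x hx
  have : 9 / c * (c * ‖p x‖ ^ 2) ≤ 9 / c * Lam u x 1 := by gcongr
  have h9 : 9 / c * (c * ‖p x‖ ^ 2) = 9 * ‖p x‖ ^ 2 := by field_simp
  have : 0 < ‖p x‖ ^ 2 := by positivity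
  linarith

/-- Taylor to first order -/
lemma Dom.tay1 {n : ℕ} {Ω U : Set (Fin n → ℂ)} {r : (Fin n → ℂ) → ℝ} {ε c C d : ℝ} (D : Dom n Ω U r ε c C d) {z v}
    (hz : z ∈ Ω) (hv : ‖v‖ < d) (hv1 : ‖v‖ ≤ 1) : |r (z + v) - r z - fderiv ℝ r z v| ≤ 2 * C * ‖v‖ ^ 2 := by
  have h1 := D.tay z hz v hv
  have h2 := (fderiv ℝ (fderiv ℝ r) z).le_opNorm₂ v v
  rw [Real.norm_eq_abs] at h2
  have h3 := D.b2 z hz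
  have h4 : ‖fderiv ℝ (fderiv ℝ r) z‖ * ‖v‖ * ‖v‖ ≤ C * ‖v‖ * ‖v‖ := by gcongr
  have h5 : C * ‖v‖ ^ 3 ≤ C * ‖v‖ ^ 2 := by
    have := D.hC
    apply mul_le_mul_of_nonneg_left _ (by linarith)
    nlinarith [sq_nonneg ‖v‖]
  have : r (z + v) - r z - fderiv ℝ r z v = (r (z + v) - r z - fderiv ℝ r z v - fderiv ℝ (fderiv ℝ r) z v v / 2) + fderiv ℝ (fderiv ℝ r) z v v / 2 := by ring
  rw [this]
  refine (abs_add_le _ _).trans ?_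
  rw [abs_div, abs_two]
  have : 0 ≤ C * ‖v‖ ^ 2 := by have := D.hC; positivity
  nlinarith

section
variable {n : ℕ} {Ω₁ U₁ Ω₂ U₂ : Set (Fin n → ℂ)} {r₁ r₂ : (Fin n → ℂ) → ℝ} {φ : (Fin n → ℂ) → (Fin n → ℂ)}
    {ε₁ ε₂ c C d : ℝ}

lemma HM.bern_disc (H : HM n Ω₁ U₁ Ω₂ U₂ r₁ r₂ φ ε₁ ε₂ c C d) {a v : Fin n → ℂ} {R : ℝ} (hR : 0 < R)
    (hd : ∀ ζ : ℂ, ‖ζ‖ ≤ R → a + ζ • v ∈ Ω₁ ∧ -ε₁ ≤ r₁ (a + ζ • v)) :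
    (R * ‖fderiv ℂ φ a v‖) ^ 2 ≤ 9 * C / c * (- r₁ a) := by
  have hc := H.D₁.hc
  have hC := H.D₁.hC
  have ha : a ∈ Ω₁ := by simpa using (hd 0 (by simpa using hR.le)).1
  have hrn := H.D₁.neg ha
  set B := 9 * C / c * (- r₁ a) with hB
  have hB0 : 0 ≤ B := by
    have : 0 ≤ - r₁ a := by linarith
    positivity
  set v' : Fin n → ℂ := (R : ℂ) • v with hv'
  have hin : ∀ ζ ∈ closedBall (0:ℂ) 1, a + ζ • v' ∈ Ω₁ ∧ -ε₁ ≤ r₁ (a + ζ • v') := by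
    intro ζ hζ
    have hζ1 : ‖ζ‖ ≤ 1 := by simpa using hζ
    have := hd (ζ * R) (by rw [norm_mul, Complex.norm_real, Real.norm_of_nonneg hR.le]; nlinarith)
    rwa [hv', smul_smul]
  obtain ⟨oW, dW⟩ := slice_diffOn H.D₁.isOpen H.hol a v'
  set W := {ζ : ℂ | a + ζ • v' ∈ Ω₁}
  set f : ℂ → Fin n → ℂ := fun ζ => φ (a + ζ • v') with hf
  have hdf : DifferentiableOn ℂ (deriv f) W := dW.deriv oW
  have key : ∀ j, ‖(deriv f 0) j‖ ^ 2 ≤ B := by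
    intro j
    have := bern (p := fun ζ => deriv f ζ j) (u := fun ζ => r₂ (f ζ)) oW (fun ζ hζ => (hin ζ hζ).1)
      (differentiableOn_pi.mp hdf j) (c := c) (fun ζ hζ => ?_) (fun ζ hζ => (H.D₂.neg (H.maps _ (hin ζ hζ).1)).le) hc ?_
    · refine this.trans ?_
      have h1 := H.hopf2 a ha
      simp only [hf, zero_smul, add_zero]
      have : 9 / c * (-r₂ (φ a)) ≤ 9 / c * (C * (- r₁ a)) := by gcongr
      refine this.trans (le_of_eq ?_)
      rw [hB]; ring
    · exact (Lam_comp (dW.analyticAt (oW.mem_nhds (hin ζ hζ).1)) (H.D₂.smooth2 (H.maps _ (hin ζ hζ).1))).1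
    · intro ζ hζ
      rw [(Lam_comp (dW.analyticAt (oW.mem_nhds (hin ζ hζ).1)) (H.D₂.smooth2 (H.maps _ (hin ζ hζ).1))).2.1]
      refine le_trans ?_ (H.D₂.lam _ (H.maps _ (hin ζ hζ).1) (H.strip _ (hin ζ hζ).1 (hin ζ hζ).2) _)
      have := norm_le_pi_norm (deriv f ζ) j
      gcongr
  have h1 : deriv f 0 = fderiv ℂ φ a v' := slice_deriv0 (H.hol.differentiableAt (H.D₁.isOpen.mem_nhds ha))
  have h2 : ‖fderiv ℂ φ a v'‖ = R * ‖fderiv ℂ φ a v‖ := by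
    rw [hv', map_smul, norm_smul, Complex.norm_real, Real.norm_of_nonneg hR.le]
  rw [← h2, ← h1]
  have : ‖deriv f 0‖ ≤ Real.sqrt B := by
    rw [pi_norm_le_iff_of_nonneg (Real.sqrt_nonneg _)]
    intro j
    exact Real.le_sqrt_of_sq_le (key j)
  calc ‖deriv f 0‖ ^ 2 ≤ Real.sqrt B ^ 2 := by gcongr
    _ = B := Real.sq_sqrt hB0

end
end

section
set_option maxSynthPendingDepth 3

section
variable {n : ℕ} {Ω₁ U₁ Ω₂ U₂ : Set (Fin n → ℂ)} {r₁ r₂ : (Fin n → ℂ) → ℝ} {φ : (Fin n → ℂ) → (Fin n → ℂ)}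
    {ε₁ ε₂ c C d : ℝ}

lemma abs_le_of_sq_le_sq_aux {x y : ℝ} (h : x ^ 2 ≤ y ^ 2) (hy : 0 ≤ y) : x ≤ y := by
  nlinarith

/-- derivative at the centre of a function with bounded real part -/
lemma bc_deriv {g : ℂ → ℂ} {R M : ℝ} (hR : 0 < R) (hM : 0 < M) (hg : DifferentiableOn ℂ g (ball 0 R)) (h0 : g 0 = 0)
    (hre : ∀ ζ ∈ ball (0:ℂ) R, (g ζ).re ≤ M) : ‖deriv g 0‖ ≤ 4 * M / R := by
  have h1 : ∀ ζ ∈ sphere (0:ℂ) (R / 2), ‖g ζ‖ ≤ 2 * M := by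
    intro ζ hζ
    have hz : ‖ζ‖ = R / 2 := by simpa using hζ
    have := borelCaratheodory_zero hM hg hre hR (z := ζ) (by simp [hz]; linarith) h0
    rw [hz] at this
    refine this.trans (le_of_eq ?_)
    field_simp
    ring
  have h2 : DiffContOnCl ℂ g (ball 0 (R / 2)) := by
    apply DifferentiableOn.diffContOnCl
    rw [closure_ball _ (by positivity)]
    exact hg.mono (closedBall_subset_ball (by linarith))
  have := norm_deriv_le_of_forall_mem_sphere_norm_le (by positivity) h2 h1
  refine this.trans (le_of_eq ?_)
  field_simp
  ring

lemma HM.disc_est (H : HM n Ω₁ U₁ Ω₂ U₂ r₁ r₂ φ ε₁ ε₂ c C d) : ∃ B ≥ 1, ∃ δ₁ > 0, ∀ (a v : Fin n → ℂ) (R : ℝ), 0 < R →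
    (∀ ζ : ℂ, ‖ζ‖ ≤ R → a + ζ • v ∈ Ω₁ ∧ -ε₁ ≤ r₁ (a + ζ • v) ∧ - r₁ (a + ζ • v) ≤ 2 * (- r₁ a)) → - r₁ a ≤ δ₁ →
    R * ‖fderiv ℂ φ a v‖ ≤ B * Real.sqrt (- r₁ a) ∧ R * ‖ell r₂ (φ a) (fderiv ℂ φ a v)‖ ≤ B * (- r₁ a) := by
  have hc := H.D₁.hc
  have hC := H.D₁.hC
  have hd0 := H.D₁.hd
  set A := 2 * (9 * C / c) with hA
  have hA0 : 0 < A := by positivity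
  set G := Real.sqrt A with hG
  have hG0 : 0 < G := Real.sqrt_pos.mpr hA0
  have hG2 : G ^ 2 = A := Real.sq_sqrt hA0.le
  set M := C + 2 * C * A with hM
  have hM0 : 0 < M := by positivity
  set q := min d 1 / (2 * G) with hq
  have hq0 : 0 < q := by positivity
  refine ⟨max (max 1 G) (8 * M), le_trans (le_max_left _ _) (le_max_left _ _), q ^ 2, by positivity, ?_⟩
  intro a v R hR hdisc hδ
  set δ := - r₁ a with hδd
  have ha : a ∈ Ω₁ := by simpa using (hdisc 0 (by simpa using hR.le)).1
  have hδ0 : 0 < δ := by have := H.D₁.neg ha; linarith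
  set s := Real.sqrt δ with hs
  have hs0 : 0 < s := Real.sqrt_pos.mpr hδ0
  have hs2 : s ^ 2 = δ := Real.sq_sqrt hδ0.le
  have hsq : s ≤ q := by
    rw [hs, Real.sqrt_le_left hq0.le]; exact hδ
  -- derivative bounds on the half disc
  have hder : ∀ ζ : ℂ, ‖ζ‖ ≤ R / 2 → R / 2 * ‖fderiv ℂ φ (a + ζ • v) v‖ ≤ G * s := by
    intro ζ hζ
    have := H.bern_disc (a := a + ζ • v) (v := v) (R := R / 2) (by positivity) (fun ξ hξ => by
      have hh := hdisc (ζ + ξ) ((norm_add_le _ _).trans (by linarith))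
      rw [add_smul, ← add_assoc] at hh
      exact ⟨hh.1, hh.2.1⟩)
    have h2 := (hdisc ζ (by linarith)).2.2
    have h3 : (R / 2 * ‖fderiv ℂ φ (a + ζ • v) v‖) ^ 2 ≤ (G * s) ^ 2 := by
      rw [mul_pow G, hG2, hs2]
      refine this.trans ?_
      have : 9 * C / c * -r₁ (a + ζ • v) ≤ 9 * C / c * (2 * δ) := by gcongr
      refine this.trans (le_of_eq ?_)
      rw [hA]; ring
    exact abs_le_of_sq_le_sq_aux h3 (by positivity)
  constructor
  · have h1 := H.bern_disc hR (fun ζ hζ => ⟨(hdisc ζ hζ).1, (hdisc ζ hζ).2.1⟩)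
    have h3 : (R * ‖fderiv ℂ φ a v‖) ^ 2 ≤ (G * s) ^ 2 := by
      rw [mul_pow G, hG2, hs2]
      refine h1.trans ?_
      rw [← hδd, hA]
      have : 0 ≤ 9 * C / c * δ := by positivity
      linarith
    refine (abs_le_of_sq_le_sq_aux h3 (by positivity)).trans ?_
    have : G ≤ max (max 1 G) (8 * M) := (le_max_right _ _).trans (le_max_left _ _)
    gcongr
  · obtain ⟨oW, dW⟩ := slice_diffOn H.D₁.isOpen H.hol a v
    set f : ℂ → Fin n → ℂ := fun ζ => φ (a + ζ • v) with hf
    have hsubW : ball (0:ℂ) (R / 2) ⊆ {ζ : ℂ | a + ζ • v ∈ Ω₁} := fun ζ hζ =>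
      (hdisc ζ (by have : ‖ζ‖ < R / 2 := by simpa using hζ
                   linarith)).1
    have hfn : ∀ ζ ∈ ball (0:ℂ) (R / 2), ‖f ζ - f 0‖ ≤ G * s := by
      intro ζ hζ
      have hζ' : ‖ζ‖ < R / 2 := by simpa using hζ
      have := (convex_ball (0:ℂ) (R / 2)).norm_image_sub_le_of_norm_deriv_le (𝕜 := ℂ) (f := f) (C := G * s / (R / 2)) (fun x hx =>
        dW.differentiableAt (oW.mem_nhds (hsubW hx))) (fun x hx => by
          have hx' : ‖x‖ < R / 2 := by simpa using hx
          have h1 : deriv f x = fderiv ℂ φ (a + x • v) v :=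
            (slice_hasDerivAt (H.hol.differentiableAt (H.D₁.isOpen.mem_nhds (hsubW hx)))).deriv
          rw [h1, le_div_iff₀ (by positivity), mul_comm]
          exact hder x hx'.le) (x := 0) (y := ζ) (by simp; linarith) hζ
      refine this.trans ?_
      rw [sub_zero, div_mul_eq_mul_div, div_le_iff₀ (by positivity)]
      gcongr
    have hf0 : f 0 = φ a := by simp [hf]
    set g : ℂ → ℂ := fun ζ => ellL r₂ (φ a) (f ζ - φ a) with hg
    have hgd : DifferentiableOn ℂ g (ball 0 (R / 2)) := by
      intro ζ hζ
      have h1 : DifferentiableAt ℂ f ζ := dW.differentiableAt (oW.mem_nhds (hsubW hζ))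
      have h2 : DifferentiableAt ℂ (fun ζ => f ζ - φ a) ζ := h1.sub_const _
      exact (((ellL r₂ (φ a)).toContinuousLinearMap.differentiableAt).comp ζ h2).differentiableWithinAt
    have hg0 : g 0 = 0 := by simp [hg, hf0]
    have hre : ∀ ζ ∈ ball (0:ℂ) (R / 2), (g ζ).re ≤ M * δ := by
      intro ζ hζ
      have h1 := hfn ζ hζ
      rw [hf0] at h1
      have hGs : G * s ≤ min d 1 / 2 := by
        calc G * s ≤ G * q := by gcongr
          _ = min d 1 / 2 := by rw [hq]; field_simp
      have hm1 := min_le_left d 1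
      have hm2 := min_le_right d 1
      have hm3 : 0 < min d 1 := by positivity
      have h2 := H.D₂.tay1 (H.maps a ha) (v := f ζ - φ a) (by linarith) (by linarith)
      rw [add_sub_cancel] at h2
      have h3 : r₂ (f ζ) < 0 := H.D₂.neg (H.maps _ (hsubW hζ))
      have h4 := H.hopf2 a ha
      have h5 : 2 * (g ζ).re = fderiv ℝ r₂ (φ a) (f ζ - φ a) := ell_re _ _ _
      have h6 : 2 * C * ‖f ζ - φ a‖ ^ 2 ≤ 2 * C * (A * δ) := by
        rw [← hG2, ← hs2, ← mul_pow]; gcongr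
      have h7 := (abs_le.mp h2).1
      have h8 : 0 ≤ C * δ := by positivity
      have h9 : 0 ≤ 2 * C * A * δ := by positivity
      rw [hM]
      nlinarith
    have hder0 : deriv g 0 = ell r₂ (φ a) (fderiv ℂ φ a v) := by
      have h1 : HasDerivAt (fun ζ => f ζ - φ a) (fderiv ℂ φ a v) 0 := by
        have : HasDerivAt f _ 0 := slice_hasDerivAt (z := a) (v := v) (ζ := 0) (f := φ) (by simpa using H.hol.differentiableAt (H.D₁.isOpen.mem_nhds ha))
        simpa using this.sub_const (φ a)
      exact ((ellL r₂ (φ a)).toContinuousLinearMap.hasFDerivAt.comp_hasDerivAt (0:ℂ) h1).deriv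
    have := bc_deriv (R := R / 2) (by positivity) (M := M * δ) (by positivity) hgd hg0 hre
    rw [hder0, le_div_iff₀ (by positivity)] at this
    have h9 : R * ‖ell r₂ (φ a) (fderiv ℂ φ a v)‖ ≤ 8 * M * δ := by linarith
    refine h9.trans ?_
    have : 8 * M ≤ max (max 1 G) (8 * M) := le_max_right _ _
    gcongr

/-- the basic size estimates for the derivative -/
lemma HM.est (H : HM n Ω₁ U₁ Ω₂ U₂ r₁ r₂ φ ε₁ ε₂ c C d) : ∃ B ≥ 1, ∃ δ₁ > 0, δ₁ ≤ ε₁ ∧ δ₁ ≤ 1 ∧ ∀ a ∈ Ω₁, - r₁ a ≤ δ₁ → ∀ v,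
    (ell r₁ a v = 0 → ‖fderiv ℂ φ a v‖ ≤ B * ‖v‖ ∧ ‖ell r₂ (φ a) (fderiv ℂ φ a v)‖ ≤ B * Real.sqrt (- r₁ a) * ‖v‖) ∧
    (Real.sqrt (- r₁ a) * ‖fderiv ℂ φ a v‖ ≤ B * ‖v‖ ∧ ‖ell r₂ (φ a) (fderiv ℂ φ a v)‖ ≤ B * ‖v‖) := by
  obtain ⟨B, hB, δ₀, hδ₀, hest⟩ := H.disc_est
  have hc := H.D₁.hc
  have hC := H.D₁.hC
  have hd0 := H.D₁.hd
  have hε := H.D₁.hε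
  set k := min d 1 / (8 * C) with hk
  have hk0 : 0 < k := by positivity
  have hm1 := min_le_left d 1
  have hm2 := min_le_right d 1
  have hm3 : 0 < min d 1 := by positivity
  have hkC : 8 * C * k = min d 1 := by rw [hk]; field_simp
  have hk1 : k ≤ 1 := by nlinarith
  have hkd : k < min d 1 := by nlinarith
  refine ⟨B / k, by rw [ge_iff_le, le_div_iff₀ hk0]; linarith, min (min δ₀ (ε₁ / 2)) 1, by positivity, ?_, min_le_right _ _, ?_⟩
  · exact (min_le_left _ _).trans ((min_le_right _ _).trans (by linarith))
  intro a ha hδ v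
  set δ := - r₁ a with hδd
  have hδ0 : 0 < δ := by have := H.D₁.neg ha; linarith
  have hδ1 : δ ≤ δ₀ := hδ.trans ((min_le_left _ _).trans (min_le_left _ _))
  have hδ2 : δ ≤ ε₁ / 2 := hδ.trans ((min_le_left _ _).trans (min_le_right _ _))
  have hδ3 : δ ≤ 1 := hδ.trans (min_le_right _ _)
  set s := Real.sqrt δ with hs
  have hs0 : 0 < s := Real.sqrt_pos.mpr hδ0
  have hs2 : s ^ 2 = δ := Real.sq_sqrt hδ0.le
  have hs1 : s ≤ 1 := Real.sqrt_le_one.mpr hδ3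
  by_cases hv : v = 0
  · simp [hv, ell]
  have hv0 : 0 < ‖v‖ := norm_pos_iff.mpr hv
  have gen : ∀ ζ : ℂ, ‖ζ • v‖ ≤ k → |r₁ (a + ζ • v) - r₁ a| ≤ δ / 2 →
      a + ζ • v ∈ Ω₁ ∧ -ε₁ ≤ r₁ (a + ζ • v) ∧ - r₁ (a + ζ • v) ≤ 2 * (- r₁ a) := by
    intro ζ h1 h2
    have h3 := abs_le.mp h2
    refine ⟨H.D₁.mem ha (by linarith) (by linarith), by linarith, by linarith⟩
  constructor
  · intro hl
    have hdisc : ∀ ζ : ℂ, ‖ζ‖ ≤ k * s / ‖v‖ →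
        a + ζ • v ∈ Ω₁ ∧ -ε₁ ≤ r₁ (a + ζ • v) ∧ - r₁ (a + ζ • v) ≤ 2 * (- r₁ a) := by
      intro ζ hζ
      have h1 : ‖ζ • v‖ ≤ k * s := by rw [norm_smul]; rwa [le_div_iff₀ hv0] at hζ
      have h1' : ‖ζ • v‖ ≤ k := by nlinarith
      refine gen ζ h1' ?_
      have h2 := H.D₁.tay1 ha (v := ζ • v) (by linarith) (by linarith)
      have h3 : fderiv ℝ r₁ a (ζ • v) = 0 := by rw [← ell_re, ell_smul, hl]; simp
      rw [h3, sub_zero] at h2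
      refine h2.trans ?_
      calc 2 * C * ‖ζ • v‖ ^ 2 ≤ 2 * C * (k * s) ^ 2 := by gcongr
        _ = (8 * C * k) * k * δ / 4 := by rw [mul_pow, hs2]; ring
        _ ≤ δ / 2 := by
          rw [hkC]
          have : min d 1 * k ≤ 1 := by nlinarith
          nlinarith
    obtain ⟨e1, e2⟩ := hest a v (k * s / ‖v‖) (by positivity) hdisc hδ1
    rw [← hδd] at e1 e2
    rw [div_mul_eq_mul_div, div_le_iff₀ hv0] at e1 e2
    constructor
    · rw [div_mul_eq_mul_div, le_div_iff₀ hk0]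
      rw [← mul_le_mul_iff_right₀ hs0]
      linarith
    · rw [div_mul_eq_mul_div, div_mul_eq_mul_div, le_div_iff₀ hk0]
      rw [← mul_le_mul_iff_right₀ hs0]
      have : s * (B * s * ‖v‖) = B * δ * ‖v‖ := by rw [← hs2]; ring
      rw [this]
      linarith
  · have hdisc : ∀ ζ : ℂ, ‖ζ‖ ≤ k * δ / ‖v‖ →
        a + ζ • v ∈ Ω₁ ∧ -ε₁ ≤ r₁ (a + ζ • v) ∧ - r₁ (a + ζ • v) ≤ 2 * (- r₁ a) := by
      intro ζ hζ
      have h1 : ‖ζ • v‖ ≤ k * δ := by rw [norm_smul]; rwa [le_div_iff₀ hv0] at hζ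
      have h1' : ‖ζ • v‖ ≤ k := by nlinarith
      refine gen ζ h1' ?_
      have h2 := abs_le.mp (H.D₁.tay1 ha (v := ζ • v) (by linarith) (by linarith))
      have h3 := abs_le.mp ((fderiv ℝ r₁ a).le_opNorm (ζ • v))
      have h4 : ‖fderiv ℝ r₁ a‖ * ‖ζ • v‖ ≤ C * (k * δ) := by
        have := H.D₁.b1 a ha
        gcongr
      have h5 : 2 * C * ‖ζ • v‖ ^ 2 ≤ 2 * C * (k * δ) := by
        have : ‖ζ • v‖ ^ 2 ≤ k * δ := by nlinarith [norm_nonneg (ζ • v)]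
        gcongr
      have h6 : 3 * C * (k * δ) ≤ δ / 2 := by
        have : 3 * C * (k * δ) = 3 / 8 * (8 * C * k) * δ := by ring
        rw [this, hkC]; nlinarith
      rw [abs_le]
      constructor <;> linarith [h2.1, h2.2, h3.1, h3.2]
    obtain ⟨e1, e2⟩ := hest a v (k * δ / ‖v‖) (by positivity) hdisc hδ1
    rw [← hδd] at e1 e2
    rw [div_mul_eq_mul_div, div_le_iff₀ hv0] at e1 e2
    constructor
    · rw [div_mul_eq_mul_div, le_div_iff₀ hk0]
      rw [← mul_le_mul_iff_right₀ hs0]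
      have : s * (s * ‖fderiv ℂ φ a v‖ * k) = k * δ * ‖fderiv ℂ φ a v‖ := by rw [← hs2]; ring
      rw [this]; linarith
    · rw [div_mul_eq_mul_div, le_div_iff₀ hk0]
      rw [← mul_le_mul_iff_right₀ hδ0]
      linarith

end
end

section
set_option maxSynthPendingDepth 3

lemma det_bound {n : ℕ} {M : Matrix (Fin n) (Fin n) ℂ} {B : ℝ} {s t : Fin n → ℝ}
    (h : ∀ i j, ‖M i j‖ ≤ B * s i * t j) : ‖M.det‖ ≤ n.factorial * (B ^ n * (∏ i, s i) * ∏ i, t i) := by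
  rw [Matrix.det_apply']
  refine (norm_sum_le _ _).trans ?_
  have : ∀ σ ∈ (Finset.univ : Finset (Equiv.Perm (Fin n))), ‖((Equiv.Perm.sign σ : ℤ) : ℂ) * ∏ i, M (σ i) i‖ ≤ B ^ n * (∏ i, s i) * ∏ i, t i := by
    intro σ _
    rw [norm_mul, norm_prod]
    have h1 : ‖((Equiv.Perm.sign σ : ℤ) : ℂ)‖ = 1 := by
      rcases Int.units_eq_one_or (Equiv.Perm.sign σ) with h | h <;> simp [h]
    rw [h1, one_mul]
    calc ∏ i, ‖M (σ i) i‖ ≤ ∏ i, (B * s (σ i) * t i) := Finset.prod_le_prod (fun _ _ => norm_nonneg _) (fun i _ => h _ _)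
      _ = _ := by
        rw [Finset.prod_mul_distrib, Finset.prod_mul_distrib, Equiv.prod_comp σ s]
        simp
  refine (Finset.sum_le_sum this).trans (le_of_eq ?_)
  simp [Fintype.card_perm]

lemma det_upd {n : ℕ} (k : Fin n) (u : Fin n → ℂ) : ((1 : Matrix (Fin n) (Fin n) ℂ).updateRow k u).det = u k := by
  rw [← Matrix.cramer_transpose_apply, Matrix.transpose_one, Matrix.cramer_one]
  rfl

lemma adj_bound {n : ℕ} {M : Matrix (Fin n) (Fin n) ℂ} {B s : ℝ} {k l : Fin n} (hB : 1 ≤ B) (hs : 0 < s) (hs1 : s ≤ 1)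
    (h : ∀ i j, ‖M i j‖ ≤ B * (if i = l then s else 1) * (if j = k then s⁻¹ else 1)) :
    ‖M.det‖ ≤ n.factorial * B ^ n ∧ ∀ i j, ‖M.adjugate i j‖ ≤ n.factorial * B ^ n * s⁻¹ := by
  have hs' : 1 ≤ s⁻¹ := (one_le_inv₀ hs).mpr hs1
  constructor
  · refine (det_bound (s := fun i => if i = l then s else 1) (t := fun j => if j = k then s⁻¹ else 1) h).trans (le_of_eq ?_)
    rw [Finset.prod_ite_eq', Finset.prod_ite_eq']
    simp only [Finset.mem_univ, if_true]
    field_simp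
  · intro i j
    rw [Matrix.adjugate_apply]
    refine (det_bound (B := B) (s := fun _ => 1) (t := fun j => if j = k then s⁻¹ else 1) ?_).trans (le_of_eq ?_)
    · intro i' j'
      have ht : 1 ≤ (if j' = k then s⁻¹ else 1) := by split_ifs <;> linarith
      by_cases hij : i' = j
      · subst hij
        rw [Matrix.updateRow_self]
        have : ‖(Pi.single i 1 : Fin n → ℂ) j'‖ ≤ 1 := by
          rw [Pi.single_apply]; split_ifs <;> simp
        nlinarith
      · rw [Matrix.updateRow_ne hij]
        refine (h i' j').trans ?_
        have : (if i' = l then s else 1) ≤ 1 := by split_ifs <;> linarith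
        gcongr
    · rw [Finset.prod_ite_eq']
      simp
      ring

lemma mat_est {n : ℕ} {A : Matrix (Fin n) (Fin n) ℂ} {u w : Fin n → ℂ} {k l : Fin n} {B L s c : ℝ} (hB : 1 ≤ B) (hL : 1 ≤ L) (hs : 0 < s) (hs1 : s ≤ 1)
    (hc : 0 < c) (hu : u k = 1) (huL : ∀ j, ‖u j‖ ≤ L) (hw : c ≤ ‖w l‖) (hwL : ∀ j, ‖w j‖ ≤ L)
    (h : ∀ i j, ‖((1 : Matrix (Fin n) (Fin n) ℂ).updateRow l w * (A * (1 : Matrix (Fin n) (Fin n) ℂ).updateRow k u)) i j‖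
      ≤ B * (if i = l then s else 1) * (if j = k then s⁻¹ else 1)) :
    ‖A.det‖ ≤ n.factorial * B ^ n / c ∧ ∀ i j, ‖A.adjugate i j‖ ≤ n * (n * (L * (n.factorial * B ^ n * s⁻¹)) * L) / c := by
  set T₁ := (1 : Matrix (Fin n) (Fin n) ℂ).updateRow k u with hT₁
  set T₂ := (1 : Matrix (Fin n) (Fin n) ℂ).updateRow l w with hT₂
  have d1 : T₁.det = 1 := by rw [hT₁, det_upd, hu]
  have d2 : T₂.det = w l := by rw [hT₂, det_upd]
  obtain ⟨h1, h2⟩ := adj_bound hB hs hs1 h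
  have b1 : ∀ i j, ‖T₁ i j‖ ≤ L := by
    intro i j
    by_cases hi : i = k
    · subst hi; rw [hT₁, Matrix.updateRow_self]; exact huL j
    · rw [hT₁, Matrix.updateRow_ne hi, Matrix.one_apply]; split_ifs <;> simp <;> linarith
  have b2 : ∀ i j, ‖T₂ i j‖ ≤ L := by
    intro i j
    by_cases hi : i = l
    · subst hi; rw [hT₂, Matrix.updateRow_self]; exact hwL j
    · rw [hT₂, Matrix.updateRow_ne hi, Matrix.one_apply]; split_ifs <;> simp <;> linarith
  constructor
  · rw [le_div_iff₀ hc]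
    rw [Matrix.det_mul, Matrix.det_mul, d1, d2, mul_one, norm_mul, mul_comm] at h1
    refine le_trans ?_ h1
    gcongr
  · intro i j
    have key : T₁ * (T₂ * (A * T₁)).adjugate * T₂ = (w l) • A.adjugate := by
      rw [Matrix.adjugate_mul_distrib, Matrix.adjugate_mul_distrib]
      calc T₁ * (T₁.adjugate * A.adjugate * T₂.adjugate) * T₂ = (T₁ * T₁.adjugate) * A.adjugate * (T₂.adjugate * T₂) := by
            simp only [Matrix.mul_assoc]
        _ = _ := by rw [Matrix.mul_adjugate, Matrix.adjugate_mul, d1, d2]; simp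
    have e := congrFun (congrFun key i) j
    rw [Matrix.smul_apply, smul_eq_mul] at e
    rw [le_div_iff₀ hc]
    have : ‖A.adjugate i j‖ * c ≤ ‖w l * A.adjugate i j‖ := by rw [norm_mul, mul_comm]; gcongr
    refine this.trans ?_
    rw [← e, Matrix.mul_apply]
    have hX : 0 ≤ (n.factorial : ℝ) * B ^ n * s⁻¹ := by positivity
    refine (norm_sum_le _ _).trans ?_
    have : ∀ y ∈ (Finset.univ : Finset (Fin n)), ‖(T₁ * (T₂ * (A * T₁)).adjugate) i y * T₂ y j‖ ≤ (n * (L * (n.factorial * B ^ n * s⁻¹)) * L) := by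
      intro y _
      rw [norm_mul]
      refine mul_le_mul ?_ (b2 _ _) (norm_nonneg _) (by positivity)
      rw [Matrix.mul_apply]
      refine (norm_sum_le _ _).trans ?_
      have : ∀ x ∈ (Finset.univ : Finset (Fin n)), ‖T₁ i x * (T₂ * (A * T₁)).adjugate x y‖ ≤ L * (n.factorial * B ^ n * s⁻¹) := by
        intro x _
        rw [norm_mul]
        exact mul_le_mul (b1 _ _) (h2 _ _) (norm_nonneg _) (by linarith)
      refine (Finset.sum_le_sum this).trans (le_of_eq ?_)
      simp
    refine (Finset.sum_le_sum this).trans (le_of_eq ?_)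
    simp

/-- the complex Jacobian matrix -/
def Am {n : ℕ} (φ : (Fin n → ℂ) → (Fin n → ℂ)) (z : Fin n → ℂ) : Matrix (Fin n) (Fin n) ℂ :=
  Matrix.of fun i j => fderiv ℂ φ z (Pi.single j 1) i

lemma Am_hol {n : ℕ} {φ : (Fin n → ℂ) → (Fin n → ℂ)} {W : Set (Fin n → ℂ)} (hW : IsOpen W) (hφ : DifferentiableOn ℂ φ W) (i j : Fin n) :
    DifferentiableOn ℂ (fun z => Am φ z i j) W := by
  have := hol_partial hW (differentiableOn_pi.mp hφ i) (Pi.single j 1)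
  refine this.congr fun z hz => ?_
  have h := hφ.differentiableAt (hW.mem_nhds hz)
  simp only [Am, Matrix.of_apply]
  rw [(hasFDerivAt_pi'.mp h.hasFDerivAt i).fderiv]
  rfl

lemma det_hol {n : ℕ} {A : (Fin n → ℂ) → Matrix (Fin n) (Fin n) ℂ} {W : Set (Fin n → ℂ)}
    (hA : ∀ i j, DifferentiableOn ℂ (fun z => A z i j) W) : DifferentiableOn ℂ (fun z => (A z).det) W := by
  simp only [Matrix.det_apply']
  refine DifferentiableOn.fun_sum fun σ _ => ?_
  refine DifferentiableOn.const_mul ?_ _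
  intro z hz
  exact (HasFDerivWithinAt.finsetProd (u := Finset.univ) (g := fun i z => A z (σ i) i)
    fun i _ => (hA (σ i) i z hz).hasFDerivWithinAt).differentiableWithinAt

lemma adj_hol {n : ℕ} {A : (Fin n → ℂ) → Matrix (Fin n) (Fin n) ℂ} {W : Set (Fin n → ℂ)}
    (hA : ∀ i j, DifferentiableOn ℂ (fun z => A z i j) W) (i j : Fin n) : DifferentiableOn ℂ (fun z => (A z).adjugate i j) W := by
  simp only [Matrix.adjugate_apply]
  refine det_hol fun i' j' => ?_
  by_cases h : i' = j
  · subst h; simp only [Matrix.updateRow_self]; exact differentiableOn_const _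
  · simp only [Matrix.updateRow_ne h]; exact hA _ _

section
variable {n : ℕ} {Ω₁ U₁ Ω₂ U₂ : Set (Fin n → ℂ)} {r₁ r₂ : (Fin n → ℂ) → ℝ} {φ : (Fin n → ℂ) → (Fin n → ℂ)}
    {ε₁ ε₂ c C d : ℝ}

lemma HM.jac_near (H : HM n Ω₁ U₁ Ω₂ U₂ r₁ r₂ φ ε₁ ε₂ c C d) : ∃ B ≥ 0, ∃ δ₁ > 0, ∀ a ∈ Ω₁, - r₁ a ≤ δ₁ →
    ‖(Am φ a).det‖ ≤ B ∧ ∀ i j, (- r₁ a) * ‖(Am φ a).adjugate i j‖ ≤ B := by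
  obtain ⟨B, hB, δ₁, hδ₁, hδε, hδ1, hest⟩ := H.est
  have hc := H.D₁.hc
  have hc1 := H.D₁.hc1
  have hC := H.D₁.hC
  set c' := c / (4 * (n + 1)) with hc'
  have hc'0 : 0 < c' := by positivity
  have hc'1 : c' ≤ 1 := by
    rw [hc', div_le_one (by positivity)]
    have : (0:ℝ) ≤ n := by positivity
    linarith
  set L := C / c' with hL
  have hL1 : 1 ≤ L := by rw [hL, le_div_iff₀ hc'0]; linarith
  have hLC : C ≤ L := by rw [hL, le_div_iff₀ hc'0]; nlinarith
  set B' := B * L with hB'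
  have hB1 : 1 ≤ B' := by nlinarith
  refine ⟨max (n.factorial * B' ^ n / c') (n * (n * (L * (n.factorial * B' ^ n)) * L) / c'), le_max_of_le_left (by positivity), δ₁, hδ₁, ?_⟩
  intro a ha hδ
  set δ := - r₁ a with hδd
  have hδ0 : 0 < δ := by have := H.D₁.neg ha; linarith
  set s := Real.sqrt δ with hs
  have hs0 : 0 < s := Real.sqrt_pos.mpr hδ0
  have hs2 : s ^ 2 = δ := Real.sq_sqrt hδ0.le
  have hs1 : s ≤ 1 := Real.sqrt_le_one.mpr (by linarith)
  have hstrip : -ε₁ ≤ r₁ a := by linarith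
  obtain ⟨k, hk⟩ := H.D₁.exists_k ha hstrip
  obtain ⟨l, hl⟩ := H.D₂.exists_k (H.maps a ha) (H.strip a ha hstrip)
  have hk0 : ell r₁ a (Pi.single k 1) ≠ 0 := by rw [← norm_pos_iff]; linarith
  set u : Fin n → ℂ := fun j => if j = k then 1 else - ell r₁ a (Pi.single j 1) / ell r₁ a (Pi.single k 1) with hu
  set w : Fin n → ℂ := fun j => ell r₂ (φ a) (Pi.single j 1) with hw
  have hsing : ∀ j : Fin n, ‖(Pi.single j 1 : Fin n → ℂ)‖ ≤ 1 := by
    intro j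
    rw [pi_norm_le_iff_of_nonneg zero_le_one]
    intro i; rw [Pi.single_apply]; split_ifs <;> simp
  have huL : ∀ j, ‖u j‖ ≤ L := by
    intro j
    simp only [hu]
    split_ifs with h
    · simpa using hL1
    · rw [norm_div, norm_neg, hL]
      have h1 := (norm_ell_le r₁ a (Pi.single j 1)).trans (mul_le_mul (H.D₁.b1 a ha) (hsing j) (norm_nonneg _) (by linarith))
      rw [mul_one] at h1
      gcongr
  have hwL : ∀ j, ‖w j‖ ≤ L := by
    intro j
    have h1 := (norm_ell_le r₂ (φ a) (Pi.single j 1)).trans (mul_le_mul (H.D₂.b1 _ (H.maps a ha)) (hsing j) (norm_nonneg _) (by linarith))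
    rw [mul_one] at h1
    exact h1.trans hLC
  set T₁ := (1 : Matrix (Fin n) (Fin n) ℂ).updateRow k u with hT₁
  set T₂ := (1 : Matrix (Fin n) (Fin n) ℂ).updateRow l w with hT₂
  -- columns
  set V : Fin n → Fin n → ℂ := fun j i => T₁ i j with hV
  have hVn : ∀ j, ‖V j‖ ≤ L := by
    intro j
    rw [pi_norm_le_iff_of_nonneg (by linarith)]
    intro i
    simp only [hV]
    by_cases hi : i = k
    · subst hi; rw [hT₁, Matrix.updateRow_self]; exact huL j
    · rw [hT₁, Matrix.updateRow_ne hi, Matrix.one_apply]; split_ifs <;> simp <;> linarith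
  have hVell : ∀ j, j ≠ k → ell r₁ a (V j) = 0 := by
    intro j hj
    rw [ell_sum]
    rw [← Finset.add_sum_erase _ _ (Finset.mem_univ k)]
    have hjk : j ∈ Finset.univ.erase k := by simp [hj]
    rw [Finset.sum_eq_single_of_mem j hjk]
    · simp only [hV]
      rw [hT₁, Matrix.updateRow_self, Matrix.updateRow_ne hj]
      simp only [hu, if_neg hj, Matrix.one_apply_eq]
      field_simp
      ring
    · intro i hi hij
      simp only [hV]
      rw [hT₁, Matrix.updateRow_ne (by simpa using hi), Matrix.one_apply_ne hij, zero_mul]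
  have hAT : ∀ i j, (Am φ a * T₁) i j = fderiv ℂ φ a (V j) i := by
    intro i j
    rw [Matrix.mul_apply]
    conv_rhs => rw [pi_eq_sum_univ' (V j)]
    simp only [map_sum, map_smul, Finset.sum_apply, Pi.smul_apply, smul_eq_mul, Am, Matrix.of_apply, hV]
    exact Finset.sum_congr rfl fun x _ => mul_comm _ _
  have hTAT : ∀ i j, (T₂ * (Am φ a * T₁)) i j = if i = l then ell r₂ (φ a) (fderiv ℂ φ a (V j)) else fderiv ℂ φ a (V j) i := by
    intro i j
    rw [Matrix.mul_apply]
    simp only [hAT]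
    split_ifs with hi
    · subst hi
      rw [hT₂, Matrix.updateRow_self, ell_sum]
      exact Finset.sum_congr rfl fun x _ => mul_comm _ _
    · rw [hT₂, Matrix.updateRow_ne hi]
      simp [Matrix.one_apply]
  have hbd : ∀ i j, ‖(T₂ * (Am φ a * T₁)) i j‖ ≤ B' * (if i = l then s else 1) * (if j = k then s⁻¹ else 1) := by
    intro i j
    rw [hTAT]
    obtain ⟨e1, e2, e3⟩ := hest a ha hδ (V j)
    have hBV : B * ‖V j‖ ≤ B' := by rw [hB']; have := hVn j; gcongr
    rw [← hδd] at e1 e2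
    have hco := norm_le_pi_norm (fderiv ℂ φ a (V j)) i
    by_cases hj : j = k
    · rw [if_pos hj]
      split_ifs with hi
      · rw [mul_assoc, mul_inv_cancel₀ hs0.ne', mul_one]
        exact e3.trans hBV
      · rw [mul_one, ← div_eq_mul_inv, le_div_iff₀ hs0, mul_comm]
        refine le_trans ?_ (e2.trans hBV)
        gcongr
    · rw [if_neg hj, mul_one]
      obtain ⟨f1, f2⟩ := e1 (hVell j hj)
      split_ifs with hi
      · refine f2.trans ?_
        calc B * s * ‖V j‖ = B * ‖V j‖ * s := by ring
          _ ≤ _ := by gcongr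
      · rw [mul_one]
        exact hco.trans (f1.trans hBV)
  obtain ⟨r1, r2⟩ := mat_est hB1 hL1 hs0 hs1 hc'0 (by simp [hu]) huL hl hwL hbd
  refine ⟨r1.trans (le_max_left _ _), fun i j => le_trans ?_ (le_max_right _ _)⟩
  calc δ * ‖(Am φ a).adjugate i j‖ ≤ δ * (n * (n * (L * (n.factorial * B' ^ n * s⁻¹)) * L) / c') := by
        gcongr; exact r2 i j
    _ = s * (n * (n * (L * (n.factorial * B' ^ n)) * L) / c') := by
        rw [← hs2]; field_simp
    _ ≤ 1 * (n * (n * (L * (n.factorial * B' ^ n)) * L) / c') := by gcongr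
    _ = _ := one_mul _

lemma HM.jac (H : HM n Ω₁ U₁ Ω₂ U₂ r₁ r₂ φ ε₁ ε₂ c C d) : ∃ B ≥ 0, ∀ a ∈ Ω₁,
    ‖(Am φ a).det‖ ≤ B ∧ ∀ i j, (- r₁ a) * ‖(Am φ a).adjugate i j‖ ≤ B := by
  obtain ⟨B, hB, δ₁, hδ₁, hnear⟩ := H.jac_near
  have hK := H.D₁.cpt hδ₁
  have hAh := Am_hol H.D₁.isOpen H.hol
  have hsub : {z | z ∈ Ω₁ ∧ r₁ z ≤ -δ₁} ⊆ Ω₁ := fun z hz => hz.1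
  have hrc : ContinuousOn r₁ {z | z ∈ Ω₁ ∧ r₁ z ≤ -δ₁} := H.D₁.cont.mono fun z hz => H.D₁.memU hz.1
  obtain ⟨B1, hB1⟩ := hK.exists_bound_of_continuousOn ((det_hol hAh).continuousOn.mono hsub)
  have : ∀ i j, ∃ B2, ∀ z ∈ {z | z ∈ Ω₁ ∧ r₁ z ≤ -δ₁}, ‖(-r₁ z) * ‖(Am φ z).adjugate i j‖‖ ≤ B2 := fun i j =>
    hK.exists_bound_of_continuousOn (hrc.neg.mul ((adj_hol hAh i j).continuousOn.mono hsub).norm)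
  choose B2 hB2 using this
  set S := ∑ i, ∑ j, |B2 i j| with hS
  refine ⟨B + |B1| + S, by positivity, fun a ha => ?_⟩
  have hS0 : 0 ≤ S := by positivity
  have hB10 := abs_nonneg B1
  by_cases hδ : - r₁ a ≤ δ₁
  · obtain ⟨h1, h2⟩ := hnear a ha hδ
    exact ⟨by linarith, fun i j => by linarith [h2 i j]⟩
  · have hm : a ∈ {z | z ∈ Ω₁ ∧ r₁ z ≤ -δ₁} := ⟨ha, by push Not at hδ; linarith⟩
    refine ⟨by linarith [hB1 a hm, le_abs_self B1], fun i j => ?_⟩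
    have h1 := (le_abs_self _).trans (hB2 i j a hm)
    have h2 : |B2 i j| ≤ S := by
      rw [hS]
      exact (Finset.single_le_sum (f := fun j => |B2 i j|) (fun _ _ => abs_nonneg _) (Finset.mem_univ j)).trans
        (Finset.single_le_sum (f := fun i => ∑ j, |B2 i j|) (fun _ _ => by positivity) (Finset.mem_univ i))
    linarith [le_abs_self (B2 i j)]

end
end

section
set_option maxSynthPendingDepth 3

section
variable {n : ℕ}

/-- the complex linear part of the real derivative -/
def dzv (f : (Fin n → ℂ) → ℂ) (z v : Fin n → ℂ) : ℂ := (fderiv ℝ f z v - I * fderiv ℝ f z (I • v)) / 2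

lemma dzv_linear (f : (Fin n → ℂ) → ℂ) (z v w : Fin n → ℂ) (a : ℂ) : dzv f z (v + w) = dzv f z v + dzv f z w ∧ dzv f z (a • v) = a * dzv f z v := by
  constructor
  · simp only [dzv, map_add, smul_add]; ring
  · simp only [dzv]
    rw [smul_comm I a v, smul_re_im a v, smul_re_im a (I • v), smul_smul I I, I_mul_I]
    simp only [map_add, map_smul, neg_smul, one_smul, map_neg, real_smul]
    conv_rhs => rw [← re_add_im a]
    linear_combination ((a.im : ℂ) * fderiv ℝ f z (I • v) / 2) * I_sq

def dzL (f : (Fin n → ℂ) → ℂ) (z : Fin n → ℂ) : (Fin n → ℂ) →ₗ[ℂ] ℂ where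
  toFun := dzv f z
  map_add' v w := (dzv_linear f z v w 0).1
  map_smul' a v := (dzv_linear f z v 0 a).2

lemma dzv_sum (f : (Fin n → ℂ) → ℂ) (z v) : dzv f z v = ∑ j, v j * dzv f z (Pi.single j 1) := by
  change dzL f z v = _
  conv_lhs => rw [pi_eq_sum_univ' v]
  simp [map_sum]
  rfl

lemma dzv_hol {f : (Fin n → ℂ) → ℂ} {z : Fin n → ℂ} (hf : DifferentiableAt ℂ f z) (v) : dzv f z v = fderiv ℂ f z v := by
  unfold dzv
  rw [hf.fderiv_restrictScalars ℝ]
  simp only [ContinuousLinearMap.coe_restrictScalars', map_smul, smul_eq_mul]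
  linear_combination (-fderiv ℂ f z v / 2) * I_sq

lemma dzv_mul {f g : (Fin n → ℂ) → ℂ} {z : Fin n → ℂ} (hf : DifferentiableAt ℝ f z) (hg : DifferentiableAt ℝ g z) (v) :
    dzv (fun x => f x * g x) z v = dzv f z v * g z + f z * dzv g z v := by
  unfold dzv
  rw [(hf.hasFDerivAt.fun_mul hg.hasFDerivAt).fderiv]
  simp
  ring

lemma dzv_fsum {ι : Type*} (s : Finset ι) {f : ι → (Fin n → ℂ) → ℂ} {z : Fin n → ℂ} (hf : ∀ i ∈ s, DifferentiableAt ℝ (f i) z) (v) :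
    dzv (fun x => ∑ i ∈ s, f i x) z v = ∑ i ∈ s, dzv (f i) z v := by
  unfold dzv
  rw [fderiv_fun_sum hf]
  simp only [sum_apply, Finset.mul_sum]
  rw [← Finset.sum_sub_distrib, Finset.sum_div]

lemma dzv_congr {f g : (Fin n → ℂ) → ℂ} {z : Fin n → ℂ} (h : f =ᶠ[nhds z] g) (v) : dzv f z v = dzv g z v := by
  unfold dzv; rw [h.fderiv_eq]

lemma dzv_comp {b : (Fin n → ℂ) → ℂ} {φ : (Fin n → ℂ) → (Fin n → ℂ)} {z : Fin n → ℂ} (hφ : DifferentiableAt ℂ φ z)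
    (hb : DifferentiableAt ℝ b (φ z)) (v) : dzv (fun x => b (φ x)) z v = dzv b (φ z) (fderiv ℂ φ z v) := by
  have h : HasFDerivAt (fun x => b (φ x)) ((fderiv ℝ b (φ z)).comp ((fderiv ℂ φ z).restrictScalars ℝ)) z :=
    hb.hasFDerivAt.comp z (hφ.hasFDerivAt.restrictScalars ℝ)
  unfold dzv
  rw [h.fderiv]
  simp

lemma norm_dzv_le (f : (Fin n → ℂ) → ℂ) (z v) : ‖dzv f z v‖ ≤ ‖fderiv ℝ f z‖ * ‖v‖ := by
  unfold dzv
  rw [norm_div]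
  have h1 := (fderiv ℝ f z).le_opNorm v
  have h2 := (fderiv ℝ f z).le_opNorm (I • v)
  rw [norm_smul, norm_I, one_mul] at h2
  have := norm_sub_le (fderiv ℝ f z v) (I * fderiv ℝ f z (I • v))
  rw [norm_mul, norm_I, one_mul] at this
  simp
  linarith

/-- the determinant as a continuous multilinear map of the rows -/
def detM (n : ℕ) : ContinuousMultilinearMap ℂ (fun _ : Fin n => Fin n → ℂ) ℂ where
  toMultilinearMap := (Matrix.detRowAlternating (n := Fin n) (R := ℂ)).toMultilinearMap
  cont := by
    change Continuous fun M : Matrix (Fin n) (Fin n) ℂ => M.det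
    exact continuous_id.matrix_det

lemma detM_apply (M : Fin n → Fin n → ℂ) : detM n M = Matrix.det (Matrix.of M) := rfl

lemma piola_alg (A : Fin n → Fin n → ℂ) (S : Fin n → Fin n → Fin n → ℂ) (hS : ∀ k i m, S k i m = S m i k) (j i : Fin n) (hij : i ≠ j) :
    ∑ k, detM n (Function.update (Function.update A j (Pi.single k 1)) i (S k i)) = 0 := by
  have h1 : ∀ k, detM n (Function.update (Function.update A j (Pi.single k 1)) i (S k i))
      = ∑ m, S k i m * detM n (Function.update (Function.update A j (Pi.single k 1)) i (Pi.single m 1)) := by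
    intro k
    have : S k i = ∑ m, S k i m • (Pi.single m 1 : Fin n → ℂ) := pi_eq_sum_univ' _
    conv_lhs => rw [this]
    change (detM n).toMultilinearMap _ = _
    rw [MultilinearMap.map_update_sum]
    refine Finset.sum_congr rfl fun m _ => ?_
    rw [MultilinearMap.map_update_smul, smul_eq_mul]
    rfl
  set T : Fin n → Fin n → ℂ := fun k m => detM n (Function.update (Function.update A j (Pi.single k 1)) i (Pi.single m 1)) with hT
  have h2 : ∀ k m, T k m = - T m k := by
    intro k m
    have := (Matrix.detRowAlternating (n := Fin n) (R := ℂ)).map_swap (v := Function.update (Function.update A j (Pi.single m 1)) i (Pi.single k 1)) hij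
    have e : (Function.update (Function.update A j (Pi.single m 1)) i (Pi.single k 1)) ∘ (Equiv.swap i j)
        = Function.update (Function.update A j (Pi.single k 1)) i (Pi.single m 1) := by
      funext x
      simp only [Function.comp]
      by_cases hx : x = i
      · subst hx; simp [Function.update_of_ne hij.symm]
      · by_cases hx' : x = j
        · subst hx'; simp [Function.update_of_ne hx]
        · rw [Equiv.swap_apply_of_ne_of_ne hx hx']; simp [hx, hx']
    rw [e] at this
    exact this
  simp only [h1]
  change ∑ k, ∑ m, S k i m * T k m = 0
  have h3 : ∑ k, ∑ m, S k i m * T k m = - ∑ k, ∑ m, S k i m * T k m := by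
    conv_lhs => rw [Finset.sum_comm]
    rw [← Finset.sum_neg_distrib]
    refine Finset.sum_congr rfl fun k _ => ?_
    rw [← Finset.sum_neg_distrib]
    refine Finset.sum_congr rfl fun m _ => ?_
    rw [h2 m k, hS m i k]; ring
  have : (2:ℂ) * ∑ k, ∑ m, S k i m * T k m = 0 := by linear_combination h3
  simpa using this

lemma piola {A : (Fin n → ℂ) → Matrix (Fin n) (Fin n) ℂ} {z : Fin n → ℂ} (hA : ∀ i j, DifferentiableAt ℂ (fun z => A z i j) z)
    (hS : ∀ k i m, fderiv ℂ (fun z => A z i m) z (Pi.single k 1) = fderiv ℂ (fun z => A z i k) z (Pi.single m 1)) (j : Fin n) :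
    ∑ k, fderiv ℂ (fun z => (A z).adjugate k j) z (Pi.single k 1) = 0 := by
  set S : Fin n → Fin n → Fin n → ℂ := fun k i m => fderiv ℂ (fun z => A z i m) z (Pi.single k 1) with hSd
  have key : ∀ k, fderiv ℂ (fun z => (A z).adjugate k j) z (Pi.single k 1)
      = ∑ i ∈ Finset.univ.erase j, detM n (Function.update (Function.update (A z) j (Pi.single k 1)) i (S k i)) := by
    intro k
    set g : Fin n → (Fin n → ℂ) → (Fin n → ℂ) := fun i z => Function.update (A z) j (Pi.single k 1) i with hg
    set g' : Fin n → ((Fin n → ℂ) →L[ℂ] (Fin n → ℂ)) := fun i => if i = j then 0 else ContinuousLinearMap.pi fun m => fderiv ℂ (fun z => A z i m) z with hg'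
    have hgd : ∀ i, HasFDerivAt (g i) (g' i) z := by
      intro i
      by_cases hi : i = j
      · subst hi
        have e1 : g i = fun _ => Pi.single k 1 := funext fun x => Function.update_self _ _ _
        have e2 : g' i = 0 := by simp [hg']
        rw [e1, e2]
        exact hasFDerivAt_const _ _
      · have e1 : g i = fun x => A x i := funext fun x => Function.update_of_ne hi _ _
        have e2 : g' i = ContinuousLinearMap.pi fun m => fderiv ℂ (fun z => A z i m) z := by simp [hg', hi]
        rw [e1, e2, hasFDerivAt_pi]
        intro m
        exact (hA i m).hasFDerivAt
    have h1 := HasFDerivAt.multilinear_comp (detM n) hgd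
    have h2 : (fun z => (A z).adjugate k j) = fun z => detM n (fun i => g i z) := by
      funext z
      rw [Matrix.adjugate_apply]
      rfl
    rw [h2, h1.fderiv]
    simp only [sum_apply, ContinuousLinearMap.comp_apply, ContinuousMultilinearMap.toContinuousLinearMap_apply]
    rw [← Finset.add_sum_erase _ _ (Finset.mem_univ j)]
    have h3 : detM n (Function.update (fun i => g i z) j ((g' j) (Pi.single k 1))) = 0 := by
      apply ContinuousMultilinearMap.map_coord_zero _ j
      simp [hg']
    rw [h3, zero_add]
    refine Finset.sum_congr rfl fun i hi => ?_
    have hi' : i ≠ j := by simpa using hi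
    simp only [hg', if_neg hi']
    rfl
  simp only [key]
  rw [Finset.sum_comm]
  refine Finset.sum_eq_zero fun i hi => ?_
  exact piola_alg _ S (fun k i m => hS k i m) j i (by simpa using hi)

lemma Am_symm {φ : (Fin n → ℂ) → (Fin n → ℂ)} {W : Set (Fin n → ℂ)} (hW : IsOpen W) (hφ : DifferentiableOn ℂ φ W) {z} (hz : z ∈ W) (k i m : Fin n) :
    fderiv ℂ (fun z => Am φ z i m) z (Pi.single k 1) = fderiv ℂ (fun z => Am φ z i k) z (Pi.single m 1) := by
  have h2 : ContDiffAt ℂ 2 φ z := (hol_contDiffOn' 2 hW hφ).contDiffAt (hW.mem_nhds hz)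
  have h3 : DifferentiableAt ℂ (fderiv ℂ φ) z := (h2.fderiv_right (m := 1) (by norm_num)).differentiableAt (by norm_num)
  have e : ∀ k m : Fin n, fderiv ℂ (fun z => Am φ z i m) z (Pi.single k 1) = fderiv ℂ (fderiv ℂ φ) z (Pi.single k 1) (Pi.single m 1) i := by
    intro k m
    have h4 : HasFDerivAt (fun z => fderiv ℂ φ z (Pi.single m 1)) ((fderiv ℂ (fderiv ℂ φ) z).flip (Pi.single m 1)) z := by
      have := h3.hasFDerivAt.clm_apply (hasFDerivAt_const (Pi.single m 1 : Fin n → ℂ) z)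
      convert! this using 1
      ext; simp
    have h5 := hasFDerivAt_pi'.mp h4 i
    have h6 : fderiv ℂ (fun z => Am φ z i m) z = _ := h5.fderiv
    rw [h6]
    rfl
  rw [e, e]
  have : IsSymmSndFDerivAt ℂ φ z := h2.isSymmSndFDerivAt (by simp)
  rw [this.eq]

lemma div_pull {φ : (Fin n → ℂ) → (Fin n → ℂ)} {W : Set (Fin n → ℂ)} (hW : IsOpen W) (hφ : DifferentiableOn ℂ φ W) {z} (hz : z ∈ W)
    {b : Fin n → (Fin n → ℂ) → ℂ} (hb : ∀ j, DifferentiableAt ℝ (b j) (φ z)) :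
    ∑ k, dzv (fun z => ∑ j, (Am φ z).adjugate k j * b j (φ z)) z (Pi.single k 1) = (Am φ z).det * ∑ j, dzv (b j) (φ z) (Pi.single j 1) := by
  have hφz := hφ.differentiableAt (hW.mem_nhds hz)
  have hadj : ∀ k j, DifferentiableAt ℂ (fun z => (Am φ z).adjugate k j) z := fun k j =>
    (adj_hol (Am_hol hW hφ) k j).differentiableAt (hW.mem_nhds hz)
  have hbφ : ∀ j, DifferentiableAt ℝ (fun x => b j (φ x)) z := fun j => (hb j).comp z (hφz.restrictScalars ℝ)
  have h1 : ∀ k, dzv (fun z => ∑ j, (Am φ z).adjugate k j * b j (φ z)) z (Pi.single k 1) =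
      ∑ j, (fderiv ℂ (fun z => (Am φ z).adjugate k j) z (Pi.single k 1) * b j (φ z) + (Am φ z).adjugate k j * ∑ i, Am φ z i k * dzv (b j) (φ z) (Pi.single i 1)) := by
    intro k
    rw [dzv_fsum _ (fun j _ => ((hadj k j).restrictScalars ℝ).fun_mul (hbφ j))]
    refine Finset.sum_congr rfl fun j _ => ?_
    rw [dzv_mul ((hadj k j).restrictScalars ℝ) (hbφ j), dzv_hol (hadj k j), dzv_comp hφz (hb j), dzv_sum (b j)]
    rfl
  simp only [h1, Finset.sum_add_distrib]
  have h2 : ∑ k, ∑ j, fderiv ℂ (fun z => (Am φ z).adjugate k j) z (Pi.single k 1) * b j (φ z) = 0 := by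
    rw [Finset.sum_comm]
    refine Finset.sum_eq_zero fun j _ => ?_
    rw [← Finset.sum_mul, piola (fun i j => (Am_hol hW hφ i j).differentiableAt (hW.mem_nhds hz)) (Am_symm hW hφ hz) j, zero_mul]
  rw [h2, zero_add, Finset.sum_comm, Finset.mul_sum]
  refine Finset.sum_congr rfl fun j _ => ?_
  have h3 : ∀ k, (Am φ z).adjugate k j * ∑ i, Am φ z i k * dzv (b j) (φ z) (Pi.single i 1) = ∑ i, (Am φ z i k * (Am φ z).adjugate k j) * dzv (b j) (φ z) (Pi.single i 1) := by
    intro k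
    rw [Finset.mul_sum]
    exact Finset.sum_congr rfl fun i _ => by ring
  simp only [h3]
  rw [Finset.sum_comm]
  have h4 : ∀ i, ∑ k, (Am φ z i k * (Am φ z).adjugate k j) * dzv (b j) (φ z) (Pi.single i 1) = ((Am φ z).det * (1 : Matrix (Fin n) (Fin n) ℂ) i j) * dzv (b j) (φ z) (Pi.single i 1) := by
    intro i
    rw [← Finset.sum_mul, ← Matrix.mul_apply, Matrix.mul_adjugate]
    rfl
  simp only [h4, Matrix.one_apply]
  simp

end
end

section
set_option maxSynthPendingDepth 3

section
variable {n : ℕ} {Ω U : Set (Fin n → ℂ)} {r : (Fin n → ℂ) → ℝ} {ε c C d : ℝ}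

lemma Dom.cptcl (D : Dom n Ω U r ε c C d) : IsCompact (closure Ω) := D.bdd.isCompact_closure

lemma Dom.ell_contDiff (D : Dom n Ω U r ε c C d) {z} (hz : z ∈ U) (v) : ContDiffAt ℝ 2 (fun z => ell r z v) z := by
  have h1 : ContDiffAt ℝ 2 (fderiv ℝ r) z := (D.smooth z hz).fderiv_right (m := 2) (by norm_num)
  have h2 : ∀ v, ContDiffAt ℝ 2 (fun z => fderiv ℝ r z v) z := fun v => h1.clm_apply contDiffAt_const
  have h3 : ∀ v, ContDiffAt ℝ 2 (fun z => ((fderiv ℝ r z v : ℝ) : ℂ)) z := fun v => ofRealCLM.contDiff.contDiffAt.comp z (h2 v)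
  unfold ell
  exact ((h3 v).sub (contDiffAt_const.mul (h3 _))).div_const _

def NN (r : (Fin n → ℂ) → ℝ) (z : Fin n → ℂ) : ℝ := ∑ j, ‖ell r z (Pi.single j 1)‖ ^ 2 + r z ^ 2

lemma Dom.NN_contDiff (D : Dom n Ω U r ε c C d) {z} (hz : z ∈ U) : ContDiffAt ℝ 2 (NN r) z := by
  unfold NN
  refine ContDiffAt.add (ContDiffAt.sum fun j _ => ?_) (((D.smooth z hz).of_le (by norm_num)).pow 2)
  exact (D.ell_contDiff hz _).norm_sq ℝ

lemma Dom.NN_pos (D : Dom n Ω U r ε c C d) : ∃ c₀ > 0, ∀ z ∈ closure Ω, c₀ ≤ NN r z := by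
  refine ⟨min ((c / (4 * (n + 1))) ^ 2) (ε ^ 2), lt_min (by have := D.hc; positivity) (by have := D.hε; positivity), ?_⟩
  have hΩ : ∀ z ∈ Ω, min ((c / (4 * (n + 1))) ^ 2) (ε ^ 2) ≤ NN r z := by
    intro z hz
    by_cases hs : -ε ≤ r z
    · obtain ⟨k, hk⟩ := D.exists_k hz hs
      refine (min_le_left _ _).trans ?_
      have h1 : (c / (4 * (n + 1))) ^ 2 ≤ ‖ell r z (Pi.single k 1)‖ ^ 2 := by
        have := D.hc
        gcongr
      have h2 := Finset.single_le_sum (f := fun j => ‖ell r z (Pi.single j 1)‖ ^ 2) (fun i _ => by positivity) (Finset.mem_univ k)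
      unfold NN
      nlinarith [sq_nonneg (r z)]
    · push Not at hs
      refine (min_le_right _ _).trans ?_
      have h2 : 0 ≤ ∑ j, ‖ell r z (Pi.single j 1)‖ ^ 2 := Finset.sum_nonneg fun i _ => by positivity
      unfold NN
      nlinarith [D.hε]
  intro z hz
  have hc : ContinuousAt (NN r) z := (D.NN_contDiff (D.sub hz)).continuousAt
  rw [mem_closure_iff_seq_limit] at hz
  obtain ⟨x, hx, hl⟩ := hz
  exact ge_of_tendsto (hc.tendsto.comp hl) (Filter.Eventually.of_forall fun k => hΩ _ (hx k))

def qq (r : (Fin n → ℂ) → ℝ) (j : Fin n) (z : Fin n → ℂ) : ℂ := (starRingEnd ℂ) (ell r z (Pi.single j 1)) / (NN r z : ℝ)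

lemma Dom.qq_contDiff (D : Dom n Ω U r ε c C d) {z} (hz : z ∈ closure Ω) (j) : ContDiffAt ℝ 2 (qq r j) z := by
  unfold qq
  obtain ⟨c₀, h0, h1⟩ := D.NN_pos
  simp only [div_eq_mul_inv]
  refine ContDiffAt.mul ?_ (ContDiffAt.inv ?_ ?_)
  · exact (conjCLE : ℂ ≃L[ℝ] ℂ).contDiff.contDiffAt.comp z (D.ell_contDiff (D.sub hz) _)
  · exact ofRealCLM.contDiff.contDiffAt.comp z (D.NN_contDiff (D.sub hz))
  · have := h1 z hz
    exact_mod_cast (by linarith : NN r z ≠ 0)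

lemma Dom.q_est (D : Dom n Ω U r ε c C d) : ∃ B, 0 ≤ B ∧ ∀ z ∈ Ω, (∀ j, ‖qq r j z‖ ≤ B ∧ ‖dzv (qq r j) z (Pi.single j 1)‖ ≤ B) ∧
    ‖1 - ∑ j, ell r z (Pi.single j 1) * qq r j z‖ ≤ B * (-r z) ∧ ‖1 - ∑ j, ell r z (Pi.single j 1) * qq r j z‖ ≤ B := by
  obtain ⟨c₀, h0, h1⟩ := D.NN_pos
  have a1 : ∀ j, ∃ B, ∀ z ∈ closure Ω, ‖qq r j z‖ ≤ B := fun j =>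
    D.cptcl.exists_bound_of_continuousOn fun z hz => (D.qq_contDiff hz j).continuousAt.continuousWithinAt
  have a2 : ∀ j, ∃ B, ∀ z ∈ closure Ω, ‖fderiv ℝ (qq r j) z‖ ≤ B := fun j =>
    D.cptcl.exists_bound_of_continuousOn fun z hz => ((D.qq_contDiff hz j).fderiv_right (m := 1) (by norm_num)).continuousAt.continuousWithinAt
  obtain ⟨R, hR⟩ := D.cptcl.exists_bound_of_continuousOn (D.cont.mono D.sub)
  choose B1 hB1 using a1
  choose B2 hB2 using a2
  refine ⟨∑ j, |B1 j| + ∑ j, |B2 j| + |R| / c₀ + |R| * (|R| / c₀), by positivity, fun z hz => ?_⟩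
  have hzc := subset_closure hz
  have p1 : 0 ≤ ∑ j, |B1 j| := Finset.sum_nonneg fun i _ => abs_nonneg _
  have p2 : 0 ≤ ∑ j, |B2 j| := Finset.sum_nonneg fun i _ => abs_nonneg _
  have p3 : 0 ≤ |R| / c₀ := by positivity
  have p4 : 0 ≤ |R| * (|R| / c₀) := by positivity
  have hr := D.neg hz
  have hrR : -r z ≤ |R| := by
    have := hR z hzc
    rw [Real.norm_eq_abs, abs_of_neg hr] at this
    exact this.trans (le_abs_self _)
  have hN := h1 z hzc
  have key : 1 - ∑ j, ell r z (Pi.single j 1) * qq r j z = ((r z ^ 2 / NN r z : ℝ) : ℂ) := by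
    have hN0 : ((NN r z : ℝ) : ℂ) ≠ 0 := by exact_mod_cast (by linarith : NN r z ≠ 0)
    have e : ∀ j, ell r z (Pi.single j 1) * qq r j z = ((‖ell r z (Pi.single j 1)‖ ^ 2 : ℝ) : ℂ) / (NN r z : ℝ) := by
      intro j
      unfold qq
      rw [mul_div_assoc', mul_conj, normSq_eq_norm_sq]
    simp only [e]
    rw [← Finset.sum_div, ← ofReal_sum, eq_comm, ofReal_div, eq_sub_iff_add_eq, ← add_div, ← ofReal_add, div_eq_one_iff_eq hN0]
    unfold NN
    rw [add_comm]
  have kn : ‖1 - ∑ j, ell r z (Pi.single j 1) * qq r j z‖ ≤ (|R| / c₀) * (-r z) := by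
    rw [key, norm_real, Real.norm_eq_abs, abs_of_nonneg (div_nonneg (sq_nonneg _) (by linarith))]
    rw [div_le_iff₀ (by linarith)]
    have : |R| / c₀ * (-r z) * c₀ ≤ |R| / c₀ * (-r z) * NN r z := by
      refine mul_le_mul_of_nonneg_left hN (mul_nonneg p3 (by linarith))
    have e : |R| / c₀ * (-r z) * c₀ = |R| * (-r z) := by field_simp
    nlinarith
  refine ⟨fun j => ⟨?_, ?_⟩, ?_, ?_⟩
  · have := Finset.single_le_sum (f := fun j => |B1 j|) (fun i _ => abs_nonneg _) (Finset.mem_univ j)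
    linarith [hB1 j z hzc, le_abs_self (B1 j)]
  · have := Finset.single_le_sum (f := fun j => |B2 j|) (fun i _ => abs_nonneg _) (Finset.mem_univ j)
    have h3 := norm_dzv_le (qq r j) z (Pi.single j 1)
    rw [Pi.norm_single, norm_one, mul_one] at h3
    linarith [hB2 j z hzc, le_abs_self (B2 j)]
  · refine kn.trans (mul_le_mul_of_nonneg_right (by linarith) (by linarith))
  · refine kn.trans ?_
    have : |R| / c₀ * (-r z) ≤ |R| / c₀ * |R| := mul_le_mul_of_nonneg_left hrR p3
    linarith

lemma exists_cut : ∃ B, 0 ≤ B ∧ ∀ e > 0, ∃ ψ : ℝ → ℝ, ContDiff ℝ 1 ψ ∧ (∀ t, -e ≤ t → ψ t = 0) ∧ (∀ t, |ψ t| ≤ |t|) ∧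
    (∀ t, -2 * e ≤ t → t ≤ 0 → |deriv ψ t| ≤ B) ∧ (∀ t, t < -2 * e → deriv ψ t = 1) ∧ (∀ t, t < -2 * e → ψ t = t) := by
  set Ψ : ℝ → ℝ := fun s => s * Real.smoothTransition (-s - 1) with hΨ
  have hs : ContDiff ℝ 1 Ψ := contDiff_id.mul (Real.smoothTransition.contDiff.comp (contDiff_id.neg.sub contDiff_const))
  obtain ⟨B, hB⟩ := (isCompact_Icc (a := (-2:ℝ)) (b := 0)).exists_bound_of_continuousOn (hs.continuous_deriv le_rfl).continuousOn
  refine ⟨|B|, abs_nonneg _, fun e he => ?_⟩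
  have hd : ∀ t, deriv (fun t => e * Ψ (t / e)) t = deriv Ψ (t / e) := by
    intro t
    have h1 : HasDerivAt (fun t : ℝ => t / e) (1 / e) t := (hasDerivAt_id t).div_const e
    have h2 : HasDerivAt Ψ (deriv Ψ (t / e)) (t / e) := ((hs.differentiable (by norm_num)) _).hasDerivAt
    have h3 := (h2.comp t h1).const_mul e
    have h4 : deriv (fun t => e * Ψ (t / e)) t = _ := h3.deriv
    rw [h4]
    field_simp
  refine ⟨fun t => e * Ψ (t / e), ?_, ?_, ?_, ?_, ?_, ?_⟩
  · exact contDiff_const.mul (hs.comp (contDiff_id.div_const _))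
  · intro t ht
    have : -1 ≤ t / e := by rw [le_div_iff₀ he]; linarith
    simp only [hΨ]
    rw [Real.smoothTransition.zero_of_nonpos (by linarith)]
    simp
  · intro t
    simp only [hΨ]
    rw [← mul_assoc, mul_div_cancel₀ _ he.ne', abs_mul, abs_of_nonneg (Real.smoothTransition.nonneg _)]
    exact mul_le_of_le_one_right (abs_nonneg _) (Real.smoothTransition.le_one _)
  · intro t h1 h2
    rw [hd]
    have := hB (t / e) ⟨by rw [le_div_iff₀ he]; linarith, div_nonpos_of_nonpos_of_nonneg h2 he.le⟩
    exact this.trans (le_abs_self _)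
  · intro t ht
    rw [hd]
    have h1 : t / e < -2 := by rw [div_lt_iff₀ he]; linarith
    have h2 : Ψ =ᶠ[nhds (t / e)] fun s => s := by
      filter_upwards [isOpen_Iio.mem_nhds h1] with s hs
      simp only [hΨ]
      rw [Real.smoothTransition.one_of_one_le (by simp only [Set.mem_Iio] at hs; linarith), mul_one]
    rw [h2.deriv_eq]
    simp
  · intro t ht
    have h1 : t / e < -2 := by rw [div_lt_iff₀ he]; linarith
    simp only [hΨ]
    rw [Real.smoothTransition.one_of_one_le (by linarith)]
    field_simp

lemma dzv_ofReal {u : (Fin n → ℂ) → ℝ} {z} (hu : DifferentiableAt ℝ u z) (v) : dzv (fun x => ((u x : ℝ) : ℂ)) z v = ell u z v := by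
  have h : HasFDerivAt (fun x => ((u x : ℝ) : ℂ)) (ofRealCLM.comp (fderiv ℝ u z)) z := ofRealCLM.hasFDerivAt.comp z hu.hasFDerivAt
  unfold dzv ell
  rw [h.fderiv]
  rfl

lemma ell_comp {ψ : ℝ → ℝ} {z : Fin n → ℂ} (hψ : DifferentiableAt ℝ ψ (r z)) (hr : DifferentiableAt ℝ r z) (v) :
    ell (fun x => ψ (r x)) z v = (deriv ψ (r z) : ℝ) * ell r z v := by
  have h : HasFDerivAt (fun x => ψ (r x)) (deriv ψ (r z) • fderiv ℝ r z) z := hψ.hasDerivAt.comp_hasFDerivAt z hr.hasFDerivAt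
  unfold ell
  rw [h.fderiv]
  simp only [smul_apply, smul_eq_mul]
  push_cast
  ring

lemma Dom.b_est (D : Dom n Ω U r ε c C d) : ∃ B, 0 ≤ B ∧ ∀ e > 0, ∃ b : Fin n → (Fin n → ℂ) → ℂ, ∀ z ∈ Ω,
    (∀ j, ContDiffAt ℝ 1 (b j) z) ∧ (-e ≤ r z → ∀ j, b j z = 0) ∧ (∀ j, ‖b j z‖ ≤ B * (-r z)) ∧
    ‖1 - ∑ j, dzv (b j) z (Pi.single j 1)‖ ≤ B * (-r z) + (if -2 * e ≤ r z then B else 0) := by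
  obtain ⟨B, hB, hq⟩ := D.q_est
  obtain ⟨B', hB', hψ⟩ := exists_cut
  refine ⟨(n + 1) * B + 1 + B' * (1 + B), by positivity, fun e he => ?_⟩
  obtain ⟨ψ, h1, h2, h3, h4, h5, h6⟩ := hψ e he
  refine ⟨fun j z => ((ψ (r z) : ℝ) : ℂ) * qq r j z, fun z hz => ?_⟩
  obtain ⟨q1, q2, q3⟩ := hq z hz
  have hr := D.neg hz
  have hrs : ContDiffAt ℝ 1 r z := (D.smooth2 hz).of_le (by norm_num)
  have hψr : ContDiffAt ℝ 1 (fun z => ψ (r z)) z := h1.contDiffAt.comp z hrs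
  have hψc : ContDiffAt ℝ 1 (fun z => ((ψ (r z) : ℝ) : ℂ)) z := ofRealCLM.contDiff.contDiffAt.comp z hψr
  have hqc : ∀ j, ContDiffAt ℝ 1 (qq r j) z := fun j => (D.qq_contDiff (subset_closure hz) j).of_le (by norm_num)
  have hψb : ‖((ψ (r z) : ℝ) : ℂ)‖ ≤ -r z := by
    rw [norm_real, Real.norm_eq_abs]
    have := h3 (r z)
    rwa [abs_of_neg hr] at this
  refine ⟨fun j => hψc.mul (hqc j), fun h j => by simp [h2 _ h], fun j => ?_, ?_⟩
  · rw [norm_mul]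
    have : ‖((ψ (r z) : ℝ) : ℂ)‖ * ‖qq r j z‖ ≤ (-r z) * B := mul_le_mul hψb (q1 j).1 (norm_nonneg _) (by linarith)
    have h0 : 0 ≤ (n * B + 1 + B' * (1 + B)) * (-r z) := mul_nonneg (by positivity) (by linarith)
    linarith
  · have e1 : ∑ j, dzv (fun z => ((ψ (r z) : ℝ) : ℂ) * qq r j z) z (Pi.single j 1)
        = (deriv ψ (r z) : ℝ) * ∑ j, ell r z (Pi.single j 1) * qq r j z + ((ψ (r z) : ℝ) : ℂ) * ∑ j, dzv (qq r j) z (Pi.single j 1) := by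
      rw [Finset.mul_sum, Finset.mul_sum, ← Finset.sum_add_distrib]
      refine Finset.sum_congr rfl fun j _ => ?_
      rw [dzv_mul (hψc.differentiableAt (by norm_num)) ((hqc j).differentiableAt (by norm_num)),
        dzv_ofReal (hψr.differentiableAt (by norm_num)), ell_comp (h1.differentiable (by norm_num) _) (hrs.differentiableAt (by norm_num))]
      ring
    rw [e1]
    set X := ∑ j, ell r z (Pi.single j 1) * qq r j z with hX
    set Y := ∑ j, dzv (qq r j) z (Pi.single j 1) with hY
    have hYb : ‖Y‖ ≤ n * B := by
      refine (norm_sum_le _ _).trans ?_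
      refine (Finset.sum_le_sum fun j _ => (q1 j).2).trans ?_
      simp
    have hψY : ‖((ψ (r z) : ℝ) : ℂ) * Y‖ ≤ (-r z) * (n * B) := by
      rw [norm_mul]; exact mul_le_mul hψb hYb (norm_nonneg _) (by linarith)
    have hr' : 0 < -r z := by linarith
    have k1 : 0 ≤ B' * (1 + B) * (-r z) := by positivity
    have k2 : 0 ≤ (n + 1) * B * (-r z) := by positivity
    have k3 : 0 ≤ n * B * (-r z) := by positivity
    have k4 : 0 ≤ B * (-r z) := by positivity
    split_ifs with hcase
    · have hd := h4 _ hcase hr.le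
      have hXb : ‖X‖ ≤ 1 + B := by
        have := norm_sub_le (1:ℂ) (1 - X)
        rw [sub_sub_cancel, norm_one] at this
        linarith
      have hdX : ‖((deriv ψ (r z) : ℝ) : ℂ) * X‖ ≤ B' * (1 + B) := by
        rw [norm_mul, norm_real, Real.norm_eq_abs]
        exact mul_le_mul hd hXb (norm_nonneg _) hB'
      have t1 : ‖1 - (((deriv ψ (r z) : ℝ) : ℂ) * X + ((ψ (r z) : ℝ) : ℂ) * Y)‖ ≤ 1 + (B' * (1 + B) + (-r z) * (n * B)) := by
        refine (norm_sub_le _ _).trans ?_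
        rw [norm_one]
        linarith [norm_add_le (((deriv ψ (r z) : ℝ) : ℂ) * X) (((ψ (r z) : ℝ) : ℂ) * Y)]
      have : 0 ≤ (n + 1) * B := by positivity
      linarith
    · push Not at hcase
      rw [h5 _ hcase]
      have t1 : ‖1 - (((1 : ℝ) : ℂ) * X + ((ψ (r z) : ℝ) : ℂ) * Y)‖ ≤ B * (-r z) + (-r z) * (n * B) := by
        rw [ofReal_one, one_mul, ← sub_sub]
        refine (norm_sub_le _ _).trans ?_
        linarith [q2]
      linarith

end
end

section
set_option maxSynthPendingDepth 3

section
variable {n : ℕ}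
open MeasureTheory

lemma int_dzv_zero {g : (Fin n → ℂ) → ℂ} (hg : ContDiff ℝ 1 g) (hs : HasCompactSupport g) (v : Fin n → ℂ) :
    Integrable (fun z => dzv g z v) ∧ ∫ z, dzv g z v = 0 := by
  have hi : ∀ v, Integrable (fun z => fderiv ℝ g z v) := fun v =>
    ((hg.continuous_fderiv (by norm_num)).clm_apply continuous_const).integrable_of_hasCompactSupport (hs.fderiv_apply ℝ v)
  have h0 : ∀ v, ∫ z, fderiv ℝ g z v = 0 := by
    intro v
    have := integral_smul_fderiv_eq_neg_fderiv_smul_of_integrable (μ := (volume : Measure (Fin n → ℂ))) (f := fun _ => (1:ℝ)) (g := g) (v := v)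
      (by simp) (by simpa using hi v) (by simpa using hg.continuous.integrable_of_hasCompactSupport hs)
      (fun x _ => differentiableAt_const _) (fun x _ => hg.differentiable (by norm_num) x)
    simpa using this
  unfold dzv
  refine ⟨((hi v).sub ((hi _).const_mul _)).div_const _, ?_⟩
  rw [integral_div, integral_sub (hi v) ((hi _).const_mul _), integral_const_mul, h0, h0]
  simp

lemma indicator_contDiff {Ω K : Set (Fin n → ℂ)} (hΩ : IsOpen Ω) (hK : IsCompact K) (hKΩ : K ⊆ Ω) {f : (Fin n → ℂ) → ℂ}
    (hf : ∀ z ∈ Ω, ContDiffAt ℝ 1 f z) (h0 : ∀ z ∈ Ω, z ∉ K → f z = 0) :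
    ContDiff ℝ 1 (Ω.indicator f) ∧ HasCompactSupport (Ω.indicator f) := by
  have hz0 : ∀ z, z ∉ K → Ω.indicator f z = 0 := by
    intro z hz
    by_cases h : z ∈ Ω
    · rw [Set.indicator_of_mem h]; exact h0 z h hz
    · exact Set.indicator_of_notMem h _
  refine ⟨contDiff_iff_contDiffAt.mpr fun z => ?_, HasCompactSupport.intro hK hz0⟩
  by_cases hz : z ∈ Ω
  · refine (hf z hz).congr_of_eventuallyEq ?_
    filter_upwards [hΩ.mem_nhds hz] with y hy
    exact Set.indicator_of_mem hy _
  · have : Ω.indicator f =ᶠ[nhds z] fun _ => 0 := by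
      filter_upwards [hK.isClosed.isOpen_compl.mem_nhds (fun h => hz (hKΩ h))] with y hy
      exact hz0 y hy
    exact contDiffAt_const.congr_of_eventuallyEq this

lemma hol_contDiffAt_real {m : ℕ} {f : (Fin n → ℂ) → ℂ} {W : Set (Fin n → ℂ)} (hW : IsOpen W) (hf : DifferentiableOn ℂ f W) {z} (hz : z ∈ W) :
    ContDiffAt ℝ m f z := ((hol_contDiffOn m hW hf).contDiffAt (hW.mem_nhds hz)).restrict_scalars ℝ

variable {Ω₁ U₁ Ω₂ U₂ : Set (Fin n → ℂ)} {r₁ r₂ : (Fin n → ℂ) → ℝ} {φ : (Fin n → ℂ) → (Fin n → ℂ)} {ε₁ ε₂ c C d : ℝ}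

lemma HM.cutoff_est (H : HM n Ω₁ U₁ Ω₂ U₂ r₁ r₂ φ ε₁ ε₂ c C d) : ∃ B, 0 ≤ B ∧ ∀ e > 0, ∀ (G : (Fin n → ℂ) → ℂ) (E : (Fin n → ℂ) → ℝ) (M : ℝ),
    (∀ z ∈ Ω₁, ContDiffAt ℝ 1 G z) → (∀ z ∈ Ω₁, ‖G z‖ ≤ M) → (∀ z ∈ Ω₁, 0 ≤ E z) → (∀ z ∈ Ω₁, ∀ k, ‖dzv G z (Pi.single k 1)‖ ≤ E z) →
    ‖∫ z in Ω₁, (Am φ z).det * G z‖ₑ ≤ ∫⁻ z in Ω₁, ENNReal.ofReal (B * (-r₁ z * ‖G z‖ + E z) + if -2 * e ≤ r₂ (φ z) then B * M else 0) := by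
  obtain ⟨B₁, hB₁, hJ⟩ := H.jac
  obtain ⟨B₂, hB₂, hb⟩ := H.D₂.b_est
  have hC := H.D₁.hC
  have hC0 : 0 ≤ C := by linarith
  refine ⟨B₁ * B₂ * C + B₁ * B₂ + n * (n * (B₁ * B₂ * C)), by positivity, fun e he G E M hG hM hEn hE => ?_⟩
  obtain ⟨b, hb⟩ := hb e he
  set Bk : Fin n → (Fin n → ℂ) → ℂ := fun k z => ∑ j, (Am φ z).adjugate k j * b j (φ z) with hBk
  set g : Fin n → (Fin n → ℂ) → ℂ := fun k z => Bk k z * G z with hg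
  set K : Set (Fin n → ℂ) := {z | z ∈ Ω₁ ∧ φ z ∈ {w | w ∈ Ω₂ ∧ r₂ w ≤ -e}} with hKdef
  have hK : IsCompact K := H.proper _ (fun w hw => hw.1) (H.D₂.cpt he)
  have hφr : ∀ z ∈ Ω₁, ContDiffAt ℝ 1 φ z := fun z hz =>
    ((hol_contDiffOn' 1 H.D₁.isOpen H.hol).contDiffAt (H.D₁.isOpen.mem_nhds hz)).restrict_scalars ℝ
  have hAm := Am_hol H.D₁.isOpen H.hol
  have hBc : ∀ k, ∀ z ∈ Ω₁, ContDiffAt ℝ 1 (Bk k) z := by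
    intro k z hz
    refine ContDiffAt.sum fun j _ => ?_
    have h1 : ContDiffAt ℝ 1 (fun z => (Am φ z).adjugate k j) z := hol_contDiffAt_real (m := 1) H.D₁.isOpen (adj_hol hAm k j) hz
    exact h1.mul (((hb _ (H.maps z hz)).1 j).comp z (hφr z hz))
  have hgc : ∀ k, ∀ z ∈ Ω₁, ContDiffAt ℝ 1 (g k) z := fun k z hz => (hBc k z hz).mul (hG z hz)
  have hind : ∀ k, ContDiff ℝ 1 (Ω₁.indicator (g k)) ∧ HasCompactSupport (Ω₁.indicator (g k)) := by
    intro k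
    refine indicator_contDiff H.D₁.isOpen hK (fun z hz => hz.1) (hgc k) fun z hz hzK => ?_
    have : -e ≤ r₂ (φ z) := by
      by_contra hcon
      push Not at hcon
      exact hzK ⟨hz, H.maps z hz, hcon.le⟩
    have h2 := (hb _ (H.maps z hz)).2.1 this
    simp [hg, hBk, h2]
  have hdz : ∀ k, ∀ z ∈ Ω₁, dzv (Ω₁.indicator (g k)) z (Pi.single k 1) = dzv (g k) z (Pi.single k 1) := by
    intro k z hz
    apply dzv_congr
    filter_upwards [H.D₁.isOpen.mem_nhds hz] with y hy
    exact Set.indicator_of_mem hy _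
  have hdz0 : ∀ k, ∀ z, z ∉ Ω₁ → dzv (Ω₁.indicator (g k)) z (Pi.single k 1) = 0 := by
    intro k z hz
    have : Ω₁.indicator (g k) =ᶠ[nhds z] fun _ => 0 := by
      filter_upwards [hK.isClosed.isOpen_compl.mem_nhds (fun h => hz h.1)] with y hy
      by_cases hyΩ : y ∈ Ω₁
      · rw [Set.indicator_of_mem hyΩ]
        have : -e ≤ r₂ (φ y) := by
          by_contra hcon
          push Not at hcon
          exact hy ⟨hyΩ, H.maps y hyΩ, hcon.le⟩
        have h2 := (hb _ (H.maps y hyΩ)).2.1 this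
        simp [hg, hBk, h2]
      · exact Set.indicator_of_notMem hyΩ _
    rw [dzv_congr this]
    simp [dzv]
  have hint0 : ∀ k, ∫ z in Ω₁, dzv (Ω₁.indicator (g k)) z (Pi.single k 1) = 0 := by
    intro k
    rw [setIntegral_eq_integral_of_forall_compl_eq_zero (hdz0 k)]
    exact (int_dzv_zero (hind k).1 (hind k).2 _).2
  have hintg : ∀ k, IntegrableOn (fun z => dzv (Ω₁.indicator (g k)) z (Pi.single k 1)) Ω₁ := fun k =>
    (int_dzv_zero (hind k).1 (hind k).2 _).1.integrableOn
  have hJG : IntegrableOn (fun z => (Am φ z).det * G z) Ω₁ := by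
    have hc : ContinuousOn (fun z => (Am φ z).det * G z) Ω₁ :=
      (det_hol hAm).continuousOn.mul fun z hz => (hG z hz).continuousAt.continuousWithinAt
    refine IntegrableOn.of_bound H.D₁.bdd.measure_lt_top (hc.aestronglyMeasurable H.D₁.isOpen.measurableSet) (B₁ * M) ?_
    refine (ae_restrict_iff' H.D₁.isOpen.measurableSet).mpr (ae_of_all _ fun z hz => ?_)
    rw [norm_mul]
    exact mul_le_mul (hJ z hz).1 (hM z hz) (norm_nonneg _) hB₁
  have heq : ∫ z in Ω₁, (Am φ z).det * G z = ∫ z in Ω₁, ((Am φ z).det * G z - ∑ k, dzv (Ω₁.indicator (g k)) z (Pi.single k 1)) := by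
    rw [integral_sub hJG (integrable_finsetSum _ fun k _ => hintg k), integral_finsetSum _ fun k _ => hintg k]
    simp [hint0]
  rw [heq]
  refine (enorm_integral_le_lintegral_enorm _).trans ?_
  refine setLIntegral_mono' H.D₁.isOpen.measurableSet fun z hz => ?_
  rw [← ofReal_norm]
  apply ENNReal.ofReal_le_ofReal
  have hr1 := H.D₁.neg hz
  have hpr := hb _ (H.maps z hz)
  have hh2 := H.hopf2 z hz
  have hr2 := H.D₂.neg (H.maps z hz)
  have hid : (Am φ z).det * G z - ∑ k, dzv (Ω₁.indicator (g k)) z (Pi.single k 1)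
      = (Am φ z).det * (1 - ∑ j, dzv (b j) (φ z) (Pi.single j 1)) * G z - ∑ k, Bk k z * dzv G z (Pi.single k 1) := by
    have h1 : ∀ k, dzv (Ω₁.indicator (g k)) z (Pi.single k 1) = dzv (Bk k) z (Pi.single k 1) * G z + Bk k z * dzv G z (Pi.single k 1) := by
      intro k
      rw [hdz k z hz]
      exact dzv_mul ((hBc k z hz).differentiableAt (by norm_num)) ((hG z hz).differentiableAt (by norm_num)) _
    simp only [h1]
    rw [Finset.sum_add_distrib, ← Finset.sum_mul, div_pull H.D₁.isOpen H.hol hz (fun j => (hpr.1 j).differentiableAt (by norm_num))]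
    ring
  rw [hid]
  have hG0 := norm_nonneg (G z)
  have hE0 := hEn z hz
  have hM0 : 0 ≤ M := hG0.trans (hM z hz)
  have hBkb : ∀ k, ‖Bk k z‖ ≤ n * (B₁ * B₂ * C) := by
    intro k
    refine (norm_sum_le _ _).trans ?_
    have : ∀ j ∈ Finset.univ, ‖(Am φ z).adjugate k j * b j (φ z)‖ ≤ B₁ * B₂ * C := by
      intro j _
      rw [norm_mul]
      have a1 := (hJ z hz).2 k j
      have a2 := hpr.2.2.1 j
      have a3 : ‖b j (φ z)‖ ≤ B₂ * (C * (-r₁ z)) := a2.trans (mul_le_mul_of_nonneg_left hh2 hB₂)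
      calc ‖(Am φ z).adjugate k j‖ * ‖b j (φ z)‖ ≤ ‖(Am φ z).adjugate k j‖ * (B₂ * (C * (-r₁ z))) := by gcongr
        _ = (B₂ * C) * ((-r₁ z) * ‖(Am φ z).adjugate k j‖) := by ring
        _ ≤ (B₂ * C) * B₁ := by gcongr
        _ = _ := by ring
    refine (Finset.sum_le_sum this).trans ?_
    simp
  have t2 : ‖∑ k, Bk k z * dzv G z (Pi.single k 1)‖ ≤ (n * (n * (B₁ * B₂ * C))) * E z := by
    refine (norm_sum_le _ _).trans ?_
    have : ∀ k ∈ Finset.univ, ‖Bk k z * dzv G z (Pi.single k 1)‖ ≤ (n * (B₁ * B₂ * C)) * E z := by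
      intro k _
      rw [norm_mul]
      exact mul_le_mul (hBkb k) (hE z hz k) (norm_nonneg _) (by positivity)
    refine (Finset.sum_le_sum this).trans ?_
    simp
    apply le_of_eq
    ring
  have t1 : ‖(Am φ z).det * (1 - ∑ j, dzv (b j) (φ z) (Pi.single j 1)) * G z‖ ≤ B₁ * (B₂ * (C * (-r₁ z)) + if -2 * e ≤ r₂ (φ z) then B₂ else 0) * ‖G z‖ := by
    rw [norm_mul, norm_mul]
    refine mul_le_mul_of_nonneg_right (mul_le_mul (hJ z hz).1 (hpr.2.2.2.trans ?_) (norm_nonneg _) hB₁) hG0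
    gcongr
  have hX : 0 ≤ -r₁ z * ‖G z‖ := mul_nonneg (by linarith) hG0
  refine (norm_sub_le _ _).trans ?_
  have p1 : 0 ≤ B₁ * B₂ := by positivity
  have p2 : 0 ≤ B₁ * B₂ * C := by positivity
  have p3 : 0 ≤ (n:ℝ) * (n * (B₁ * B₂ * C)) := by positivity
  have q1 := mul_nonneg p1 hX
  have q2 := mul_nonneg p3 hX
  have q3 := mul_nonneg p1 hE0
  have q4 := mul_nonneg p2 hE0
  have q5 := mul_nonneg p2 hM0
  have q6 := mul_nonneg p3 hM0
  have q7 := mul_le_mul_of_nonneg_left (hM z hz) p1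
  split_ifs at t1 ⊢ with hcase
  · nlinarith [t1, t2, q1, q2, q3, q4, q5, q6, q7]
  · nlinarith [t1, t2, q1, q2, q3, q4, q5, q6, q7]

lemma HM.main_int (H : HM n Ω₁ U₁ Ω₂ U₂ r₁ r₂ φ ε₁ ε₂ c C d) : ∃ B, 0 ≤ B ∧ ∀ (G : (Fin n → ℂ) → ℂ) (E : (Fin n → ℂ) → ℝ) (M : ℝ),
    (∀ z ∈ Ω₁, ContDiffAt ℝ 1 G z) → (∀ z ∈ Ω₁, ‖G z‖ ≤ M) → (∀ z ∈ Ω₁, 0 ≤ E z) → (∀ z ∈ Ω₁, ∀ k, ‖dzv G z (Pi.single k 1)‖ ≤ E z) →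
    ‖∫ z in Ω₁, (Am φ z).det * G z‖ₑ ≤ ENNReal.ofReal B * ∫⁻ z in Ω₁, ENNReal.ofReal (-r₁ z * ‖G z‖ + E z) := by
  obtain ⟨B, hB, h⟩ := H.cutoff_est
  refine ⟨B, hB, fun G E M hG hM hEn hE => ?_⟩
  set S : ℕ → Set (Fin n → ℂ) := fun N => {z | z ∈ Ω₁ ∧ -2 * (1 / ((N:ℝ) + 1)) ≤ r₂ (φ z)} with hS
  have hcont : ContinuousOn (fun z => r₂ (φ z)) Ω₁ := H.D₂.cont.comp H.hol.continuousOn fun z hz => H.D₂.memU (H.maps z hz)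
  have hSm : ∀ N, MeasurableSet (S N) := by
    intro N
    have : S N = Ω₁ \ (Ω₁ ∩ (fun z => r₂ (φ z)) ⁻¹' (Set.Iio (-2 * (1 / ((N:ℝ) + 1))))) := by
      ext z
      simp only [hS, Set.mem_ofPred_eq, Set.mem_diff, Set.mem_inter_iff, Set.mem_preimage, Set.mem_Iio, not_and, not_lt]
      tauto
    rw [this]
    exact H.D₁.isOpen.measurableSet.diff (hcont.isOpen_inter_preimage H.D₁.isOpen isOpen_Iio).measurableSet
  have hSub : ∀ N, S N ⊆ Ω₁ := fun N z hz => hz.1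
  have hbound : ∀ N, ‖∫ z in Ω₁, (Am φ z).det * G z‖ₑ ≤ ENNReal.ofReal B * (∫⁻ z in Ω₁, ENNReal.ofReal (-r₁ z * ‖G z‖ + E z)) + ENNReal.ofReal (B * M) * volume (S N) := by
    intro N
    refine (h (1 / ((N:ℝ) + 1)) (by positivity) G E M hG hM hEn hE).trans ?_
    have h1 : ∀ z ∈ Ω₁, ENNReal.ofReal (B * (-r₁ z * ‖G z‖ + E z) + if -2 * (1 / ((N:ℝ) + 1)) ≤ r₂ (φ z) then B * M else 0)
        ≤ ENNReal.ofReal B * ENNReal.ofReal (-r₁ z * ‖G z‖ + E z) + (S N).indicator (fun _ => ENNReal.ofReal (B * M)) z := by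
      intro z hz
      refine ENNReal.ofReal_add_le.trans ?_
      rw [ENNReal.ofReal_mul hB]
      gcongr
      split_ifs with hc
      · rw [Set.indicator_of_mem (show z ∈ S N from ⟨hz, hc⟩)]
      · simp
    refine (setLIntegral_mono' H.D₁.isOpen.measurableSet h1).trans ?_
    rw [lintegral_add_right _ (measurable_const.indicator (hSm N)), lintegral_const_mul' _ _ ENNReal.ofReal_ne_top,
      lintegral_indicator (hSm N), lintegral_const, Measure.restrict_restrict (hSm N), Measure.restrict_apply_univ, Set.inter_eq_left.mpr (hSub N)]
  have hlim : Filter.Tendsto (fun N => volume (S N)) Filter.atTop (nhds 0) := by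
    have h0 : ⋂ N, S N = ∅ := by
      rw [Set.eq_empty_iff_forall_notMem]
      intro z hz
      rw [Set.mem_iInter] at hz
      have hr := H.D₂.neg (H.maps z (hz 0).1)
      obtain ⟨N, hN⟩ := exists_nat_one_div_lt (show 0 < -r₂ (φ z) / 2 by linarith)
      have := (hz N).2
      linarith
    have := tendsto_measure_iInter_atTop (μ := (volume : Measure (Fin n → ℂ))) (s := S) (fun N => (hSm N).nullMeasurableSet) ?_ ⟨0, ?_⟩
    · rwa [h0, measure_empty] at this
    · intro a b hab z hz
      refine ⟨hz.1, le_trans ?_ hz.2⟩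
      have := one_div_le_one_div_of_le (show (0:ℝ) < a + 1 by positivity) (show (a:ℝ) + 1 ≤ b + 1 by gcongr)
      linarith
    · exact (lt_of_le_of_lt (measure_mono (hSub 0)) H.D₁.bdd.measure_lt_top).ne
  have hl2 : Filter.Tendsto (fun N => ENNReal.ofReal B * (∫⁻ z in Ω₁, ENNReal.ofReal (-r₁ z * ‖G z‖ + E z)) + ENNReal.ofReal (B * M) * volume (S N)) Filter.atTop
      (nhds (ENNReal.ofReal B * (∫⁻ z in Ω₁, ENNReal.ofReal (-r₁ z * ‖G z‖ + E z)) + ENNReal.ofReal (B * M) * 0)) :=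
    tendsto_const_nhds.add (ENNReal.Tendsto.const_mul hlim (Or.inr ENNReal.ofReal_ne_top))
  rw [mul_zero, add_zero] at hl2
  exact ge_of_tendsto' hl2 hbound

end
end

section
set_option maxSynthPendingDepth 3

section
variable {m : ℕ}
open MeasureTheory

lemma exists_AA (k : Fin (m+1)) (ℓ : (Fin (m+1) → ℂ) →ₗ[ℂ] ℂ) {c' C' : ℝ} (hc' : 0 < c') (hk : c' ≤ ‖ℓ (Pi.single k 1)‖) (hC : ∀ v, ‖ℓ v‖ ≤ C' * ‖v‖) (hC0 : 0 ≤ C') :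
    ∃ A : (Fin (m+1) → ℂ) ≃L[ℂ] (Fin m → ℂ) × ℂ, (∀ z, (A z).2 = ℓ z) ∧ (∀ z, ‖(A z).1‖ ≤ ‖z‖) ∧
      (∀ p, ‖A.symm p‖ ≤ ‖p.1‖ + (‖p.2‖ + C' * ‖p.1‖) / c') ∧ (∀ w : ℂ, A.symm (0, w) = (w / ℓ (Pi.single k 1)) • Pi.single k 1) := by
  have hL : ℓ (Pi.single k 1) ≠ 0 := by
    intro h; rw [h, norm_zero] at hk; linarith
  have hins : ∀ (y : ℂ) (x : Fin m → ℂ), (k.insertNth y x : Fin (m+1) → ℂ) = k.insertNth 0 x + y • Pi.single k 1 := by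
    intro y x
    funext i
    refine Fin.succAboveCases k ?_ (fun j => ?_) i
    · simp
    · simp [Fin.succAbove_ne]
  have hinsl : ∀ (y : ℂ) (x : Fin m → ℂ), ℓ (k.insertNth y x : Fin (m+1) → ℂ) = ℓ (k.insertNth 0 x : Fin (m+1) → ℂ) + y * ℓ (Pi.single k 1) := by
    intro y x
    rw [hins y x, map_add, map_smul, smul_eq_mul]
  let A₀ : (Fin (m+1) → ℂ) ≃ₗ[ℂ] (Fin m → ℂ) × ℂ :=
    { toFun := fun z => (fun j => z (k.succAbove j), ℓ z)
      map_add' := fun x y => by ext <;> simp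
      map_smul' := fun x y => by ext <;> simp
      invFun := fun p => (k.insertNth ((p.2 - ℓ (k.insertNth 0 p.1 : Fin (m+1) → ℂ)) / ℓ (Pi.single k 1)) p.1 : Fin (m+1) → ℂ)
      left_inv := fun z => by
        simp only
        have e : z = (k.insertNth (z k) (fun j => z (k.succAbove j)) : Fin (m+1) → ℂ) := (Fin.insertNth_self_removeNth k z).symm
        have h1 := hinsl (z k) (fun j => z (k.succAbove j))
        rw [← e] at h1
        rw [h1, add_sub_cancel_left, mul_div_cancel_right₀ _ hL, ← e]
      right_inv := fun p => by
        ext i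
        · simp
        · simp only
          rw [hinsl, div_mul_cancel₀ _ hL]; ring }
  refine ⟨A₀.toContinuousLinearEquiv, fun z => rfl, fun z => ?_, fun p => ?_, fun w => ?_⟩
  · change ‖(fun j => z (k.succAbove j))‖ ≤ ‖z‖
    exact (pi_norm_le_iff_of_nonneg (norm_nonneg _)).mpr fun j => norm_le_pi_norm z _
  · change ‖(k.insertNth ((p.2 - ℓ (k.insertNth 0 p.1 : Fin (m+1) → ℂ)) / ℓ (Pi.single k 1)) p.1 : Fin (m+1) → ℂ)‖ ≤ _
    have h0 : ‖(k.insertNth 0 p.1 : Fin (m+1) → ℂ)‖ ≤ ‖p.1‖ := by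
      refine (pi_norm_le_iff_of_nonneg (norm_nonneg _)).mpr fun i => ?_
      refine Fin.succAboveCases k ?_ (fun j => ?_) i
      · simp
      · simpa using norm_le_pi_norm p.1 j
    have h1 : ‖(p.2 - ℓ (k.insertNth 0 p.1 : Fin (m+1) → ℂ)) / ℓ (Pi.single k 1)‖ ≤ (‖p.2‖ + C' * ‖p.1‖) / c' := by
      rw [norm_div]
      refine div_le_div₀ (by positivity) ?_ hc' hk
      refine (norm_sub_le _ _).trans ?_
      have := (hC (k.insertNth 0 p.1 : Fin (m+1) → ℂ)).trans (mul_le_mul_of_nonneg_left h0 hC0)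
      linarith
    have p1 : 0 ≤ (‖p.2‖ + C' * ‖p.1‖) / c' := by positivity
    refine (pi_norm_le_iff_of_nonneg (by positivity)).mpr fun i => ?_
    refine Fin.succAboveCases k ?_ (fun j => ?_) i
    · rw [Fin.insertNth_apply_same]
      linarith [norm_nonneg p.1]
    · rw [Fin.insertNth_apply_succAbove]
      linarith [norm_le_pi_norm p.1 j]
  · change (k.insertNth ((w - ℓ (k.insertNth 0 0 : Fin (m+1) → ℂ)) / ℓ (Pi.single k 1)) 0 : Fin (m+1) → ℂ) = _
    have h0 : (k.insertNth 0 0 : Fin (m+1) → ℂ) = 0 := by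
      funext i
      refine Fin.succAboveCases k ?_ (fun j => ?_) i <;> simp
    rw [hins, h0, map_zero, sub_zero, zero_add]

lemma exists_BB {n : ℕ} (β : (Fin n → ℂ) →L[ℝ] (Fin n → ℂ) →L[ℝ] ℝ) : ∃ B : (Fin n → ℂ) →L[ℂ] (Fin n → ℂ) →L[ℂ] ℂ,
    (∀ v, (B v v).re = (β v v - β (I • v) (I • v)) / 4) ∧ ∀ u v, ‖B u v‖ ≤ ‖β‖ * ‖u‖ * ‖v‖ := by
  set b : (Fin n → ℂ) → (Fin n → ℂ) → ℂ := fun u v => ((β u v - β (I • u) (I • v) : ℝ) : ℂ) / 4 - I / 4 * ((β u (I • v) + β (I • u) v : ℝ) : ℂ) with hb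
  have hII : ∀ u : Fin n → ℂ, I • I • u = -u := fun u => by rw [smul_smul, I_mul_I, neg_one_smul]
  let B₀ : (Fin n → ℂ) →ₗ[ℂ] (Fin n → ℂ) →ₗ[ℂ] ℂ := LinearMap.mk₂ ℂ b
    (fun u u' v => by simp only [hb, smul_add, map_add, add_apply]; push_cast; ring)
    (fun a u v => by
      simp only [hb]
      rw [smul_comm I a u, smul_re_im a u, smul_re_im a (I • u), hII]
      simp only [map_add, map_smul, map_neg, smul_neg, add_apply, smul_apply, neg_apply, smul_eq_mul]
      push_cast
      conv_rhs => rw [← re_add_im a]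
      linear_combination ((a.im : ℂ) * ((β u (I • v) : ℝ) + (β (I • u) v : ℝ)) / 4) * I_sq)
    (fun u v v' => by simp only [hb, smul_add, map_add]; push_cast; ring)
    (fun a u v => by
      simp only [hb]
      rw [smul_comm I a v, smul_re_im a v, smul_re_im a (I • v), hII]
      simp only [map_add, map_smul, map_neg, smul_neg, smul_eq_mul]
      push_cast
      conv_rhs => rw [← re_add_im a]
      linear_combination ((a.im : ℂ) * ((β u (I • v) : ℝ) + (β (I • u) v : ℝ)) / 4) * I_sq)
  have hbd : ∀ u v, ‖B₀ u v‖ ≤ ‖β‖ * ‖u‖ * ‖v‖ := by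
    intro u v
    change ‖b u v‖ ≤ _
    have hI : ∀ u : Fin n → ℂ, ‖I • u‖ = ‖u‖ := fun u => by rw [norm_smul, norm_I, one_mul]
    have h1 := β.le_opNorm₂ u v
    have h2 := β.le_opNorm₂ (I • u) (I • v)
    have h3 := β.le_opNorm₂ (I • u) v
    have h4 := β.le_opNorm₂ u (I • v)
    rw [hI] at h3 h4
    rw [hI, hI] at h2
    simp only [hb]
    refine (norm_sub_le _ _).trans ?_
    rw [norm_div, norm_mul, norm_div, norm_I, norm_real, norm_real]
    have h5 := norm_sub_le (β u v) (β (I • u) (I • v))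
    have h6 := norm_add_le (β u (I • v)) (β (I • u) v)
    simp only [RCLike.norm_ofNat]
    linarith
  refine ⟨B₀.mkContinuous₂ ‖β‖ hbd, fun v => ?_, hbd⟩
  change (b v v).re = _
  simp [hb]

lemma map_vol_smul (A : (Fin (m+1) → ℂ) ≃L[ℂ] (Fin m → ℂ) × ℂ) : ∃ κ : ENNReal, κ ≠ 0 ∧ κ ≠ ⊤ ∧
    Measure.map A (volume : Measure (Fin (m+1) → ℂ)) = κ • (volume : Measure ((Fin m → ℂ) × ℂ)) := by
  have h1 : (Measure.map A (volume : Measure (Fin (m+1) → ℂ))).IsAddHaarMeasure := A.isAddHaarMeasure_map _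
  have : (volume : Measure ((Fin m → ℂ) × ℂ)).IsAddHaarMeasure :=
    Measure.prod.instIsAddHaarMeasure (volume : Measure (Fin m → ℂ)) (volume : Measure ℂ)
  have h2 := Measure.isAddLeftInvariant_eq_smul (Measure.map A (volume : Measure (Fin (m+1) → ℂ))) (volume : Measure ((Fin m → ℂ) × ℂ))
  refine ⟨_, ?_, ENNReal.coe_ne_top, h2⟩
  have := Measure.addHaarScalarFactor_pos_of_isAddHaarMeasure (Measure.map A (volume : Measure (Fin (m+1) → ℂ))) (volume : Measure ((Fin m → ℂ) × ℂ))
  exact_mod_cast this.ne'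

lemma shear_preserving {Q : (Fin m → ℂ) → ℂ} (hQ : Continuous Q) :
    MeasurePreserving (fun p : (Fin m → ℂ) × ℂ => (p.1, p.2 + Q p.1)) volume volume := by
  refine MeasurePreserving.skew_product (g := fun x w => w + Q x) (MeasurePreserving.id volume) (by fun_prop) ?_
  exact Filter.Eventually.of_forall fun x => map_add_right_eq_self volume (Q x)

end
end

section
set_option maxSynthPendingDepth 3

section
variable {m : ℕ}
open MeasureTheory

lemma Lam_smul {n : ℕ} (r : (Fin n → ℂ) → ℝ) (z) (a : ℂ) (v : Fin n → ℂ) : Lam r z (a • v) = ‖a‖ ^ 2 * Lam r z v := by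
  have hII : I • I • v = -v := by rw [smul_smul, I_mul_I, neg_one_smul]
  unfold Lam
  rw [smul_comm I a v, smul_re_im a v, smul_re_im a (I • v), hII, ← normSq_eq_norm_sq, normSq_apply]
  simp only [map_add, map_smul, map_neg, smul_neg, add_apply, smul_apply, neg_apply, smul_eq_mul]
  ring

/-- normal form coordinates at a point -/
structure Coords (m : ℕ) (U : Set (Fin (m+1) → ℂ)) (r : (Fin (m+1) → ℂ) → ℝ) (a : Fin (m+1) → ℂ) (k : Fin (m+1)) (c₁ C₁ r₀ : ℝ)
    (Ψ : (Fin (m+1) → ℂ) ≃ₜ (Fin m → ℂ) × ℂ) (H : (Fin m → ℂ) → ℝ) : Prop where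
  dif : Differentiable ℂ Ψ
  difs : Differentiable ℂ Ψ.symm
  der : ∀ z, ‖Ψ z‖ ≤ 1 → ‖fderiv ℂ Ψ z‖ ≤ C₁
  base : ∀ w : ℂ, Ψ.symm (0, w) = a + (w / ell r a (Pi.single k 1)) • Pi.single k 1
  vol : ∃ κ : ENNReal, κ ≠ 0 ∧ κ ≠ ⊤ ∧ Measure.map Ψ volume = κ • (volume : Measure ((Fin m → ℂ) × ℂ))
  Hc : Continuous H
  Hh : ∀ (c : ℂ) x, H (c • x) = ‖c‖ ^ 2 * H x
  Hl : ∀ x, c₁ * ‖x‖ ^ 2 ≤ H x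
  Hu : ∀ x, H x ≤ C₁ * ‖x‖ ^ 2
  memU : ∀ p ∈ ball (0 : (Fin m → ℂ) × ℂ) r₀, Ψ.symm p ∈ U
  exp : ∀ p ∈ ball (0 : (Fin m → ℂ) × ℂ) r₀, |r (Ψ.symm p) - (H p.1 + 2 * p.2.re + r a)| ≤ EE C₁ p

lemma err_arith {C KA q X W Uu v s t : ℝ} (hC : 1 ≤ C) (hKA : 1 ≤ KA) (hq : 0 ≤ q) (hX : 0 ≤ X) (hX1 : X ≤ 1) (hW : 0 ≤ W) (hW1 : W ≤ 1)
    (hU : 0 ≤ Uu) (hU1 : Uu ≤ W + q * X ^ 2) (hv : 0 ≤ v) (hv1 : v ≤ KA * (X + Uu)) (hs : 0 ≤ s) (hs1 : s ≤ KA * Uu) (ht1 : t ≤ KA * X) :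
    C * (t * s + s ^ 2) + C * v ^ 3 ≤ (C * KA ^ 2 * (3 + q + 2 * q ^ 2) + 4 * C * KA ^ 3 * ((1 + q) ^ 3 + 1)) * (W ^ 2 + W * X + X ^ 3) := by
  have hC0 : 0 ≤ C := by linarith
  have hK0 : 0 ≤ KA := by linarith
  set e := W ^ 2 + W * X + X ^ 3 with he
  have e0 : 0 ≤ e := by positivity
  have hX3 : 0 ≤ X ^ 3 := by positivity
  have hWX : 0 ≤ W * X := by positivity
  have hX4 : X ^ 4 ≤ X ^ 3 := by nlinarith
  have hW3 : W ^ 3 ≤ W ^ 2 := by nlinarith [sq_nonneg W]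
  have a1 : X * Uu ≤ (1 + q) * e := by
    have := mul_le_mul_of_nonneg_left hU1 hX
    have : 0 ≤ q * (W ^ 2 + W * X) := by positivity
    nlinarith [sq_nonneg W]
  have a2 : Uu ^ 2 ≤ (2 + 2 * q ^ 2) * e := by
    have h1 : Uu ^ 2 ≤ (W + q * X ^ 2) ^ 2 := by gcongr
    have h2 : (W + q * X ^ 2) ^ 2 ≤ 2 * W ^ 2 + 2 * (q ^ 2 * X ^ 4) := by nlinarith [sq_nonneg (W - q * X ^ 2)]
    have h3 : q ^ 2 * X ^ 4 ≤ q ^ 2 * X ^ 3 := by gcongr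
    have h4 : 0 ≤ q ^ 2 * (W ^ 2 + W * X) := by positivity
    nlinarith
  have a3 : t * s ≤ KA ^ 2 * (X * Uu) := by
    calc t * s ≤ (KA * X) * (KA * Uu) := by gcongr
      _ = _ := by ring
  have a4 : s ^ 2 ≤ KA ^ 2 * Uu ^ 2 := by
    calc s ^ 2 ≤ (KA * Uu) ^ 2 := by gcongr
      _ = _ := by ring
  have a5 : t * s + s ^ 2 ≤ KA ^ 2 * ((3 + q + 2 * q ^ 2) * e) := by
    have : KA ^ 2 * (X * Uu + Uu ^ 2) ≤ KA ^ 2 * ((3 + q + 2 * q ^ 2) * e) := by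
      gcongr; linarith
    linarith
  have a6 : v ^ 3 ≤ KA ^ 3 * (4 * ((1 + q) ^ 3 + 1) * e) := by
    have h1 : X + Uu ≤ (1 + q) * X + W := by nlinarith [mul_nonneg hq hX, mul_nonneg (mul_nonneg hq hX) (sub_nonneg.mpr hX1)]
    have h2 : v ≤ KA * ((1 + q) * X + W) := hv1.trans (by gcongr)
    have h3 : v ^ 3 ≤ (KA * ((1 + q) * X + W)) ^ 3 := by gcongr
    have h4 : ((1 + q) * X + W) ^ 3 ≤ 4 * (((1 + q) * X) ^ 3 + W ^ 3) := by
      have := add_pow_le (show 0 ≤ (1 + q) * X by positivity) hW 3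
      norm_num at this
      linarith
    have h5 : 4 * (((1 + q) * X) ^ 3 + W ^ 3) ≤ 4 * ((1 + q) ^ 3 + 1) * e := by
      have g1 : 0 ≤ (1 + q) ^ 3 := by positivity
      rw [mul_pow]
      nlinarith [mul_nonneg g1 (show 0 ≤ W ^ 2 + W * X by positivity)]
    calc v ^ 3 ≤ (KA * ((1 + q) * X + W)) ^ 3 := h3
      _ = KA ^ 3 * ((1 + q) * X + W) ^ 3 := by ring
      _ ≤ KA ^ 3 * (4 * ((1 + q) ^ 3 + 1) * e) := by gcongr; exact h4.trans h5
  have a7 := mul_le_mul_of_nonneg_left a5 hC0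
  have a8 := mul_le_mul_of_nonneg_left a6 hC0
  linarith

lemma quad_deriv {n : ℕ} (B : (Fin n → ℂ) →L[ℂ] (Fin n → ℂ) →L[ℂ] ℂ) (T : (Fin m → ℂ) →L[ℂ] (Fin n → ℂ)) (x) :
    HasFDerivAt (fun x => (2⁻¹ : ℂ) * B (T x) (T x)) ((2⁻¹ : ℂ) • ((B (T x)).comp T + (B.flip (T x)).comp T)) x := by
  have h1 : HasFDerivAt (fun x => B (T x)) (B.comp T) x := (B.comp T).hasFDerivAt
  have h2 := (h1.clm_apply T.hasFDerivAt).const_mul (2⁻¹ : ℂ)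
  convert! h2 using 1

lemma two_terms {C KA X a b c : ℝ} (hC : 0 ≤ C) (hK : 0 ≤ KA) (ha : 0 ≤ a) (hX : X ≤ 1) (hX0 : 0 ≤ X)
    (h1 : b ≤ KA * X) (h2 : c ≤ KA * a) (_ : 0 ≤ b) (hc : 0 ≤ c) : C * b * c ≤ C * KA ^ 2 * a := by
  calc C * b * c ≤ C * (KA * X) * (KA * a) := by gcongr
    _ ≤ C * (KA * 1) * (KA * a) := by gcongr
    _ = _ := by ring

variable {Ω U : Set (Fin (m+1) → ℂ)} {r : (Fin (m+1) → ℂ) → ℝ} {ε c C d : ℝ}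

set_option maxHeartbeats 4000000 in
lemma Dom.coords (D : Dom (m+1) Ω U r ε c C d) {c' : ℝ} (hc' : 0 < c') : ∃ c₁ C₁ r₀ : ℝ, 0 < c₁ ∧ c₁ ≤ 1 ∧ 1 ≤ C₁ ∧ 0 < r₀ ∧ r₀ ≤ c₁ / (8 * C₁) ∧ r₀ ≤ 1 ∧
    ∀ a ∈ Ω, -ε ≤ r a → ∀ k, c' ≤ ‖ell r a (Pi.single k 1)‖ → ∃ Ψ H, Coords m U r a k c₁ C₁ r₀ Ψ H := by
  have hc := D.hc
  have hc1 := D.hc1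
  have hC := D.hC
  have hd := D.hd
  have hC0 : 0 ≤ C := by linarith
  set KA : ℝ := 1 + (1 + C) / c' with hKA
  have hKA1 : 1 ≤ KA := by
    have : 0 ≤ (1 + C) / c' := by positivity
    linarith
  have hK0 : 0 ≤ KA := by linarith
  set q : ℝ := C * KA ^ 2 with hq
  have hq0 : 0 ≤ q := by positivity
  set C₁ : ℝ := C * KA ^ 2 * (3 + q + 2 * q ^ 2) + 4 * C * KA ^ 3 * ((1 + q) ^ 3 + 1) + C * (1 + KA ^ 2) with hC₁
  have hp1 : 0 ≤ C * KA ^ 2 * (3 + q + 2 * q ^ 2) := by positivity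
  have hp2 : 0 ≤ 4 * C * KA ^ 3 * ((1 + q) ^ 3 + 1) := by positivity
  have hp3 : 1 ≤ C * (1 + KA ^ 2) := by nlinarith [sq_nonneg KA, mul_nonneg hC0 (sq_nonneg KA)]
  have hC₁1 : 1 ≤ C₁ := by linarith
  have hC₁2 : C * (1 + KA ^ 2) ≤ C₁ := by linarith
  refine ⟨c / 4, C₁, min (min (c / 4 / (8 * C₁)) 1) (d / (KA * (2 + q))), by positivity, by linarith, hC₁1, ?_, (min_le_left _ _).trans (min_le_left _ _), (min_le_left _ _).trans (min_le_right _ _), ?_⟩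
  · refine lt_min (lt_min ?_ one_pos) ?_ <;> positivity
  intro a ha hs k hk
  set β := fderiv ℝ (fderiv ℝ r) a with hβ
  have hβC : ‖β‖ ≤ C := D.b2 a ha
  have hellC : ∀ v, ‖ellL r a v‖ ≤ C * ‖v‖ := fun v => (norm_ell_le r a v).trans (mul_le_mul_of_nonneg_right (D.b1 a ha) (norm_nonneg _))
  obtain ⟨A, hA2, hA1, hAs, hA0⟩ := exists_AA k (ellL r a) hc' hk hellC hC0
  obtain ⟨B, hB1, hB2⟩ := exists_BB β
  have hAs' : ∀ p, ‖A.symm p‖ ≤ KA * (‖p.1‖ + ‖p.2‖) := by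
    intro p
    refine (hAs p).trans ?_
    rw [hKA, add_mul, one_mul, div_mul_eq_mul_div]
    have : (‖p.2‖ + C * ‖p.1‖) / c' ≤ (1 + C) * (‖p.1‖ + ‖p.2‖) / c' := by
      gcongr
      nlinarith [norm_nonneg p.1, norm_nonneg p.2, mul_nonneg hC0 (norm_nonneg p.2)]
    linarith [norm_nonneg p.2]
  have hBC : ∀ u v, ‖B u v‖ ≤ C * ‖u‖ * ‖v‖ := fun u v => (hB2 u v).trans (by gcongr)
  set T : (Fin m → ℂ) →L[ℂ] (Fin (m+1) → ℂ) := (A.symm : ((Fin m → ℂ) × ℂ) →L[ℂ] (Fin (m+1) → ℂ)).comp (ContinuousLinearMap.inl ℂ (Fin m → ℂ) ℂ) with hT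
  have hTa : ∀ x, T x = A.symm (x, 0) := fun x => rfl
  have hTn : ∀ x, ‖T x‖ ≤ KA * ‖x‖ := fun x => by simpa [hTa] using hAs' (x, 0)
  have hTl : ∀ x, ‖x‖ ≤ ‖T x‖ := fun x => by
    have := hA1 (T x)
    rwa [hTa, A.apply_symm_apply] at this
  set Q : (Fin m → ℂ) → ℂ := fun x => (2⁻¹ : ℂ) * B (T x) (T x) with hQ
  have hQd : Differentiable ℂ Q := by
    exact fun x => (quad_deriv B T x).differentiableAt
  have hQn : ∀ x, ‖Q x‖ ≤ q * ‖x‖ ^ 2 := by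
    intro x
    have h1 := hBC (T x) (T x)
    have h2 : C * ‖T x‖ * ‖T x‖ ≤ C * (KA * ‖x‖) * (KA * ‖x‖) := by
      have := hTn x
      gcongr
    simp only [hQ, norm_mul, norm_inv, RCLike.norm_ofNat]
    have : 0 ≤ ‖B (T x) (T x)‖ := norm_nonneg _
    nlinarith
  let Ψ : (Fin (m+1) → ℂ) ≃ₜ (Fin m → ℂ) × ℂ :=
    { toFun := fun z => ((A (z - a)).1, (A (z - a)).2 + Q (A (z - a)).1)
      invFun := fun p => a + A.symm (p.1, p.2 - Q p.1)
      left_inv := fun z => by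
        simp only [add_sub_cancel_right, Prod.mk.eta, ContinuousLinearEquiv.symm_apply_apply, add_sub_cancel]
      right_inv := fun p => by
        simp only [add_sub_cancel_left, ContinuousLinearEquiv.apply_symm_apply, sub_add_cancel, Prod.mk.eta]
      continuous_toFun := by
        have := hQd.continuous
        fun_prop
      continuous_invFun := by
        have := hQd.continuous
        fun_prop }
  have hΨ : ∀ z, Ψ z = ((A (z - a)).1, (A (z - a)).2 + Q (A (z - a)).1) := fun z => rfl
  have hΨs : ∀ p, Ψ.symm p = a + A.symm (p.1, p.2 - Q p.1) := fun p => rfl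
  have hr0 : ∀ p ∈ ball (0 : (Fin m → ℂ) × ℂ) (min (min (c / 4 / (8 * C₁)) 1) (d / (KA * (2 + q)))), ‖p.1‖ ≤ 1 ∧ ‖p.2‖ ≤ 1 ∧ ‖A.symm (p.1, p.2 - Q p.1)‖ < d := by
    intro p hp
    rw [mem_ball_zero_iff] at hp
    have h1 : ‖p.1‖ ≤ ‖p‖ := norm_fst_le p
    have h2 : ‖p.2‖ ≤ ‖p‖ := norm_snd_le p
    have h3 : ‖p‖ < 1 := hp.trans_le ((min_le_left _ _).trans (min_le_right _ _))
    have h4 : ‖p‖ < d / (KA * (2 + q)) := hp.trans_le (min_le_right _ _)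
    rw [lt_div_iff₀ (by positivity)] at h4
    refine ⟨by linarith, by linarith, lt_of_le_of_lt (hAs' _) ?_⟩
    have h5 : ‖p.2 - Q p.1‖ ≤ ‖p.2‖ + q * ‖p.1‖ ^ 2 := (norm_sub_le _ _).trans (by linarith [hQn p.1])
    have h6 : ‖p.1‖ ^ 2 ≤ ‖p‖ := by nlinarith [norm_nonneg p.1]
    have h7 : ‖p.1‖ + ‖p.2 - Q p.1‖ ≤ ‖p‖ * (2 + q) := by nlinarith [mul_le_mul_of_nonneg_left h6 hq0]
    have h8 := mul_le_mul_of_nonneg_left h7 hK0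
    simp only at h8 ⊢
    linarith
  refine ⟨Ψ, fun x => Lam r a (T x) / 4, ?_, ?_, ?_, ?_, ?_, ?_, ?_, ?_, ?_, ?_, ?_⟩
  · change Differentiable ℂ fun z => ((A (z - a)).1, (A (z - a)).2 + Q (A (z - a)).1)
    fun_prop
  · change Differentiable ℂ fun p : (Fin m → ℂ) × ℂ => a + A.symm (p.1, p.2 - Q p.1)
    fun_prop
  · intro z hz
    have hx : ‖(A (z - a)).1‖ ≤ 1 := (norm_fst_le (Ψ z)).trans hz
    have h1 : HasFDerivAt (fun z => A (z - a)) (A : (Fin (m+1) → ℂ) →L[ℂ] (Fin m → ℂ) × ℂ) z := by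
      have := (A : (Fin (m+1) → ℂ) →L[ℂ] (Fin m → ℂ) × ℂ).hasFDerivAt.comp z ((hasFDerivAt_id z).sub_const a)
      exact this
    have h2 := h1.fst
    have h3 := h1.snd.add ((quad_deriv B T (A (z - a)).1).comp z h2)
    have h4 : fderiv ℂ Ψ z = _ := (h2.prodMk h3).fderiv
    rw [h4]
    refine ContinuousLinearMap.opNorm_le_bound _ (by linarith) fun v => ?_
    have hv0 := norm_nonneg v
    refine le_trans ?_ (mul_le_mul_of_nonneg_right hC₁2 hv0)
    have g1 : ‖T (A v).1‖ ≤ KA * ‖v‖ := (hTn _).trans (mul_le_mul_of_nonneg_left (hA1 v) hK0)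
    have g2 : ‖T (A (z - a)).1‖ ≤ KA * ‖(A (z - a)).1‖ := hTn _
    have g3 := (hBC (T (A (z - a)).1) (T (A v).1)).trans (two_terms hC0 hK0 hv0 hx (norm_nonneg _) g2 g1 (norm_nonneg _) (norm_nonneg _))
    have g4 := (hBC (T (A v).1) (T (A (z - a)).1)).trans (le_trans (le_of_eq (by ring)) (two_terms hC0 hK0 hv0 hx (norm_nonneg _) g2 g1 (norm_nonneg _) (norm_nonneg _)))
    change max ‖(A v).1‖ ‖(A v).2 + (2⁻¹ : ℂ) * (B (T (A (z - a)).1) (T (A v).1) + B (T (A v).1) (T (A (z - a)).1))‖ ≤ _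
    have g5 : 0 ≤ C * KA ^ 2 * ‖v‖ := by positivity
    refine max_le ?_ ?_
    · have := hA1 v
      nlinarith
    · refine (norm_add_le _ _).trans ?_
      rw [norm_mul, norm_inv, RCLike.norm_ofNat]
      have g6 := norm_add_le (B (T (A (z - a)).1) (T (A v).1)) (B (T (A v).1) (T (A (z - a)).1))
      have g7 : ‖(A v).2‖ ≤ C * ‖v‖ := by rw [hA2]; exact hellC v
      linarith
  · intro w
    rw [hΨs]
    have : Q 0 = 0 := by simp [hQ]
    simp only [this, sub_zero]
    rw [hA0]
    rfl
  · obtain ⟨κ, k1, k2, k3⟩ := map_vol_smul A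
    refine ⟨κ, k1, k2, ?_⟩
    have e1 : (Ψ : (Fin (m+1) → ℂ) → (Fin m → ℂ) × ℂ) = (fun p : (Fin m → ℂ) × ℂ => (p.1, p.2 + Q p.1)) ∘ (A ∘ fun z => z - a) := rfl
    have hsh := shear_preserving hQd.continuous
    rw [e1, ← Measure.map_map hsh.measurable (A.continuous.measurable.comp (measurable_sub_const a)),
      ← Measure.map_map A.continuous.measurable (measurable_sub_const a), map_sub_right_eq_self, k3, Measure.map_smul, hsh.map_eq]
  · have h1 : Continuous fun v => Lam r a v := by
      unfold Lam
      have : Continuous fun v : Fin (m+1) → ℂ => I • v := continuous_const_smul I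
      exact ((β.continuous.clm_apply continuous_id).add ((β.continuous.comp this).clm_apply this))
    exact (h1.comp T.continuous).div_const _
  · intro c x
    rw [map_smul, Lam_smul]
    ring
  · intro x
    have h1 := D.lam a ha hs (T x)
    have h2 : ‖x‖ ^ 2 ≤ ‖T x‖ ^ 2 := by gcongr; exact hTl x
    nlinarith
  · intro x
    have h1 := (le_abs_self _).trans (Lam_le r a (T x))
    have h2 : ‖T x‖ ^ 2 ≤ (KA * ‖x‖) ^ 2 := by gcongr; exact hTn x
    have h3 : 2 * ‖β‖ * ‖T x‖ ^ 2 ≤ 2 * C * (KA * ‖x‖) ^ 2 := by gcongr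
    have h4 : 0 ≤ C * ‖x‖ ^ 2 := by positivity
    have h5 : C * (1 + KA ^ 2) * ‖x‖ ^ 2 ≤ C₁ * ‖x‖ ^ 2 := by gcongr
    have h6 : 0 ≤ C * (KA ^ 2 * ‖x‖ ^ 2) := by positivity
    nlinarith
  · intro p hp
    rw [hΨs]
    exact D.tayU a ha _ (hr0 p hp).2.2
  · intro p hp
    obtain ⟨g1, g2, g3⟩ := hr0 p hp
    rw [hΨs]
    set u := p.2 - Q p.1 with hu
    set s := A.symm (0, u) with hsd
    have hv : A.symm (p.1, u) = T p.1 + s := by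
      rw [hTa, hsd, ← map_add]
      simp
    have ht := D.tay a ha _ g3
    have hellv : ell r a (A.symm (p.1, u)) = u := by
      have := hA2 (A.symm (p.1, u))
      rw [A.apply_symm_apply] at this
      exact this.symm
    have hfd : fderiv ℝ r a (A.symm (p.1, u)) = 2 * u.re := by rw [← ell_re, hellv]
    rw [hfd, ← hβ] at ht
    have hun : ‖u‖ ≤ ‖p.2‖ + q * ‖p.1‖ ^ 2 := (norm_sub_le _ _).trans (by linarith [hQn p.1])
    have hsn : ‖s‖ ≤ KA * ‖u‖ := by simpa using hAs' (0, u)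
    have hvn : ‖A.symm (p.1, u)‖ ≤ KA * (‖p.1‖ + ‖u‖) := hAs' _
    have hquad : |β (A.symm (p.1, u)) (A.symm (p.1, u)) - β (T p.1) (T p.1)| ≤ 2 * C * (‖T p.1‖ * ‖s‖ + ‖s‖ ^ 2) := by
      have e : β (A.symm (p.1, u)) (A.symm (p.1, u)) - β (T p.1) (T p.1) = β (T p.1) s + β s (T p.1) + β s s := by
        rw [hv]
        simp only [map_add, add_apply]
        ring
      rw [e]
      have b1 := (β.le_opNorm₂ (T p.1) s).trans (show ‖β‖ * ‖T p.1‖ * ‖s‖ ≤ C * ‖T p.1‖ * ‖s‖ by gcongr)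
      have b2 := (β.le_opNorm₂ s (T p.1)).trans (show ‖β‖ * ‖s‖ * ‖T p.1‖ ≤ C * ‖s‖ * ‖T p.1‖ by gcongr)
      have b3 := (β.le_opNorm₂ s s).trans (show ‖β‖ * ‖s‖ * ‖s‖ ≤ C * ‖s‖ * ‖s‖ by gcongr)
      rw [Real.norm_eq_abs] at b1 b2 b3
      have b4 := abs_add_three (β (T p.1) s) (β s (T p.1)) (β s s)
      have b5 : 0 ≤ C * ‖s‖ * ‖s‖ := by positivity
      nlinarith
    have hre : 2 * u.re = 2 * p.2.re - (β (T p.1) (T p.1) - β (I • T p.1) (I • T p.1)) / 4 := by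
      rw [hu, sub_re, ← hB1]
      simp only [hQ]
      have : ((2⁻¹ : ℂ) * B (T p.1) (T p.1)).re = (B (T p.1) (T p.1)).re / 2 := by
        rw [show (2⁻¹ : ℂ) = ((2⁻¹ : ℝ) : ℂ) by simp, re_ofReal_mul]; ring
      rw [this]; ring
    have hfin := err_arith hC hKA1 hq0 (norm_nonneg p.1) g1 (norm_nonneg p.2) g2 (norm_nonneg u) hun (norm_nonneg _) hvn (norm_nonneg s) hsn (hTn p.1)
    have hE : (C * KA ^ 2 * (3 + q + 2 * q ^ 2) + 4 * C * KA ^ 3 * ((1 + q) ^ 3 + 1)) * (‖p.2‖ ^ 2 + ‖p.2‖ * ‖p.1‖ + ‖p.1‖ ^ 3) ≤ EE C₁ p := by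
      unfold EE
      gcongr
      linarith
    have hLam : Lam r a (T p.1) = β (T p.1) (T p.1) + β (I • T p.1) (I • T p.1) := rfl
    rw [abs_le] at ht hquad ⊢
    rw [hLam]
    constructor
    · linarith [ht.1, ht.2, hquad.1, hquad.2]
    · linarith [ht.1, ht.2, hquad.1, hquad.2]

end
end

section
set_option maxSynthPendingDepth 3

section
variable {m : ℕ}
open MeasureTheory

lemma Coords.transfer {U : Set (Fin (m+1) → ℂ)} {r : (Fin (m+1) → ℂ) → ℝ} {a k c₁ C₁ r₀} {Ψ : (Fin (m+1) → ℂ) ≃ₜ (Fin m → ℂ) × ℂ} {H}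
    (h : Coords m U r a k c₁ C₁ r₀ Ψ H) : ∃ κ : ENNReal, κ ≠ 0 ∧ κ ≠ ⊤ ∧
    (∀ (S : Set ((Fin m → ℂ) × ℂ)) (F : (Fin m → ℂ) × ℂ → ℂ), ‖∫ z in Ψ ⁻¹' S, F (Ψ z)‖ₑ = κ * ‖∫ p in S, F p‖ₑ) ∧
    (∀ (S : Set ((Fin m → ℂ) × ℂ)) (F : (Fin m → ℂ) × ℂ → ENNReal), ∫⁻ z in Ψ ⁻¹' S, F (Ψ z) = κ * ∫⁻ p in S, F p) := by
  obtain ⟨κ, k1, k2, k3⟩ := h.vol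
  refine ⟨κ, k1, k2, fun S F => ?_, fun S F => ?_⟩
  · rw [← Ψ.measurableEmbedding.setIntegral_map, k3, Measure.restrict_smul, integral_smul_measure, enorm_smul]
    congr 1
    rw [Real.enorm_eq_ofReal ENNReal.toReal_nonneg, ENNReal.ofReal_toReal k2]
  · rw [← Ψ.measurableEmbedding.lintegral_map, ← Ψ.measurableEmbedding.restrict_map, k3, Measure.restrict_smul, lintegral_smul_measure]
    rfl

lemma exists_chi (m : ℕ) {r₁ r₂ : ℝ} (h0 : 0 < r₁) (h1 : r₁ ≤ 1) (h : r₁ < r₂) : ∃ (χ : (Fin m → ℂ) × ℂ → ℝ) (B : ℝ), 0 ≤ B ∧ ContDiff ℝ 1 χ ∧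
    (∀ p, 0 ≤ χ p) ∧ (∀ p, χ p ≤ 1) ∧ (∀ p ∈ ball 0 r₁, χ p = 1) ∧ (∀ p, r₂ ≤ ‖p‖ → χ p = 0) ∧ (∀ δ > 0, ∀ p, ‖fderiv ℝ χ p‖ ≤ B * tt δ p) := by
  let b : ContDiffBump (0 : (Fin m → ℂ) × ℂ) := ⟨r₁, r₂, h0, h⟩
  have hb : ContDiff ℝ 1 b := b.contDiff
  have hone : ∀ p ∈ ball (0 : (Fin m → ℂ) × ℂ) r₁, b p = 1 := fun p hp => b.one_of_mem_closedBall (ball_subset_closedBall hp)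
  obtain ⟨B, hB⟩ := (b.hasCompactSupport.fderiv (𝕜 := ℝ)).exists_bound_of_continuous (hb.continuous_fderiv one_ne_zero)
  have hB0 : 0 ≤ B := (norm_nonneg _).trans (hB 0)
  refine ⟨b, B / r₁ ^ 2, by positivity, hb, fun p => b.nonneg, fun p => b.le_one, hone, fun p hp => b.zero_of_le_dist (by simpa [dist_zero_right] using hp), ?_⟩
  intro δ hδ p
  have ht := tt_pos hδ p
  by_cases hp : p ∈ ball (0 : (Fin m → ℂ) × ℂ) r₁
  · have : (b : (Fin m → ℂ) × ℂ → ℝ) =ᶠ[nhds p] fun _ => 1 := by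
      filter_upwards [isOpen_ball.mem_nhds hp] with q hq using hone q hq
    rw [this.fderiv_eq]
    simp
    positivity
  · rw [mem_ball_zero_iff, not_lt, Prod.norm_def, le_max_iff] at hp
    have : r₁ ^ 2 ≤ tt δ p := by
      unfold tt
      rcases hp with hp | hp
      · have : r₁ ^ 2 ≤ ‖p.1‖ ^ 2 := by gcongr
        linarith [norm_nonneg p.2]
      · nlinarith [sq_nonneg ‖p.1‖]
    rw [div_mul_eq_mul_div, le_div_iff₀ (by positivity)]
    exact mul_le_mul (hB p) this (by positivity) hB0

lemma kap_hol {n m : ℕ} {K δ : ℝ} {h : (Fin n → ℂ) → ℂ} {W : Set (Fin n → ℂ)} (hW : IsOpen W) (hh : DifferentiableOn ℂ h W) (h0 : ∀ z ∈ W, (δ:ℂ) - h z ≠ 0) {z} (hz : z ∈ W) (v) :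
    ContDiffAt ℝ 1 (fun z => kap m K δ (h z)) z ∧ dzv (fun z => kap m K δ (h z)) z v = 0 := by
  set k0 : (Fin n → ℂ) → ℂ := fun z => (h z + (1 / K : ℝ)) * ((δ - h z)⁻¹) ^ (m + 3) with hk0
  have hk : DifferentiableOn ℂ k0 W := (hh.add_const _).mul (((hh.const_sub _).inv h0).pow _)
  have hc := hol_contDiffAt_real (m := 1) hW hk hz
  have hd := hk.differentiableAt (hW.mem_nhds hz)
  have e : (fun z => kap m K δ (h z)) = fun z => conjCLE (k0 z) := rfl
  rw [e]
  constructor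
  · exact conjCLE.contDiff.contDiffAt.comp z hc
  · have h1 : HasFDerivAt (fun z => conjCLE (k0 z)) ((conjCLE : ℂ →L[ℝ] ℂ).comp ((fderiv ℂ k0 z).restrictScalars ℝ)) z :=
      (conjCLE : ℂ →L[ℝ] ℂ).hasFDerivAt.comp z (hd.hasFDerivAt.restrictScalars ℝ)
    unfold dzv
    rw [h1.fderiv]
    have : ∀ u, ((conjCLE : ℂ →L[ℝ] ℂ).comp ((fderiv ℂ k0 z).restrictScalars ℝ)) u = starRingEnd ℂ (fderiv ℂ k0 z u) := fun u => rfl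
    rw [this, this, map_smul, smul_eq_mul, map_mul, conj_I]
    linear_combination (starRingEnd ℂ (fderiv ℂ k0 z v) / 2) * I_sq

end
end

section
set_option maxSynthPendingDepth 3

section
variable {m : ℕ} {Ω₁ U₁ Ω₂ U₂ : Set (Fin (m+1) → ℂ)} {r₁ r₂ : (Fin (m+1) → ℂ) → ℝ} {φ : (Fin (m+1) → ℂ) → (Fin (m+1) → ℂ)} {ε₁ ε₂ c C d : ℝ}
open MeasureTheory

/-- pointwise facts on the test function -/
lemma Coords.test (D : Dom (m+1) Ω₁ U₁ r₁ ε₁ c C d) {a k} {c₁ C₁ r₀ K : ℝ} {Ψ : (Fin (m+1) → ℂ) ≃ₜ (Fin m → ℂ) × ℂ} {h}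
    (hΨ : Coords m U₁ r₁ a k c₁ C₁ r₀ Ψ h) (hc0 : 0 < c₁) (hc1 : c₁ ≤ 1) (hC1 : 1 ≤ C₁) (hr0 : 0 < r₀) (hr0' : r₀ ≤ c₁ / (8 * C₁)) (hr1 : r₀ ≤ 1)
    (ha : a ∈ Ω₁) (hK : 1 ≤ K) {χ : (Fin m → ℂ) × ℂ → ℝ} {Bχ r' : ℝ} (hr' : r' < r₀) (hBχ : 0 ≤ Bχ) (hχd : ContDiff ℝ 1 χ)
    (hχ0 : ∀ p, 0 ≤ χ p) (hχ1 : ∀ p, χ p ≤ 1) (hχs : ∀ p, r' ≤ ‖p‖ → χ p = 0) (hχe : ∀ δ > 0, ∀ p, ‖fderiv ℝ χ p‖ ≤ Bχ * tt δ p) :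
    (∀ z ∈ Ω₁, ContDiffAt ℝ 1 (fun z => (χ (Ψ z) : ℂ) * kap m K (-r₁ a) (Ψ z).2) z) ∧
    (∃ M, ∀ z ∈ Ω₁, ‖(χ (Ψ z) : ℂ) * kap m K (-r₁ a) (Ψ z).2‖ ≤ M) ∧
    (∀ z ∈ Ω₁, ∀ j, ‖dzv (fun z => (χ (Ψ z) : ℂ) * kap m K (-r₁ a) (Ψ z).2) z (Pi.single j 1)‖ ≤
      if ‖Ψ z‖ < r₀ then Bχ * C₁ * (tt (-r₁ a) (Ψ z) * ‖kap m K (-r₁ a) (Ψ z).2‖) else 0) ∧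
    (∀ z ∈ Ω₁, ‖Ψ z‖ < r₀ → -r₁ z ≤ (2 + 2 * C₁) * tt (-r₁ a) (Ψ z)) := by
  set δ := -r₁ a with hδd
  have hδ : 0 < δ := by have := D.neg ha; linarith
  have hC10 : 0 ≤ C₁ := by linarith
  set W : Set (Fin (m+1) → ℂ) := Ω₁ ∩ Ψ ⁻¹' ball 0 r₀ with hW
  have hWo : IsOpen W := D.isOpen.inter (isOpen_ball.preimage Ψ.continuous)
  have hexp : ∀ z ∈ Ω₁, ‖Ψ z‖ < r₀ → |r₁ z - (h (Ψ z).1 + 2 * (Ψ z).2.re - δ)| ≤ EE C₁ (Ψ z) := by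
    intro z hz hn
    have := hΨ.exp (Ψ z) (by simpa using hn)
    rw [Ψ.symm_apply_apply] at this
    rw [hδd]
    convert this using 2
    ring
  have hkl : ∀ z ∈ Ω₁, ‖Ψ z‖ < r₀ → tt δ (Ψ z) ≤ (2 + 8 / c₁) * ‖(δ:ℂ) - (Ψ z).2‖ := by
    intro z hz hn
    refine kernel_lower hc0 hc1 hC1 hδ (by rw [mem_ball_zero_iff]; linarith) ?_
    have := (abs_le.mp (hexp z hz hn)).1
    have h2 := hΨ.Hl (Ψ z).1
    have h3 := D.neg hz
    linarith
  have hdpos : ∀ z ∈ Ω₁, ‖Ψ z‖ < r₀ → δ / (2 + 8 / c₁) ≤ ‖(δ:ℂ) - (Ψ z).2‖ := by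
    intro z hz hn
    rw [div_le_iff₀' (by positivity)]
    refine le_trans ?_ (hkl z hz hn)
    unfold tt
    have := norm_nonneg (Ψ z).2
    have := sq_nonneg ‖(Ψ z).1‖
    linarith
  have hne : ∀ z ∈ W, (δ:ℂ) - (Ψ z).2 ≠ 0 := by
    intro z hz
    rw [← norm_pos_iff]
    refine lt_of_lt_of_le ?_ (hdpos z hz.1 (by simpa using hz.2))
    positivity
  have hh : DifferentiableOn ℂ (fun z => (Ψ z).2) W := (hΨ.dif.snd).differentiableOn
  have hχΨ : ∀ z, ContDiffAt ℝ 1 (fun z => (χ (Ψ z) : ℂ)) z := by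
    intro z
    have h1 : ContDiffAt ℝ 1 Ψ z := by
      have e : (fun z => ((Ψ z).1, (Ψ z).2)) = (Ψ : (Fin (m+1) → ℂ) → (Fin m → ℂ) × ℂ) := by ext z <;> rfl
      rw [← e]
      refine ContDiffAt.prodMk ?_ ?_
      · exact ((hol_contDiffOn' 1 isOpen_univ (hΨ.dif.fst).differentiableOn).contDiffAt Filter.univ_mem).restrict_scalars ℝ
      · exact hol_contDiffAt_real (m := 1) isOpen_univ (hΨ.dif.snd).differentiableOn (Set.mem_univ z)
    exact ofRealCLM.contDiff.contDiffAt.comp z (hχd.contDiffAt.comp z h1)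
  have hfar : ∀ z, ¬ ‖Ψ z‖ < r₀ → (fun z => (χ (Ψ z) : ℂ) * kap m K δ (Ψ z).2) =ᶠ[nhds z] fun _ => 0 := by
    intro z hz
    have : ∀ᶠ y in nhds z, r' < ‖Ψ y‖ := (isOpen_lt continuous_const (Ψ.continuous.norm)).mem_nhds (show r' < ‖Ψ z‖ by linarith)
    filter_upwards [this] with y hy
    rw [hχs _ hy.le]; simp
  refine ⟨?_, ?_, ?_, ?_⟩
  · intro z hz
    by_cases hn : ‖Ψ z‖ < r₀
    · exact (hχΨ z).mul (kap_hol hWo hh hne (show z ∈ W from ⟨hz, by simpa using hn⟩) 0).1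
    · exact contDiffAt_const.congr_of_eventuallyEq (hfar z hn)
  · refine ⟨(2 + 1) * ((δ / (2 + 8 / c₁))⁻¹) ^ (m + 3), fun z hz => ?_⟩
    by_cases hn : ‖Ψ z‖ < r₀
    · have h1 : ‖kap m K δ (Ψ z).2‖ ≤ (2 + 1) * ((δ / (2 + 8 / c₁))⁻¹) ^ (m + 3) := by
        unfold kap
        rw [RCLike.norm_conj, norm_mul, norm_pow, norm_inv]
        have h2 := norm_snd_le (Ψ z)
        have h3 : ‖((1 / K : ℝ) : ℂ)‖ ≤ 1 := by
          rw [norm_real, Real.norm_eq_abs, abs_of_pos (by positivity)]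
          rw [div_le_one (by linarith)]; exact hK
        have h4 := hdpos z hz hn
        have h5 := norm_add_le (Ψ z).2 ((1 / K : ℝ) : ℂ)
        gcongr
        linarith
      rw [norm_mul, norm_real, Real.norm_eq_abs, abs_of_nonneg (hχ0 _)]
      exact (mul_le_of_le_one_left (norm_nonneg _) (hχ1 _)).trans h1
    · rw [(hfar z hn).eq_of_nhds]; simp; positivity
  · intro z hz j
    split_ifs with hn
    · have hzW : z ∈ W := ⟨hz, by simpa using hn⟩
      obtain ⟨k1, k2⟩ := kap_hol (m := m) (K := K) hWo hh hne hzW (Pi.single j 1)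
      rw [dzv_mul ((hχΨ z).differentiableAt one_ne_zero) (k1.differentiableAt one_ne_zero), k2, mul_zero, add_zero, norm_mul, ← mul_assoc]
      refine mul_le_mul_of_nonneg_right ?_ (norm_nonneg _)
      refine (norm_dzv_le _ _ _).trans ?_
      rw [Pi.norm_single, norm_one, mul_one]
      have h1 : HasFDerivAt (fun z => (χ (Ψ z) : ℂ)) (ofRealCLM.comp ((fderiv ℝ χ (Ψ z)).comp ((fderiv ℂ Ψ z).restrictScalars ℝ))) z := by
        have g1 : HasFDerivAt Ψ ((fderiv ℂ Ψ z).restrictScalars ℝ) z := (hΨ.dif z).hasFDerivAt.restrictScalars ℝ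
        have g2 := ((hχd.differentiable one_ne_zero) (Ψ z)).hasFDerivAt.comp z g1
        exact ofRealCLM.hasFDerivAt.comp z g2
      rw [h1.fderiv]
      refine ContinuousLinearMap.opNorm_le_bound _ (mul_nonneg (by positivity) (tt_pos hδ _).le) fun v => ?_
      change ‖((fderiv ℝ χ (Ψ z) (fderiv ℂ Ψ z v) : ℝ) : ℂ)‖ ≤ _
      rw [norm_real]
      have g3 := (fderiv ℝ χ (Ψ z)).le_opNorm (fderiv ℂ Ψ z v)
      have g4 := (fderiv ℂ Ψ z).le_opNorm v
      have g5 := hΨ.der z (by linarith)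
      have g6 := hχe δ hδ (Ψ z)
      have g7 := (tt_pos hδ (Ψ z)).le
      calc _ ≤ _ := g3
        _ ≤ (Bχ * tt δ (Ψ z)) * (C₁ * ‖v‖) := by
          gcongr
          exact g4.trans (by gcongr)
        _ = _ := by ring
    · rw [dzv_congr (hfar z hn)]
      unfold dzv; simp
  · intro z hz hn
    have h1 := (abs_le.mp (hexp z hz hn)).1
    have h2 := hΨ.Hl (Ψ z).1
    have h3 := EE_le_lin hC10 hδ (Ψ z) (r := 1) (by rw [mem_ball_zero_iff]; linarith)
    have h4 := abs_le.mp (abs_re_le_norm (Ψ z).2)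
    have h5 : 0 ≤ c₁ * ‖(Ψ z).1‖ ^ 2 := by positivity
    have h6 : δ + 2 * ‖(Ψ z).2‖ ≤ 2 * tt δ (Ψ z) := by unfold tt; nlinarith [sq_nonneg ‖(Ψ z).1‖]
    nlinarith

end
end

section
set_option maxSynthPendingDepth 3

section
variable {m : ℕ} {Ω₁ U₁ Ω₂ U₂ : Set (Fin (m+1) → ℂ)} {r₁ r₂ : (Fin (m+1) → ℂ) → ℝ} {φ : (Fin (m+1) → ℂ) → (Fin (m+1) → ℂ)} {ε₁ ε₂ c C d : ℝ}
open MeasureTheory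

lemma HM.normal_est (H : HM (m+1) Ω₁ U₁ Ω₂ U₂ r₁ r₂ φ ε₁ ε₂ c C d) {c' : ℝ} (hc' : 0 < c') : ∃ Cn δ₁ : ℝ, 0 ≤ Cn ∧ 0 < δ₁ ∧
    ∀ a ∈ Ω₁, -δ₁ < r₁ a → ∀ k, c' ≤ ‖ell r₁ a (Pi.single k 1)‖ →
    ‖fderiv ℂ (fun z => (Am φ z).det) a (Pi.single k 1)‖ ≤ Cn * (-r₁ a) ^ (-(1/2 : ℝ)) := by
  have D := H.D₁
  obtain ⟨c₁, C₁, r₀, hc0, hc1, hC1, hr0, hr0', hr1, hco⟩ := D.coords hc'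
  obtain ⟨K, hK, δ₀, hδ₀, Cc, hCc, hcore⟩ := core m hc0 hc1 hC1 hr0' (show 0 < r₀ / 3 by positivity) (by linarith)
  obtain ⟨B, hB, hmain⟩ := H.main_int
  obtain ⟨BJ, hBJ, hJ⟩ := H.jac
  obtain ⟨χ, Bχ, hBχ, hχd, hχ0, hχ1, hχone, hχs, hχe⟩ := exists_chi m (r₁ := r₀ / 3) (r₂ := 2 * r₀ / 3) (by positivity) (by linarith) (by linarith)
  set A := B * ((2 + 2 * C₁) + Bχ * C₁) with hA
  have hA0 : 0 ≤ A := by positivity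
  refine ⟨C * (Cc * (BJ + A)), min ε₁ δ₀, by have := D.hC; positivity, lt_min D.hε hδ₀, ?_⟩
  intro a ha hs k hk
  have hs1 : -ε₁ ≤ r₁ a := by linarith [min_le_left ε₁ δ₀]
  have hs2 : -r₁ a < δ₀ := by linarith [min_le_right ε₁ δ₀]
  have hneg := D.neg ha
  obtain ⟨Ψ, h, hΨ⟩ := hco a ha hs1 k hk
  set δ := -r₁ a with hδd
  have hδ : 0 < δ := by linarith
  obtain ⟨t1, ⟨M, t2⟩, t3, t4⟩ := Coords.test D hΨ hc0 hc1 hC1 hr0 hr0' hr1 ha hK (r' := 2 * r₀ / 3) (by linarith) hBχ hχd hχ0 hχ1 hχs hχe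
  rw [← hδd] at t1 t2 t3 t4
  have hJhol : DifferentiableOn ℂ (fun z => (Am φ z).det) Ω₁ := det_hol (Am_hol D.isOpen H.hol)
  set J : (Fin (m+1) → ℂ) → ℂ := fun z => (Am φ z).det with hJd
  set O : Set ((Fin m → ℂ) × ℂ) := Ψ.symm ⁻¹' Ω₁ with hO
  have hOo : IsOpen O := D.isOpen.preimage Ψ.symm.continuous
  set f : (Fin m → ℂ) × ℂ → ℂ := fun p => J (Ψ.symm p) with hf
  set G : (Fin (m+1) → ℂ) → ℂ := fun z => (χ (Ψ z) : ℂ) * kap m K δ (Ψ z).2 with hG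
  have hm := hmain G _ M t1 t2 (fun z hz => by
    split_ifs
    · have := tt_pos hδ (Ψ z); positivity
    · exact le_rfl) t3
  have hpre : Ψ ⁻¹' (O ∩ ball 0 r₀) = {z | z ∈ Ω₁ ∧ ‖Ψ z‖ < r₀} := by
    ext z
    simp [hO]
  have hSmeas : MeasurableSet (Ψ ⁻¹' (O ∩ ball 0 r₀)) := ((hOo.inter isOpen_ball).preimage Ψ.continuous).measurableSet
  have hSsub : Ψ ⁻¹' (O ∩ ball 0 r₀) ⊆ Ω₁ := by rw [hpre]; exact fun z hz => hz.1
  have hG0 : ∀ z, ¬ ‖Ψ z‖ < r₀ → G z = 0 := by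
    intro z hz
    simp only [hG]
    rw [hχs _ (by linarith)]; simp
  obtain ⟨κ, κ0, κ1, κ2, κ3⟩ := hΨ.transfer
  have e1 : ∫ z in Ω₁, J z * G z = ∫ z in Ψ ⁻¹' (O ∩ ball 0 r₀), (fun p => f p * χ p * kap m K δ p.2) (Ψ z) := by
    rw [setIntegral_eq_of_subset_of_forall_sdiff_eq_zero D.isOpen.measurableSet hSsub]
    · refine setIntegral_congr_fun hSmeas fun z hz => ?_
      simp only [hf, hG, Ψ.symm_apply_apply]; ring
    · intro z hz
      rw [hpre] at hz
      rw [hG0 z (fun hn => hz.2 ⟨hz.1, hn⟩), mul_zero]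
  have e2 : ∫⁻ z in Ω₁, ENNReal.ofReal (-r₁ z * ‖G z‖ + if ‖Ψ z‖ < r₀ then Bχ * C₁ * (tt δ (Ψ z) * ‖kap m K δ (Ψ z).2‖) else 0) ≤
      ENNReal.ofReal ((2 + 2 * C₁) + Bχ * C₁) * ∫⁻ z in Ψ ⁻¹' (O ∩ ball 0 r₀), (fun p => ENNReal.ofReal (tt δ p * ‖kap m K δ p.2‖)) (Ψ z) := by
    rw [← lintegral_const_mul' _ _ ENNReal.ofReal_ne_top, ← lintegral_indicator hSmeas]
    refine le_trans (setLIntegral_mono' D.isOpen.measurableSet (g := (Ψ ⁻¹' (O ∩ ball 0 r₀)).indicator fun z => ENNReal.ofReal ((2 + 2 * C₁) + Bχ * C₁) * ENNReal.ofReal (tt δ (Ψ z) * ‖kap m K δ (Ψ z).2‖)) ?_) (setLIntegral_le_lintegral _ _)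
    intro z hz
    by_cases hn : ‖Ψ z‖ < r₀
    · rw [Set.indicator_of_mem (by rw [hpre]; exact ⟨hz, hn⟩), if_pos hn, ← ENNReal.ofReal_mul (by positivity)]
      refine ENNReal.ofReal_le_ofReal ?_
      have g1 := t4 z hz hn
      have g2 : ‖G z‖ ≤ ‖kap m K δ (Ψ z).2‖ := by
        simp only [hG]
        rw [norm_mul, norm_real, Real.norm_eq_abs, abs_of_nonneg (hχ0 _)]
        exact mul_le_of_le_one_left (norm_nonneg _) (hχ1 _)
      have g3 := D.neg hz
      have g4 : -r₁ z * ‖G z‖ ≤ ((2 + 2 * C₁) * tt δ (Ψ z)) * ‖kap m K δ (Ψ z).2‖ := by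
        have := (tt_pos hδ (Ψ z)).le
        gcongr
      linarith
    · rw [if_neg hn, hG0 z hn]; simp
  have key : ‖∫ p in O ∩ ball 0 r₀, f p * χ p * kap m K δ p.2‖ₑ ≤
        ENNReal.ofReal A * ∫⁻ p in O ∩ ball 0 r₀, ENNReal.ofReal (tt δ p * ‖kap m K δ p.2‖) := by
    have h1 := hm.trans (mul_le_mul_right e2 _)
    have q2 := κ2 (O ∩ ball 0 r₀) (fun p => f p * χ p * kap m K δ p.2)
    have q3 := κ3 (O ∩ ball 0 r₀) (fun p => ENNReal.ofReal (tt δ p * ‖kap m K δ p.2‖))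
    rw [e1, q2, q3, ← mul_assoc, ← ENNReal.ofReal_mul hB, ← hA, mul_left_comm] at h1
    exact (ENNReal.mul_le_mul_iff_right κ0 κ1).mp h1
  have hfin := hcore δ hδ hs2 h O f χ BJ A hΨ.Hc hΨ.Hh hΨ.Hl hΨ.Hu hOo ?_ ?_ ?_ hBJ hA0 ?_ hχd.continuous hχ0 hχ1 hχone key
  · set L := ell r₁ a (Pi.single k 1) with hL
    have hL0 : L ≠ 0 := by rw [← norm_pos_iff]; linarith
    have hd : HasDerivAt (fun w => f (0, w)) (L⁻¹ • fderiv ℂ J a (Pi.single k 1)) 0 := by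
      have e : (fun w => f (0, w)) = fun w : ℂ => J (a + (w / L) • Pi.single k 1) := by
        funext w
        simp only [hf]
        rw [hΨ.base w]
      rw [e]
      have g1 : HasDerivAt (fun w : ℂ => a + (w / L) • (Pi.single k 1 : Fin (m+1) → ℂ)) ((1 / L) • (Pi.single k 1 : Fin (m+1) → ℂ)) 0 :=
        (((hasDerivAt_id (0:ℂ)).div_const L).smul_const _).const_add a
      have g2 : HasFDerivAt J (fderiv ℂ J a) (a + ((0:ℂ) / L) • (Pi.single k 1 : Fin (m+1) → ℂ)) := by
        simpa using (hJhol.differentiableAt (D.isOpen.mem_nhds ha)).hasFDerivAt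
      have g3 := g2.comp_hasDerivAt 0 g1
      rw [map_smul, one_div] at g3
      exact g3
    rw [hd.deriv, norm_smul, norm_inv] at hfin
    have hLC : ‖L‖ ≤ C := by
      refine (norm_ell_le r₁ a _).trans ?_
      rw [Pi.norm_single, norm_one, mul_one]
      exact D.b1 a ha
    rw [inv_mul_le_iff₀ (norm_pos_iff.mpr hL0)] at hfin
    refine hfin.trans ?_
    rw [mul_assoc C]
    gcongr
  · intro p hp hlt
    have h1 := (abs_le.mp (hΨ.exp p hp)).2
    change Ψ.symm p ∈ Ω₁
    rw [D.eq]
    exact ⟨hΨ.memU p hp, by linarith⟩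
  · intro p hp hpO
    have h1 := (abs_le.mp (hΨ.exp p hp)).1
    have := D.neg (show Ψ.symm p ∈ Ω₁ from hpO)
    linarith
  · exact hJhol.comp hΨ.difs.differentiableOn fun p hp => hp
  · intro p hp
    exact (hJ _ hp.1).1

end
end

section
set_option maxSynthPendingDepth 3

section
variable {n : ℕ} {Ω U : Set (Fin n → ℂ)} {r : (Fin n → ℂ) → ℝ} {ε c C d : ℝ}

lemma Dom.tan_est (D : Dom n Ω U r ε c C d) {J : (Fin n → ℂ) → ℂ} {B : ℝ} (hJ : DifferentiableOn ℂ J Ω) (hB : ∀ z ∈ Ω, ‖J z‖ ≤ B)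
    {a} (ha : a ∈ Ω) (h1 : -r a ≤ 1) (h2 : -r a < d ^ 2) {v} (hv : ell r a v = 0) : ‖fderiv ℂ J a v‖ ≤ 2 * C * B / Real.sqrt (-r a) * ‖v‖ := by
  have hneg := D.neg ha
  have hC := D.hC
  have hδ : 0 < -r a := by linarith
  have hB0 : 0 ≤ B := (norm_nonneg _).trans (hB a ha)
  by_cases hv0 : v = 0
  · simp [hv0]
  have hvn : 0 < ‖v‖ := norm_pos_iff.mpr hv0
  have hs0 : 0 < Real.sqrt (-r a) := Real.sqrt_pos.mpr hδ
  have hs1 : Real.sqrt (-r a) ≤ 1 := Real.sqrt_le_one.mpr h1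
  have hs2 : Real.sqrt (-r a) < d := (Real.sqrt_lt' D.hd).mpr h2
  have hsq := Real.sq_sqrt hδ.le
  set s := Real.sqrt (-r a) with hs
  have hin : ∀ ζ : ℂ, ‖ζ‖ ≤ s / (2 * C * ‖v‖) → a + ζ • v ∈ Ω := by
    intro ζ hζ
    rw [le_div_iff₀ (by positivity)] at hζ
    have hn : ‖ζ • v‖ * (2 * C) ≤ s := by rw [norm_smul]; linarith
    have hn0 := norm_nonneg (ζ • v)
    have hn1 : ‖ζ • v‖ ≤ s := by nlinarith
    have ht := (abs_le.mp (D.tay1 ha (show ‖ζ • v‖ < d by linarith) (by linarith))).2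
    have hf : fderiv ℝ r a (ζ • v) = 0 := by rw [← ell_re, ell_smul, hv]; simp
    refine D.mem ha (by linarith) ?_
    have h3 : (‖ζ • v‖ * (2 * C)) ^ 2 ≤ s ^ 2 := by gcongr
    have h4 : 2 * C * ‖ζ • v‖ ^ 2 * 2 ≤ (‖ζ • v‖ * (2 * C)) ^ 2 := by
      nlinarith [mul_nonneg (show 0 ≤ C - 1 by linarith) (mul_nonneg (show 0 ≤ C by linarith) (sq_nonneg ‖ζ • v‖))]
    nlinarith
  have := cauchy_disc D.isOpen hJ (z := a) (v := v) (ρ := s / (2 * C * ‖v‖)) (by positivity) hin fun ζ hζ => hB _ (hin ζ hζ)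
  refine this.trans (le_of_eq ?_)
  field_simp

end

section
variable {m : ℕ} {Ω₁ U₁ Ω₂ U₂ : Set (Fin (m+1) → ℂ)} {r₁ r₂ : (Fin (m+1) → ℂ) → ℝ} {φ : (Fin (m+1) → ℂ) → (Fin (m+1) → ℂ)} {ε₁ ε₂ c C d : ℝ}

lemma HM.grad_est (H : HM (m+1) Ω₁ U₁ Ω₂ U₂ r₁ r₂ φ ε₁ ε₂ c C d) : ∃ A : ℝ, 0 ≤ A ∧
    ∀ a ∈ Ω₁, ‖fderiv ℂ (fun z => (Am φ z).det) a‖ ≤ A / Real.sqrt (-r₁ a) := by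
  have D := H.D₁
  have hc := D.hc
  have hC := D.hC
  have hd := D.hd
  set c' : ℝ := c / (4 * ((m + 1 : ℕ) + 1)) with hc'
  have hc'0 : 0 < c' := by positivity
  obtain ⟨Cn, δ₁, hCn, hδ₁, hno⟩ := H.normal_est hc'0
  obtain ⟨B, hB, hJ⟩ := H.jac
  have hJhol : DifferentiableOn ℂ (fun z => (Am φ z).det) Ω₁ := det_hol (Am_hol D.isOpen H.hol)
  set J : (Fin (m+1) → ℂ) → ℂ := fun z => (Am φ z).det with hJd
  set η := min (min δ₁ ε₁) (min 1 (d ^ 2)) with hη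
  have hη0 : 0 < η := lt_min (lt_min hδ₁ D.hε) (lt_min one_pos (by positivity))
  have hfc : ContinuousOn (fderiv ℂ J) Ω₁ := (hol_contDiffOn 1 D.isOpen hJhol).continuousOn_fderiv_of_isOpen D.isOpen le_rfl
  obtain ⟨A1, hA1⟩ := (D.cpt hη0).exists_bound_of_continuousOn (hfc.mono fun z hz => hz.1)
  obtain ⟨R, hR⟩ := (D.bdd.isCompact_closure).exists_bound_of_continuousOn (D.cont.mono D.sub)
  set A0 : ℝ := 2 * C * B * (1 + C / c') + Cn * (C / c') with hA0
  have hA00 : 0 ≤ A0 := by positivity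
  refine ⟨max A0 (|A1| * Real.sqrt |R|), le_max_of_le_left hA00, fun a ha => ?_⟩
  have hneg := D.neg ha
  have hδ : 0 < -r₁ a := by linarith
  have hs0 : 0 < Real.sqrt (-r₁ a) := Real.sqrt_pos.mpr hδ
  by_cases hdeep : r₁ a ≤ -η
  · have h1 := (hA1 a ⟨ha, hdeep⟩).trans (le_abs_self A1)
    have h2 := (hR a (subset_closure ha)).trans (le_abs_self R)
    rw [Real.norm_eq_abs, abs_of_neg hneg] at h2
    have h3 := Real.sqrt_le_sqrt h2
    refine h1.trans ?_
    rw [le_div_iff₀ hs0]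
    refine le_trans ?_ (le_max_right _ _)
    gcongr
  · push Not at hdeep
    have e1 : η ≤ δ₁ := (min_le_left _ _).trans (min_le_left _ _)
    have e2 : η ≤ ε₁ := (min_le_left _ _).trans (min_le_right _ _)
    have e3 : η ≤ 1 := (min_le_right _ _).trans (min_le_left _ _)
    have e4 : η ≤ d ^ 2 := (min_le_right _ _).trans (min_le_right _ _)
    obtain ⟨k, hk⟩ := D.exists_k ha (by linarith)
    have hk' : c' ≤ ‖ell r₁ a (Pi.single k 1)‖ := hk
    have h1 := hno a ha (by linarith) k hk'
    rw [Real.rpow_neg hδ.le, ← Real.sqrt_eq_rpow, ← div_eq_mul_inv] at h1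
    set L := ell r₁ a (Pi.single k 1) with hL
    have hL0 : L ≠ 0 := by rw [← norm_pos_iff]; linarith
    refine ContinuousLinearMap.opNorm_le_bound _ (by positivity) fun v => ?_
    set α := ell r₁ a v / L with hα
    have hαn : ‖α‖ ≤ C / c' * ‖v‖ := by
      rw [hα, norm_div, div_mul_eq_mul_div]
      have h3 := (norm_ell_le r₁ a v).trans (mul_le_mul_of_nonneg_right (D.b1 a ha) (norm_nonneg _))
      gcongr
    set u := v + (-α) • (Pi.single k 1 : Fin (m+1) → ℂ) with hu
    have hu0 : ell r₁ a u = 0 := by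
      rw [hu, ell_add, ell_smul, ← hL, hα]; field_simp; ring
    have hun : ‖u‖ ≤ (1 + C / c') * ‖v‖ := by
      refine (norm_add_le _ _).trans ?_
      rw [norm_smul, norm_neg, Pi.norm_single, norm_one, mul_one]; linarith
    have h2 := D.tan_est hJhol (fun z hz => (hJ z hz).1) ha (by linarith) (by linarith) hu0
    have hv : v = u + α • (Pi.single k 1 : Fin (m+1) → ℂ) := by rw [hu]; simp
    calc ‖fderiv ℂ J a v‖ = ‖fderiv ℂ J a u + α • fderiv ℂ J a (Pi.single k 1)‖ := by
          conv_lhs => rw [hv, map_add, map_smul]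
      _ ≤ ‖fderiv ℂ J a u‖ + ‖α‖ * ‖fderiv ℂ J a (Pi.single k 1)‖ := by
          refine (norm_add_le _ _).trans ?_
          rw [norm_smul]
      _ ≤ 2 * C * B / Real.sqrt (-r₁ a) * ((1 + C / c') * ‖v‖) + (C / c' * ‖v‖) * (Cn / Real.sqrt (-r₁ a)) := by
          refine add_le_add (h2.trans ?_) ?_
          · gcongr
          · gcongr
      _ = A0 / Real.sqrt (-r₁ a) * ‖v‖ := by rw [hA0]; ring
      _ ≤ _ := by
          gcongr
          exact le_max_left _ _

end
end

section
set_option maxSynthPendingDepth 3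

section
variable {n : ℕ} {Ω U : Set (Fin n → ℂ)} {r : (Fin n → ℂ) → ℝ} {ε c C d : ℝ}

lemma path_deriv {J : (Fin n → ℂ) → ℂ} {y v : Fin n → ℂ} {s : ℝ} (h : DifferentiableAt ℂ J (y + s • v)) :
    HasDerivAt (fun s : ℝ => J (y + s • v)) (fderiv ℂ J (y + s • v) v) s := by
  have h1 : HasDerivAt (fun s : ℝ => y + s • v) ((1:ℝ) • v) s := ((hasDerivAt_id s).smul_const v).const_add y
  have h2 := (h.hasFDerivAt.restrictScalars ℝ).comp_hasDerivAt s h1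
  rw [one_smul] at h2
  exact h2

lemma line_est {J : (Fin n → ℂ) → ℂ} {A κ δ s₀ : ℝ} (hΩ : IsOpen Ω) (hJ : DifferentiableOn ℂ J Ω) (hA0 : 0 ≤ A)
    (hA : ∀ a ∈ Ω, ‖fderiv ℂ J a‖ ≤ A / Real.sqrt (-r a)) {y v} (hv : ‖v‖ ≤ 1) (hκ : 0 < κ) (hδ : 0 < δ) (hs : 0 ≤ s₀)
    (hin : ∀ s ∈ Set.Icc (0:ℝ) s₀, y + s • v ∈ Ω ∧ δ + κ * s ≤ -r (y + s • v)) :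
    ‖J (y + s₀ • v) - J y‖ ≤ 2 * A / κ * Real.sqrt (κ * s₀) := by
  have hpos : ∀ s ∈ Set.Icc (0:ℝ) s₀, 0 < δ + κ * s := fun s hs => by
    have := mul_nonneg hκ.le hs.1; linarith
  have hf : ∀ s ∈ Set.Icc (0:ℝ) s₀, HasDerivAt (fun s : ℝ => J (y + s • v) - J y) (fderiv ℂ J (y + s • v) v) s := fun s hs =>
    (path_deriv (hJ.differentiableAt (hΩ.mem_nhds (hin s hs).1))).sub_const _
  have hg : ∀ s ∈ Set.Icc (0:ℝ) s₀, HasDerivAt (fun s => 2 * A / κ * (Real.sqrt (δ + κ * s) - Real.sqrt δ)) (A / Real.sqrt (δ + κ * s)) s := by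
    intro s hs
    have h1 : HasDerivAt (fun s => δ + κ * s) (κ * 1) s := ((hasDerivAt_id s).const_mul κ).const_add δ
    have h2 := ((h1.sqrt (hpos s hs).ne').sub_const (Real.sqrt δ)).const_mul (2 * A / κ)
    convert! h2 using 1
    have := Real.sqrt_pos.mpr (hpos s hs)
    field_simp
  have key := image_norm_le_of_norm_deriv_right_le_deriv_boundary' (f := fun s : ℝ => J (y + s • v) - J y) (a := 0) (b := s₀)
    (f' := fun s => fderiv ℂ J (y + s • v) v) (B := fun s => 2 * A / κ * (Real.sqrt (δ + κ * s) - Real.sqrt δ)) (B' := fun s => A / Real.sqrt (δ + κ * s))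
    (fun s hs => (hf s hs).continuousAt.continuousWithinAt) (fun s hs => (hf s ⟨hs.1, hs.2.le⟩).hasDerivWithinAt) (by simp)
    (fun s hs => (hg s hs).continuousAt.continuousWithinAt) (fun s hs => (hg s ⟨hs.1, hs.2.le⟩).hasDerivWithinAt) ?_
  · refine (key (Set.right_mem_Icc.mpr hs)).trans ?_
    have h1 : Real.sqrt (δ + κ * s₀) ≤ Real.sqrt δ + Real.sqrt (κ * s₀) := by
      rw [Real.sqrt_le_iff]
      refine ⟨by positivity, ?_⟩
      have g1 := Real.sq_sqrt hδ.le
      have g2 := Real.sq_sqrt (mul_nonneg hκ.le hs)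
      have g3 := mul_nonneg (Real.sqrt_nonneg δ) (Real.sqrt_nonneg (κ * s₀))
      nlinarith
    gcongr
    linarith
  · intro s hs
    have hs' : s ∈ Set.Icc (0:ℝ) s₀ := ⟨hs.1, hs.2.le⟩
    refine (ContinuousLinearMap.le_opNorm _ _).trans ((mul_le_of_le_one_right (norm_nonneg _) hv).trans ((hA _ (hin s hs').1).trans ?_))
    have h2 := Real.sqrt_pos.mpr (hpos s hs')
    have h3 := Real.sqrt_le_sqrt (hin s hs').2
    gcongr

lemma seg_est {J : (Fin n → ℂ) → ℂ} {A η : ℝ} (hΩ : IsOpen Ω) (hJ : DifferentiableOn ℂ J Ω) (hA0 : 0 ≤ A)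
    (hA : ∀ a ∈ Ω, ‖fderiv ℂ J a‖ ≤ A / Real.sqrt (-r a)) (hη : 0 < η) {z u : Fin n → ℂ}
    (hin : ∀ x, ‖x‖ ≤ ‖u‖ → z + x ∈ Ω ∧ η ≤ -r (z + x)) : ‖J (z + u) - J z‖ ≤ A / Real.sqrt η * ‖u‖ := by
  have h0 : 0 < Real.sqrt η := Real.sqrt_pos.mpr hη
  have hin' : ∀ x ∈ closedBall z ‖u‖, x ∈ Ω ∧ η ≤ -r x := by
    intro x hx
    have := hin (x - z) (by rwa [mem_closedBall, dist_eq_norm] at hx)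
    simpa using this
  have := (convex_closedBall z ‖u‖).norm_image_sub_le_of_norm_hasFDerivWithin_le (𝕜 := ℂ) (f := J) (f' := fderiv ℂ J) (C := A / Real.sqrt η) (x := z) (y := z + u)
    (fun x hx => (hJ.differentiableAt (hΩ.mem_nhds (hin' x hx).1)).hasFDerivAt.hasFDerivWithinAt)
    (fun x hx => (hA x (hin' x hx).1).trans (by
      have := Real.sqrt_le_sqrt (hin' x hx).2
      gcongr)) (mem_closedBall_self (norm_nonneg _)) (by simp)
  simpa using this

lemma Dom.mono_path (D : Dom n Ω U r ε c C d) {z v u : Fin n → ℂ} (hz : z ∈ Ω) (hv : ‖v‖ ≤ 1) (hvr : fderiv ℝ r z v ≤ -(c/2)) {s : ℝ} (hs : 0 ≤ s)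
    (h1 : ‖u‖ + s < d) (h2 : ‖u‖ + s ≤ c / (4 * C)) : r (z + u + s • v) ≤ r (z + u) - c / 4 * s := by
  have hC := D.hC
  have hn : ∀ x ∈ Set.Icc (0:ℝ) s, ‖u + x • v‖ ≤ ‖u‖ + s := by
    intro x hx
    refine (norm_add_le _ _).trans ?_
    rw [norm_smul, Real.norm_eq_abs, abs_of_nonneg hx.1]
    have : x * ‖v‖ ≤ x * 1 := mul_le_mul_of_nonneg_left hv hx.1
    linarith [hx.2]
  have hd : ∀ x ∈ Set.Icc (0:ℝ) s, HasDerivAt (fun x : ℝ => r (z + u + x • v)) (fderiv ℝ r (z + u + x • v) v) x := by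
    intro x hx
    have hU := D.tayU z hz (u + x • v) (by linarith [hn x hx])
    rw [← add_assoc] at hU
    have g1 : HasDerivAt (fun s : ℝ => z + u + s • v) ((1:ℝ) • v) x := ((hasDerivAt_id x).smul_const v).const_add _
    have g2 := ((D.smooth _ hU).differentiableAt (by norm_num)).hasFDerivAt.comp_hasDerivAt x g1
    rw [one_smul] at g2
    exact g2
  have key := (convex_Icc (0:ℝ) s).image_sub_le_mul_sub_of_deriv_le (f := fun x : ℝ => r (z + u + x • v)) (C := -(c/4))
    (fun x hx => (hd x hx).continuousAt.continuousWithinAt) (fun x hx => (hd x (interior_subset hx)).differentiableAt.differentiableWithinAt)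
    (fun x hx => by
      have hx := interior_subset hx
      rw [(hd x hx).deriv]
      have g1 := D.lip1 z hz (u + x • v) (by linarith [hn x hx])
      rw [← add_assoc] at g1
      have g2 := (fderiv ℝ r (z + u + x • v) - fderiv ℝ r z).le_opNorm v
      rw [sub_apply, Real.norm_eq_abs] at g2
      have g3 := (le_abs_self _).trans g2
      have g4 : C * ‖u + x • v‖ ≤ C * (c / (4 * C)) := by
        gcongr; exact (hn x hx).trans h2
      have g5 : C * (c / (4 * C)) = c / 4 := by field_simp
      have g6 := mul_le_of_le_one_right (norm_nonneg (fderiv ℝ r (z + u + x • v) - fderiv ℝ r z)) hv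
      linarith) 0 ⟨le_rfl, hs⟩ s ⟨hs, le_rfl⟩ hs
  simp only [zero_smul, add_zero] at key
  linarith

end
end

section
set_option maxSynthPendingDepth 3

section
variable {n : ℕ} {Ω U : Set (Fin n → ℂ)} {r : (Fin n → ℂ) → ℝ} {ε c C d : ℝ}

lemma Dom.lip0 (D : Dom n Ω U r ε c C d) {z v} (hz : z ∈ Ω) (hv : ‖v‖ < d) (hv1 : ‖v‖ ≤ 1) : r (z + v) ≤ r z + 3 * C * ‖v‖ := by
  have h1 := (abs_le.mp (D.tay1 hz hv hv1)).2
  have h2 := (le_abs_self _).trans ((fderiv ℝ r z).le_opNorm v)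
  have h3 := mul_le_mul_of_nonneg_right (D.b1 z hz) (norm_nonneg v)
  have hC := D.hC
  have h4 : 2 * C * ‖v‖ ^ 2 ≤ 2 * C * ‖v‖ := by
    have := norm_nonneg v
    gcongr
    nlinarith
  linarith

lemma Dom.exists_v (D : Dom n Ω U r ε c C d) {z} (hz : z ∈ Ω) (hs : -ε ≤ r z) : ∃ v, ‖v‖ ≤ 1 ∧ fderiv ℝ r z v ≤ -(c/2) := by
  have h := D.grad z hz hs
  have hc := D.hc
  obtain ⟨x, hx, hx2⟩ := (fderiv ℝ r z).exists_lt_apply_of_lt_opNorm (show c / 2 < ‖fderiv ℝ r z‖ by linarith)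
  rw [Real.norm_eq_abs, lt_abs] at hx2
  rcases hx2 with h1 | h1
  · exact ⟨-x, by rw [norm_neg]; exact hx.le, by rw [map_neg]; linarith⟩
  · exact ⟨x, hx.le, by linarith⟩

set_option maxHeartbeats 1000000 in
lemma Dom.lip_half (D : Dom n Ω U r ε c C d) {J : (Fin n → ℂ) → ℂ} {A B : ℝ} (hJ : DifferentiableOn ℂ J Ω) (hB : ∀ z ∈ Ω, ‖J z‖ ≤ B) (hA0 : 0 ≤ A)
    (hA : ∀ a ∈ Ω, ‖fderiv ℂ J a‖ ≤ A / Real.sqrt (-r a)) : ∃ C', 0 ≤ C' ∧ ∀ z ∈ Ω, ∀ w ∈ Ω, ‖J z - J w‖ ≤ C' * Real.sqrt ‖z - w‖ := by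
  have hc := D.hc
  have hc1 := D.hc1
  have hC := D.hC
  have hd := D.hd
  have hε := D.hε
  have hΩ := D.isOpen
  set M := 16 * C / c with hM
  have hM0 : 0 < M := by positivity
  have hMc : c / 4 * M = 4 * C := by rw [hM]; field_simp; norm_num
  set t₀ := min (min (d / (2 * (M + 1))) (c / (4 * C) / (M + 1))) (min (1 / (M + 1)) (ε / (6 * C))) with ht₀
  have ht₀0 : 0 < t₀ := by
    refine lt_min (lt_min ?_ ?_) (lt_min ?_ ?_) <;> positivity
  have ha : t₀ * (M + 1) < d := by
    have : t₀ ≤ d / (2 * (M + 1)) := (min_le_left _ _).trans (min_le_left _ _)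
    rw [le_div_iff₀ (by positivity)] at this
    linarith
  have hb : t₀ * (M + 1) ≤ c / (4 * C) := by
    have : t₀ ≤ c / (4 * C) / (M + 1) := (min_le_left _ _).trans (min_le_right _ _)
    rwa [le_div_iff₀ (by positivity)] at this
  have hcc : t₀ * (M + 1) ≤ 1 := by
    have : t₀ ≤ 1 / (M + 1) := (min_le_right _ _).trans (min_le_left _ _)
    rwa [le_div_iff₀ (by positivity)] at this
  have hdd : 3 * C * t₀ ≤ ε / 2 := by
    have : t₀ ≤ ε / (6 * C) := (min_le_right _ _).trans (min_le_right _ _)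
    rw [le_div_iff₀ (by positivity)] at this
    linarith
  set C1 := 2 * |B| / Real.sqrt t₀ with hC1
  set C2 := A / Real.sqrt (ε / 2) with hC2
  set C3 := A + 2 * (2 * A / (c / 4) * Real.sqrt (c / 4 * M)) with hC3
  have hC10 : 0 ≤ C1 := by positivity
  have hC20 : 0 ≤ C2 := by positivity
  have hC30 : 0 ≤ C3 := by positivity
  refine ⟨C1 + C2 + C3, by positivity, fun z hz w hw => ?_⟩
  set t := ‖z - w‖ with ht
  have ht0 : 0 ≤ t := norm_nonneg _
  have hst := Real.sqrt_nonneg t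
  rcases ht0.eq_or_lt with h0 | htpos
  · have : z = w := by rw [← sub_eq_zero, ← norm_eq_zero]; exact h0.symm
    rw [this]; simp; positivity
  by_cases hbig : t₀ ≤ t
  · have h1 : ‖J z - J w‖ ≤ 2 * |B| := by
      have g1 := (hB z hz).trans (le_abs_self B)
      have g2 := (hB w hw).trans (le_abs_self B)
      exact (norm_sub_le _ _).trans (by linarith)
    have h2 : 2 * |B| ≤ C1 * Real.sqrt t := by
      have := Real.sqrt_le_sqrt hbig
      rw [hC1, div_mul_eq_mul_div, le_div_iff₀ (Real.sqrt_pos.mpr ht₀0)]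
      gcongr
    nlinarith
  push Not at hbig
  have htM : t * (M + 1) ≤ t₀ * (M + 1) := by gcongr
  have htM' : t * (M + 1) = t + M * t := by ring
  have hMt : 0 < M * t := by positivity
  have hnzw : ‖w - z‖ = t := by rw [ht, norm_sub_rev]
  by_cases hdeep : r z ≤ -ε
  · have h1 := seg_est (r := r) hΩ hJ hA0 hA (η := ε / 2) (by positivity) (z := z) (u := w - z) (fun x hx => by
      rw [hnzw] at hx
      have g1 := D.lip0 hz (v := x) (by linarith) (by linarith)
      have g2 : 3 * C * ‖x‖ ≤ 3 * C * t₀ := by gcongr; linarith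
      exact ⟨D.mem hz (by linarith) (by linarith), by linarith⟩)
    rw [hnzw, add_sub_cancel, norm_sub_rev] at h1
    have h2 : t ≤ Real.sqrt t := by
      have g1 := Real.sq_sqrt ht0
      have g2 : Real.sqrt t ≤ 1 := Real.sqrt_le_one.mpr (by linarith)
      nlinarith
    have h3 : C2 * t ≤ C2 * Real.sqrt t := by gcongr
    nlinarith
  · push Not at hdeep
    obtain ⟨v, hv, hvr⟩ := D.exists_v hz hdeep.le
    -- path from a point u in Ω close to z
    have hline : ∀ u, ‖u‖ ≤ t → z + u ∈ Ω → (∀ s ∈ Set.Icc (0:ℝ) (M * t), z + u + s • v ∈ Ω ∧ -r (z + u) + c / 4 * s ≤ -r (z + u + s • v)) := by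
      intro u hu huΩ s hs
      have g1 := D.mono_path hz hv hvr (u := u) hs.1 (by linarith [hs.2]) (by linarith [hs.2])
      have g2 := D.neg huΩ
      have g3 : 0 ≤ c / 4 * s := mul_nonneg (by positivity) hs.1
      refine ⟨?_, by linarith⟩
      rw [D.eq]
      refine ⟨?_, by linarith⟩
      rw [add_assoc]
      refine D.tayU z hz _ ?_
      refine lt_of_le_of_lt (norm_add_le _ _) ?_
      rw [norm_smul, Real.norm_eq_abs, abs_of_nonneg hs.1]
      have : s * ‖v‖ ≤ s * 1 := mul_le_mul_of_nonneg_left hv hs.1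
      linarith [hs.2]
    have hJline : ∀ u, ‖u‖ ≤ t → z + u ∈ Ω → ‖J (z + u + (M * t) • v) - J (z + u)‖ ≤ 2 * A / (c / 4) * Real.sqrt (c / 4 * M) * Real.sqrt t := by
      intro u hu huΩ
      have := line_est (r := r) hΩ hJ hA0 hA hv (κ := c / 4) (by positivity) (show 0 < -r (z + u) by linarith [D.neg huΩ]) hMt.le (hline u hu huΩ)
      rwa [← mul_assoc, Real.sqrt_mul (by positivity), ← mul_assoc] at this
    have hz0 : z + 0 ∈ Ω := by rwa [add_zero]
    have hwz : z + (w - z) ∈ Ω := by rwa [add_sub_cancel]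
    have l1 := hJline 0 (by simpa using ht0) hz0
    have l2 := hJline (w - z) hnzw.le hwz
    have hz1 := hline 0 (by simpa using ht0) hz0 (M * t) ⟨hMt.le, le_rfl⟩
    rw [add_zero] at l1 hz1
    rw [add_sub_cancel] at l2
    have l3 := seg_est (r := r) hΩ hJ hA0 hA (η := t) htpos (z := z + (M * t) • v) (u := w - z) (fun x hx => by
      rw [hnzw] at hx
      have g1 := D.lip0 hz1.1 (v := x) (by linarith) (by linarith)
      have g2 : 3 * C * ‖x‖ ≤ 3 * C * t := by gcongr
      have g3 : c / 4 * (M * t) = 4 * C * t := by rw [← mul_assoc, hMc]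
      have g4 := hz1.2
      have g5 := D.neg hz
      have g6 : t ≤ C * t := le_mul_of_one_le_left ht0 hC
      exact ⟨D.mem hz1.1 (by linarith) (by linarith), by linarith⟩)
    have e : z + (M * t) • v + (w - z) = w + (M * t) • v := by abel
    rw [e, hnzw] at l3
    have l4 : A / Real.sqrt t * t = A * Real.sqrt t := by
      have g1 := Real.sqrt_pos.mpr htpos
      have g2 := Real.mul_self_sqrt ht0
      field_simp
      nlinarith
    rw [l4] at l3
    have l5 : ‖J z - J w‖ ≤ ‖J (z + (M * t) • v) - J z‖ + ‖J (w + (M * t) • v) - J (z + (M * t) • v)‖ + ‖J (w + (M * t) • v) - J w‖ := by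
      have : J z - J w = -(J (z + (M * t) • v) - J z) - (J (w + (M * t) • v) - J (z + (M * t) • v)) + (J (w + (M * t) • v) - J w) := by ring
      rw [this]
      refine (norm_add_le _ _).trans ?_
      gcongr
      refine (norm_sub_le _ _).trans ?_
      rw [norm_neg]
    have l6 : ‖J z - J w‖ ≤ C3 * Real.sqrt t := by rw [hC3]; linarith
    nlinarith

end
end

section
set_option maxSynthPendingDepth 3

theorem final_pi {n : ℕ} {Ω₁ U₁ Ω₂ U₂ : Set (Fin n → ℂ)} {r₁ r₂ : (Fin n → ℂ) → ℝ} {φ : (Fin n → ℂ) → (Fin n → ℂ)}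
    {ε₁ ε₂ c₁ C₁ d₁ c₂ C₂ d₂ : ℝ} (D₁ : Dom n Ω₁ U₁ r₁ ε₁ c₁ C₁ d₁) (D₂ : Dom n Ω₂ U₂ r₂ ε₂ c₂ C₂ d₂)
    (hol : DifferentiableOn ℂ φ Ω₁) (maps : ∀ z ∈ Ω₁, φ z ∈ Ω₂)
    (proper : ∀ K ⊆ Ω₂, IsCompact K → IsCompact {z | z ∈ Ω₁ ∧ φ z ∈ K}) :
    ∃ C', 0 ≤ C' ∧ ∀ z ∈ Ω₁, ∀ w ∈ Ω₁, ‖(Am φ z).det - (Am φ w).det‖ ≤ C' * Real.sqrt ‖z - w‖ := by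
  obtain _ | m := n
  · exact ⟨0, le_rfl, fun z _ w _ => by simp⟩
  · obtain ⟨_, _, _, _, _, H⟩ := exists_HM D₁ D₂ hol maps proper
    obtain ⟨B, hB0, hB⟩ := H.jac
    obtain ⟨A, hA0, hA⟩ := H.grad_est
    exact H.D₁.lip_half (det_hol (Am_hol H.D₁.isOpen H.hol)) (fun z hz => (hB z hz).1) hA0 hA

section
variable {E : Type*} [NormedAddCommGroup E] [NormedSpace ℂ E]

def sesq (β : E →L[ℝ] E →L[ℝ] ℝ) (u v : E) : ℂ :=
  ((β u v + β (I • u) (I • v) : ℝ) : ℂ) + I * ((β u (I • v) - β (I • u) v : ℝ) : ℂ)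

lemma csmul_eq (a : ℂ) (u : E) : a • u = a.re • u + a.im • (I • u) := by
  conv_lhs => rw [← Complex.re_add_im a]
  rw [add_smul, mul_smul, Complex.coe_smul, Complex.coe_smul]

lemma csmulI_eq (a : ℂ) (u : E) : I • a • u = a.re • (I • u) + (-a.im) • u := by
  rw [smul_smul, csmul_eq]
  simp [add_comm]

lemma sesq_smul_left (β : E →L[ℝ] E →L[ℝ] ℝ) (a : ℂ) (u v : E) : sesq β (a • u) v = a * sesq β u v := by
  unfold sesq
  rw [csmulI_eq, csmul_eq]
  simp only [map_add, map_smul, add_apply, smul_apply, smul_eq_mul]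
  apply Complex.ext <;> simp <;> ring

lemma sesq_smul_right (β : E →L[ℝ] E →L[ℝ] ℝ) (a : ℂ) (u v : E) : sesq β u (a • v) = starRingEnd ℂ a * sesq β u v := by
  unfold sesq
  rw [csmulI_eq, csmul_eq]
  simp only [map_add, map_smul, smul_eq_mul]
  apply Complex.ext <;> simp <;> ring

lemma sesq_sum_left {ι : Type*} (s : Finset ι) (β : E →L[ℝ] E →L[ℝ] ℝ) (u : ι → E) (v : E) :
    sesq β (∑ i ∈ s, u i) v = ∑ i ∈ s, sesq β (u i) v := by
  unfold sesq
  simp only [Finset.smul_sum, map_sum, sum_apply]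
  rw [← Finset.sum_add_distrib, ← Finset.sum_sub_distrib]
  push_cast
  rw [Finset.mul_sum, ← Finset.sum_add_distrib]

lemma sesq_sum_right {ι : Type*} (s : Finset ι) (β : E →L[ℝ] E →L[ℝ] ℝ) (u : ι → E) (v : E) :
    sesq β v (∑ i ∈ s, u i) = ∑ i ∈ s, sesq β v (u i) := by
  unfold sesq
  simp only [Finset.smul_sum, map_sum]
  rw [← Finset.sum_add_distrib, ← Finset.sum_sub_distrib]
  push_cast
  rw [Finset.mul_sum, ← Finset.sum_add_distrib]

lemma sesq_re (r : E → ℝ) (z v : E) : (sesq (fderiv ℝ (fderiv ℝ r) z) v v).re = Lam r z v := by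
  simp [sesq, Lam]

lemma ell_smul' (r : E → ℝ) (z v : E) (a : ℂ) : ell r z (a • v) = a * ell r z v := by
  unfold ell
  rw [csmulI_eq, csmul_eq]
  simp only [map_add, map_smul, smul_eq_mul]
  apply Complex.ext <;> simp <;> ring

lemma ell_sum' {ι : Type*} (s : Finset ι) (r : E → ℝ) (z : E) (u : ι → E) : ell r z (∑ i ∈ s, u i) = ∑ i ∈ s, ell r z (u i) := by
  unfold ell
  simp only [Finset.smul_sum, map_sum]
  push_cast
  rw [Finset.mul_sum, ← Finset.sum_sub_distrib, Finset.sum_div]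

variable {F : Type*} [NormedAddCommGroup F] [NormedSpace ℂ F]

def eR (e : F ≃L[ℂ] E) : F ≃L[ℝ] E :=
  { e.toLinearEquiv.restrictScalars ℝ with
    continuous_toFun := e.continuous
    continuous_invFun := e.symm.continuous }

lemma eR_apply (e : F ≃L[ℂ] E) (x : F) : eR e x = e x := rfl

lemma eR_comp (e : F ≃L[ℂ] E) (T : E →L[ℝ] ℝ) (x : F) : (T.comp (eR e : F →L[ℝ] E)) x = T (e x) := rfl

lemma ell_equiv (e : F ≃L[ℂ] E) (r : E → ℝ) (z v : F) : ell (r ∘ e) z v = ell r (e z) (e v) := by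
  have h := (eR e).comp_right_fderiv (f := r) (x := z)
  have h' : fderiv ℝ (r ∘ e) z = (fderiv ℝ r (e z)).comp (eR e : F →L[ℝ] E) := h
  unfold ell
  rw [h', eR_comp, eR_comp, map_smul]

lemma Lam_equiv (e : F ≃L[ℂ] E) (r : E → ℝ) (z v : F) (hr : DifferentiableAt ℝ (fderiv ℝ r) (e z)) : Lam (r ∘ e) z v = Lam r (e z) (e v) := by
  have h' : fderiv ℝ (r ∘ e) = fun z => (fderiv ℝ r (e z)).comp (eR e : F →L[ℝ] E) :=
    funext fun z => (eR e).comp_right_fderiv (f := r) (x := z)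
  have h2 : HasFDerivAt (fun z => fderiv ℝ r (e z)) ((fderiv ℝ (fderiv ℝ r) (e z)).comp (eR e : F →L[ℝ] E)) z :=
    HasFDerivAt.comp z (g := fderiv ℝ r) (f := e) hr.hasFDerivAt (eR e).hasFDerivAt
  have h3 := h2.clm_comp (hasFDerivAt_const (eR e : F →L[ℝ] E) z)
  unfold Lam
  rw [h', h3.fderiv]
  simp [eR_apply]
end
end

set_option maxSynthPendingDepth 3

section
variable {n : ℕ}

lemma single_I (j : Fin n) : (EuclideanSpace.single j I : EuclideanSpace ℂ (Fin n)) = I • EuclideanSpace.single j (1 : ℂ) := by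
  ext i; simp

lemma vec_sum (w : Fin n → ℂ) : (WithLp.toLp 2 w : EuclideanSpace ℂ (Fin n)) = ∑ j, w j • EuclideanSpace.single j (1 : ℂ) := by
  ext i; simp [Pi.single_apply]

lemma fderiv_ofReal {E : Type*} [NormedAddCommGroup E] [NormedSpace ℝ E] {r : E → ℝ} {z : E} (hr : DifferentiableAt ℝ r z) (v : E) :
    fderiv ℝ (fun v => ((r v : ℝ) : ℂ)) z v = ((fderiv ℝ r z v : ℝ) : ℂ) := by
  have h := HasFDerivAt.comp z (g := Complex.ofRealCLM) (f := r) Complex.ofRealCLM.hasFDerivAt hr.hasFDerivAt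
  have h' : HasFDerivAt (fun v => ((r v : ℝ) : ℂ)) (Complex.ofRealCLM.comp (fderiv ℝ r z)) z := h
  rw [h'.fderiv]
  simp

lemma wDz_real {r : EuclideanSpace ℂ (Fin n) → ℝ} {z} (hr : DifferentiableAt ℝ r z) (j) :
    wDz n j (fun v => ((r v : ℝ) : ℂ)) z = ell r z (EuclideanSpace.single j 1) := by
  rw [wDz, fderiv_ofReal hr, fderiv_ofReal hr, single_I, ell]

lemma cGradPair_eq {r : EuclideanSpace ℂ (Fin n) → ℝ} {z} (hr : DifferentiableAt ℝ r z) (w : Fin n → ℂ) :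
    cGradPair n r z w = ell r z (WithLp.toLp 2 w) := by
  rw [vec_sum, ell_sum', cGradPair]
  refine Finset.sum_congr rfl fun j _ => ?_
  rw [wDz_real hr, ell_smul', mul_comm]

lemma cHess_eq {r : EuclideanSpace ℂ (Fin n) → ℝ} {z} (hr : ∀ᶠ w in nhds z, DifferentiableAt ℝ r w)
    (hr2 : DifferentiableAt ℝ (fderiv ℝ r) z) (i j) :
    cHess n r z i j = sesq (fderiv ℝ (fderiv ℝ r) z) (EuclideanSpace.single i 1) (EuclideanSpace.single j 1) / 4 := by
  set β := fderiv ℝ (fderiv ℝ r) z with hβ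
  have hp : ∀ v u, HasFDerivAt (fun w => ((fderiv ℝ r w v : ℝ) : ℂ)) (Complex.ofRealCLM.comp (β.flip v)) z ∧
      (Complex.ofRealCLM.comp (β.flip v)) u = ((β u v : ℝ) : ℂ) := by
    intro v u
    refine ⟨?_, by simp⟩
    have h1 : HasFDerivAt (fun w => fderiv ℝ r w v) (β.flip v) z := by
      have := hr2.hasFDerivAt.clm_apply (hasFDerivAt_const v z)
      convert! this using 1
      ext u; simp [hβ]
    exact HasFDerivAt.comp z (g := Complex.ofRealCLM) Complex.ofRealCLM.hasFDerivAt h1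
  have hev : (fun w => wDzBar n j (fun v => ((r v : ℝ) : ℂ)) w) =ᶠ[nhds z]
      fun w => (((fderiv ℝ r w (EuclideanSpace.single j 1) : ℝ) : ℂ) + I * ((fderiv ℝ r w (I • EuclideanSpace.single j 1) : ℝ) : ℂ)) * (2⁻¹ : ℂ) := by
    filter_upwards [hr] with w hw
    rw [wDzBar, fderiv_ofReal hw, fderiv_ofReal hw, single_I, div_eq_mul_inv]
  have hd := ((hp (EuclideanSpace.single j 1) 0).1.add ((hp (I • EuclideanSpace.single j 1) 0).1.const_mul I)).mul_const (2⁻¹ : ℂ)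
  have hd' := (hd.congr_of_eventuallyEq hev).fderiv
  rw [cHess, Matrix.of_apply, wDz, hd', single_I]
  simp only [smul_apply, add_apply, (hp _ _).2, smul_eq_mul]
  unfold sesq
  push_cast
  ring_nf
  rw [I_sq]
  ring

lemma cHessForm_eq {r : EuclideanSpace ℂ (Fin n) → ℝ} {z} (hr : ∀ᶠ w in nhds z, DifferentiableAt ℝ r w)
    (hr2 : DifferentiableAt ℝ (fderiv ℝ r) z) (w : Fin n → ℂ) :
    (cHessForm n r z w).re = Lam r z (WithLp.toLp 2 w) / 4 := by
  have : cHessForm n r z w = sesq (fderiv ℝ (fderiv ℝ r) z) (WithLp.toLp 2 w) (WithLp.toLp 2 w) / 4 := by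
    rw [vec_sum, sesq_sum_left, cHessForm, Finset.sum_div]
    refine Finset.sum_congr rfl fun i _ => ?_
    rw [sesq_sum_right, Finset.sum_div]
    refine Finset.sum_congr rfl fun j _ => ?_
    rw [cHess_eq hr hr2, sesq_smul_left, sesq_smul_right]
    ring
  rw [this, ← sesq_re]
  rw [show (4 : ℂ) = ((4 : ℝ) : ℂ) by norm_num, Complex.div_ofReal_re]

abbrev eqv (n : ℕ) : (Fin n → ℂ) ≃L[ℂ] EuclideanSpace ℂ (Fin n) := (EuclideanSpace.equiv (Fin n) ℂ).symm

lemma eqv_apply (w : Fin n → ℂ) : eqv n w = WithLp.toLp 2 w := rfl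

theorem dom_of_spd {Ω : Set (EuclideanSpace ℂ (Fin n))} (h : IsStrictlyPseudoconvexDomain n ⊤ Ω) :
    ∃ U r ε c C d, Dom n (eqv n ⁻¹' Ω) U r ε c C d := by
  obtain ⟨ho, hb, U, ρ, ⟨hU, hsub, hρ, heq, hg⟩, hlev⟩ := h
  set e := eqv n with he
  have hfr : frontier (e ⁻¹' Ω) = e ⁻¹' frontier Ω := (e.toHomeomorph.preimage_frontier Ω).symm
  have hcl : closure (e ⁻¹' Ω) = e ⁻¹' closure Ω := (e.toHomeomorph.preimage_closure Ω).symm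
  have hfd : ∀ z ∈ U, DifferentiableAt ℝ ρ z := fun z hz => (hρ.contDiffAt (hU.mem_nhds hz)).differentiableAt (by simp)
  have hfd2 : ∀ z ∈ U, DifferentiableAt ℝ (fderiv ℝ ρ) z := fun z hz =>
    ((hρ.contDiffAt (hU.mem_nhds hz)).fderiv_right (m := 1) (by norm_cast)).differentiableAt (by simp)
  refine ⟨e ⁻¹' U, exists_dom (ρ := ρ ∘ e) (ho.preimage e.continuous) ?_ (hU.preimage e.continuous) ?_ ?_ ?_ ?_ ?_⟩
  · rw [← e.image_symm_eq_preimage]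
    exact (e.symm : EuclideanSpace ℂ (Fin n) →L[ℂ] (Fin n → ℂ)).lipschitz.isBounded_image hb
  · rw [hcl]; exact Set.preimage_mono hsub
  · exact hρ.comp (eR e).contDiff.contDiffOn (fun x hx => hx)
  · ext z
    constructor
    · intro hz
      have : e z ∈ {z ∈ U | ρ z < 0} := heq ▸ hz
      exact this
    · intro hz
      show e z ∈ Ω
      rw [heq]; exact hz
  · intro z hz h0
    rw [hfr] at hz
    refine hg _ hz ?_
    have h' : fderiv ℝ (ρ ∘ e) z = (fderiv ℝ ρ (e z)).comp ((eR e) : (Fin n → ℂ) →L[ℝ] EuclideanSpace ℂ (Fin n)) :=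
      (eR e).comp_right_fderiv (f := ρ) (x := z)
    rw [h'] at h0
    ext v
    have := congrArg (fun T => T (e.symm v)) h0
    simpa [eR_apply] using this
  · intro z hz v hv hl
    rw [hfr] at hz
    have hzU : e z ∈ U := hsub (frontier_subset_closure hz)
    rw [ell_equiv] at hl
    rw [Lam_equiv _ _ _ _ (hfd2 _ hzU)]
    have h1 := hlev _ hz v hv (by rw [cGradPair_eq (hfd _ hzU)]; exact hl)
    rw [cHessForm_eq (Filter.mem_of_superset (hU.mem_nhds hzU) hfd) (hfd2 _ hzU)] at h1
    have : eqv n v = WithLp.toLp 2 v := rfl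
    rw [he, this]
    linarith

lemma jac_eq {φ : EuclideanSpace ℂ (Fin n) → EuclideanSpace ℂ (Fin n)} {z} (h : DifferentiableAt ℂ φ (eqv n z)) :
    jacobian n φ (eqv n z) = Am (fun x => (eqv n).symm (φ (eqv n x))) z := by
  ext i j
  have h1 : HasFDerivAt (fun x => (eqv n).symm (φ (eqv n x))) ((((eqv n).symm : EuclideanSpace ℂ (Fin n) →L[ℂ] (Fin n → ℂ)).comp (fderiv ℂ φ (eqv n z))).comp (eqv n : (Fin n → ℂ) →L[ℂ] EuclideanSpace ℂ (Fin n))) z := by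
    have ha := HasFDerivAt.comp z (g := φ) (f := eqv n) h.hasFDerivAt (eqv n).hasFDerivAt
    exact (eqv n).symm.hasFDerivAt.comp z ha
  have h2 : HasFDerivAt (fun w => φ w i) ((EuclideanSpace.proj i : EuclideanSpace ℂ (Fin n) →L[ℂ] ℂ).comp (fderiv ℂ φ (eqv n z))) (eqv n z) :=
    HasFDerivAt.comp _ (g := (EuclideanSpace.proj i : EuclideanSpace ℂ (Fin n) →L[ℂ] ℂ)) (ContinuousLinearMap.hasFDerivAt _) h.hasFDerivAt
  have h3 := (h2.restrictScalars ℝ).fderiv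
  rw [jacobian, Am, Matrix.of_apply, Matrix.of_apply, h1.fderiv, wDz, h3, single_I]
  have h4 : eqv n (Pi.single j 1) = EuclideanSpace.single j (1 : ℂ) := rfl
  simp only [ContinuousLinearMap.coe_restrictScalars', ContinuousLinearMap.comp_apply, map_smul, ContinuousLinearEquiv.coe_coe, h4, smul_eq_mul]
  rw [← mul_assoc, I_mul_I]
  have h5 : ∀ x : EuclideanSpace ℂ (Fin n), (eqv n).symm x i = EuclideanSpace.proj (𝕜 := ℂ) i x := fun x => rfl
  rw [h5]
  ring
end

/-- For a proper holomorphic map `φ` between bounded strictly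
pseudoconvex domains with `C^∞` boundary, `det φ′ ∈ Lip_{1/2}(Ω̄₁)`. -/
theorem det_jacobian_lip_half (n : ℕ)
    (Ω₁ Ω₂ : Set (EuclideanSpace ℂ (Fin n)))
    (hΩ₁ : IsStrictlyPseudoconvexDomain n ⊤ Ω₁)
    (hΩ₂ : IsStrictlyPseudoconvexDomain n ⊤ Ω₂)
    (φ : EuclideanSpace ℂ (Fin n) → EuclideanSpace ℂ (Fin n))
    (hφ : DifferentiableOn ℂ φ Ω₁)
    (hproper : IsProperMapOn n φ Ω₁ Ω₂) :
    ∃ C : ℝ, ∀ z ∈ Ω₁, ∀ w ∈ Ω₁,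
      ‖(jacobian n φ z).det - (jacobian n φ w).det‖ ≤ C * ‖z - w‖ ^ ((1 : ℝ) / 2) := by
  have ho := hΩ₁.1
  obtain ⟨U₁, r₁, _, _, _, _, D₁⟩ := dom_of_spd hΩ₁
  obtain ⟨U₂, r₂, _, _, _, _, D₂⟩ := dom_of_spd hΩ₂
  obtain ⟨hmaps, hprop⟩ := hproper
  obtain ⟨C, hC0, hC⟩ := final_pi (φ := fun x => (eqv n).symm (φ (eqv n x))) D₁ D₂
    (fun x hx => by
      have h := hφ.differentiableAt (ho.mem_nhds (show eqv n x ∈ Ω₁ from hx))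
      have ha := DifferentiableAt.comp x (g := φ) (f := eqv n) h (eqv n).differentiableAt
      exact (DifferentiableAt.comp x (g := (eqv n).symm) (eqv n).symm.differentiableAt ha).differentiableWithinAt)
    (fun z hz => by
      show eqv n ((eqv n).symm _) ∈ Ω₂
      rw [ContinuousLinearEquiv.apply_symm_apply]
      exact hmaps hz)
    (fun K hK hKc => by
      have h1 := hprop (eqv n '' K) (by rintro _ ⟨x, hx, rfl⟩; exact hK hx) (hKc.image (eqv n).continuous)
      have h2 := h1.image (eqv n).symm.continuous
      convert! h2 using 1
      ext z
      constructor
      · rintro ⟨hz, hz2⟩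
        exact ⟨eqv n z, ⟨hz, ⟨_, hz2, ContinuousLinearEquiv.apply_symm_apply _ _⟩⟩, ContinuousLinearEquiv.symm_apply_apply _ _⟩
      · rintro ⟨y, ⟨hy, ⟨x, hx, hxy⟩⟩, rfl⟩
        refine ⟨by simpa using hy, ?_⟩
        show (eqv n).symm (φ (eqv n ((eqv n).symm y))) ∈ K
        rw [ContinuousLinearEquiv.apply_symm_apply, ← hxy, ContinuousLinearEquiv.symm_apply_apply]
        exact hx)
  refine ⟨C, fun z hz w hw => ?_⟩
  have hz' : (eqv n).symm z ∈ eqv n ⁻¹' Ω₁ := by simpa using hz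
  have hw' : (eqv n).symm w ∈ eqv n ⁻¹' Ω₁ := by simpa using hw
  have h := hC _ hz' _ hw'
  have hd : ∀ x ∈ Ω₁, jacobian n φ x = Am (fun x => (eqv n).symm (φ (eqv n x))) ((eqv n).symm x) := by
    intro x hx
    rw [← jac_eq, ContinuousLinearEquiv.apply_symm_apply]
    rw [ContinuousLinearEquiv.apply_symm_apply]
    exact hφ.differentiableAt (ho.mem_nhds hx)
  rw [hd z hz, hd w hw]
  refine h.trans ?_
  rw [← Real.sqrt_eq_rpow]
  gcongr
  rw [← map_sub]
  rw [pi_norm_le_iff_of_nonneg (norm_nonneg _)]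
  intro i
  exact EuclideanSpace.norm_eq (z - w) ▸ by
    apply Real.le_sqrt_of_sq_le
    exact Finset.single_le_sum (f := fun i => ‖(z - w) i‖ ^ 2) (fun i _ => sq_nonneg _) (Finset.mem_univ i)
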